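/- Let n and m be distinct natural numbers with n even, n ≥ 6, and n(n−1)/2 ≤ m < n(n+1)/2. Then every group homomorphism φ : Out(F_n) → Out(F_m) has finite image. -/

import Mathlib

noncomputable section

/-- The free group on `n` generators. -/
abbrev FG (n : ℕ) : Type := FreeGroup (Fin n)

/-- The subgroup of inner automorphisms of the free group `F_n`. -/
def InnFG (n : ℕ) : Subgroup (MulAut (FG n)) :=
  (MulAut.conj : FG n →* MulAut (FG n)).range

instance InnFG.normal (n : ℕ) : (InnFG n).Normal := by
  constructor
  rintro x ⟨g, rfl⟩ e
  refine ⟨e g, ?_⟩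
  ext y
  simp [MulAut.conj_apply, map_mul, map_inv]

/-- The outer automorphism group of the free group `F_n`. -/
def OutFG (n : ℕ) : Type := MulAut (FG n) ⧸ InnFG n

instance (n : ℕ) : Group (OutFG n) :=
  inferInstanceAs (Group (MulAut (FG n) ⧸ InnFG n))

open Module

section LinearAlgebra

/-- Additivity of the trace along an exact sequence. -/
theorem trace_eq_add_of_exact {k K V W : Type*} [Field k] [AddCommGroup K] [AddCommGroup V]
    [AddCommGroup W] [Module k K] [Module k V] [Module k W] [FiniteDimensional k V]
    (i : K →ₗ[k] V) (p : V →ₗ[k] W) (hi : Function.Injective i) (hp : Function.Surjective p)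
    (hip : LinearMap.range i = LinearMap.ker p)
    (a : K →ₗ[k] K) (b : V →ₗ[k] V) (c : W →ₗ[k] W)
    (hab : i ∘ₗ a = b ∘ₗ i) (hbc : p ∘ₗ b = c ∘ₗ p) :
    LinearMap.trace k V b = LinearMap.trace k K a + LinearMap.trace k W c := by
  have : FiniteDimensional k K := FiniteDimensional.of_injective i hi
  have : FiniteDimensional k W := Module.Finite.of_surjective p hp
  obtain ⟨s, hs⟩ := p.exists_rightInverse_of_surjective (LinearMap.range_eq_top.2 hp)
  have hps : ∀ w, p (s w) = w := fun w => LinearMap.congr_fun hs w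
  have hmem : ∀ v, v - s (p v) ∈ LinearMap.range i := by
    intro v
    rw [hip, LinearMap.mem_ker, map_sub, hps, sub_self]
  let e := LinearEquiv.ofInjective i hi
  let r : V →ₗ[k] K := e.symm.toLinearMap ∘ₗ
    LinearMap.codRestrict (LinearMap.range i) (LinearMap.id - s ∘ₗ p) hmem
  have hir : ∀ v, i (r v) = v - s (p v) := by
    intro v
    have : (e (r v) : V) = v - s (p v) := by simp [r]
    simpa [e] using this
  have hpi : ∀ x, p (i x) = 0 := by
    intro x
    rw [← LinearMap.mem_ker, ← hip]
    exact ⟨x, rfl⟩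
  have hri : ∀ x, r (i x) = x := by
    intro x
    apply hi
    rw [hir, hpi, map_zero, sub_zero]
  have h1 : b = (b ∘ₗ i) ∘ₗ r + (b ∘ₗ s) ∘ₗ p := by
    ext v
    simp [hir]
  have h2 : r ∘ₗ (b ∘ₗ i) = a := by
    rw [← hab]
    ext x
    simp [hri]
  have h3 : p ∘ₗ (b ∘ₗ s) = c := by
    rw [← LinearMap.comp_assoc, hbc]
    ext x
    simp [hps]
  conv_lhs => rw [h1]
  rw [map_add, LinearMap.trace_comp_comm', h2, LinearMap.trace_comp_comm', h3]

theorem trace_eq_ker_add_range {k V W : Type*} [Field k] [AddCommGroup V]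
    [AddCommGroup W] [Module k V] [Module k W] [FiniteDimensional k V]
    (p : V →ₗ[k] W) (b : V →ₗ[k] V) (c : W →ₗ[k] W) (hbc : p ∘ₗ b = c ∘ₗ p)
    (K : Submodule k V) (R : Submodule k W) (hK : K = LinearMap.ker p)
    (hR : R = LinearMap.range p) (hbK : ∀ x ∈ K, b x ∈ K) (hcR : ∀ x ∈ R, c x ∈ R) :
    LinearMap.trace k V b = LinearMap.trace k K (b.restrict hbK) +
      LinearMap.trace k R (c.restrict hcR) := by
  subst hK hR
  refine trace_eq_add_of_exact (Submodule.subtype _) p.rangeRestrict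
    (Submodule.injective_subtype _) p.surjective_rangeRestrict (by simp) _ _ _ ?_ ?_
  · ext; rfl
  · ext x
    exact LinearMap.congr_fun hbc x

theorem trace_eq_sum_of_sum_eq_id {k V ι : Type*} [Field k] [AddCommGroup V] [Module k V]
    [FiniteDimensional k V] [Fintype ι] {A : ι → Type*} [∀ i, AddCommGroup (A i)]
    [∀ i, Module k (A i)] [∀ i, FiniteDimensional k (A i)]
    (inc : ∀ i, A i →ₗ[k] V) (proj : ∀ i, V →ₗ[k] A i)
    (h : ∑ i, inc i ∘ₗ proj i = LinearMap.id) (L : V →ₗ[k] V) :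
    LinearMap.trace k V L = ∑ i, LinearMap.trace k (A i) (proj i ∘ₗ L ∘ₗ inc i) := by
  have : L = ∑ i, (L ∘ₗ inc i) ∘ₗ proj i := by
    conv_lhs => rw [← LinearMap.comp_id L, ← h]
    ext v
    simp
  conv_lhs => rw [this]
  rw [map_sum]
  refine Finset.sum_congr rfl fun i _ => ?_
  rw [LinearMap.trace_comp_comm']

end LinearAlgebra

section Sections

variable {E X M : Type*} [Group E] [MulAction E X] [AddCommGroup M] [Module ℚ M]

/-- `F`-equivariant sections of the family of coefficient modules `A x ≤ M`. -/
def equivSec (F : Subgroup E) (ρ : Representation ℚ E M) (A : X → Submodule ℚ M) :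
    Submodule ℚ (X → M) where
  carrier := {w | (∀ x, w x ∈ A x) ∧ ∀ f ∈ F, ∀ x, w (f • x) = ρ f (w x)}
  zero_mem' := ⟨fun x => (A x).zero_mem, fun f _ x => by simp⟩
  add_mem' := fun {a b} ha hb => ⟨fun x => (A x).add_mem (ha.1 x) (hb.1 x),
    fun f hf x => by simp [ha.2 f hf x, hb.2 f hf x]⟩
  smul_mem' := fun c a ha => ⟨fun x => (A x).smul_mem c (ha.1 x),
    fun f hf x => by simp [ha.2 f hf x]⟩

/-- The translation operator on functions `X → M`. -/
def secL (ρ : Representation ℚ E M) (t : E) : (X → M) →ₗ[ℚ] (X → M) where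
  toFun w x := ρ t (w (t⁻¹ • x))
  map_add' a b := by ext x; simp
  map_smul' a b := by ext x; simp

@[simp] theorem secL_apply (ρ : Representation ℚ E M) (t : E) (w : X → M) (x : X) :
    secL ρ t w x = ρ t (w (t⁻¹ • x)) := rfl

/-- A system of equivariant coefficients with trivial action of the `F`-stabilizers. -/
structure CoeffSys (F : Subgroup E) (ρ : Representation ℚ E M) (A : X → Submodule ℚ M) :
    Prop where
  map_mem : ∀ e x a, a ∈ A x → ρ e a ∈ A (e • x)
  trivial : ∀ f ∈ F, ∀ x : X, f • x = x → ∀ a ∈ A x, ρ f a = a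

variable {F : Subgroup E} {ρ : Representation ℚ E M} {A : X → Submodule ℚ M}

theorem CoeffSys.secL_mem [hF : F.Normal] (h : CoeffSys F ρ A) (t : E) :
    ∀ w ∈ equivSec F ρ A, secL ρ t w ∈ equivSec F ρ A := by
  intro w hw
  refine ⟨fun x => ?_, fun f hf x => ?_⟩
  · have := h.map_mem t _ _ (hw.1 (t⁻¹ • x))
    simpa using this
  · have h1 : t⁻¹ • f • x = (t⁻¹ * f * t) • t⁻¹ • x := by simp [smul_smul]
    have h2 : t⁻¹ * f * t ∈ F := by simpa using hF.conj_mem f hf t⁻¹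
    rw [secL_apply, secL_apply, h1, hw.2 _ h2, ← Module.End.mul_apply, ← Module.End.mul_apply,
      ← map_mul, ← map_mul]
    congr 2
    group

/-- A transporter in `F` from the chosen representative of the orbit of `x` to `x`. -/
theorem exists_transporter (F : Subgroup E) (x : X) :
    ∃ k ∈ F, k • (Quotient.mk (MulAction.orbitRel F X) x).out = x := by
  have h : (MulAction.orbitRel F X).r x (Quotient.mk (MulAction.orbitRel F X) x).out :=
    Quotient.exact (Quotient.out_eq _).symm
  obtain ⟨k, hk⟩ := h
  exact ⟨k, k.2, hk⟩

def transporter (F : Subgroup E) (x : X) : E := (exists_transporter F x).choose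

theorem transporter_mem (F : Subgroup E) (x : X) : transporter F x ∈ F :=
  (exists_transporter F x).choose_spec.1

theorem transporter_smul (F : Subgroup E) {x : X} {q : MulAction.orbitRel.Quotient F X}
    (h : Quotient.mk (MulAction.orbitRel F X) x = q) : transporter F x • q.out = x := by
  subst h
  exact (exists_transporter F x).choose_spec.2

theorem mk_smul_eq {f : E} (hf : f ∈ F) (x : X) :
    Quotient.mk (MulAction.orbitRel F X) (f • x) = Quotient.mk (MulAction.orbitRel F X) x :=
  Quotient.sound ⟨⟨f, hf⟩, rfl⟩

/-- Evaluation of sections at the representative of an orbit. -/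
def secProj (F : Subgroup E) (ρ : Representation ℚ E M) (A : X → Submodule ℚ M)
    (q : MulAction.orbitRel.Quotient F X) : equivSec F ρ A →ₗ[ℚ] A q.out where
  toFun w := ⟨w.1 q.out, w.2.1 _⟩
  map_add' _ _ := rfl
  map_smul' _ _ := rfl

open Classical in
/-- The section supported on one orbit with prescribed value at the representative. -/
def CoeffSys.inc (h : CoeffSys F ρ A) (q : MulAction.orbitRel.Quotient F X) :
    A q.out →ₗ[ℚ] equivSec F ρ A where
  toFun a := ⟨fun x => if Quotient.mk (MulAction.orbitRel F X) x = q then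
      ρ (transporter F x) a.1 else 0, by
    refine ⟨fun x => ?_, fun f hf x => ?_⟩
    · beta_reduce
      split_ifs with hx
      · have := h.map_mem (transporter F x) _ _ a.2
        rwa [transporter_smul F hx] at this
      · exact zero_mem _
    · beta_reduce
      rw [mk_smul_eq hf]
      split_ifs with hx
      · have hfx := (mk_smul_eq hf x).trans hx
        have h1 := h.trivial ((f * transporter F x)⁻¹ * transporter F (f • x))
          (mul_mem (inv_mem (mul_mem hf (transporter_mem F x))) (transporter_mem F _)) q.out
          (by rw [mul_smul, transporter_smul F hfx, inv_smul_eq_iff, mul_smul,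
                transporter_smul F hx]) a.1 a.2
        have h2 := congrArg (ρ (f * transporter F x)) h1
        rw [← Module.End.mul_apply, ← map_mul, mul_inv_cancel_left] at h2
        rw [h2, map_mul, Module.End.mul_apply]
      · simp⟩
  map_add' a b := by ext x; simp; split_ifs <;> simp
  map_smul' a b := by ext x; simp

theorem CoeffSys.inc_apply_of_eq (h : CoeffSys F ρ A) {q : MulAction.orbitRel.Quotient F X}
    (a : A q.out) {x : X} (hx : Quotient.mk (MulAction.orbitRel F X) x = q) {k : E}
    (hk : k ∈ F) (hkx : k • q.out = x) : (h.inc q a).1 x = ρ k a.1 := by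
  have h1 := h.trivial (k⁻¹ * transporter F x)
    (mul_mem (inv_mem hk) (transporter_mem F x)) q.out
    (by rw [mul_smul, transporter_smul F hx, inv_smul_eq_iff, hkx]) a.1 a.2
  have h2 := congrArg (ρ k) h1
  rw [← Module.End.mul_apply, ← map_mul, mul_inv_cancel_left] at h2
  simp [CoeffSys.inc, hx, h2]

theorem CoeffSys.inc_apply_of_ne (h : CoeffSys F ρ A) {q : MulAction.orbitRel.Quotient F X}
    (a : A q.out) {x : X} (hx : Quotient.mk (MulAction.orbitRel F X) x ≠ q) :
    (h.inc q a).1 x = 0 := by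
  simp [CoeffSys.inc, hx]

theorem CoeffSys.sum_inc_proj (h : CoeffSys F ρ A) [Fintype (MulAction.orbitRel.Quotient F X)] :
    ∑ q, h.inc q ∘ₗ secProj F ρ A q = LinearMap.id := by
  ext w x
  simp only [LinearMap.sum_apply, LinearMap.comp_apply, LinearMap.id_apply,
    Submodule.coe_sum, Finset.sum_apply]
  rw [Finset.sum_eq_single (Quotient.mk (MulAction.orbitRel F X) x)]
  · rw [h.inc_apply_of_eq _ rfl (transporter_mem F x) (transporter_smul F rfl)]
    have := w.2.2 (transporter F x) (transporter_mem F x)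
      (Quotient.mk (MulAction.orbitRel F X) x).out
    rw [transporter_smul F rfl] at this
    rw [this]; rfl
  · intro q _ hq
    exact h.inc_apply_of_ne _ (Ne.symm hq)
  · simp

/-- The orbit of `x` under `F` is fixed by `t`. -/
def OrbFix (F : Subgroup E) (t : E) (x : X) : Prop := ∃ f ∈ F, (f * t) • x = x

theorem CoeffSys.proj_secL_inc_of_fix [hF : F.Normal] (h : CoeffSys F ρ A)
    (q : MulAction.orbitRel.Quotient F X) {t u : E} (hu : u * t⁻¹ ∈ F) (hux : u • q.out = q.out)
    (a : A q.out) : (secL ρ t (h.inc q a).1) q.out = ρ u a.1 := by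
  have h1 : t⁻¹ * u ∈ F := by
    have := hF.conj_mem _ hu t⁻¹
    simpa [mul_assoc] using this
  have hx : t⁻¹ • q.out = (t⁻¹ * u) • q.out := by rw [mul_smul, hux]
  rw [secL_apply, h.inc_apply_of_eq (k := t⁻¹ * u) a _ h1 hx.symm, ← Module.End.mul_apply,
    ← map_mul, mul_inv_cancel_left]
  rw [hx, mk_smul_eq h1]
  exact Quotient.out_eq q

theorem CoeffSys.proj_secL_inc_of_not_fix [hF : F.Normal] (h : CoeffSys F ρ A)
    (q : MulAction.orbitRel.Quotient F X) {t : E} (hq : ¬ OrbFix F t q.out)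
    (a : A q.out) : (secL ρ t (h.inc q a).1) q.out = 0 := by
  rw [secL_apply, h.inc_apply_of_ne, map_zero]
  intro hx
  apply hq
  have h1 := transporter_smul F hx
  refine ⟨t * transporter F (t⁻¹ • q.out) * t⁻¹, hF.conj_mem _ (transporter_mem F _) _, ?_⟩
  rw [inv_mul_cancel_right, mul_smul, h1, smul_inv_smul]

theorem CoeffSys.finite_fiber (h : CoeffSys F ρ A) [FiniteDimensional ℚ (equivSec F ρ A)]
    (q : MulAction.orbitRel.Quotient F X) : FiniteDimensional ℚ (A q.out) := by
  refine FiniteDimensional.of_injective (h.inc q) ?_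
  intro a b hab
  have := congrFun (congrArg Subtype.val hab) q.out
  rw [h.inc_apply_of_eq (k := 1) a (Quotient.out_eq q) (one_mem _) (one_smul _ _),
    h.inc_apply_of_eq (k := 1) b (Quotient.out_eq q) (one_mem _) (one_smul _ _)] at this
  ext
  simpa using this

/-- The trace of the translation operator as a sum over the fixed orbits. -/
theorem CoeffSys.trace_secL [hF : F.Normal] (h : CoeffSys F ρ A)
    [Fintype (MulAction.orbitRel.Quotient F X)] [FiniteDimensional ℚ (equivSec F ρ A)] (t : E)
    (tr : MulAction.orbitRel.Quotient F X → ℚ)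
    (htr : ∀ q : MulAction.orbitRel.Quotient F X, OrbFix F t q.out → ∃ u : E, u * t⁻¹ ∈ F ∧
      u • q.out = q.out ∧ ∀ hu : ∀ a ∈ A q.out, ρ u a ∈ A q.out,
      LinearMap.trace ℚ (A q.out) ((ρ u).restrict hu) = tr q)
    (htr0 : ∀ q : MulAction.orbitRel.Quotient F X, ¬ OrbFix F t q.out → tr q = 0) :
    LinearMap.trace ℚ (equivSec F ρ A) ((secL ρ t).restrict (h.secL_mem t)) = ∑ q, tr q := by
  have hfin := h.finite_fiber
  rw [trace_eq_sum_of_sum_eq_id _ _ h.sum_inc_proj]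
  refine Finset.sum_congr rfl fun q _ => ?_
  by_cases hq : OrbFix F t q.out
  · obtain ⟨u, hut, hux, hu⟩ := htr q hq
    rw [← hu fun a ha => by simpa [hux] using h.map_mem u _ a ha]
    congr 1
    ext a
    exact h.proj_secL_inc_of_fix q hut hux a
  · rw [htr0 q hq]
    have : secProj F ρ A q ∘ₗ (secL ρ t).restrict (h.secL_mem t) ∘ₗ h.inc q = 0 := by
      ext a
      exact h.proj_secL_inc_of_not_fix q hq a
    rw [this, map_zero]

theorem CoeffSys.secL_inc [hF : F.Normal] (h : CoeffSys F ρ A)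
    (q : MulAction.orbitRel.Quotient F X) {t u : E} (hu : u * t⁻¹ ∈ F) (hux : u • q.out = q.out)
    (a : A q.out) (ha : ρ u a.1 = a.1) : secL ρ t (h.inc q a).1 = (h.inc q a).1 := by
  have hut : t⁻¹ * u ∈ F := by
    have := hF.conj_mem _ hu t⁻¹
    simpa [mul_assoc] using this
  ext x
  by_cases hx : Quotient.mk (MulAction.orbitRel F X) x = q
  · have h1 := transporter_smul F hx
    set k := transporter F x with hk
    have hkF : k ∈ F := transporter_mem F x
    have h2 : (t⁻¹ * k * u) • q.out = t⁻¹ • x := by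
      rw [mul_smul, hux, mul_smul, h1]
    have h3 : t⁻¹ * k * u ∈ F := by
      have e : t⁻¹ * k * u = (t⁻¹ * k * t) * (t⁻¹ * u) := by group
      rw [e]
      refine mul_mem ?_ hut
      simpa using hF.conj_mem _ hkF t⁻¹
    rw [secL_apply, h.inc_apply_of_eq a _ h3 h2, h.inc_apply_of_eq a hx hkF h1,
      ← Module.End.mul_apply, ← map_mul]
    · have e : t * (t⁻¹ * k * u) = k * u := by group
      rw [e, map_mul, Module.End.mul_apply, ha]
    · rw [← h2, mk_smul_eq h3]
      exact Quotient.out_eq q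
  · rw [secL_apply, h.inc_apply_of_ne a hx, h.inc_apply_of_ne, map_zero]
    intro hx'
    apply hx
    have h1 := transporter_smul F hx'
    set k := transporter F (t⁻¹ • x)
    have hkF : k ∈ F := transporter_mem F _
    have h2 : x = (t * k * u⁻¹) • q.out := by
      rw [mul_smul, inv_smul_eq_iff.2 hux.symm, mul_smul, h1, smul_inv_smul]
    have h3 : t * k * u⁻¹ ∈ F := by
      have e : t * k * u⁻¹ = (t * k * t⁻¹) * (u * t⁻¹)⁻¹ := by group
      rw [e]
      exact mul_mem (hF.conj_mem _ hkF t) (inv_mem hu)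
    rw [h2, mk_smul_eq h3]
    exact Quotient.out_eq q

/-- The section assembled from values at the representatives of a family of orbits. -/
def CoeffSys.incSum (h : CoeffSys F ρ A)
    (S : Finset (MulAction.orbitRel.Quotient F X)) :
    (∀ q : S, A q.1.out) →ₗ[ℚ] equivSec F ρ A :=
  ∑ q : S, h.inc q.1 ∘ₗ LinearMap.proj q

theorem CoeffSys.incSum_out (h : CoeffSys F ρ A)
    (S : Finset (MulAction.orbitRel.Quotient F X)) (a : ∀ q : S, A q.1.out) (q : S) :
    (h.incSum S a).1 q.1.out = (a q).1 := by
  simp only [CoeffSys.incSum, LinearMap.sum_apply, LinearMap.comp_apply, LinearMap.proj_apply,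
    Submodule.coe_sum, Finset.sum_apply]
  rw [Finset.sum_eq_single q]
  · rw [h.inc_apply_of_eq (k := 1) _ (Quotient.out_eq q.1) (one_mem _) (one_smul _ _)]
    simp
  · intro q' _ hq'
    refine h.inc_apply_of_ne _ ?_
    rw [show Quotient.mk (MulAction.orbitRel F X) q.1.out = q.1 from Quotient.out_eq q.1]
    exact fun e => hq' (Subtype.ext e.symm)
  · simp

theorem CoeffSys.secL_incSum [F.Normal] (h : CoeffSys F ρ A)
    (S : Finset (MulAction.orbitRel.Quotient F X)) (a : ∀ q : S, A q.1.out) {t : E}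
    (u : S → E) (hu : ∀ q, u q * t⁻¹ ∈ F) (hux : ∀ q, u q • q.1.out = q.1.out)
    (ha : ∀ q, ρ (u q) (a q).1 = (a q).1) :
    secL ρ t (h.incSum S a).1 = (h.incSum S a).1 := by
  simp only [CoeffSys.incSum, LinearMap.sum_apply, LinearMap.comp_apply, LinearMap.proj_apply,
    Submodule.coe_sum, map_sum]
  exact Finset.sum_congr rfl fun q _ => h.secL_inc q.1 (hu q) (hux q) _ (ha q)

theorem CoeffSys.sum_finrank_fix_le [F.Normal] (h : CoeffSys F ρ A)
    [FiniteDimensional ℚ (equivSec F ρ A)] {t : E}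
    (S : Finset (MulAction.orbitRel.Quotient F X))
    (u : S → E) (hu : ∀ q, u q * t⁻¹ ∈ F) (hux : ∀ q, u q • q.1.out = q.1.out)
    (huA : ∀ q : S, ∀ a ∈ A q.1.out, ρ (u q) a ∈ A q.1.out) :
    ∑ q : S, finrank ℚ (LinearMap.ker ((ρ (u q)).restrict (huA q) - 1)) ≤
      finrank ℚ (LinearMap.ker ((secL ρ t).restrict (h.secL_mem t) - 1)) := by
  have hfin := h.finite_fiber
  let Φ : (∀ q : S, LinearMap.ker ((ρ (u q)).restrict (huA q) - 1)) →ₗ[ℚ]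
      LinearMap.ker ((secL ρ t).restrict (h.secL_mem t) - 1) :=
    ((h.incSum S) ∘ₗ LinearMap.pi fun q => Submodule.subtype _ ∘ₗ LinearMap.proj q).codRestrict _
      (by
        intro a
        rw [LinearMap.mem_ker, LinearMap.sub_apply, sub_eq_zero]
        ext1
        refine h.secL_incSum S _ u hu hux fun q => ?_
        have := (a q).2
        rw [LinearMap.mem_ker, LinearMap.sub_apply, sub_eq_zero] at this
        exact congrArg Subtype.val this)
  have hΦ : Function.Injective Φ := by
    intro a b hab
    ext q
    have h1 := congrFun (congrArg (fun z => z.1.1) hab) q.1.out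
    have h2 := h.incSum_out S (fun q => (a q).1) q
    have h3 := h.incSum_out S (fun q => (b q).1) q
    exact h2.symm.trans (h1.trans h3)
  rw [← Module.finrank_pi_fintype]
  exact LinearMap.finrank_le_finrank_of_injective hΦ

end Sections

/-- Fixed vectors lift along an equivariant surjection for a finite-order operator. -/
theorem finrank_fix_add_le {V W : Type*} [AddCommGroup V] [AddCommGroup W] [Module ℚ V]
    [Module ℚ W] [FiniteDimensional ℚ V] (p : V →ₗ[ℚ] W) (hp : Function.Surjective p)
    (b : V →ₗ[ℚ] V) (c : W →ₗ[ℚ] W) (hbc : p ∘ₗ b = c ∘ₗ p) {N : ℕ} (hN : 0 < N)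
    (hb : b ^ N = 1) (U : Submodule ℚ V) (hU : U ≤ LinearMap.ker (b - 1))
    (hUp : U ≤ LinearMap.ker p) :
    finrank ℚ U + finrank ℚ (LinearMap.ker (c - 1)) ≤ finrank ℚ (LinearMap.ker (b - 1)) := by
  have hpb : ∀ v, p (b v) = c (p v) := fun v => LinearMap.congr_fun hbc v
  have hfix : ∀ v ∈ LinearMap.ker (b - 1), p v ∈ LinearMap.ker (c - 1) := by
    intro v hv
    rw [LinearMap.mem_ker, LinearMap.sub_apply, sub_eq_zero, Module.End.one_apply] at hv ⊢
    rw [← hpb, hv]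
  let p' := p.restrict hfix
  have hsurj : Function.Surjective p' := by
    rintro ⟨w, hw⟩
    rw [LinearMap.mem_ker, LinearMap.sub_apply, sub_eq_zero, Module.End.one_apply] at hw
    obtain ⟨v, rfl⟩ := hp w
    have hpi : ∀ i : ℕ, p ((b ^ i) v) = p v := by
      intro i
      induction i with
      | zero => simp
      | succ i ih => rw [pow_succ', Module.End.mul_apply, hpb, ih, hw]
    let z := ∑ i ∈ Finset.range N, (b ^ i) v
    have hz : b z = z := by
      have h1 := Finset.sum_range_succ (fun i => (b ^ i) v) N
      have h2 := Finset.sum_range_succ' (fun i => (b ^ i) v) N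
      rw [h1] at h2
      rw [hb, pow_zero] at h2
      have h3 := add_right_cancel h2
      simp only [z, map_sum]
      rw [h3]
      exact Finset.sum_congr rfl fun i _ => by rw [pow_succ', Module.End.mul_apply]
    refine ⟨⟨(N : ℚ)⁻¹ • z, ?_⟩, ?_⟩
    · rw [LinearMap.mem_ker, LinearMap.sub_apply, sub_eq_zero, Module.End.one_apply, map_smul, hz]
    · ext1
      change p ((N : ℚ)⁻¹ • z) = p v
      rw [map_smul, map_sum, Finset.sum_congr rfl fun i _ => hpi i, Finset.sum_const,
        Finset.card_range, ← Nat.cast_smul_eq_nsmul ℚ, smul_smul, inv_mul_cancel₀, one_smul]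
      exact_mod_cast hN.ne'
  have h1 := LinearMap.finrank_range_add_finrank_ker p'
  rw [LinearMap.range_eq_top.2 hsurj, finrank_top] at h1
  let j : U →ₗ[ℚ] LinearMap.ker p' :=
    (Submodule.inclusion hU).codRestrict _ fun x => by
      rw [LinearMap.mem_ker]
      ext1
      exact hUp x.2
  have h2 : finrank ℚ U ≤ finrank ℚ (LinearMap.ker p') := by
    refine LinearMap.finrank_le_finrank_of_injective (f := j) ?_
    intro x y hxy
    have := congrArg (fun z => z.1.1) hxy
    exact Subtype.ext this
  omega

section HomQ

variable {E : Type*} [Group E]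

/-- Homomorphisms from the subgroup `F` to `ℚ`, extended by zero to the whole group. -/
def homQ (F : Subgroup E) : Submodule ℚ (E → ℚ) where
  carrier := {h | (∀ k, k ∉ F → h k = 0) ∧ ∀ a ∈ F, ∀ b ∈ F, h (a * b) = h a + h b}
  zero_mem' := by simp
  add_mem' := fun {a b} ha hb => ⟨fun k hk => by simp [ha.1 k hk, hb.1 k hk],
    fun x hx y hy => by simp only [Pi.add_apply]; rw [ha.2 x hx y hy, hb.2 x hx y hy]; ring⟩
  smul_mem' := fun c a ha => ⟨fun k hk => by simp [ha.1 k hk],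
    fun x hx y hy => by simp only [Pi.smul_apply, smul_eq_mul]; rw [ha.2 x hx y hy]; ring⟩

theorem homQ_one {F : Subgroup E} {h : E → ℚ} (hh : h ∈ homQ F) : h 1 = 0 := by
  have := hh.2 1 (one_mem _) 1 (one_mem _)
  rw [mul_one] at this
  linarith

theorem homQ_inv {F : Subgroup E} {h : E → ℚ} (hh : h ∈ homQ F) {a : E} (ha : a ∈ F) :
    h a⁻¹ = - h a := by
  have := hh.2 a ha a⁻¹ (inv_mem ha)
  rw [mul_inv_cancel, homQ_one hh] at this
  linarith

/-- The conjugation action on functions. -/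
def conjRep (E : Type*) [Group E] : Representation ℚ E (E → ℚ) where
  toFun t :=
    { toFun := fun h k => h (t⁻¹ * k * t)
      map_add' := fun _ _ => rfl
      map_smul' := fun _ _ => rfl }
  map_one' := by ext; simp
  map_mul' a b := by
    ext h k
    simp [mul_assoc]

@[simp] theorem conjRep_apply (t : E) (h : E → ℚ) (k : E) :
    conjRep E t h k = h (t⁻¹ * k * t) := rfl

theorem conjRep_mem {F : Subgroup E} {t : E} (ht : ∀ k, k ∈ F ↔ t⁻¹ * k * t ∈ F) :
    ∀ h ∈ homQ F, conjRep E t h ∈ homQ F := by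
  intro h hh
  refine ⟨fun k hk => hh.1 _ (by rwa [← ht]), fun a ha b hb => ?_⟩
  rw [conjRep_apply, conjRep_apply, conjRep_apply, ← hh.2 _ ((ht a).1 ha) _ ((ht b).1 hb)]
  congr 1
  group

theorem conjRep_of_mem {F : Subgroup E} {t : E} (ht : t ∈ F) {h : E → ℚ} (hh : h ∈ homQ F) :
    conjRep E t h = h := by
  ext k
  by_cases hk : k ∈ F
  · rw [conjRep_apply, hh.2 _ (mul_mem (inv_mem ht) hk) _ ht, hh.2 _ (inv_mem ht) _ hk,
      homQ_inv hh ht]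
    ring
  · rw [conjRep_apply, hh.1 _ hk, hh.1]
    rwa [Subgroup.mul_mem_cancel_right _ ht, Subgroup.mul_mem_cancel_left _ (inv_mem ht)]

theorem normal_conj_iff {F : Subgroup E} [hF : F.Normal] (t : E) (k : E) :
    k ∈ F ↔ t⁻¹ * k * t ∈ F := by
  constructor
  · intro h
    simpa using hF.conj_mem k h t⁻¹
  · intro h
    simpa [mul_assoc] using hF.conj_mem _ h t

/-- The Lefschetz dichotomy for the action of `t` on `Hom(F, ℚ)`. -/
def Lef (F : Subgroup E) (t : E) : Prop :=
  ∀ ht : ∀ h ∈ homQ F, conjRep E t h ∈ homQ F,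
    ((∀ f ∈ F, ¬ IsOfFinOrder (f * t)) →
      LinearMap.trace ℚ (homQ F) ((conjRep E t).restrict ht) = 1) ∧
    ((∃ f ∈ F, IsOfFinOrder (f * t)) →
      LinearMap.trace ℚ (homQ F) ((conjRep E t).restrict ht) ≤
        finrank ℚ (LinearMap.ker ((conjRep E t).restrict ht - 1)))

end HomQ

/-- A tree (given cohomologically) with an action of `E` such that `F` acts freely and
cocompactly on the edges. -/
structure TreeAct {E : Type*} [Group E] (F : Subgroup E) (X D : Type*) [MulAction E X]
    [MulAction E D] where
  o : D → X
  τ : D → X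
  o_smul : ∀ (e : E) (d : D), o (e • d) = e • o d
  τ_smul : ∀ (e : E) (d : D), τ (e • d) = e • τ d
  conn : ∀ g : X → ℚ, (∀ d, g (τ d) = g (o d)) → ∀ x y, g x = g y
  acyclic : ∀ c : D → ℚ, ∃ g : X → ℚ, ∀ d, g (τ d) - g (o d) = c d
  finX : Finite (MulAction.orbitRel.Quotient F X)
  finD : Finite (MulAction.orbitRel.Quotient F D)
  free : ∀ f ∈ F, ∀ d : D, f • d = d → f = 1
  nonempty : Nonempty X

namespace TreeAct

variable {E : Type*} [Group E] {F : Subgroup E} {X D : Type*} [MulAction E X]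
    [MulAction E D] (T : TreeAct F X D)

/-- The coboundary. -/
def delta : (X → ℚ) →ₗ[ℚ] (D → ℚ) where
  toFun g d := g (T.τ d) - g (T.o d)
  map_add' a b := by ext; simp; ring
  map_smul' a b := by ext; simp; ring

@[simp] theorem delta_apply (g : X → ℚ) (d : D) : T.delta g d = g (T.τ d) - g (T.o d) := rfl

theorem delta_surj : Function.Surjective T.delta := fun c => by
  obtain ⟨g, hg⟩ := T.acyclic c
  exact ⟨g, funext hg⟩

def prim : (D → ℚ) →ₗ[ℚ] (X → ℚ) :=
  (T.delta.exists_rightInverse_of_surjective (LinearMap.range_eq_top.2 T.delta_surj)).choose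

theorem delta_prim (c : D → ℚ) : T.delta (T.prim c) = c :=
  LinearMap.congr_fun (T.delta.exists_rightInverse_of_surjective
    (LinearMap.range_eq_top.2 T.delta_surj)).choose_spec c

theorem delta_eq {g g' : X → ℚ} (h : T.delta g = T.delta g') (x y : X) :
    g x - g' x = g y - g' y := by
  refine T.conn (fun x => g x - g' x) (fun d => ?_) x y
  have := congrFun h d
  simp at this
  linarith

/-- The trivial one-dimensional representation. -/
abbrev triv (E : Type*) [Group E] : Representation ℚ E ℚ := 1

theorem delta_secL (t : E) (g : X → ℚ) :
    T.delta (secL (triv E) t g) = secL (triv E) t (T.delta g) := by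
  ext d
  simp [T.o_smul, T.τ_smul]

theorem triv_coeff (F : Subgroup E) (X : Type*) [MulAction E X] :
    CoeffSys (X := X) F (triv E) (fun _ => ⊤) :=
  ⟨fun _ _ _ _ => trivial, fun _ _ _ _ _ _ => rfl⟩

variable (F) in
/-- Invariant functions. -/
abbrev inv (X : Type*) [MulAction E X] : Submodule ℚ (X → ℚ) :=
  equivSec F (triv E) (fun _ => ⊤)

theorem mem_inv {g : X → ℚ} : g ∈ inv F X ↔ ∀ f ∈ F, ∀ x, g (f • x) = g x := by
  simp [equivSec]

/-- The connecting map from invariant functions on edges to functions on the group. -/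
def bd (F : Subgroup E) (T : TreeAct F X D) : (D → ℚ) →ₗ[ℚ] (E → ℚ) where
  toFun c f := by
    classical
    exact if f ∈ F then T.prim c (f • T.nonempty.some) - T.prim c T.nonempty.some else 0
  map_add' a b := by
    ext
    simp only [map_add, Pi.add_apply]
    split_ifs
    · ring
    · simp
  map_smul' a b := by
    ext
    simp only [map_smul, Pi.smul_apply, smul_eq_mul, RingHom.id_apply]
    split_ifs
    · ring
    · simp

theorem bd_eq {c : D → ℚ} (hc : c ∈ inv F D) {g : X → ℚ} (hg : T.delta g = c) {f : E}
    (hf : f ∈ F) (x : X) : bd F T c f = g (f • x) - g x := by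
  have h1 : T.delta (fun x => g (f • x)) = T.delta g := by
    ext d
    have := mem_inv.1 hc f hf d
    rw [← hg] at this
    simpa [T.o_smul, T.τ_smul] using this
  have h2 := T.delta_eq h1 x T.nonempty.some
  have h3 := T.delta_eq ((T.delta_prim c).trans hg.symm) (f • T.nonempty.some) T.nonempty.some
  simp only [bd, LinearMap.coe_mk, AddHom.coe_mk, hf, if_true]
  beta_reduce at h2
  linarith

theorem bd_mem {c : D → ℚ} (hc : c ∈ inv F D) : bd F T c ∈ homQ F := by
  refine ⟨fun k hk => by simp [bd, hk], fun a ha b hb => ?_⟩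
  rw [T.bd_eq hc (T.delta_prim c) (mul_mem ha hb) T.nonempty.some,
    T.bd_eq hc (T.delta_prim c) ha (b • T.nonempty.some),
    T.bd_eq hc (T.delta_prim c) hb T.nonempty.some, mul_smul]
  ring

theorem secL_mem_inv [F.Normal] (t : E) : ∀ c ∈ inv F D, secL (triv E) t c ∈ inv F D :=
  (triv_coeff F D).secL_mem t

theorem bd_secL [F.Normal] (t : E) {c : D → ℚ} (hc : c ∈ inv F D) :
    bd F T (secL (triv E) t c) = conjRep E t (bd F T c) := by
  ext f
  by_cases hf : f ∈ F
  · have hf' := (normal_conj_iff (F := F) t f).1 hf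
    rw [conjRep_apply, T.bd_eq hc (T.delta_prim c) hf' (t⁻¹ • T.nonempty.some),
      T.bd_eq (secL_mem_inv t c hc) (g := secL (triv E) t (T.prim c))
        (by rw [delta_secL, delta_prim]) hf T.nonempty.some]
    simp [smul_smul]
  · rw [(T.bd_mem (secL_mem_inv t c hc)).1 _ hf, conjRep_apply, (T.bd_mem hc).1]
    rwa [← normal_conj_iff]

/-- The connecting map as a map into `Hom(F, ℚ)`. -/
def bdr : inv F D →ₗ[ℚ] homQ F :=
  ((bd F T).comp (Submodule.subtype _)).codRestrict _ fun c => T.bd_mem c.2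

/-- The coboundary on invariant functions. -/
def dlt : inv F X →ₗ[ℚ] inv F D :=
  (T.delta.comp (Submodule.subtype _)).codRestrict _ fun c => by
    have := mem_inv.1 c.2
    rw [mem_inv]
    intro f hf d
    simp [T.o_smul, T.τ_smul, this f hf]

variable (F) in
/-- The vertex groups coefficient system. -/
def vert (x : X) : Submodule ℚ (E → ℚ) := homQ (F ⊓ MulAction.stabilizer E x)

variable (F X) in
theorem vert_coeff [F.Normal] : CoeffSys (X := X) F (conjRep E) (vert F) := by
  constructor
  · intro e x h hh
    have key : ∀ k, k ∈ F ⊓ MulAction.stabilizer E (e • x) ↔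
        e⁻¹ * k * e ∈ F ⊓ MulAction.stabilizer E x := by
      intro k
      rw [Subgroup.mem_inf, Subgroup.mem_inf, ← normal_conj_iff e k, MulAction.mem_stabilizer_iff,
        MulAction.mem_stabilizer_iff, mul_smul, mul_smul, inv_smul_eq_iff]
    refine ⟨fun k hk => hh.1 _ (by rwa [← key]), fun a ha b hb => ?_⟩
    rw [conjRep_apply, conjRep_apply, conjRep_apply, ← hh.2 _ ((key a).1 ha) _ ((key b).1 hb)]
    congr 1
    group
  · intro f hf x hx a ha
    exact conjRep_of_mem (F := F ⊓ MulAction.stabilizer E x) ⟨hf, hx⟩ ha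

variable (F X) in
open Classical in
/-- Restriction of homomorphisms to the vertex groups. -/
def res [F.Normal] : homQ F →ₗ[ℚ] equivSec (X := X) F (conjRep E) (vert F) where
  toFun h := ⟨fun x k => if k ∈ F ⊓ MulAction.stabilizer E x then h.1 k else 0, by
    refine ⟨fun x => ⟨fun k hk => if_neg hk, fun a ha b hb => ?_⟩, fun f hf x => ?_⟩
    · beta_reduce
      rw [if_pos ha, if_pos hb, if_pos (mul_mem ha hb), h.2.2 _ ha.1 _ hb.1]
    · ext k
      have key : k ∈ F ⊓ MulAction.stabilizer E (f • x) ↔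
          f⁻¹ * k * f ∈ F ⊓ MulAction.stabilizer E x := by
        rw [Subgroup.mem_inf, Subgroup.mem_inf, ← normal_conj_iff f k,
          MulAction.mem_stabilizer_iff, MulAction.mem_stabilizer_iff, mul_smul, mul_smul,
          inv_smul_eq_iff]
      rw [conjRep_apply]
      simp only [key]
      congr 1
      exact (congrFun (conjRep_of_mem hf h.2) k).symm⟩
  map_add' a b := by ext x k; simp; split_ifs <;> simp
  map_smul' a b := by ext x k; simp

theorem res_apply [F.Normal] (h : homQ F) (x : X) {k : E} (hk : k ∈ F) (hkx : k • x = x) :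
    (res F X h).1 x k = h.1 k := by
  have : k ∈ F ⊓ MulAction.stabilizer E x := ⟨hk, hkx⟩
  simp only [res, LinearMap.coe_mk, AddHom.coe_mk, this, if_true]

theorem res_secL [F.Normal] (t : E) (h : homQ F) (ht : ∀ h ∈ homQ F, conjRep E t h ∈ homQ F) :
    (res F X ((conjRep E t).restrict ht h)).1 = secL (conjRep E) t (res F X h).1 := by
  classical
  ext x k
  have key : k ∈ F ⊓ MulAction.stabilizer E x ↔
      t⁻¹ * k * t ∈ F ⊓ MulAction.stabilizer E (t⁻¹ • x) := by
    rw [Subgroup.mem_inf, Subgroup.mem_inf, ← normal_conj_iff t k,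
      MulAction.mem_stabilizer_iff, MulAction.mem_stabilizer_iff, mul_smul, mul_smul,
      smul_inv_smul, smul_left_cancel_iff]
  rw [secL_apply, conjRep_apply]
  simp only [res, LinearMap.coe_mk, AddHom.coe_mk]
  exact if_congr key rfl rfl

theorem range_dlt : LinearMap.range T.dlt = LinearMap.ker T.bdr := by
  ext c
  constructor
  · rintro ⟨g, rfl⟩
    rw [LinearMap.mem_ker]
    ext f
    by_cases hf : f ∈ F
    · refine (T.bd_eq (T.dlt g).2 (g := g.1) rfl hf T.nonempty.some).trans ?_
      simp [mem_inv.1 g.2 f hf]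
    · exact (T.bd_mem (T.dlt g).2).1 _ hf
  · intro hc
    have h0 : bd F T c.1 = 0 := congrArg Subtype.val hc
    refine ⟨⟨T.prim c.1, mem_inv.2 fun f hf x => ?_⟩, ?_⟩
    · have := T.bd_eq c.2 (T.delta_prim c.1) hf x
      rw [h0] at this
      simp at this
      linarith
    · ext1
      exact T.delta_prim c.1

theorem range_bdr [F.Normal] : LinearMap.range T.bdr = LinearMap.ker (res F X) := by
  ext h
  constructor
  · rintro ⟨c, rfl⟩
    rw [LinearMap.mem_ker]
    ext x k
    by_cases hk : k ∈ F ⊓ MulAction.stabilizer E x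
    · rw [res_apply _ _ hk.1 hk.2]
      refine (T.bd_eq c.2 (T.delta_prim c.1) hk.1 x).trans ?_
      rw [show k • x = x from hk.2, sub_self]
      rfl
    · exact ((res F X _).2.1 x).1 _ hk
  · intro hh
    have hh' : ∀ x : X, ∀ k ∈ F, k • x = x → h.1 k = 0 := by
      intro x k hk hkx
      rw [← res_apply h x hk hkx, LinearMap.mem_ker.1 hh]
      rfl
    let g : X → ℚ := fun x => h.1 (transporter F x)
    have hg : ∀ f ∈ F, ∀ x, g (f • x) = g x + h.1 f := by
      intro f hf x
      have hfx := mk_smul_eq (F := F) hf x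
      have h1 := hh' (Quotient.mk (MulAction.orbitRel F X) x).out
        ((f * transporter F x)⁻¹ * transporter F (f • x))
        (mul_mem (inv_mem (mul_mem hf (transporter_mem F x))) (transporter_mem F _))
        (by rw [mul_smul, transporter_smul F hfx, inv_smul_eq_iff, mul_smul,
              transporter_smul F rfl])
      rw [h.2.2 _ (inv_mem (mul_mem hf (transporter_mem F x))) _ (transporter_mem F _),
        homQ_inv h.2 (mul_mem hf (transporter_mem F x)), h.2.2 _ hf _ (transporter_mem F x)] at h1
      simp only [g]
      linarith
    have hc : T.delta g ∈ inv F D := by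
      rw [mem_inv]
      intro f hf d
      simp [T.o_smul, T.τ_smul, hg f hf]
    refine ⟨⟨T.delta g, hc⟩, ?_⟩
    ext f
    by_cases hf : f ∈ F
    · refine (T.bd_eq hc rfl hf T.nonempty.some).trans ?_
      rw [hg f hf]
      ring
    · rw [h.2.1 f hf]
      exact (T.bd_mem hc).1 _ hf

theorem res_surjective [F.Normal] (T : TreeAct F X D) : Function.Surjective (res F X) := by
  intro w
  let q : X → MulAction.orbitRel.Quotient F X := Quotient.mk (MulAction.orbitRel F X)
  let κ : X → E := transporter F
  have hκ : ∀ x, κ x ∈ F := transporter_mem F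
  have hκx : ∀ x, κ x • (q x).out = x := fun x => transporter_smul F rfl
  have hq : ∀ f ∈ F, ∀ x, q (f • x) = q x := fun f hf x => mk_smul_eq hf x
  let σ : E → X → ℚ := fun f x => w.1 (q x).out ((κ (f • x))⁻¹ * f * κ x)
  have hmem : ∀ f ∈ F, ∀ x, (κ (f • x))⁻¹ * f * κ x ∈ F ⊓ MulAction.stabilizer E (q x).out := by
    intro f hf x
    refine Subgroup.mem_inf.2 ⟨mul_mem (mul_mem (inv_mem (hκ _)) hf) (hκ _), ?_⟩
    rw [MulAction.mem_stabilizer_iff, mul_smul, mul_smul, hκx, inv_smul_eq_iff]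
    conv_rhs => rw [← hq f hf x, hκx]
  have hσ : ∀ f' ∈ F, ∀ f ∈ F, ∀ x, σ (f' * f) x = σ f' (f • x) + σ f x := by
    intro f' hf' f hf x
    simp only [σ]
    have h1 := hmem f' hf' (f • x)
    rw [hq f hf] at h1 ⊢
    rw [← (w.2.1 (q x).out).2 _ h1 _ (hmem f hf x), mul_smul]
    group
  let κD : D → E := transporter F
  let c : D → ℚ := fun d =>
    -(σ (κD d) (T.τ (Quotient.mk (MulAction.orbitRel F D) d).out) -
      σ (κD d) (T.o (Quotient.mk (MulAction.orbitRel F D) d).out))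
  have hc : ∀ f ∈ F, ∀ d, σ f (T.τ d) - σ f (T.o d) = c d - c (f • d) := by
    intro f hf d
    have h1 : κD (f • d) = f * κD d := by
      have := T.free ((f * κD d)⁻¹ * κD (f • d))
        (mul_mem (inv_mem (mul_mem hf (transporter_mem F d))) (transporter_mem F _))
        (Quotient.mk (MulAction.orbitRel F D) d).out
        (by rw [mul_smul, transporter_smul F (mk_smul_eq hf d), inv_smul_eq_iff, mul_smul,
              transporter_smul F rfl])
      rw [inv_mul_eq_one] at this
      exact this.symm
    have h2 := transporter_smul F (x := d) rfl
    simp only [c, h1, mk_smul_eq hf d]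
    rw [hσ f hf _ (transporter_mem F d), hσ f hf _ (transporter_mem F d), ← T.τ_smul,
      ← T.o_smul]
    have h3 : κD d • (Quotient.mk (MulAction.orbitRel F D) d).out = d := h2
    rw [h3]
    ring
  obtain ⟨b, hb⟩ := T.acyclic c
  have hind : ∀ f ∈ F, ∀ x y, σ f x + b (f • x) - b x = σ f y + b (f • y) - b y := by
    intro f hf
    refine T.conn _ fun d => ?_
    have h1 := hc f hf d
    have h2 := hb d
    have h3 := hb (f • d)
    rw [T.o_smul, T.τ_smul] at h3
    linarith
  classical
  let x₀ := T.nonempty.some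
  refine ⟨⟨fun f => if f ∈ F then σ f x₀ + b (f • x₀) - b x₀ else 0,
    fun k hk => if_neg hk, fun f' hf' f hf => ?_⟩, ?_⟩
  · beta_reduce
    rw [if_pos hf, if_pos hf', if_pos (mul_mem hf' hf), hσ f' hf' f hf, hind f' hf' x₀ (f • x₀),
      mul_smul]
    ring
  · ext x k
    by_cases hk : k ∈ F ⊓ MulAction.stabilizer E x
    · rw [res_apply _ _ hk.1 hk.2]
      have hkx : k • x = x := hk.2
      have hkF : k ∈ F := hk.1
      simp only [hkF, if_true]
      rw [hind k hk.1 x₀ x, hkx]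
      simp only [σ, hkx]
      have := congrFun (w.2.2 (κ x) (hκ x) (q x).out) k
      rw [hκx] at this
      rw [this, conjRep_apply]
      ring
    · rw [((res F X _).2.1 x).1 _ hk, (w.2.1 x).1 _ hk]

end TreeAct

namespace TreeAct

variable {E : Type*} [Group E] {F : Subgroup E} {X D : Type*} [MulAction E X]
    [MulAction E D]

theorem trace_id_of_finrank_eq_one {V : Type*} [AddCommGroup V] [Module ℚ V] (K : Submodule ℚ V)
    (h : finrank ℚ K = 1) : LinearMap.trace ℚ K LinearMap.id = 1 := by
  have := FiniteDimensional.of_finrank_eq_succ h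
  rw [LinearMap.trace_id, h, Nat.cast_one]

theorem finite_inv (X : Type*) [MulAction E X] [Finite (MulAction.orbitRel.Quotient F X)] :
    FiniteDimensional ℚ (inv F X) := by
  let j : inv F X →ₗ[ℚ] (MulAction.orbitRel.Quotient F X → ℚ) :=
    { toFun := fun g q => g.1 q.out
      map_add' := fun _ _ => rfl
      map_smul' := fun _ _ => rfl }
  refine FiniteDimensional.of_injective j fun a b hab => ?_
  ext x
  have h := congrFun hab (Quotient.mk (MulAction.orbitRel F X) x)
  have h1 := mem_inv.1 a.2 _ (transporter_mem F x) (Quotient.mk (MulAction.orbitRel F X) x).out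
  have h2 := mem_inv.1 b.2 _ (transporter_mem F x) (Quotient.mk (MulAction.orbitRel F X) x).out
  rw [transporter_smul F rfl] at h1 h2
  rw [h1, h2]
  exact h

theorem finite_sec [F.Normal] [FiniteDimensional ℚ (homQ F)] (T : TreeAct F X D) :
    FiniteDimensional ℚ (equivSec (X := X) F (conjRep E) (vert F)) :=
  Module.Finite.of_surjective _ T.res_surjective

theorem res_comp_restrict [F.Normal] (t : E) (ht : ∀ h ∈ homQ F, conjRep E t h ∈ homQ F) :
    res F X ∘ₗ ((conjRep E t).restrict ht) =
      ((secL (conjRep E) t).restrict ((vert_coeff F X).secL_mem t)) ∘ₗ res F X := by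
  ext1 h
  exact Subtype.ext (res_secL t h ht)

theorem trace_formula [F.Normal] [FiniteDimensional ℚ (homQ F)] (T : TreeAct F X D) (t : E)
    (ht : ∀ h ∈ homQ F, conjRep E t h ∈ homQ F) :
    LinearMap.trace ℚ (homQ F) ((conjRep E t).restrict ht) =
      LinearMap.trace ℚ _ ((secL (conjRep E) t).restrict ((vert_coeff F X).secL_mem t)) +
      LinearMap.trace ℚ _ ((secL (triv E) t).restrict ((triv_coeff F D).secL_mem t)) -
      LinearMap.trace ℚ _ ((secL (triv E) t).restrict ((triv_coeff F X).secL_mem t)) + 1 := by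
  have := T.finX
  have := T.finD
  have := finite_inv (F := F) X
  have := finite_inv (F := F) D
  have hd : T.dlt ∘ₗ ((secL (triv E) t).restrict ((triv_coeff F X).secL_mem t)) =
      ((secL (triv E) t).restrict ((triv_coeff F D).secL_mem t)) ∘ₗ T.dlt := by
    ext1 g
    exact Subtype.ext (T.delta_secL t g.1)
  have hb : T.bdr ∘ₗ ((secL (triv E) t).restrict ((triv_coeff F D).secL_mem t)) =
      ((conjRep E t).restrict ht) ∘ₗ T.bdr := by
    ext1 c
    exact Subtype.ext (T.bd_secL t c.2)
  have hr := res_comp_restrict (X := X) t ht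
  have hK : ∀ x ∈ LinearMap.ker T.dlt,
      ((secL (triv E) t).restrict ((triv_coeff F X).secL_mem t)) x ∈ LinearMap.ker T.dlt := by
    intro x hx
    have := LinearMap.congr_fun hd x
    rw [LinearMap.comp_apply, LinearMap.comp_apply, LinearMap.mem_ker.1 hx, map_zero] at this
    exact this
  have hR1 : ∀ x ∈ LinearMap.range T.dlt,
      ((secL (triv E) t).restrict ((triv_coeff F D).secL_mem t)) x ∈ LinearMap.range T.dlt := by
    rintro _ ⟨x, rfl⟩
    exact ⟨_, LinearMap.congr_fun hd x⟩
  have hR2 : ∀ x ∈ LinearMap.range T.bdr,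
      ((conjRep E t).restrict ht) x ∈ LinearMap.range T.bdr := by
    rintro _ ⟨x, rfl⟩
    exact ⟨_, LinearMap.congr_fun hb x⟩
  have e1 := trace_eq_ker_add_range T.dlt _ _ hd _ _ rfl rfl hK hR1
  have e2 := trace_eq_ker_add_range T.bdr _ _ hb _ _ T.range_dlt rfl hR1 hR2
  have e3 := trace_eq_add_of_exact (K := LinearMap.range T.bdr)
    (Submodule.subtype (LinearMap.range T.bdr)) (res F X)
    (Submodule.injective_subtype _) T.res_surjective (by simpa using T.range_bdr)
    (((conjRep E t).restrict ht).restrict hR2) _ _ (by ext1; rfl) hr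
  have hconst : ∀ g ∈ LinearMap.ker T.dlt, ∀ x y, g.1 x = g.1 y := by
    intro g hg
    refine T.conn g.1 fun d => ?_
    have := congrFun (congrArg Subtype.val (LinearMap.mem_ker.1 hg)) d
    exact sub_eq_zero.1 this
  have e4 : LinearMap.trace ℚ (LinearMap.ker T.dlt)
      (((secL (triv E) t).restrict ((triv_coeff F X).secL_mem t)).restrict hK) = 1 := by
    have h1 : ((secL (triv E) t).restrict ((triv_coeff F X).secL_mem t)).restrict hK
        = LinearMap.id := by
      ext g x
      exact hconst g.1 g.2 _ _
    rw [h1]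
    refine trace_id_of_finrank_eq_one (LinearMap.ker T.dlt) ?_
    have hone : (fun _ => 1 : X → ℚ) ∈ inv F X := mem_inv.2 fun _ _ _ => rfl
    refine finrank_eq_one (⟨⟨_, hone⟩, ?_⟩ : LinearMap.ker T.dlt) ?_ ?_
    · rw [LinearMap.mem_ker]
      ext d
      exact sub_self _
    · intro h
      have := congrFun (congrArg (fun z => z.1.1) h) T.nonempty.some
      exact one_ne_zero this
    · intro g
      refine ⟨g.1.1 T.nonempty.some, ?_⟩
      ext x
      change g.1.1 _ * 1 = g.1.1 x
      rw [mul_one]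
      exact hconst g.1 g.2 _ _
  linarith

open Classical in
theorem trace_inv [F.Normal] (X : Type*) [MulAction E X]
    [Fintype (MulAction.orbitRel.Quotient F X)] (t : E) :
    LinearMap.trace ℚ _ ((secL (triv E) t).restrict ((triv_coeff F X).secL_mem t)) =
      ∑ q : MulAction.orbitRel.Quotient F X, if OrbFix F t q.out then (1 : ℚ) else 0 := by
  have := finite_inv (F := F) X
  refine (triv_coeff F X).trace_secL t _ (fun q hq => ?_) fun q hq => if_neg hq
  obtain ⟨f, hf, hfx⟩ := hq
  refine ⟨f * t, by simpa using hf, hfx, fun hu => ?_⟩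
  rw [if_pos ⟨f, hf, hfx⟩]
  have : ((triv E) (f * t)).restrict hu = LinearMap.id := rfl
  rw [this, LinearMap.trace_id]
  simp

/-- The first Betti number of the quotient graph of groups. -/
theorem finrank_formula [F.Normal] [FiniteDimensional ℚ (homQ F)]
    [Fintype (MulAction.orbitRel.Quotient F X)] [Fintype (MulAction.orbitRel.Quotient F D)]
    (T : TreeAct F X D) :
    finrank ℚ (homQ F) + Fintype.card (MulAction.orbitRel.Quotient F X) =
      ∑ q : MulAction.orbitRel.Quotient F X, finrank ℚ (vert F q.out) +
      Fintype.card (MulAction.orbitRel.Quotient F D) + 1 := by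
  classical
  have := T.finite_sec
  have hfin : ∀ q : MulAction.orbitRel.Quotient F X, OrbFix F 1 q.out :=
    fun q => ⟨1, one_mem _, by simp⟩
  have hfin' : ∀ q : MulAction.orbitRel.Quotient F D, OrbFix F 1 q.out :=
    fun q => ⟨1, one_mem _, by simp⟩
  have h1 := T.trace_formula 1 (fun h hh => by simpa using hh)
  rw [trace_inv, trace_inv, (vert_coeff F X).trace_secL 1
    (fun q => (finrank ℚ (vert F q.out) : ℚ)) (fun q _ => ⟨1, by simp, by simp, fun hu => ?_⟩)
    (fun q hq => absurd (hfin q) hq)] at h1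
  · have h2 : (conjRep E 1).restrict (p := homQ F) (q := homQ F)
        (fun h hh => by simpa using hh) = LinearMap.id := by
      ext h x
      simp
    rw [h2, LinearMap.trace_id] at h1
    simp only [hfin, hfin', if_true, Finset.sum_const, Finset.card_univ, nsmul_eq_mul,
      mul_one] at h1
    have : (finrank ℚ (homQ F) + Fintype.card (MulAction.orbitRel.Quotient F X) : ℚ) =
      ∑ q : MulAction.orbitRel.Quotient F X, (finrank ℚ (vert F q.out) : ℚ) +
      Fintype.card (MulAction.orbitRel.Quotient F D) + 1 := by linarith
    exact_mod_cast this
  · have h2 : (conjRep E 1).restrict hu = LinearMap.id := by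
      ext h x
      simp
    have := (vert_coeff F X).finite_fiber q
    rw [h2, LinearMap.trace_id]

/-- The orbit of `x` has a torsion element of the coset `F t` in its stabilizer. -/
def TorFix (F : Subgroup E) (t : E) {X : Type*} [MulAction E X] (x : X) : Prop :=
  ∃ f ∈ F, (f * t) • x = x ∧ IsOfFinOrder (f * t)

theorem torFix_smul [hF : F.Normal] {X : Type*} [MulAction E X] {t e : E} (he : e ∈ F) {x : X}
    (h : TorFix F t (e • x)) : TorFix F t x := by
  obtain ⟨f, hf, hfx, hfin⟩ := h
  have : (e⁻¹ * f * (t * e * t⁻¹) * t) = e⁻¹ * (f * t) * e := by group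
  refine ⟨e⁻¹ * f * (t * e * t⁻¹), mul_mem (mul_mem (inv_mem he) hf) (hF.conj_mem e he t), ?_, ?_⟩
  · rw [this, mul_smul, mul_smul, hfx, inv_smul_smul]
  · rw [this]
    have h2 := MulAut.conj e⁻¹ |>.toMonoidHom.isOfFinOrder hfin
    simpa using h2

open Classical in
/-- Invariant classes supported on fixed edges. -/
theorem exists_fixed_classes [F.Normal] [Fintype (MulAction.orbitRel.Quotient F X)]
    [Fintype (MulAction.orbitRel.Quotient F D)] [FiniteDimensional ℚ (homQ F)] (T : TreeAct F X D)
    (t : E) (ht : ∀ h ∈ homQ F, conjRep E t h ∈ homQ F)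
    (hstab : ∀ d : D, OrbFix F t d → TorFix F t d)
    (q₀ : MulAction.orbitRel.Quotient F X) (hq₀ : TorFix F t q₀.out) :
    ∃ U : Submodule ℚ (homQ F), U ≤ LinearMap.ker ((conjRep E t).restrict ht - 1) ∧
      U ≤ LinearMap.ker (res F X) ∧
      (Finset.univ.filter fun q : MulAction.orbitRel.Quotient F D => OrbFix F t q.out).card + 1 ≤
        finrank ℚ U +
        (Finset.univ.filter fun q : MulAction.orbitRel.Quotient F X => TorFix F t q.out).card := by
  set S := Finset.univ.filter fun q : MulAction.orbitRel.Quotient F D => OrbFix F t q.out with hS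
  set S' := Finset.univ.filter fun q : MulAction.orbitRel.Quotient F X => TorFix F t q.out with hS'
  let Ψ : (S → ℚ) →ₗ[ℚ] inv F D := (triv_coeff F D).incSum S ∘ₗ
    LinearMap.pi fun q => (Submodule.topEquiv.symm.toLinearMap ∘ₗ LinearMap.proj q)
  have hΨ : ∀ c q, (Ψ c).1 q.1.out = c q := by
    intro c q
    exact (triv_coeff F D).incSum_out S _ q
  have hΨt : ∀ c, secL (triv E) t (Ψ c).1 = (Ψ c).1 := by
    intro c
    have hu : ∀ q : S, ∃ u : E, u * t⁻¹ ∈ F ∧ u • q.1.out = q.1.out := by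
      intro q
      obtain ⟨f, hf, hfx⟩ := (Finset.mem_filter.1 q.2).2
      exact ⟨f * t, by simpa using hf, hfx⟩
    choose u hu1 hu2 using hu
    exact (triv_coeff F D).secL_incSum S _ u hu1 hu2 fun q => rfl
  let Φ := T.bdr ∘ₗ Ψ
  refine ⟨LinearMap.range Φ, ?_, ?_, ?_⟩
  · rintro _ ⟨c, rfl⟩
    rw [LinearMap.mem_ker, LinearMap.sub_apply, sub_eq_zero]
    ext1
    have := T.bd_secL t (Ψ c).2
    rw [hΨt] at this
    exact this.symm
  · rw [← T.range_bdr]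
    exact LinearMap.range_comp_le_range _ _
  · have h1 := LinearMap.finrank_range_add_finrank_ker Φ
    rw [Module.finrank_fintype_fun_eq_card, Fintype.card_coe] at h1
    let j : LinearMap.ker Φ →ₗ[ℚ] ({q // q ∈ S'.erase q₀} → ℚ) :=
      { toFun := fun c q => T.prim (Ψ c.1).1 q.1.out - T.prim (Ψ c.1).1 q₀.out
        map_add' := fun a b => by ext q; simp; ring
        map_smul' := fun a b => by ext q; simp; ring }
    have hj : Function.Injective j := by
      rw [← LinearMap.ker_eq_bot, LinearMap.ker_eq_bot']
      intro c hc
      have hcg : ∀ f ∈ F, ∀ x, T.prim (Ψ c.1).1 (f • x) = T.prim (Ψ c.1).1 x := by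
        intro f hf x
        have h2 := T.bd_eq (Ψ c.1).2 (T.delta_prim _) hf x
        have h3 : T.bdr (Ψ c.1) = 0 := c.2
        have h4 : bd F T (Ψ c.1).1 = 0 := congrArg Subtype.val h3
        rw [h4] at h2
        simp at h2
        linarith
      have hval : ∀ x, TorFix F t x → T.prim (Ψ c.1).1 x = T.prim (Ψ c.1).1 q₀.out := by
        intro x hx
        have hx1 : TorFix F t (Quotient.mk (MulAction.orbitRel F X) x).out := by
          refine torFix_smul (transporter_mem F x) ?_
          rwa [transporter_smul F rfl]
        have hx2 := hcg _ (transporter_mem F x) (Quotient.mk (MulAction.orbitRel F X) x).out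
        rw [transporter_smul F rfl] at hx2
        rw [hx2]
        by_cases e : (Quotient.mk (MulAction.orbitRel F X) x) = q₀
        · rw [e]
        · have := congrFun hc ⟨_, Finset.mem_erase.2 ⟨e, by simpa [hS'] using hx1⟩⟩
          exact sub_eq_zero.1 this
      ext q
      change c.1 q = 0
      rw [← hΨ c.1 q, ← T.delta_prim (Ψ c.1).1, delta_apply]
      obtain ⟨f, hf, hfx, hfin⟩ := hstab _ (Finset.mem_filter.1 q.2).2
      rw [hval (T.τ q.1.out) ⟨f, hf, by rw [← T.τ_smul, hfx], hfin⟩,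
        hval (T.o q.1.out) ⟨f, hf, by rw [← T.o_smul, hfx], hfin⟩, sub_self]
    have h2 := LinearMap.finrank_le_finrank_of_injective hj
    rw [Module.finrank_fintype_fun_eq_card, Fintype.card_coe] at h2
    have h3 := Finset.card_erase_add_one (s := S') (a := q₀) (by simpa [hS'] using hq₀)
    omega

/-- The Lefschetz dichotomy is inherited from the vertex groups. -/
theorem lef [F.Normal] [F.FiniteIndex] [FiniteDimensional ℚ (homQ F)] (T : TreeAct F X D) (t : E)
    (hstab : ∀ d : D, (MulAction.stabilizer E d : Set E).Finite)
    (htor : ∀ e : E, IsOfFinOrder e → ∃ x : X, e • x = x)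
    (hv : ∀ x : X, ∀ u : E, u • x = x → u * t⁻¹ ∈ F →
      Lef (F ⊓ MulAction.stabilizer E x) u) : Lef F t := by
  classical
  intro ht
  have := T.finite_sec
  have := T.finX
  have := T.finD
  have := Fintype.ofFinite (MulAction.orbitRel.Quotient F X)
  have := Fintype.ofFinite (MulAction.orbitRel.Quotient F D)
  have hstab' : ∀ d : D, OrbFix F t d → TorFix F t d := by
    rintro d ⟨f, hf, hfd⟩
    refine ⟨f, hf, hfd, ?_⟩
    have : Finite (MulAction.stabilizer E d) := (hstab d).to_subtype
    have h1 := isOfFinOrder_of_finite (⟨f * t, hfd⟩ : MulAction.stabilizer E d)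
    simpa using (MulAction.stabilizer E d).subtype.isOfFinOrder h1
  have hu : ∀ q : MulAction.orbitRel.Quotient F X, ∃ u : E, OrbFix F t q.out →
      (u * t⁻¹ ∈ F ∧ u • q.out = q.out ∧ (TorFix F t q.out → IsOfFinOrder u)) := by
    intro q
    by_cases h1 : TorFix F t q.out
    · obtain ⟨f, hf, hfx, hfin⟩ := h1
      exact ⟨f * t, fun _ => ⟨by simpa using hf, hfx, fun _ => hfin⟩⟩
    · by_cases h2 : OrbFix F t q.out
      · obtain ⟨f, hf, hfx⟩ := h2
        exact ⟨f * t, fun _ => ⟨by simpa using hf, hfx, fun h => absurd h h1⟩⟩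
      · exact ⟨1, fun h => absurd h h2⟩
  choose u hu using hu
  have huA : ∀ q : MulAction.orbitRel.Quotient F X, OrbFix F t q.out →
      ∀ a ∈ vert F q.out, conjRep E (u q) a ∈ vert F q.out := by
    intro q hq a ha
    have := (vert_coeff F X).map_mem (u q) _ a ha
    rwa [(hu q hq).2.1] at this
  let tr : MulAction.orbitRel.Quotient F X → ℚ := fun q =>
    if hq : OrbFix F t q.out then
      LinearMap.trace ℚ (vert F q.out) ((conjRep E (u q)).restrict (huA q hq)) else 0
  have hW := (vert_coeff F X).trace_secL t tr
    (fun q hq => ⟨u q, (hu q hq).1, (hu q hq).2.1, fun _ => by simp only [tr, dif_pos hq]⟩)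
    (fun q hq => by simp only [tr, dif_neg hq])
  have hform := T.trace_formula t ht
  rw [hW, trace_inv, trace_inv, add_sub_right_comm, ← Finset.sum_sub_distrib] at hform
  have htr1 : ∀ q : MulAction.orbitRel.Quotient F X, OrbFix F t q.out → ¬ TorFix F t q.out →
      tr q = 1 := by
    intro q hq hq'
    have h1 := (hv q.out (u q) (hu q hq).2.1 (hu q hq).1 (huA q hq)).1 ?_
    · simp only [tr, dif_pos hq]
      exact h1
    · intro f hf hfin
      apply hq'
      refine ⟨f * (u q * t⁻¹), mul_mem hf.1 (hu q hq).1, ?_, ?_⟩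
      · rw [← mul_assoc, inv_mul_cancel_right, mul_smul, (hu q hq).2.1]
        exact hf.2
      · rwa [← mul_assoc, inv_mul_cancel_right]
  constructor
  · intro hno
    have hno' : ∀ {Y : Type _} [MulAction E Y] (y : Y), ¬ TorFix F t y := by
      rintro Y _ y ⟨f, hf, _, hfin⟩
      exact hno f hf hfin
    have hnoD : ∀ d : D, ¬ OrbFix F t d := by
      intro d hd
      obtain ⟨f, hf, _, hfin⟩ := hstab' d hd
      exact hno f hf hfin
    rw [hform, Finset.sum_eq_zero, Finset.sum_eq_zero]
    · ring
    · intro q _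
      rw [if_neg (hnoD _)]
    · intro q _
      by_cases hq : OrbFix F t q.out
      · rw [htr1 q hq (hno' _), if_pos hq, sub_self]
      · rw [if_neg hq]
        simp only [tr, dif_neg hq, sub_zero]
  · rintro ⟨f₀, hf₀, hfin₀⟩
    obtain ⟨x₀, hx₀⟩ := htor _ hfin₀
    have hq₀ : TorFix F t (Quotient.mk (MulAction.orbitRel F X) x₀).out := by
      refine torFix_smul (transporter_mem F x₀) ?_
      rw [transporter_smul F rfl]
      exact ⟨f₀, hf₀, hx₀, hfin₀⟩
    obtain ⟨U, hU1, hU2, hU3⟩ := T.exists_fixed_classes t ht hstab' _ hq₀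
    set S' := Finset.univ.filter fun q : MulAction.orbitRel.Quotient F X => TorFix F t q.out
      with hS'
    have hSfix : ∀ q ∈ S', OrbFix F t q.out := by
      intro q hq
      obtain ⟨f, hf, hfx, _⟩ := (Finset.mem_filter.1 hq).2
      exact ⟨f, hf, hfx⟩
    have hWfix := (vert_coeff F X).sum_finrank_fix_le (t := t) S' (fun q => u q.1)
      (fun q => (hu q.1 (hSfix _ q.2)).1) (fun q => (hu q.1 (hSfix _ q.2)).2.1)
      (fun q => huA q.1 (hSfix _ q.2))
    have hr := res_comp_restrict (X := X) t ht
    obtain ⟨N, hN, hNF⟩ : ∃ N : ℕ, 0 < N ∧ t ^ N ∈ F := by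
      obtain ⟨N, hN, _, h⟩ := Subgroup.exists_pow_mem_of_index_ne_zero
        (H := F) Subgroup.FiniteIndex.index_ne_zero t
      exact ⟨N, hN, h⟩
    have hpow : ((conjRep E t).restrict ht) ^ N = 1 := by
      ext1 h
      ext1
      have h2 : ∀ i : ℕ, (((conjRep E t).restrict ht ^ i) h).1 = conjRep E (t ^ i) h.1 := by
        intro i
        induction i with
        | zero => simp
        | succ i ih =>
          rw [pow_succ', Module.End.mul_apply, pow_succ', map_mul, Module.End.mul_apply, ← ih]
          rfl
      rw [h2, conjRep_of_mem hNF h.2]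
      rfl
    have hfix := finrank_fix_add_le (res F X) T.res_surjective _ _ hr hN hpow U hU1 hU2
    have hsum : ∑ q : MulAction.orbitRel.Quotient F X,
        (tr q - if OrbFix F t q.out then (1 : ℚ) else 0) = ∑ q ∈ S', (tr q - 1) := by
      rw [hS', Finset.sum_filter]
      refine Finset.sum_congr rfl fun q _ => ?_
      by_cases hq : TorFix F t q.out
      · rw [if_pos hq, if_pos]
        obtain ⟨f, hf, hfx, _⟩ := hq
        exact ⟨f, hf, hfx⟩
      · rw [if_neg hq]
        by_cases hq' : OrbFix F t q.out
        · rw [if_pos hq', htr1 q hq' hq, sub_self]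
        · rw [if_neg hq']
          simp only [tr, dif_neg hq', sub_zero]
    have hle : ∑ q ∈ S', tr q ≤
        ((∑ q : S', finrank ℚ (LinearMap.ker ((conjRep E (u q.1)).restrict
          (huA q.1 (hSfix _ q.2)) - 1)) : ℕ) : ℚ) := by
      rw [← Finset.sum_coe_sort S', Nat.cast_sum]
      refine Finset.sum_le_sum fun q _ => ?_
      have hq := hSfix _ q.2
      have h1 := (hv q.1.out (u q.1) (hu q.1 hq).2.1 (hu q.1 hq).1 (huA q.1 hq)).2
        ⟨1, one_mem _, by rw [one_mul]; exact (hu q.1 hq).2.2 (Finset.mem_filter.1 q.2).2⟩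
      simp only [tr, dif_pos hq]
      exact h1
    rw [hform, hsum, Finset.sum_sub_distrib, Finset.sum_const, nsmul_eq_mul, mul_one,
      Finset.sum_boole]
    have h5 : ((∑ q : S', finrank ℚ (LinearMap.ker ((conjRep E (u q.1)).restrict
          (huA q.1 (hSfix _ q.2)) - 1)) : ℕ) : ℚ) ≤ _ := Nat.cast_le.2 hWfix
    have h6 := (Nat.cast_le (α := ℚ)).2 hU3
    have h7 := (Nat.cast_le (α := ℚ)).2 hfix
    push_cast at h5 h6 h7 hle ⊢
    linarith

end TreeAct

namespace Cut

variable {V : Type*}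

/-- The oriented boundary of a set of vertices. -/
def bdry (R : V → V → Prop) (A : Set V) : Set (V × V) := {p | R p.1 p.2 ∧ p.1 ∈ A ∧ p.2 ∉ A}

/-- A set of vertices spanning a connected subgraph. -/
def Conn (R : V → V → Prop) (A : Set V) : Prop :=
  ∀ P ⊆ A, P.Nonempty → (∀ x ∈ P, ∀ y ∈ A, R x y → y ∈ P) → P = A

theorem Conn.subset_reach {R : V → V → Prop} {A : Set V} (hA : Conn R A) {x : V} (hx : x ∈ A) :
    ∀ z ∈ A, Relation.ReflTransGen R x z := by
  have := hA {z | z ∈ A ∧ Relation.ReflTransGen R x z} (fun z hz => hz.1)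
    ⟨x, hx, Relation.ReflTransGen.refl⟩ (fun z hz y hy h => ⟨hy, hz.2.tail h⟩)
  intro z hz
  rw [← this] at hz
  exact hz.2

theorem symm_reach {R : V → V → Prop} (hR : ∀ x y, R x y → R y x) {x y : V}
    (h : Relation.ReflTransGen R x y) : Relation.ReflTransGen R y x := by
  induction h with
  | refl => exact Relation.ReflTransGen.refl
  | tail _ h ih => exact Relation.ReflTransGen.head (hR _ _ h) ih

/-- Only finitely many connected cuts of given size separate two given vertices. -/
theorem finite_separating (k : ℕ) : ∀ (R : V → V → Prop), (∀ x y, R x y → R y x) → ∀ x y : V,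
    {A : Set V | x ∈ A ∧ y ∉ A ∧ Conn R A ∧ Conn R Aᶜ ∧ (bdry R A).encard = k}.Finite := by
  induction k with
  | zero =>
    intro R hR x y
    refine Set.Subsingleton.finite ?_
    rintro A ⟨hx, hy, hA, hA', hk⟩ B ⟨hx', hy', hB, hB', hk'⟩
    have key : ∀ A : Set V, x ∈ A → Conn R A → (bdry R A).encard = (0 : ℕ) →
        A = {z | Relation.ReflTransGen R x z} := by
      intro A hx hA hk
      refine Set.Subset.antisymm (fun z hz => hA.subset_reach hx z hz) fun z hz => ?_
      have h0 : bdry R A = ∅ := by simpa using hk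
      induction hz with
      | refl => exact hx
      | @tail b c _ h ih =>
        by_contra hc
        have : (b, c) ∈ bdry R A := ⟨h, ih, hc⟩
        simp [h0] at this
    rw [key A hx hA hk, key B hx' hB hk']
  | succ k ih =>
    intro R hR x y
    by_cases hxy : Relation.ReflTransGen R x y
    · induction hxy with
      | refl => exact Set.Finite.subset Set.finite_empty fun A hA => absurd hA.1 hA.2.1
      | @tail b c _ hbc ih' =>
        refine Set.Finite.subset (ih'.union (ih (fun u v => R u v ∧ (u, v) ≠ (b, c) ∧
          (v, u) ≠ (b, c)) (fun u v h => ⟨hR _ _ h.1, h.2.2, h.2.1⟩) b c)) ?_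
        rintro A ⟨hx, hy, hA, hA', hk⟩
        by_cases hb : b ∈ A
        · right
          refine ⟨hb, hy, ?_, ?_, ?_⟩
          · intro P hPA hP h
            refine hA P hPA hP fun u hu v hv huv => h u hu v hv ⟨huv, ?_, ?_⟩
            · rintro ⟨⟩; exact hy hv
            · rintro ⟨⟩; exact hy (hPA hu)
          · intro P hPA hP h
            refine hA' P hPA hP fun u hu v hv huv => h u hu v hv ⟨huv, ?_, ?_⟩
            · rintro ⟨⟩; exact hPA hu hb
            · rintro ⟨⟩; exact hv hb
          · have hmem : (b, c) ∈ bdry R A := ⟨hbc, hb, hy⟩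
            have : bdry (fun u v => R u v ∧ (u, v) ≠ (b, c) ∧ (v, u) ≠ (b, c)) A
                = bdry R A \ {(b, c)} := by
              ext ⟨u, v⟩
              simp only [bdry, Set.mem_ofPred_eq, Set.mem_sdiff, Set.mem_singleton_iff]
              constructor
              · rintro ⟨⟨h1, h2, h3⟩, h4, h5⟩
                exact ⟨⟨h1, h4, h5⟩, h2⟩
              · rintro ⟨⟨h1, h4, h5⟩, h2⟩
                refine ⟨⟨h1, h2, ?_⟩, h4, h5⟩
                rintro ⟨⟩
                exact hy h4
            rw [this]
            have h2 := Set.encard_sdiff_singleton_add_one hmem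
            rw [hk] at h2
            push_cast at h2
            exact (ENat.add_left_injective_of_ne_top ENat.one_ne_top) h2
        · exact Or.inl ⟨hx, hb, hA, hA', hk⟩
    · refine Set.Subsingleton.finite ?_
      have key : ∀ A : Set V, x ∈ A → y ∉ A → Conn R A → Conn R Aᶜ →
          A = {z | Relation.ReflTransGen R x z} := by
        intro A hx hy hA hA'
        refine Set.Subset.antisymm (fun z hz => hA.subset_reach hx z hz) fun z hz => ?_
        by_contra hzA
        exact hxy (hz.trans (symm_reach hR (hA'.subset_reach hy z hzA)))
      rintro A ⟨hx, hy, hA, hA', hk⟩ B ⟨hx', hy', hB, hB', hk'⟩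
      rw [key A hx hy hA hA', key B hx' hy' hB hB']

variable (R : V → V → Prop)

theorem bdry_compl (hR : ∀ x y, R x y → R y x) (A : Set V) :
    bdry R Aᶜ = Prod.swap '' bdry R A := by
  ext ⟨u, v⟩
  simp only [bdry, Set.mem_ofPred_eq, Set.image_swap_eq_preimage_swap, Set.mem_preimage,
    Prod.swap_prod_mk, Set.mem_compl_iff, not_not]
  exact ⟨fun h => ⟨hR _ _ h.1, h.2.2, h.2.1⟩, fun h => ⟨hR _ _ h.1, h.2.2, h.2.1⟩⟩

theorem encard_bdry_compl (hR : ∀ x y, R x y → R y x) (A : Set V) :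
    (bdry R Aᶜ).encard = (bdry R A).encard := by
  rw [bdry_compl R hR, Prod.swap_injective.encard_image]

theorem encard_bdry_inter_add_union (A B : Set V) :
    (bdry R (A ∩ B)).encard + (bdry R (A ∪ B)).encard ≤
      (bdry R A).encard + (bdry R B).encard := by
  rw [← Set.encard_union_add_encard_inter, ← Set.encard_union_add_encard_inter (bdry R A)]
  refine add_le_add (Set.encard_le_encard ?_) (Set.encard_le_encard ?_)
  · rintro ⟨u, v⟩ h
    simp only [bdry, Set.mem_union, Set.mem_inter_iff, Set.mem_ofPred_eq] at h ⊢
    tauto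
  · rintro ⟨u, v⟩ h
    simp only [bdry, Set.mem_union, Set.mem_inter_iff, Set.mem_ofPred_eq] at h ⊢
    tauto

/-- Infinite, co-infinite sets with finite boundary. -/
def IsCut (A : Set V) : Prop := A.Infinite ∧ Aᶜ.Infinite ∧ (bdry R A).Finite

/-- Cuts with boundary of minimal size. -/
def IsMinCut (A : Set V) : Prop :=
  IsCut R A ∧ ∀ B, IsCut R B → (bdry R A).encard ≤ (bdry R B).encard

theorem IsCut.compl (hR : ∀ x y, R x y → R y x) {A : Set V} (h : IsCut R A) : IsCut R Aᶜ :=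
  ⟨h.2.1, by rw [compl_compl]; exact h.1, by rw [bdry_compl R hR]; exact h.2.2.image _⟩

theorem IsMinCut.compl (hR : ∀ x y, R x y → R y x) {A : Set V} (h : IsMinCut R A) :
    IsMinCut R Aᶜ :=
  ⟨h.1.compl R hR, fun B hB => by rw [encard_bdry_compl R hR]; exact h.2 B hB⟩

theorem exists_isMinCut {A : Set V} (h : IsCut R A) : ∃ B, IsMinCut R B := by
  obtain ⟨B, hB, hmin⟩ := exists_minimalFor_of_wellFoundedLT (IsCut R)
    (fun B => (bdry R B).encard) ⟨A, h⟩
  refine ⟨B, hB, fun C hC => ?_⟩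
  rcases le_total ((bdry R B).encard) ((bdry R C).encard) with h | h
  · exact h
  · exact hmin hC h

theorem IsMinCut.conn (hR : ∀ x y, R x y → R y x)
    (hconn : ∀ A : Set V, bdry R A = ∅ → A = ∅ ∨ A = Set.univ) {A : Set V} (h : IsMinCut R A) :
    Conn R A := by
  have key : ∀ P Q : Set V, P ∪ Q = A → Disjoint P Q → (∀ x ∈ P, ∀ y ∈ Q, ¬ R x y) →
      P.Infinite → Q = ∅ := by
    intro P Q hPQ hdis hno hP
    have hno' : ∀ x ∈ Q, ∀ y ∈ P, ¬ R x y := fun x hx y hy hxy => hno y hy x hx (hR _ _ hxy)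
    have hun : bdry R A = bdry R P ∪ bdry R Q := by
      ext ⟨u, v⟩
      have h1 := hno u
      have h2 := hno' u
      have h3 := Set.disjoint_left.1 hdis
      simp only [bdry, Set.mem_union, Set.mem_ofPred_eq, ← hPQ]
      constructor
      · tauto
      · rintro (⟨h4, h5, h6⟩ | ⟨h4, h5, h6⟩)
        · exact ⟨h4, Or.inl h5, fun h => h.elim h6 fun h7 => h1 h5 v h7 h4⟩
        · exact ⟨h4, Or.inr h5, fun h => h.elim (fun h7 => h2 h5 v h7 h4) h6⟩
    have hd : Disjoint (bdry R P) (bdry R Q) :=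
      Set.disjoint_left.2 fun p hp hq => Set.disjoint_left.1 hdis hp.2.1 hq.2.1
    have hsub : Aᶜ ⊆ Pᶜ := Set.compl_subset_compl.2 (hPQ ▸ Set.subset_union_left)
    have hcut : IsCut R P := ⟨hP, h.1.2.1.mono hsub, h.1.2.2.subset (hun ▸ Set.subset_union_left)⟩
    have h2 := h.2 P hcut
    rw [hun, Set.encard_union_eq hd] at h2
    have hfin : (bdry R P).encard ≠ ⊤ := hcut.2.2.encard_lt_top.ne
    have h3 : (bdry R Q).encard = 0 := by
      by_contra hne
      have h1 : 1 ≤ (bdry R Q).encard := Order.one_le_iff_pos.2 (pos_iff_ne_zero.2 hne)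
      have : (bdry R P).encard + 1 ≤ (bdry R P).encard := (by gcongr : _ ≤ _).trans h2
      exact absurd (ENat.add_one_le_iff hfin |>.1 this) (lt_irrefl _)
    refine (hconn Q (Set.encard_eq_zero.1 h3)).resolve_right fun hQ => ?_
    have : Aᶜ = ∅ := by
      rw [← hPQ, hQ, Set.union_univ, Set.compl_univ]
    exact h.1.2.1 (this ▸ Set.finite_empty)
  intro P hPA hP hcl
  have hdis : Disjoint P (A \ P) := Set.disjoint_sdiff_right
  have hno : ∀ x ∈ P, ∀ y ∈ A \ P, ¬ R x y := fun x hx y hy hxy => hy.2 (hcl x hx y hy.1 hxy)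
  have hun : P ∪ A \ P = A := Set.union_sdiff_cancel hPA
  by_cases hinf : P.Infinite
  · have := key P (A \ P) hun hdis hno hinf
    exact hPA.antisymm (Set.sdiff_eq_empty.1 this)
  · have : (A \ P).Infinite := h.1.1.sdiff (Set.not_infinite.1 hinf)
    exact absurd (key (A \ P) P (by rw [Set.union_comm, hun]) hdis.symm
      (fun x hx y hy hxy => hno y hy x hx (hR _ _ hxy)) this) hP.ne_empty

theorem finite_isMinCut_separating (hR : ∀ x y, R x y → R y x)
    (hconn : ∀ A : Set V, bdry R A = ∅ → A = ∅ ∨ A = Set.univ) (x y : V) :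
    {A : Set V | IsMinCut R A ∧ x ∈ A ∧ y ∉ A}.Finite := by
  rcases Set.eq_empty_or_nonempty {A : Set V | IsMinCut R A ∧ x ∈ A ∧ y ∉ A} with h0 | ⟨A, hA⟩
  · rw [h0]; exact Set.finite_empty
  · refine (finite_separating (bdry R A).ncard R hR x y).subset ?_
    rintro B ⟨hB, hx, hy⟩
    refine ⟨hx, hy, hB.conn R hR hconn, (hB.compl R hR).conn R hR hconn, ?_⟩
    rw [hA.1.1.2.2.cast_ncard_eq]
    exact le_antisymm (hB.2 A hA.1.1) (hA.1.2 B hB.1)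

/-- Nested pairs of sets. -/
def Nested (A B : Set V) : Prop := A ⊆ B ∨ A ⊆ Bᶜ ∨ Aᶜ ⊆ B ∨ Aᶜ ⊆ Bᶜ

theorem Nested.compl_right {A B : Set V} (h : Nested A B) : Nested A Bᶜ := by
  unfold Nested at *
  rw [compl_compl]
  tauto

theorem Nested.inter {A B D : Set V} (h : Nested D A) (h' : Nested D B)
    (hne : (Aᶜ ∩ Bᶜ).Nonempty) : Nested D (A ∩ B) := by
  obtain ⟨x, hx1, hx2⟩ := hne
  unfold Nested at *
  rcases h with h | h | h | h
  · rcases h' with h' | h' | h' | h'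
    · exact Or.inl (Set.subset_inter h h')
    · exact Or.inr (Or.inl (h'.trans (Set.compl_subset_compl.2 Set.inter_subset_right)))
    · by_cases hx : x ∈ D
      · exact absurd (h hx) hx1
      · exact absurd (h' hx) hx2
    · exact Or.inr (Or.inr (Or.inr (h'.trans (Set.compl_subset_compl.2 Set.inter_subset_right))))
  · exact Or.inr (Or.inl (h.trans (Set.compl_subset_compl.2 Set.inter_subset_left)))
  · rcases h' with h' | h' | h' | h'
    · by_cases hx : x ∈ D
      · exact absurd (h' hx) hx2
      · exact absurd (h hx) hx1
    · exact Or.inr (Or.inl (h'.trans (Set.compl_subset_compl.2 Set.inter_subset_right)))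
    · exact Or.inr (Or.inr (Or.inl (Set.subset_inter h h')))
    · exact Or.inr (Or.inr (Or.inr (h'.trans (Set.compl_subset_compl.2 Set.inter_subset_right))))
  · exact Or.inr (Or.inr (Or.inr (h.trans (Set.compl_subset_compl.2 Set.inter_subset_left))))

/-- The minimal cuts crossing a given set. -/
def crossing (A : Set V) : Set (Set V) := {D | IsMinCut R D ∧ ¬ Nested D A}

theorem crossing_compl (A : Set V) : crossing R Aᶜ = crossing R A := by
  ext D
  refine and_congr_right fun _ => not_congr ⟨fun h => ?_, fun h => h.compl_right⟩
  simpa using h.compl_right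

theorem finite_crossing (hR : ∀ x y, R x y → R y x)
    (hconn : ∀ A : Set V, bdry R A = ∅ → A = ∅ ∨ A = Set.univ) {A : Set V} (hA : IsCut R A) :
    (crossing R A).Finite := by
  have hfin := hA.2.2
  let K : Set V := Prod.fst '' bdry R A ∪ Prod.snd '' bdry R A
  have hK : K.Finite := (hfin.image _).union (hfin.image _)
  have key : ∀ D : Set V, Conn R D → (D ∩ A).Nonempty → (D ∩ Aᶜ).Nonempty → ∃ x ∈ K, x ∈ D := by
    intro D hD h1 h2
    by_contra! hno
    have := hD (D ∩ A) Set.inter_subset_left h1 fun x hx y hy hxy => by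
      refine ⟨hy, ?_⟩
      by_contra hyA
      exact hno x (Or.inl ⟨(x, y), ⟨hxy, hx.2, hyA⟩, rfl⟩) hx.1
    obtain ⟨z, hz, hzA⟩ := h2
    rw [← this] at hz
    exact hzA hz.2
  refine ((hK.prod hK).biUnion fun p _ =>
    finite_isMinCut_separating R hR hconn p.1 p.2).subset ?_
  rintro D ⟨hD, hDA⟩
  simp only [Nested, not_or, Set.not_subset, Set.mem_compl_iff, not_not] at hDA
  obtain ⟨⟨a, ha1, ha2⟩, ⟨b, hb1, hb2⟩, ⟨c, hc1, hc2⟩, ⟨d, hd1, hd2⟩⟩ := hDA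
  obtain ⟨x, hxK, hx⟩ := key D (hD.conn R hR hconn) ⟨b, hb1, hb2⟩ ⟨a, ha1, ha2⟩
  obtain ⟨y, hyK, hy⟩ := key Dᶜ ((hD.compl R hR).conn R hR hconn) ⟨d, hd1, hd2⟩ ⟨c, hc1, hc2⟩
  exact Set.mem_biUnion (x := (x, y)) ⟨hxK, hyK⟩ ⟨hD, hx, hy⟩

/-- Minimal cuts crossing as few minimal cuts as possible. -/
def opt : Set (Set V) :=
  {A | IsMinCut R A ∧ ∀ B, IsMinCut R B → (crossing R A).encard ≤ (crossing R B).encard}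

theorem opt_nonempty {A : Set V} (h : IsCut R A) : (opt R).Nonempty := by
  obtain ⟨B, hB, hmin⟩ := exists_minimalFor_of_wellFoundedLT (IsMinCut R)
    (fun B => (crossing R B).encard) (exists_isMinCut R h)
  refine ⟨B, hB, fun C hC => ?_⟩
  rcases le_total ((crossing R B).encard) ((crossing R C).encard) with h | h
  · exact h
  · exact hmin hC h

theorem opt_compl (hR : ∀ x y, R x y → R y x) {A : Set V} (h : A ∈ opt R) : Aᶜ ∈ opt R :=
  ⟨h.1.compl R hR, by rw [crossing_compl]; exact h.2⟩

theorem isMinCut_inter {A B : Set V} (hA : IsMinCut R A)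
    (hB : IsMinCut R B) (h1 : (A ∩ B).Infinite) (h2 : (A ∪ B)ᶜ.Infinite) :
    IsMinCut R (A ∩ B) ∧ IsMinCut R (A ∪ B) := by
  have hsub := encard_bdry_inter_add_union R A B
  have hAB : (bdry R A).encard = (bdry R B).encard := le_antisymm (hA.2 B hB.1) (hB.2 A hA.1)
  have hAfin := hA.1.2.2.encard_lt_top
  have hfin : (bdry R (A ∩ B)).encard + (bdry R (A ∪ B)).encard < ⊤ :=
    hsub.trans_lt (WithTop.add_lt_top.2 ⟨hAfin, hAB ▸ hAfin⟩)
  have c1 : IsCut R (A ∩ B) := ⟨h1, h2.mono (Set.compl_subset_compl.2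
    (Set.inter_subset_left.trans Set.subset_union_left)),
    Set.encard_lt_top_iff.1 (WithTop.add_lt_top.1 hfin).1⟩
  have c2 : IsCut R (A ∪ B) := ⟨h1.mono (Set.inter_subset_left.trans Set.subset_union_left), h2,
    Set.encard_lt_top_iff.1 (WithTop.add_lt_top.1 hfin).2⟩
  have e1 := hA.2 _ c1
  have e2 := hA.2 _ c2
  rw [← hAB] at hsub
  obtain ⟨a, ha⟩ := ENat.ne_top_iff_exists.1 hAfin.ne
  obtain ⟨b, hb⟩ := ENat.ne_top_iff_exists.1 (WithTop.add_lt_top.1 hfin).1.ne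
  obtain ⟨c, hc⟩ := ENat.ne_top_iff_exists.1 (WithTop.add_lt_top.1 hfin).2.ne
  rw [← ha, ← hb, ← hc] at hsub
  rw [← ha, ← hb] at e1
  rw [← ha, ← hc] at e2
  norm_cast at hsub e1 e2
  refine ⟨⟨c1, fun C hC => ?_⟩, ⟨c2, fun C hC => ?_⟩⟩
  · rw [← hb, show b = a by omega, ha]
    exact hA.2 C hC
  · rw [← hc, show c = a by omega, ha]
    exact hA.2 C hC

theorem opt_nested_aux (hR : ∀ x y, R x y → R y x)
    (hconn : ∀ A : Set V, bdry R A = ∅ → A = ∅ ∨ A = Set.univ) {A B : Set V} (hA : A ∈ opt R)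
    (hB : B ∈ opt R) (h1 : (A ∩ B).Infinite) (h2 : (A ∪ B)ᶜ.Infinite) : Nested A B := by
  by_contra hcr
  obtain ⟨m1, m2⟩ := isMinCut_inter R hA.1 hB.1 h1 h2
  have e1 := hA.2 _ m1
  have e2 := hB.2 _ m2
  have hne : (Aᶜ ∩ Bᶜ).Nonempty := by rw [← Set.compl_union]; exact h2.nonempty
  have hne' : (Aᶜᶜ ∩ Bᶜᶜ).Nonempty := by rw [compl_compl, compl_compl]; exact h1.nonempty
  have s1 : crossing R (A ∩ B) ⊆ crossing R A ∪ crossing R B := by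
    rintro D ⟨hD, hn⟩
    by_cases h : Nested D A
    · exact Or.inr ⟨hD, fun h' => hn (h.inter h' hne)⟩
    · exact Or.inl ⟨hD, h⟩
  have s2 : crossing R (A ∪ B) ⊆ crossing R A ∪ crossing R B := by
    rintro D ⟨hD, hn⟩
    by_cases h : Nested D A
    · refine Or.inr ⟨hD, fun h' => hn ?_⟩
      have := (h.compl_right.inter h'.compl_right hne').compl_right
      rwa [← Set.compl_union, compl_compl] at this
    · exact Or.inl ⟨hD, h⟩
  have s3 : crossing R (A ∩ B) ∩ crossing R (A ∪ B) ⊆ crossing R A ∩ crossing R B := by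
    rintro D ⟨⟨hD, hn⟩, -, hn'⟩
    simp only [Nested, not_or, Set.not_subset, Set.mem_compl_iff, not_not, Set.mem_inter_iff,
      Set.mem_union] at hn hn'
    obtain ⟨-, ⟨b, hb1, hb2⟩, -, ⟨d, hd1, hd2⟩⟩ := hn
    obtain ⟨⟨a, ha1, ha2⟩, -, ⟨c, hc1, hc2⟩, -⟩ := hn'
    refine ⟨⟨hD, ?_⟩, ⟨hD, ?_⟩⟩
    · rintro (h | h | h | h)
      · exact ha2.1 (h ha1)
      · exact h hb1 hb2.1
      · exact hc2.1 (h hc1)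
      · exact h hd1 hd2.1
    · rintro (h | h | h | h)
      · exact ha2.2 (h ha1)
      · exact h hb1 hb2.2
      · exact hc2.2 (h hc1)
      · exact h hd1 hd2.2
  have hAmem : A ∈ crossing R A ∪ crossing R B := Or.inr ⟨hA.1, hcr⟩
  have hAn : A ∉ crossing R (A ∩ B) ∪ crossing R (A ∪ B) := by
    rintro (h | h)
    · exact h.2 (Or.inr (Or.inr (Or.inr (Set.compl_subset_compl.2 Set.inter_subset_left))))
    · exact h.2 (Or.inl Set.subset_union_left)
  have fA := finite_crossing R hR hconn hA.1.1
  have fB := finite_crossing R hR hconn hB.1.1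
  have l1 : (crossing R (A ∩ B) ∪ crossing R (A ∪ B)).encard <
      (crossing R A ∪ crossing R B).encard :=
    (fA.union fB |>.subset (Set.union_subset s1 s2)).encard_lt_encard
      ⟨Set.union_subset s1 s2, fun h => hAn (h hAmem)⟩
  have l2 := Set.encard_le_encard s3
  have l3 := Set.encard_union_add_encard_inter (crossing R (A ∩ B)) (crossing R (A ∪ B))
  have l4 := Set.encard_union_add_encard_inter (crossing R A) (crossing R B)
  have l5 : (crossing R (A ∩ B)).encard + (crossing R (A ∪ B)).encard <
      (crossing R A).encard + (crossing R B).encard := by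
    rw [← l3, ← l4]
    exact ENat.add_lt_add_of_lt_of_le
      ((fA.subset Set.inter_subset_left).subset s3).encard_lt_top.ne l1 l2
  exact absurd l5 (not_lt.2 (add_le_add e1 e2))

theorem opt_nested (hR : ∀ x y, R x y → R y x)
    (hconn : ∀ A : Set V, bdry R A = ∅ → A = ∅ ∨ A = Set.univ) {A B : Set V} (hA : A ∈ opt R)
    (hB : B ∈ opt R) : Nested A B := by
  by_cases h : (A ∩ B).Infinite ∧ (A ∪ B)ᶜ.Infinite
  · exact opt_nested_aux R hR hconn hA hB h.1 h.2
  · have h' : (A ∩ Bᶜ).Infinite ∧ (A ∪ Bᶜ)ᶜ.Infinite := by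
      have a1 := hA.1.1.1
      have a2 := hA.1.1.2.1
      have b1 := hB.1.1.1
      have b2 := hB.1.1.2.1
      rw [← Set.inter_union_compl A B, Set.infinite_union] at a1
      rw [← Set.inter_union_compl Aᶜ B, Set.infinite_union] at a2
      rw [← Set.inter_union_compl B A, Set.infinite_union, Set.inter_comm,
        Set.inter_comm B] at b1
      rw [← Set.inter_union_compl Bᶜ A, Set.infinite_union, Set.inter_comm,
        Set.inter_comm Bᶜ] at b2
      rw [Set.compl_union] at h ⊢
      rw [compl_compl]
      tauto
    simpa using (opt_nested_aux R hR hconn hA (opt_compl R hR hB) h'.1 h'.2).compl_right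

end Cut

/-- A discrete nested family of sets closed under complementation. -/
structure Nest {V : Type*} (𝒯 : Set (Set V)) : Prop where
  compl : ∀ A ∈ 𝒯, Aᶜ ∈ 𝒯
  nested : ∀ A ∈ 𝒯, ∀ B ∈ 𝒯, Cut.Nested A B
  nonempty : ∀ A ∈ 𝒯, A.Nonempty
  fin : ∀ x y, {A | A ∈ 𝒯 ∧ x ∈ A ∧ y ∉ A}.Finite

namespace Nest

variable {V : Type*} {𝒯 : Set (Set V)}

/-- An orientation of a family of sets: an upward closed choice of one set from each
complementary pair. -/
structure IsOri (𝒯 : Set (Set V)) (O : Set (Set V)) : Prop where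
  sub : O ⊆ 𝒯
  mem_iff : ∀ B ∈ 𝒯, Bᶜ ∈ O ↔ B ∉ O
  up : ∀ B ∈ O, ∀ C ∈ 𝒯, B ⊆ C → C ∈ O

/-- The orientation pointing at the initial vertex of the edge `A`. -/
def ori (𝒯 : Set (Set V)) (A : Set V) : Set (Set V) := {B | B ∈ 𝒯 ∧ (A ⊆ B ∨ Aᶜ ⊂ B)}

theorem self_mem_ori {A : Set V} (hA : A ∈ 𝒯) : A ∈ ori 𝒯 A := ⟨hA, Or.inl subset_rfl⟩

theorem ne_compl (h : Nest 𝒯) {A : Set V} (hA : A ∈ 𝒯) : A ≠ Aᶜ := by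
  obtain ⟨x, hx⟩ := h.nonempty A hA
  intro e
  rw [e] at hx
  have := hx
  rw [← e] at hx
  exact this hx

theorem isOri (h : Nest 𝒯) {A : Set V} (hA : A ∈ 𝒯) : IsOri 𝒯 (ori 𝒯 A) := by
  refine ⟨fun B hB => hB.1, fun B hB => ⟨?_, fun hn => ⟨h.compl B hB, ?_⟩⟩, ?_⟩
  · rintro ⟨-, h1⟩ ⟨-, h2⟩
    rcases h1 with h1 | h1
    · rcases h2 with h2 | h2
      · obtain ⟨x, hx⟩ := h.nonempty A hA
        exact h1 hx (h2 hx)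
      · exact h2.2 (Set.subset_compl_comm.1 h1)
    · rcases h2 with h2 | h2
      · exact h1.2 (Set.compl_subset_compl.2 h2)
      · obtain ⟨x, hx⟩ := h.nonempty _ (h.compl A hA)
        exact h1.1 hx (h2.1 hx)
  · simp only [ori, Set.mem_ofPred_eq, hB, true_and, not_or] at hn
    rcases h.nested A hA B hB with h1 | h1 | h1 | h1
    · exact absurd h1 hn.1
    · exact Or.inl h1
    · have : Aᶜ = B := by
        by_contra hne
        exact hn.2 (h1.ssubset_of_ne hne)
      left
      rw [← this, compl_compl]
    · right
      refine h1.ssubset_of_ne fun e => hn.1 ?_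
      rw [compl_inj_iff.1 e]
  · rintro B ⟨-, h1⟩ C hC hBC
    exact ⟨hC, h1.imp (fun h1 => h1.trans hBC) fun h1 => h1.trans_subset hBC⟩

theorem IsOri.eq_of_subset {O O' : Set (Set V)} (hO : IsOri 𝒯 O) (hO' : IsOri 𝒯 O')
    (hs : O ⊆ O') : O = O' := by
  refine hs.antisymm fun B hB => ?_
  by_contra hn
  have hBT := hO'.sub hB
  exact (hO'.mem_iff B hBT).1 (hs ((hO.mem_iff B hBT).2 hn)) hB

theorem IsOri.eq_ori {O : Set (Set V)} (h : Nest 𝒯) (hO : IsOri 𝒯 O) {C : Set V} (hC : C ∈ O)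
    (hmin : ∀ B ∈ O, B ⊆ C → B = C) : O = ori 𝒯 C := by
  have hCT := hO.sub hC
  refine hO.eq_of_subset (h.isOri hCT) fun B hB => ⟨hO.sub hB, ?_⟩
  have hBT := hO.sub hB
  rcases h.nested C hCT B hBT with h1 | h1 | h1 | h1
  · exact Or.inl h1
  · exact absurd hB ((hO.mem_iff B hBT).1 (hO.up C hC _ (h.compl B hBT) h1))
  · refine Or.inr (h1.ssubset_of_ne ?_)
    rintro rfl
    exact (hO.mem_iff C hCT).1 hB hC
  · rw [hmin B hB (Set.compl_subset_compl.1 h1)]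
    exact Or.inl subset_rfl

theorem mem_ori_compl (h : Nest 𝒯) {A B : Set V} (hA : A ∈ 𝒯) :
    B ∈ ori 𝒯 Aᶜ ↔ (B ∈ ori 𝒯 A ∧ B ≠ A) ∨ B = Aᶜ := by
  simp only [ori, Set.mem_ofPred_eq, compl_compl]
  constructor
  · rintro ⟨hB, h1 | h1⟩
    · by_cases e : B = Aᶜ
      · exact Or.inr e
      · refine Or.inl ⟨⟨hB, Or.inr (h1.ssubset_of_ne (Ne.symm e))⟩, ?_⟩
        rintro rfl
        obtain ⟨x, hx⟩ := h.nonempty _ (h.compl B hB)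
        exact hx (h1 hx)
    · exact Or.inl ⟨⟨hB, Or.inl h1.1⟩, h1.ne'⟩
  · rintro (⟨⟨hB, h1 | h1⟩, hne⟩ | rfl)
    · exact ⟨hB, Or.inr (h1.ssubset_of_ne (Ne.symm hne))⟩
    · exact ⟨hB, Or.inl h1.1⟩
    · exact ⟨h.compl A hA, Or.inl subset_rfl⟩

theorem finite_ori_diff (h : Nest 𝒯) {A B : Set V} (hA : A ∈ 𝒯) (hB : B ∈ 𝒯) :
    (ori 𝒯 A \ ori 𝒯 B).Finite := by
  obtain ⟨a, ha⟩ := h.nonempty A hA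
  obtain ⟨a', ha'⟩ := h.nonempty _ (h.compl A hA)
  obtain ⟨b, hb⟩ := h.nonempty B hB
  obtain ⟨b', hb'⟩ := h.nonempty _ (h.compl B hB)
  refine ((((h.fin a b).union (h.fin a b')).union (h.fin a' b)).union (h.fin a' b')).subset ?_
  rintro C ⟨hC, hC'⟩
  have h1 := ((h.isOri hB).mem_iff C hC.1).2 hC'
  have hCT := hC.1
  have h2 : a ∈ C ∨ a' ∈ C := hC.2.imp (fun h => h ha) fun h => h.1 ha'
  have h3 : b ∉ C ∨ b' ∉ C := h1.2.imp (fun h => h hb) fun h => h.1 hb'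
  simp only [Set.mem_union, Set.mem_ofPred_eq]
  tauto

/-- Minimal element of the difference of two vertices. -/
theorem exists_flip (h : Nest 𝒯) {A B : Set V} (hA : A ∈ 𝒯) (hB : B ∈ 𝒯)
    (hne : ori 𝒯 A ≠ ori 𝒯 B) :
    ∃ C ∈ 𝒯, ori 𝒯 A = ori 𝒯 C ∧ C ∉ ori 𝒯 B := by
  have hn : (ori 𝒯 A \ ori 𝒯 B).Nonempty := by
    by_contra hn
    exact hne ((h.isOri hA).eq_of_subset (h.isOri hB)
      (Set.sdiff_eq_empty.1 (Set.not_nonempty_iff_eq_empty.1 hn)))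
  obtain ⟨C, hC⟩ := (h.finite_ori_diff hA hB).exists_minimal hn
  refine ⟨C, hC.1.1.1, (h.isOri hA).eq_ori h hC.1.1 fun D hD hDC => ?_, hC.1.2⟩
  refine hDC.antisymm (hC.2 ⟨hD, fun hDB => hC.1.2 ?_⟩ hDC)
  exact (h.isOri hB).up D hDB C hC.1.1.1 hDC

theorem ori_diff_flip (h : Nest 𝒯) {B C : Set V} (hB : B ∈ 𝒯) (hC : C ∈ 𝒯)
    (hCB : C ∉ ori 𝒯 B) : ori 𝒯 Cᶜ \ ori 𝒯 B = (ori 𝒯 C \ ori 𝒯 B) \ {C} := by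
  ext D
  simp only [Set.mem_sdiff, h.mem_ori_compl hC, Set.mem_singleton_iff]
  have : Cᶜ ∈ ori 𝒯 B := ((h.isOri hB).mem_iff C hC).2 hCB
  constructor
  · rintro ⟨⟨h1, h2⟩ | rfl, h3⟩
    · exact ⟨⟨h1, h3⟩, h2⟩
    · exact absurd this h3
  · rintro ⟨⟨h1, h3⟩, h2⟩
    exact ⟨Or.inl ⟨h1, h2⟩, h3⟩

theorem conn_aux (h : Nest 𝒯) (g : Set (Set V) → ℚ)
    (hg : ∀ A ∈ 𝒯, g (ori 𝒯 Aᶜ) = g (ori 𝒯 A)) {B : Set V} (hB : B ∈ 𝒯) (k : ℕ) :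
    ∀ A ∈ 𝒯, (ori 𝒯 A \ ori 𝒯 B).ncard = k → g (ori 𝒯 A) = g (ori 𝒯 B) := by
  induction k with
  | zero =>
    intro A hA hk
    rw [Set.ncard_eq_zero (h.finite_ori_diff hA hB)] at hk
    rw [(h.isOri hA).eq_of_subset (h.isOri hB) (Set.sdiff_eq_empty.1 hk)]
  | succ k ih =>
    intro A hA hk
    have hne : ori 𝒯 A ≠ ori 𝒯 B := by
      intro e
      rw [e, sdiff_self] at hk
      simp at hk
    obtain ⟨C, hC, hAC, hCB⟩ := h.exists_flip hA hB hne
    rw [hAC, ← hg C hC]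
    refine ih Cᶜ (h.compl C hC) ?_
    have hmem : C ∈ ori 𝒯 C \ ori 𝒯 B := ⟨self_mem_ori hC, hCB⟩
    rw [h.ori_diff_flip hB hC hCB, Set.ncard_sdiff_singleton_of_mem hmem, ← hAC, hk,
      Nat.add_sub_cancel]

theorem conn_ori (h : Nest 𝒯) (g : Set (Set V) → ℚ)
    (hg : ∀ A ∈ 𝒯, g (ori 𝒯 Aᶜ) = g (ori 𝒯 A)) {A B : Set V} (hA : A ∈ 𝒯) (hB : B ∈ 𝒯) :
    g (ori 𝒯 A) = g (ori 𝒯 B) :=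
  h.conn_aux g hg hB _ A hA rfl

theorem acyclic_ori (h : Nest 𝒯) (b : Set V → ℚ) (hb : ∀ A ∈ 𝒯, b Aᶜ = - b A) :
    ∃ g : Set (Set V) → ℚ, ∀ A ∈ 𝒯, g (ori 𝒯 Aᶜ) - g (ori 𝒯 A) = b A := by
  rcases Set.eq_empty_or_nonempty 𝒯 with rfl | ⟨B, hB⟩
  · exact ⟨0, by simp⟩
  refine ⟨fun O => ∑ᶠ C ∈ O \ ori 𝒯 B, - b C, fun A hA => ?_⟩
  have key : ∀ A ∈ 𝒯, A ∉ ori 𝒯 B → (∑ᶠ C ∈ ori 𝒯 Aᶜ \ ori 𝒯 B, - b C) -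
      ∑ᶠ C ∈ ori 𝒯 A \ ori 𝒯 B, - b C = b A := by
    intro A hA hAB
    rw [h.ori_diff_flip hB hA hAB]
    have hmem : A ∈ ori 𝒯 A \ ori 𝒯 B := ⟨self_mem_ori hA, hAB⟩
    have hfin := h.finite_ori_diff hA hB
    have := finsum_mem_insert (fun C => - b C) (a := A) (s := (ori 𝒯 A \ ori 𝒯 B) \ {A})
      (by simp) (hfin.subset Set.sdiff_subset)
    rw [Set.insert_sdiff_singleton, Set.insert_eq_of_mem hmem] at this
    rw [this]
    ring
  by_cases hAB : A ∈ ori 𝒯 B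
  · have h1 := key Aᶜ (h.compl A hA) fun hn => ((h.isOri hB).mem_iff A hA).1 hn hAB
    rw [compl_compl, hb A hA] at h1
    linarith
  · exact key A hA hAB

/-- Each vertex has at least two edges as soon as there are no minimal sets. -/
theorem exists_ne_ori_eq (h : Nest 𝒯) (hsub : ∀ A ∈ 𝒯, ∃ C ∈ 𝒯, C ⊂ A) {A : Set V}
    (hA : A ∈ 𝒯) : ∃ B ∈ 𝒯, B ≠ A ∧ ori 𝒯 B = ori 𝒯 A := by
  obtain ⟨C, hC, hCA⟩ := hsub A hA
  have hCA' : Aᶜ ⊂ Cᶜ := compl_lt_compl_iff_lt.2 hCA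
  obtain ⟨x, hx⟩ := h.nonempty _ (h.compl A hA)
  obtain ⟨y, hy⟩ := h.nonempty C hC
  have hfin : {B | B ∈ 𝒯 ∧ Aᶜ ⊂ B ∧ B ⊆ Cᶜ}.Finite :=
    (h.fin x y).subset fun B hB => ⟨hB.1, hB.2.1.1 hx, fun hyB => hB.2.2 hyB hy⟩
  obtain ⟨B, hB⟩ := hfin.exists_minimal ⟨Cᶜ, h.compl C hC, hCA', subset_rfl⟩
  refine ⟨B, hB.1.1, ?_, ((h.isOri hA).eq_ori h ⟨hB.1.1, Or.inr hB.1.2.1⟩ ?_).symm⟩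
  · rintro rfl
    exact hx (hB.1.2.1.1 hx)
  · rintro D ⟨hD, h1⟩ hDB
    rcases h1 with h1 | h1
    · obtain ⟨z, hz⟩ := h.nonempty _ (h.compl B hB.1.1)
      by_cases hzA : z ∈ A
      · exact absurd (hDB (h1 hzA)) hz
      · exact absurd (hB.1.2.1.1 hzA) hz
    · exact hDB.antisymm (hB.2 ⟨hD, h1, hDB.trans hB.1.2.2⟩ hDB)

end Nest

section

open scoped Pointwise

namespace Nest

variable {V : Type*} {𝒯 : Set (Set V)} {E : Type*} [Group E] [MulAction E V]

theorem smul_ori (hinv : ∀ (e : E), ∀ A ∈ 𝒯, e • A ∈ 𝒯) (e : E) (A : Set V) :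
    e • ori 𝒯 A = ori 𝒯 (e • A) := by
  ext B
  rw [Set.mem_smul_set_iff_inv_smul_mem]
  have h1 : e⁻¹ • B ∈ 𝒯 ↔ B ∈ 𝒯 :=
    ⟨fun h => by simpa using hinv e _ h, fun h => hinv e⁻¹ _ h⟩
  have h2 : ∀ C : Set V, C ⊆ e⁻¹ • B ↔ e • C ⊆ B := fun C => by
    rw [Set.subset_smul_set_iff, inv_inv]
  have h3 : ∀ C : Set V, e⁻¹ • B ⊆ C ↔ B ⊆ e • C := fun C => by
    rw [Set.smul_set_subset_iff_subset_inv_smul_set, inv_inv]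
  simp only [ori, Set.mem_ofPred_eq, h1, h2, h3, ssubset_iff_subset_not_subset,
    Set.smul_set_compl]

/-- The edges of the tree. -/
def edges (hinv : ∀ (e : E), ∀ A ∈ 𝒯, e • A ∈ 𝒯) : SubMulAction E (Set V) where
  carrier := 𝒯
  smul_mem' := fun e {A} hA => hinv e A hA

/-- The vertices of the tree. -/
def verts (hinv : ∀ (e : E), ∀ A ∈ 𝒯, e • A ∈ 𝒯) : SubMulAction E (Set (Set V)) where
  carrier := {O | ∃ A ∈ 𝒯, O = ori 𝒯 A}
  smul_mem' := by
    rintro e _ ⟨A, hA, rfl⟩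
    exact ⟨e • A, hinv e A hA, smul_ori hinv e A⟩

theorem smul_pair (e : E) (A : Set V) : e • ({A, Aᶜ} : Set (Set V)) = {e • A, (e • A)ᶜ} := by
  rw [← Set.smul_set_compl, ← Set.image_smul, Set.image_pair]

/-- The midpoints of the edges of the tree. -/
def mids (hinv : ∀ (e : E), ∀ A ∈ 𝒯, e • A ∈ 𝒯) : SubMulAction E (Set (Set V)) where
  carrier := {O | ∃ A ∈ 𝒯, O = {A, Aᶜ}}
  smul_mem' := by
    rintro e _ ⟨A, hA, rfl⟩
    exact ⟨e • A, hinv e A hA, smul_pair e A⟩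

/-- The midpoint of an edge. -/
def mid (hinv : ∀ (e : E), ∀ A ∈ 𝒯, e • A ∈ 𝒯) (d : edges hinv) : mids hinv :=
  ⟨{d.1, d.1ᶜ}, d.1, d.2, rfl⟩

/-- The initial vertex of an edge. -/
def org (hinv : ∀ (e : E), ∀ A ∈ 𝒯, e • A ∈ 𝒯) (d : edges hinv) : verts hinv :=
  ⟨ori 𝒯 d.1, d.1, d.2, rfl⟩

/-- The subdivided tree of a nested family. -/
def tree (h : Nest 𝒯) (hinv : ∀ (e : E), ∀ A ∈ 𝒯, e • A ∈ 𝒯) (F : Subgroup E)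
    (hfin : Finite (MulAction.orbitRel.Quotient F (edges hinv)))
    (hfree : ∀ f ∈ F, ∀ d : edges hinv, f • d = d → f = 1) (hne : 𝒯.Nonempty) :
    TreeAct F (verts hinv ⊕ mids hinv) (edges hinv) where
  o d := Sum.inl (org hinv d)
  τ d := Sum.inr (mid hinv d)
  o_smul e d := congrArg Sum.inl (Subtype.ext (smul_ori hinv e d.1).symm)
  τ_smul e d := congrArg Sum.inr (Subtype.ext (smul_pair e d.1).symm)
  conn := by
    intro g hg
    classical
    let g' : Set (Set V) → ℚ := fun O => if hO : O ∈ verts hinv then g (Sum.inl ⟨O, hO⟩) else 0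
    have hg' : ∀ A (hA : A ∈ 𝒯), g' (ori 𝒯 A) = g (Sum.inl (org hinv ⟨A, hA⟩)) := fun A hA => by
      have : ori 𝒯 A ∈ verts hinv := ⟨A, hA, rfl⟩
      exact dif_pos this
    have hmid : ∀ A (hA : A ∈ 𝒯), mid hinv ⟨Aᶜ, h.compl A hA⟩ = mid hinv ⟨A, hA⟩ := by
      intro A hA
      refine Subtype.ext ?_
      change ({Aᶜ, Aᶜᶜ} : Set (Set V)) = {A, Aᶜ}
      rw [compl_compl, Set.pair_comm]
    have hflip : ∀ A ∈ 𝒯, g' (ori 𝒯 Aᶜ) = g' (ori 𝒯 A) := by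
      intro A hA
      rw [hg' A hA, hg' _ (h.compl A hA), ← hg, ← hg, hmid]
    obtain ⟨B, hB⟩ := hne
    have key : ∀ x, g x = g' (ori 𝒯 B) := by
      rintro (⟨_, A, hA, rfl⟩ | ⟨_, A, hA, rfl⟩)
      · exact (hg' A hA).symm.trans (h.conn_ori g' hflip hA hB)
      · exact ((hg ⟨A, hA⟩).trans (hg' A hA).symm).trans (h.conn_ori g' hflip hA hB)
    intro x y
    rw [key, key]
  acyclic := by
    intro c
    classical
    let c' : Set V → ℚ := fun A => if hA : A ∈ 𝒯 then c ⟨A, hA⟩ else 0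
    have hc' : ∀ A (hA : A ∈ 𝒯), c' A = c ⟨A, hA⟩ := fun A hA => dif_pos hA
    obtain ⟨g, hg⟩ := h.acyclic_ori (fun A => c' A - c' Aᶜ)
      (fun A hA => by rw [compl_compl]; ring)
    choose B hB hBp using fun p : mids hinv => p.2
    refine ⟨Sum.elim (fun O => g O.1) (fun p => g (ori 𝒯 (B p)) + c' (B p)), fun d => ?_⟩
    change g (ori 𝒯 (B (mid hinv d))) + c' (B (mid hinv d)) - g (ori 𝒯 d.1) = c d
    have hd : B (mid hinv d) ∈ ({d.1, d.1ᶜ} : Set (Set V)) := by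
      have : (mid hinv d).1 = {d.1, d.1ᶜ} := rfl
      rw [← this, hBp]
      simp
    have hcd : c d = c' d.1 := (hc' d.1 d.2).symm
    rcases hd with hd | hd
    · rw [hd, hcd]
      ring
    · rw [Set.mem_singleton_iff.1 hd, hcd]
      have := hg d.1 d.2
      linarith
  finX := by
    refine Finite.of_surjective (α := MulAction.orbitRel.Quotient F (edges hinv) ⊕
      MulAction.orbitRel.Quotient F (edges hinv)) (Sum.elim
      (Quotient.map' (fun d => Sum.inl (org hinv d)) ?_)
      (Quotient.map' (fun d => Sum.inr (mid hinv d)) ?_)) ?_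
    · rintro _ d ⟨f, rfl⟩
      exact ⟨f, congrArg Sum.inl (Subtype.ext (smul_ori hinv f.1 d.1))⟩
    · rintro _ d ⟨f, rfl⟩
      exact ⟨f, congrArg Sum.inr (Subtype.ext (smul_pair f.1 d.1))⟩
    · intro q
      induction q using Quotient.inductionOn' with
      | h x =>
        rcases x with ⟨_, A, hA, rfl⟩ | ⟨_, A, hA, rfl⟩
        · exact ⟨Sum.inl (Quotient.mk'' ⟨A, hA⟩), rfl⟩
        · exact ⟨Sum.inr (Quotient.mk'' ⟨A, hA⟩), rfl⟩
  finD := hfin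
  free := hfree
  nonempty := by
    obtain ⟨A, hA⟩ := hne
    exact ⟨Sum.inl (org hinv ⟨A, hA⟩)⟩

theorem not_ssubset_smul {e : E} (he : IsOfFinOrder e) {C : Set V} : ¬ C ⊂ e • C := by
  intro h
  have key : ∀ k : ℕ, C ⊂ e ^ (k + 1) • C := by
    intro k
    induction k with
    | zero => simpa using h
    | succ k ih =>
      rw [pow_succ', mul_smul]
      exact h.trans ((Set.smul_set_subset_smul_set_iff.2 ih.1).ssubset_of_ne
        fun e' => ih.ne (smul_left_cancel _ e'))
  obtain ⟨k, hk, hk'⟩ := isOfFinOrder_iff_pow_eq_one.1 he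
  have := key (k - 1)
  rw [Nat.sub_add_cancel hk, hk', one_smul] at this
  exact this.ne rfl

/-- A finite order element fixes a vertex of the subdivided tree. -/
theorem exists_fixed (h : Nest 𝒯) (hinv : ∀ (e : E), ∀ A ∈ 𝒯, e • A ∈ 𝒯) (hne : 𝒯.Nonempty)
    {e : E} (he : IsOfFinOrder e) : ∃ x : verts hinv ⊕ mids hinv, e • x = x := by
  by_contra! hno
  obtain ⟨A, hA, hmin⟩ := exists_minimalFor_of_wellFoundedLT (fun A => A ∈ 𝒯)
    (fun A => (ori 𝒯 A \ ori 𝒯 (e • A)).ncard) hne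
  have hfix : ∀ C ∈ 𝒯, e • C ≠ Cᶜ := by
    intro C hC hCe
    refine hno (Sum.inr ⟨{C, Cᶜ}, C, hC, rfl⟩) ?_
    refine congrArg Sum.inr (Subtype.ext ((smul_pair e C).trans ?_))
    change ({e • C, (e • C)ᶜ} : Set (Set V)) = {C, Cᶜ}
    rw [hCe, compl_compl, Set.pair_comm]
  have hne' : ori 𝒯 A ≠ ori 𝒯 (e • A) := by
    intro hA'
    refine hno (Sum.inl ⟨_, A, hA, rfl⟩) (congrArg Sum.inl (Subtype.ext ?_))
    change e • ori 𝒯 A = ori 𝒯 A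
    rw [smul_ori hinv, ← hA']
  obtain ⟨C, hC, hAC, hCn⟩ := h.exists_flip hA (hinv e A hA) hne'
  have heA : ori 𝒯 (e • A) = ori 𝒯 (e • C) := by
    rw [← smul_ori hinv, hAC, smul_ori hinv]
  rw [heA] at hCn
  have heC := hinv e C hC
  have hCc : Cᶜ ∈ ori 𝒯 (e • C) := ((h.isOri heC).mem_iff C hC).2 hCn
  have hCs : e • C ≠ C := by
    intro e'
    rw [e'] at hCn
    exact hCn (self_mem_ori hC)
  rcases h.nested C hC _ heC with h1 | h1 | h1 | h1
  · exact not_ssubset_smul he (h1.ssubset_of_ne (Ne.symm hCs))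
  · -- flipping `C` decreases the displacement
    have hss : e • C ⊆ Cᶜ := Set.subset_compl_comm.1 h1
    have hlt : (ori 𝒯 Cᶜ \ ori 𝒯 (e • Cᶜ)).ncard < (ori 𝒯 C \ ori 𝒯 (e • C)).ncard := by
      refine Set.ncard_lt_ncard ⟨?_, fun hs => ?_⟩ (h.finite_ori_diff hC heC)
      · rintro B ⟨hB, hB'⟩
        rw [h.mem_ori_compl hC] at hB
        rw [Set.smul_set_compl, h.mem_ori_compl heC, not_or, not_and_or, not_not] at hB'
        rcases hB with ⟨hB, hBC⟩ | rfl
        · refine ⟨hB, hB'.1.resolve_right ?_⟩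
          rintro rfl
          exact ((h.isOri hC).mem_iff C hC).1
            ((h.isOri hC).up _ hB Cᶜ (h.compl C hC) hss) (self_mem_ori hC)
        · rcases hB'.1 with hB1 | hB1
          · exact absurd hCc hB1
          · exact absurd hB1.symm (hfix C hC)
      · have := (hs ⟨self_mem_ori hC, hCn⟩).1
        rw [h.mem_ori_compl hC] at this
        rcases this with h' | h'
        · exact h'.2 rfl
        · exact h.ne_compl hC h'
    simp only [hAC, heA] at hmin
    exact absurd (hmin (h.compl C hC) hlt.le) (not_le.2 hlt)
  · have hss : Cᶜ ⊂ e • C := h1.ssubset_of_ne (Ne.symm (hfix C hC))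
    rcases hCc.2 with h2 | h2
    · exact hss.2 h2
    · have h3 := Set.compl_subset_compl.1 h2.1
      exact not_ssubset_smul he (h3.ssubset_of_ne (Ne.symm hCs))
  · have h2 : e • C ⊂ C := (Set.compl_subset_compl.1 h1).ssubset_of_ne hCs
    refine not_ssubset_smul (C := C) he.inv ?_
    have h3 : C ⊆ e⁻¹ • C := by
      rw [Set.subset_smul_set_iff, inv_inv]
      exact h2.1
    refine h3.ssubset_of_ne fun h4 => hCs ?_
    nth_rewrite 1 [h4]
    rw [smul_inv_smul]

end Nest

namespace Cut

variable {E : Type*} [Group E]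

/-- Adjacency in the Cayley graph. -/
def cay (S : Set E) (x y : E) : Prop := x⁻¹ * y ∈ S

theorem cay_symm {S : Set E} (hS : ∀ s ∈ S, s⁻¹ ∈ S) (x y : E) (h : cay S x y) : cay S y x := by
  have := hS _ h
  rwa [mul_inv_rev, inv_inv] at this

theorem cay_smul {S : Set E} (e x y : E) : cay S (e * x) (e * y) ↔ cay S x y := by
  unfold cay
  rw [mul_inv_rev, mul_assoc, inv_mul_cancel_left]

theorem cay_conn {S : Set E} (hS : ∀ s ∈ S, s⁻¹ ∈ S) (hgen : Subgroup.closure S = ⊤) (A : Set E)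
    (hA : bdry (cay S) A = ∅) : A = ∅ ∨ A = Set.univ := by
  rcases Set.eq_empty_or_nonempty A with h | ⟨a, ha⟩
  · exact Or.inl h
  right
  have hs : ∀ s ∈ S, ∀ x ∈ A, x * s ∈ A := by
    intro s hs x hx
    by_contra hn
    have : (x, x * s) ∈ bdry (cay S) A := ⟨by simpa [cay] using hs, hx, hn⟩
    simp [hA] at this
  have key : ∀ g : E, ∀ x ∈ A, x * g ∈ A := by
    intro g
    have hg : g ∈ Subgroup.closure S := hgen ▸ Subgroup.mem_top g
    induction hg using Subgroup.closure_induction'' with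
    | one => simp
    | mem s h => exact hs s h
    | inv_mem s h => exact hs _ (hS s h)
    | mul x y _ _ hx hy =>
      intro z hz
      rw [← mul_assoc]
      exact hy _ (hx z hz)
  refine Set.eq_univ_of_forall fun x => ?_
  simpa using key (a⁻¹ * x) a ha

variable {S : Set E}

theorem bdry_smul (e : E) (A : Set E) :
    bdry (cay S) (e • A) = Prod.map (e * ·) (e * ·) '' bdry (cay S) A := by
  ext ⟨u, v⟩
  constructor
  · rintro ⟨h1, h2, h3⟩
    rw [Set.mem_smul_set_iff_inv_smul_mem] at h2 h3
    exact ⟨(e⁻¹ * u, e⁻¹ * v), ⟨(cay_smul _ _ _).2 h1, h2, h3⟩, by simp⟩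
  · rintro ⟨⟨x, y⟩, ⟨h1, h2, h3⟩, h4⟩
    obtain ⟨rfl, rfl⟩ := Prod.mk.inj h4
    exact ⟨(cay_smul _ _ _).2 h1, Set.smul_mem_smul_set h2,
      fun h => h3 ((Set.smul_mem_smul_set_iff (a := e)).1 h)⟩

theorem encard_bdry_smul (e : E) (A : Set E) :
    (bdry (cay S) (e • A)).encard = (bdry (cay S) A).encard := by
  rw [bdry_smul, Function.Injective.encard_image]
  exact (mul_right_injective e).prodMap (mul_right_injective e)

theorem IsCut.smul (e : E) {A : Set E} (h : IsCut (cay S) A) : IsCut (cay S) (e • A) := by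
  refine ⟨h.1.smul_set, ?_, ?_⟩
  · rw [← Set.smul_set_compl]
    exact h.2.1.smul_set
  · rw [bdry_smul]
    exact h.2.2.image _

theorem IsMinCut.smul (e : E) {A : Set E} (h : IsMinCut (cay S) A) : IsMinCut (cay S) (e • A) :=
  ⟨h.1.smul e, fun B hB => by rw [encard_bdry_smul]; exact h.2 B hB⟩

theorem Nested.smul (e : E) {A B : Set E} (h : Nested A B) : Nested (e • A) (e • B) := by
  unfold Nested at *
  simpa only [← Set.smul_set_compl, Set.smul_set_subset_smul_set_iff] using h

theorem crossing_smul_subset (e : E) (A : Set E) :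
    e • crossing (cay S) A ⊆ crossing (cay S) (e • A) := by
  rintro _ ⟨D, ⟨hD, hn⟩, rfl⟩
  refine ⟨hD.smul e, fun h => hn ?_⟩
  simpa using h.smul e⁻¹

theorem crossing_smul (e : E) (A : Set E) :
    crossing (cay S) (e • A) = e • crossing (cay S) A := by
  refine Set.Subset.antisymm ?_ (crossing_smul_subset e A)
  rw [Set.subset_smul_set_iff]
  simpa using crossing_smul_subset e⁻¹ (e • A)

theorem opt_smul (e : E) : ∀ A ∈ opt (cay S), e • A ∈ opt (cay S) := by
  rintro A ⟨h1, h2⟩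
  refine ⟨h1.smul e, fun B hB => ?_⟩
  rw [crossing_smul, Set.encard_smul_set]
  exact h2 B hB

theorem nest_opt (hS : ∀ s ∈ S, s⁻¹ ∈ S) (hgen : Subgroup.closure S = ⊤) :
    Nest (opt (cay S)) where
  compl _ hA := opt_compl _ (cay_symm hS) hA
  nested _ hA _ hB := opt_nested _ (cay_symm hS) (cay_conn hS hgen) hA hB
  nonempty _ hA := hA.1.1.1.nonempty
  fin x y := (finite_isMinCut_separating _ (cay_symm hS) (cay_conn hS hgen) x y).subset
    fun _ hA => ⟨hA.1.1, hA.2⟩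

theorem bdry_nonempty (hS : ∀ s ∈ S, s⁻¹ ∈ S) (hgen : Subgroup.closure S = ⊤) {A : Set E}
    (hA : A ∈ opt (cay S)) : (bdry (cay S) A).Nonempty := by
  by_contra hn
  rcases cay_conn hS hgen A (Set.not_nonempty_iff_eq_empty.1 hn) with h | h
  · exact hA.1.1.1 (h ▸ Set.finite_empty)
  · refine hA.1.1.2.1 ?_
    rw [h, Set.compl_univ]
    exact Set.finite_empty

theorem finite_stabilizer (hS : ∀ s ∈ S, s⁻¹ ∈ S) (hgen : Subgroup.closure S = ⊤) {A : Set E}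
    (hA : A ∈ opt (cay S)) : {e : E | e • A = A}.Finite := by
  obtain ⟨⟨x, y⟩, hxy⟩ := bdry_nonempty hS hgen hA
  refine Set.Finite.of_finite_image (f := fun e => (e * x, e * y)) (hA.1.1.2.2.subset ?_) ?_
  · rintro _ ⟨e, he, rfl⟩
    have : (e * x, e * y) ∈ bdry (cay S) (e • A) := by
      rw [bdry_smul]
      exact ⟨(x, y), hxy, rfl⟩
    rwa [show e • A = A from he] at this
  · intro a _ b _ hab
    exact mul_right_cancel (congrArg Prod.fst hab)

theorem finite_translates (hS : ∀ s ∈ S, s⁻¹ ∈ S) (hgen : Subgroup.closure S = ⊤)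
    {A : Set E} (hA : A ∈ opt (cay S)) (κ : E) : {x : E | x ∈ A ∧ x * κ ∉ A}.Finite := by
  have hκ : κ ∈ Subgroup.closure S := hgen ▸ Subgroup.mem_top κ
  have hs : ∀ s ∈ S, {x : E | x ∈ A ∧ x * s ∉ A}.Finite := by
    intro s hs
    refine (hA.1.1.2.2.image Prod.fst).subset ?_
    rintro x ⟨h1, h2⟩
    exact ⟨(x, x * s), ⟨by simpa [cay] using hs, h1, h2⟩, rfl⟩
  induction hκ using Subgroup.closure_induction'' with
  | one => simp
  | mem s h => exact hs s h
  | inv_mem s h => exact hs _ (hS s h)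
  | mul x y _ _ hx hy =>
    refine (hx.union (hy.preimage (f := fun z => z * x) (mul_left_injective x).injOn)).subset ?_
    rintro z ⟨h1, h2⟩
    by_cases hz : z * x ∈ A
    · exact Or.inr ⟨hz, by rwa [mul_assoc]⟩
    · exact Or.inl ⟨h1, hz⟩

theorem exists_ssubset (hS : ∀ s ∈ S, s⁻¹ ∈ S) (hgen : Subgroup.closure S = ⊤) {A : Set E}
    (hA : A ∈ opt (cay S)) : ∃ C ∈ opt (cay S), C ⊂ A := by
  obtain ⟨⟨x, y⟩, hxy⟩ := bdry_nonempty hS hgen hA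
  have hfin := (finite_translates hS hgen hA x).union (finite_translates hS hgen hA y)
  obtain ⟨e, he, hne⟩ := (hA.1.1.1.sdiff hfin).nonempty
  simp only [Set.mem_union, Set.mem_ofPred_eq, not_or, not_and, not_not] at hne
  have hx : e * x ∈ A := hne.1 he
  have hy : e * y ∈ A := hne.2 he
  have hx' : e * x ∈ e • A := Set.smul_mem_smul_set hxy.2.1
  have hy' : e * y ∉ e • A := fun h => hxy.2.2 ((Set.smul_mem_smul_set_iff (a := e)).1 h)
  rcases opt_nested _ (cay_symm hS) (cay_conn hS hgen) hA (opt_smul e A hA) with h | h | h | h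
  · exact absurd (h hy) hy'
  · exact absurd hx' (h hx)
  · refine ⟨(e • A)ᶜ, opt_compl _ (cay_symm hS) (opt_smul e A hA), Set.compl_subset_comm.1 h,
      fun h' => h' hx hx'⟩
  · exact ⟨e • A, opt_smul e A hA, Set.compl_subset_compl.1 h, fun h' => hy' (h' hy)⟩

theorem finite_orbits (hSf : S.Finite) (hS : ∀ s ∈ S, s⁻¹ ∈ S) (hgen : Subgroup.closure S = ⊤)
    (F : Subgroup E) [F.FiniteIndex] :
    Finite (MulAction.orbitRel.Quotient F
      (Nest.edges (𝒯 := opt (cay S)) fun e : E => opt_smul e)) := by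
  have hn := nest_opt hS hgen
  let K : Set E := Set.range fun q : E ⧸ F => (q.out)⁻¹
  have hK : K.Finite := Set.finite_range _
  have hfin : {A : Set E | ∃ x ∈ K, ∃ s ∈ S, A ∈ opt (cay S) ∧ x ∈ A ∧ x * s ∉ A}.Finite := by
    refine (hK.biUnion fun x _ => hSf.biUnion fun s _ => hn.fin x (x * s)).subset ?_
    rintro A ⟨x, hx, s, hs, h⟩
    exact Set.mem_biUnion hx (Set.mem_biUnion hs h)
  have := hfin.to_subtype
  refine Finite.of_surjective (fun A : {A : Set E | ∃ x ∈ K, ∃ s ∈ S, A ∈ opt (cay S) ∧ x ∈ A ∧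
    x * s ∉ A} => (Quotient.mk'' ⟨A.1, by obtain ⟨_, _, _, _, h, _⟩ := A.2; exact h⟩ :
      MulAction.orbitRel.Quotient F (Nest.edges (𝒯 := opt (cay S)) fun e : E => opt_smul e))) ?_
  intro q
  induction q using Quotient.inductionOn' with
  | h A =>
    obtain ⟨⟨x, y⟩, h1, h2, h3⟩ := bdry_nonempty hS hgen A.2
    obtain ⟨f, hf⟩ := QuotientGroup.mk_out_eq_mul F x⁻¹
    have hx : ((x⁻¹ : E) : E ⧸ F).out⁻¹ = f.1⁻¹ * x := by rw [hf]; group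
    refine ⟨⟨f.1⁻¹ • A.1, _, ⟨((x⁻¹ : E) : E ⧸ F), rfl⟩, x⁻¹ * y, h1, opt_smul _ _ A.2, ?_, ?_⟩,
      Quotient.sound' ⟨f⁻¹, rfl⟩⟩
    · simp only [hx]
      exact Set.smul_mem_smul_set h2
    · simp only [hx, mul_assoc, mul_inv_cancel_left]
      exact fun h => h3 ((Set.smul_mem_smul_set_iff (a := f.1⁻¹)).1 h)

end Cut

namespace Cut

theorem getLast?_reduce_cons {ι : Type*} [DecidableEq ι] (p : ι × Bool) (x : FreeGroup ι)
    (h : 2 ≤ x.toWord.length) :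
    (FreeGroup.mk [p] * x).toWord.getLast? = x.toWord.getLast? := by
  have h1 : (FreeGroup.mk [p] * x).toWord = FreeGroup.reduce (p :: x.toWord) := by
    conv_lhs => rw [← FreeGroup.mk_toWord (x := x)]
    rw [FreeGroup.mul_mk, FreeGroup.toWord_mk]
    rfl
  rw [h1, FreeGroup.reduce.cons, FreeGroup.reduce_toWord]
  rcases hw : x.toWord with _ | ⟨a, _ | ⟨b, t⟩⟩
  · simp [hw] at h
  · simp [hw] at h
  · simp only
    split_ifs <;> simp

/-- In a free group there is an almost right invariant set which is infinite and co-infinite. -/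
theorem exists_almost_invariant (ι : Type*) [Nonempty ι] : ∃ W : Set (FreeGroup ι), W.Infinite ∧
    Wᶜ.Infinite ∧ ∀ g, {x | x ∈ W ∧ x * g ∉ W}.Finite := by
  classical
  obtain ⟨b⟩ := ‹Nonempty ι›
  have hinj : ∀ g : FreeGroup ι, g ≠ 1 → (Set.range fun k : ℕ => g ^ (k + 1)).Infinite := by
    intro g hg
    refine Set.infinite_range_of_injective fun i j hij => ?_
    have := (injective_pow_iff_not_isOfFinOrder.2 (not_isOfFinOrder_of_isMulTorsionFree hg)) hij
    omega
  have hb : FreeGroup.of b ≠ 1 := FreeGroup.of_ne_one b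
  refine ⟨{x | x⁻¹.toWord.getLast? = some (b, true)}, ?_, ?_, ?_⟩
  · refine (hinj (FreeGroup.of b)⁻¹ (inv_ne_one.2 hb)).mono ?_
    rintro _ ⟨k, rfl⟩
    simp only [Set.mem_ofPred_eq, inv_pow, inv_inv, FreeGroup.toWord_of_pow]
    simp [List.getLast?_replicate]
  · refine (hinj (FreeGroup.of b) hb).mono ?_
    rintro _ ⟨k, rfl⟩
    simp only [Set.mem_compl_iff, Set.mem_ofPred_eq, FreeGroup.toWord_inv,
      FreeGroup.toWord_of_pow]
    simp [FreeGroup.invRev, List.getLast?_replicate]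
  · have key : ∀ p : ι × Bool, {x : FreeGroup ι | x⁻¹.toWord.getLast? = some (b, true) ∧
        ¬ (x * (FreeGroup.mk [p])⁻¹)⁻¹.toWord.getLast? = some (b, true)}.Finite := by
      intro p
      refine (Set.finite_singleton (FreeGroup.of b)⁻¹).subset ?_
      rintro x ⟨h1, h2⟩
      rw [mul_inv_rev, inv_inv] at h2
      by_cases hl : 2 ≤ x⁻¹.toWord.length
      · rw [getLast?_reduce_cons p _ hl] at h2
        exact absurd h1 h2
      · have : x⁻¹.toWord = [(b, true)] := by
          rcases hw : x⁻¹.toWord with _ | ⟨a, _ | ⟨c, t⟩⟩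
          · simp [hw] at h1
          · simpa [hw] using h1
          · simp [hw] at hl
        rw [← FreeGroup.toWord_of, FreeGroup.toWord_inj] at this
        rw [Set.mem_singleton_iff, ← this, inv_inv]
    intro g
    induction g using FreeGroup.induction_on with
    | C1 => simp
    | of x =>
      have := key (x, false)
      rwa [show (FreeGroup.mk [(x, false)])⁻¹ = FreeGroup.of x from rfl] at this
    | inv_of x _ => exact key (x, true)
    | mul x y hx hy =>
      refine (hx.union (hy.preimage (f := fun z => z * x) (mul_left_injective x).injOn)).subset ?_
      rintro z ⟨h1, h2⟩
      by_cases hz : z * x ∈ {x : FreeGroup ι | x⁻¹.toWord.getLast? = some (b, true)}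
      · exact Or.inr ⟨hz, by rwa [mul_assoc]⟩
      · exact Or.inl ⟨h1, hz⟩

variable {E : Type*} [Group E]

theorem exists_isCut (F : Subgroup E) [F.Normal] [F.FiniteIndex] [IsFreeGroup F] (hF : F ≠ ⊥)
    {S : Set E} (hSf : S.Finite) : ∃ A, IsCut (cay S) A := by
  let ι := IsFreeGroup.Generators F
  let e : F ≃* FreeGroup ι := IsFreeGroup.toFreeGroup F
  have hι : Nonempty ι := by
    by_contra hn
    rw [not_nonempty_iff] at hn
    refine hF ((Subgroup.eq_bot_iff_forall _).2 fun x hx => ?_)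
    have : (⟨x, hx⟩ : F) = 1 := e.injective (Subsingleton.elim _ _)
    exact congrArg Subtype.val this
  obtain ⟨W, hW1, hW2, hW3⟩ := exists_almost_invariant ι
  let r : E → F := fun x => ⟨x * (x : E ⧸ F).out⁻¹, by
    rw [← QuotientGroup.eq_one_iff]; simp⟩
  let A : Set E := {x | e (r x) ∈ W}
  let c : E := ((1 : E) : E ⧸ F).out
  have hr : ∀ w : F, r (w * c) = w := by
    intro w
    refine Subtype.ext ?_
    have hc : c ∈ F := by rw [← QuotientGroup.eq_one_iff]; simp [c]
    have h1 : ((w.1 * c : E) : E ⧸ F) = ((1 : E) : E ⧸ F) :=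
      (QuotientGroup.eq_one_iff _).2 (F.mul_mem w.2 hc)
    change (w.1 * c) * ((w.1 * c : E) : E ⧸ F).out⁻¹ = w.1
    rw [h1]
    exact mul_inv_cancel_right _ _
  let j : FreeGroup ι → E := fun w => (e.symm w).1 * c
  have hj : Function.Injective j := fun a b hab =>
    e.symm.injective (Subtype.ext (mul_right_cancel hab))
  have hjA : ∀ w, j w ∈ A ↔ w ∈ W := by
    intro w
    change e (r ((e.symm w).1 * c)) ∈ W ↔ _
    rw [hr, e.apply_symm_apply]
  refine ⟨A, ?_, ?_, ?_⟩
  · refine (hW1.image hj.injOn).mono ?_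
    rintro _ ⟨w, hw, rfl⟩
    exact (hjA w).2 hw
  · refine (hW2.image hj.injOn).mono ?_
    rintro _ ⟨w, hw, rfl⟩
    exact fun h => hw ((hjA w).1 h)
  · have hs : ∀ s ∈ S, {x : E | x ∈ A ∧ x * s ∉ A}.Finite := by
      intro s _
      have hq : ∀ q : E ⧸ F, q.out * s * (q * (s : E ⧸ F)).out⁻¹ ∈ F := fun q => by
        rw [← QuotientGroup.eq_one_iff]; simp
      refine (Set.finite_iUnion fun q : E ⧸ F => (hW3 (e ⟨_, hq q⟩)).image
        fun w => (e.symm w).1 * q.out).subset ?_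
      rintro x ⟨h1, h2⟩
      refine Set.mem_iUnion.2 ⟨(x : E ⧸ F), e (r x), ⟨h1, ?_⟩, ?_⟩
      · have : r x * ⟨_, hq (x : E ⧸ F)⟩ = r (x * s) := by
          refine Subtype.ext ?_
          change (x * (x : E ⧸ F).out⁻¹) * ((x : E ⧸ F).out * s *
            ((x : E ⧸ F) * (s : E ⧸ F)).out⁻¹) = (x * s) * ((x * s : E) : E ⧸ F).out⁻¹
          rw [QuotientGroup.mk_mul]
          group
        rw [← map_mul, this]
        exact h2
      · simp [r]
    refine (hSf.biUnion fun s h => (hs s h).image fun x => (x, x * s)).subset ?_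
    rintro ⟨x, y⟩ ⟨h1, h2, h3⟩
    refine Set.mem_biUnion h1 ⟨x, ⟨h2, ?_⟩, ?_⟩
    · simpa using h3
    · simp

end Cut

end

section

open scoped Pointwise

theorem conjRep_injective {E : Type*} [Group E] (e : E) : Function.Injective (conjRep E e) := by
  intro a b hab
  have := congrArg (conjRep E e⁻¹) hab
  rwa [← Module.End.mul_apply, ← Module.End.mul_apply, ← map_mul, inv_mul_cancel, map_one] at this

namespace TreeAct

variable {E : Type*} [Group E] {F : Subgroup E} {X D : Type*} [MulAction E X] [MulAction E D]

theorem vert_smul [F.Normal] (e : E) (x : X) :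
    vert F (e • x) = (vert F x).map (conjRep E e) := by
  refine le_antisymm (fun h hh => ?_) ?_
  · refine ⟨conjRep E e⁻¹ h, ?_, ?_⟩
    · simpa using (vert_coeff F X).map_mem e⁻¹ _ h hh
    · rw [← Module.End.mul_apply, ← map_mul, mul_inv_cancel, map_one, Module.End.one_apply]
  · rintro _ ⟨h, hh, rfl⟩
    exact (vert_coeff F X).map_mem e _ h hh

theorem finrank_vert_smul [F.Normal] (e : E) (x : X) :
    finrank ℚ (vert F (e • x)) = finrank ℚ (vert F x) := by
  rw [vert_smul]
  exact (Submodule.equivMapOfInjective _ (conjRep_injective e) _).symm.finrank_eq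

theorem finite_vert [F.Normal] [FiniteDimensional ℚ (homQ F)] (T : TreeAct F X D) (x : X) :
    FiniteDimensional ℚ (vert F x) := by
  have := T.finite_sec
  have := (vert_coeff F X).finite_fiber
    (Quotient.mk (MulAction.orbitRel F X) x)
  rw [← transporter_smul F (rfl : Quotient.mk (MulAction.orbitRel F X) x = _), vert_smul]
  exact Module.Finite.equiv (Submodule.equivMapOfInjective _ (conjRep_injective _) _)

/-- In a tree without leaves the vertex groups have smaller rank. -/
theorem finrank_vert_lt [F.Normal] [FiniteDimensional ℚ (homQ F)] (T : TreeAct F X D)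
    (hdeg : ∀ x, (∃ d d', d ≠ d' ∧ T.o d = x ∧ T.o d' = x) ∨
      (∃ d d', d ≠ d' ∧ T.τ d = x ∧ T.τ d' = x))
    (hF : ∀ x : X, F ⊓ MulAction.stabilizer E x ≠ ⊥ → 0 < finrank ℚ (vert F x)) (x : X) :
    finrank ℚ (vert F x) < finrank ℚ (homQ F) := by
  classical
  have := T.finX
  have := T.finD
  have := Fintype.ofFinite (MulAction.orbitRel.Quotient F X)
  have := Fintype.ofFinite (MulAction.orbitRel.Quotient F D)
  have hform := T.finrank_formula
  by_contra! hle
  let πX : X → MulAction.orbitRel.Quotient F X := Quotient.mk (MulAction.orbitRel F X)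
  let πD : D → MulAction.orbitRel.Quotient F D := Quotient.mk (MulAction.orbitRel F D)
  let q₀ := πX x
  have hq₀ : finrank ℚ (vert F q₀.out) = finrank ℚ (vert F x) := by
    rw [← finrank_vert_smul (transporter F x), transporter_smul F rfl]
  rw [← hq₀] at hle
  let oq : MulAction.orbitRel.Quotient F D → MulAction.orbitRel.Quotient F X :=
    fun q => πX (T.o q.out)
  let τq : MulAction.orbitRel.Quotient F D → MulAction.orbitRel.Quotient F X :=
    fun q => πX (T.τ q.out)
  have hπ : ∀ f ∈ F, ∀ z : X, πX (f • z) = πX z := fun f hf z => Quotient.sound ⟨⟨f, hf⟩, rfl⟩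
  have hoq : ∀ d, oq (πD d) = πX (T.o d) := by
    intro d
    have h1 : transporter F d • (πD d).out = d := transporter_smul F rfl
    conv_rhs => rw [← h1, T.o_smul, hπ _ (transporter_mem F d)]
  have hτq : ∀ d, τq (πD d) = πX (T.τ d) := by
    intro d
    have h1 : transporter F d • (πD d).out = d := transporter_smul F rfl
    conv_rhs => rw [← h1, T.τ_smul, hπ _ (transporter_mem F d)]
  let deg : MulAction.orbitRel.Quotient F X → ℕ := fun q =>
    (Finset.univ.filter fun d => oq d = q).card + (Finset.univ.filter fun d => τq d = q).card
  have hsum : ∑ q, deg q = 2 * Fintype.card (MulAction.orbitRel.Quotient F D) := by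
    rw [Finset.sum_add_distrib, ← Finset.card_eq_sum_card_fiberwise (fun _ _ => Finset.mem_univ _),
      ← Finset.card_eq_sum_card_fiberwise (fun _ _ => Finset.mem_univ _), Finset.card_univ]
    ring
  have hdeg1 : ∀ q, 1 ≤ deg q := by
    intro q
    rcases hdeg q.out with ⟨d, -, -, hd, -⟩ | ⟨d, -, -, hd, -⟩
    · have : 0 < (Finset.univ.filter fun d => oq d = q).card :=
        Finset.card_pos.2 ⟨πD d, Finset.mem_filter.2 ⟨Finset.mem_univ _, by
              rw [hoq, hd]; exact Quotient.out_eq q⟩⟩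
      simp only [deg]
      omega
    · have : 0 < (Finset.univ.filter fun d => τq d = q).card :=
        Finset.card_pos.2 ⟨πD d, Finset.mem_filter.2 ⟨Finset.mem_univ _, by
              rw [hτq, hd]; exact Quotient.out_eq q⟩⟩
      simp only [deg]
      omega
  have hinj : ∀ q : MulAction.orbitRel.Quotient F X, F ⊓ MulAction.stabilizer E q.out = ⊥ →
      ∀ p : D → X, (∀ (e : E) d, p (e • d) = e • p d) → ∀ d d', p d = q.out → p d' = q.out →
      πD d = πD d' → d = d' := by
    intro q hq p hp d d' hd hd' he
    obtain ⟨f, hf⟩ := Quotient.exact he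
    change f.1 • d' = d at hf
    have : f.1 ∈ F ⊓ MulAction.stabilizer E q.out := by
      refine ⟨f.2, ?_⟩
      change f.1 • q.out = q.out
      nth_rewrite 1 [← hd']
      rw [← hp, hf, hd]
    rw [hq, Subgroup.mem_bot] at this
    rw [← hf, this, one_smul]
  have hdeg2 : ∀ q, 2 ≤ deg q + 2 * finrank ℚ (vert F q.out) := by
    intro q
    by_cases hb : F ⊓ MulAction.stabilizer E q.out = ⊥
    · have h2 : 2 ≤ deg q := by
        rcases hdeg q.out with ⟨d, d', hne, hd, hd'⟩ | ⟨d, d', hne, hd, hd'⟩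
        · have : 1 < (Finset.univ.filter fun d => oq d = q).card :=
            Finset.one_lt_card.2 ⟨πD d, Finset.mem_filter.2 ⟨Finset.mem_univ _, by
              rw [hoq, hd]; exact Quotient.out_eq q⟩,
              πD d', Finset.mem_filter.2 ⟨Finset.mem_univ _, by
              rw [hoq, hd']; exact Quotient.out_eq q⟩,
              fun e => hne (hinj q hb T.o T.o_smul d d' hd hd' e)⟩
          simp only [deg]
          omega
        · have : 1 < (Finset.univ.filter fun d => τq d = q).card :=
            Finset.one_lt_card.2 ⟨πD d, Finset.mem_filter.2 ⟨Finset.mem_univ _, by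
              rw [hτq, hd]; exact Quotient.out_eq q⟩,
              πD d', Finset.mem_filter.2 ⟨Finset.mem_univ _, by
              rw [hτq, hd']; exact Quotient.out_eq q⟩,
              fun e => hne (hinj q hb T.τ T.τ_smul d d' hd hd' e)⟩
          simp only [deg]
          omega
      omega
    · have := hF q.out hb
      omega
  have h1 : ∑ q ∈ Finset.univ.erase q₀, 2 ≤
      ∑ q ∈ Finset.univ.erase q₀, (deg q + 2 * finrank ℚ (vert F q.out)) :=
    Finset.sum_le_sum fun q _ => hdeg2 q
  rw [Finset.sum_const, smul_eq_mul, Finset.card_erase_of_mem (Finset.mem_univ _),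
    Finset.card_univ, Finset.sum_add_distrib, ← Finset.mul_sum] at h1
  have h2 := Finset.sum_erase_add (f := deg) (a := q₀) _ (Finset.mem_univ _)
  have h3 := Finset.sum_erase_add (f := fun q : MulAction.orbitRel.Quotient F X =>
    finrank ℚ (vert F q.out)) (a := q₀) _ (Finset.mem_univ _)
  have h4 : 0 < Fintype.card (MulAction.orbitRel.Quotient F X) := Fintype.card_pos_iff.2 ⟨q₀⟩
  have h5 := hdeg1 q₀
  rw [hsum] at h2
  omega

end TreeAct

universe u

theorem exists_tree {E : Type u} [Group E] [Group.FG E] (F : Subgroup E) [F.Normal]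
    [F.FiniteIndex] [IsFreeGroup F] (hF : F ≠ ⊥) :
    ∃ (X D : Type u) (_ : MulAction E X) (_ : MulAction E D) (T : TreeAct F X D),
      (∀ d : D, (MulAction.stabilizer E d : Set E).Finite) ∧
      (∀ e : E, IsOfFinOrder e → ∃ x : X, e • x = x) ∧
      ∀ x, (∃ d d', d ≠ d' ∧ T.o d = x ∧ T.o d' = x) ∨
        (∃ d d', d ≠ d' ∧ T.τ d = x ∧ T.τ d' = x) := by
  obtain ⟨S₀, hS₀, hf⟩ := Group.fg_iff.1 ‹Group.FG E›
  let S : Set E := S₀ ∪ S₀⁻¹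
  have hSf : S.Finite := hf.union hf.inv
  have hS : ∀ s ∈ S, s⁻¹ ∈ S := by
    rintro s (h | h)
    · exact Or.inr (by simpa using h)
    · exact Or.inl h
  have hgen : Subgroup.closure S = ⊤ := by
    rw [eq_top_iff, ← hS₀]
    exact Subgroup.closure_mono Set.subset_union_left
  have hn := Cut.nest_opt hS hgen
  obtain ⟨A, hA⟩ := Cut.exists_isCut F hF hSf
  have hne := Cut.opt_nonempty _ hA
  have hinv : ∀ (e : E), ∀ A ∈ Cut.opt (Cut.cay S), e • A ∈ Cut.opt (Cut.cay S) :=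
    fun e => Cut.opt_smul e
  have hstab : ∀ d : Nest.edges hinv, (MulAction.stabilizer E d : Set E).Finite := by
    intro d
    refine (Cut.finite_stabilizer hS hgen d.2).subset fun e he => ?_
    exact congrArg Subtype.val (MulAction.mem_stabilizer_iff.1 he)
  have htf : IsMulTorsionFree F :=
    (IsFreeGroup.toFreeGroup F).injective.isMulTorsionFree (IsFreeGroup.toFreeGroup F).toMonoidHom
  have hfree : ∀ f ∈ F, ∀ d : Nest.edges hinv, f • d = d → f = 1 := by
    intro f hf d hd
    have hord : IsOfFinOrder f := by
      have := (hstab d).to_subtype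
      have h1 : IsOfFinOrder (⟨f, hd⟩ : MulAction.stabilizer E d) := isOfFinOrder_of_finite _
      exact (MulAction.stabilizer E d).subtype.isOfFinOrder h1
    have h2 : IsOfFinOrder (⟨f, hf⟩ : F) := Submonoid.isOfFinOrder_coe.1 hord
    by_contra h1
    exact not_isOfFinOrder_of_isMulTorsionFree (fun h => h1 (congrArg Subtype.val h)) h2
  refine ⟨_, _, inferInstance, inferInstance, hn.tree hinv F
    (Cut.finite_orbits hSf hS hgen F) hfree hne, hstab,
    fun e he => hn.exists_fixed hinv hne he, ?_⟩
  rintro (⟨_, A, hA, rfl⟩ | ⟨_, A, hA, rfl⟩)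
  · left
    obtain ⟨B, hB, hBA, hO⟩ := hn.exists_ne_ori_eq (fun A hA => Cut.exists_ssubset hS hgen hA) hA
    exact ⟨⟨B, hB⟩, ⟨A, hA⟩, fun h => hBA (congrArg Subtype.val h),
      congrArg Sum.inl (Subtype.ext hO), rfl⟩
  · right
    refine ⟨⟨Aᶜ, hn.compl A hA⟩, ⟨A, hA⟩, fun h => hn.ne_compl hA (congrArg Subtype.val h).symm,
      congrArg Sum.inr (Subtype.ext ?_), rfl⟩
    change ({Aᶜ, Aᶜᶜ} : Set (Set E)) = {A, Aᶜ}
    rw [compl_compl, Set.pair_comm]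

end

section

open scoped Pointwise

section Transfer

variable {E E' : Type*} [Group E] [Group E']

/-- Homomorphisms to `ℚ` are transported by injective maps. -/
def homQMap (j : E' →* E) (hj : Function.Injective j) (F : Subgroup E') :
    homQ (F.map j) ≃ₗ[ℚ] homQ F where
  toFun h := ⟨fun k => h.1 (j k), fun k hk => h.2.1 _ (by
      rintro ⟨k', hk', e⟩
      exact hk (hj e ▸ hk')), fun a ha b hb => by
      simp only [map_mul]
      exact h.2.2 _ (Subgroup.mem_map_of_mem j ha) _ (Subgroup.mem_map_of_mem j hb)⟩
  map_add' _ _ := rfl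
  map_smul' _ _ := rfl
  invFun h := ⟨Function.extend j h.1 0, by
    refine ⟨fun k hk => ?_, ?_⟩
    · by_cases hk' : ∃ a, j a = k
      · obtain ⟨a, rfl⟩ := hk'
        rw [hj.extend_apply]
        exact h.2.1 _ fun ha => hk (Subgroup.mem_map_of_mem j ha)
      · rw [Function.extend_apply' _ _ _ hk', Pi.zero_apply]
    · rintro _ ⟨a, ha, rfl⟩ _ ⟨b, hb, rfl⟩
      rw [← map_mul, hj.extend_apply, hj.extend_apply, hj.extend_apply]
      exact h.2.2 a ha b hb⟩
  left_inv h := by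
    ext k
    by_cases hk' : ∃ a, j a = k
    · obtain ⟨a, rfl⟩ := hk'
      exact hj.extend_apply _ _ _
    · change Function.extend j _ (0 : E → ℚ) k = _
      rw [Function.extend_apply' _ _ _ hk', Pi.zero_apply]
      refine (h.2.1 k fun hk => hk' ?_).symm
      obtain ⟨a, -, e⟩ := hk
      exact ⟨a, e⟩
  right_inv h := by
    ext k
    exact hj.extend_apply _ _ _

theorem homQMap_apply (j : E' →* E) (hj : Function.Injective j) (F : Subgroup E')
    (h : homQ (F.map j)) (k : E') : (homQMap j hj F h).1 k = h.1 (j k) := rfl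

theorem finrank_ker_conj {V W : Type*} [AddCommGroup V] [Module ℚ V] [AddCommGroup W] [Module ℚ W]
    (e : V ≃ₗ[ℚ] W) (f : V →ₗ[ℚ] V) (g : W →ₗ[ℚ] W) (h : ∀ v, e (f v) = g (e v)) :
    finrank ℚ (LinearMap.ker f) = finrank ℚ (LinearMap.ker g) := by
  have : LinearMap.ker g = (LinearMap.ker f).map (e : V →ₗ[ℚ] W) := by
    ext w
    constructor
    · intro hw
      refine ⟨e.symm w, ?_, by simp⟩
      apply e.injective
      rw [h, map_zero]
      simpa using hw
    · rintro ⟨v, hv, rfl⟩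
      change g (e v) = 0
      rw [← h, LinearMap.mem_ker.1 hv, map_zero]
  rw [this, LinearEquiv.finrank_map_eq]

theorem trace_eq_of_equiv {V W : Type*} [AddCommGroup V] [Module ℚ V] [AddCommGroup W] [Module ℚ W]
    (e : V ≃ₗ[ℚ] W) (f : V →ₗ[ℚ] V) (g : W →ₗ[ℚ] W) (h : ∀ v, e (f v) = g (e v)) :
    LinearMap.trace ℚ V f = LinearMap.trace ℚ W g := by
  have : g = e.conj f := by
    ext w
    rw [LinearEquiv.conj_apply_apply, h, e.apply_symm_apply]
  rw [this, LinearMap.trace_conj']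

theorem Lef.map {j : E' →* E} (hj : Function.Injective j) {F : Subgroup E'} {t : E'}
    (hn : ∀ k, k ∈ F ↔ t⁻¹ * k * t ∈ F) (h : Lef F t) : Lef (F.map j) (j t) := by
  intro ht
  have ht' := conjRep_mem hn
  have key : ∀ v, homQMap j hj F ((conjRep E (j t)).restrict ht v) =
      (conjRep E' t).restrict ht' (homQMap j hj F v) := by
    intro v
    ext k
    rw [homQMap_apply]
    change v.1 _ = v.1 (j _)
    simp
  obtain ⟨h1, h2⟩ := h ht'
  rw [trace_eq_of_equiv _ _ _ key]
  have hk := finrank_ker_conj (homQMap j hj F) ((conjRep E (j t)).restrict ht - 1)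
    ((conjRep E' t).restrict ht' - 1) (fun v => by
      rw [LinearMap.sub_apply, map_sub, key]; rfl)
  rw [hk]
  refine ⟨fun hf => h1 fun f hfF hfo => hf (j f) (Subgroup.mem_map_of_mem j hfF) ?_, ?_⟩
  · rw [← map_mul]
    exact j.isOfFinOrder hfo
  · rintro ⟨_, ⟨f, hf, rfl⟩, hfo⟩
    refine h2 ⟨f, hf, ?_⟩
    rw [← map_mul] at hfo
    exact hj.isOfFinOrder_iff.1 hfo

end Transfer

section Free

/-- Homomorphisms from a free group to `ℚ`. -/
def homQFree (ι : Type*) : homQ (⊤ : Subgroup (FreeGroup ι)) ≃ₗ[ℚ] (ι → ℚ) where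
  toFun h i := h.1 (FreeGroup.of i)
  map_add' _ _ := rfl
  map_smul' _ _ := rfl
  invFun v := ⟨fun k => Multiplicative.toAdd
      (FreeGroup.lift (fun i => Multiplicative.ofAdd (v i)) k), fun k hk => (hk trivial).elim,
    fun a _ b _ => by simp⟩
  left_inv h := by
    ext k
    let H : FreeGroup ι →* Multiplicative ℚ :=
      { toFun := fun k => Multiplicative.ofAdd (h.1 k)
        map_one' := by rw [homQ_one h.2]; rfl
        map_mul' := fun a b => by rw [h.2.2 a trivial b trivial]; rfl }
    have : FreeGroup.lift (fun i => Multiplicative.ofAdd (h.1 (FreeGroup.of i))) = H := by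
      ext i; simp [H]
    change Multiplicative.toAdd (FreeGroup.lift _ k) = _
    rw [this]
    rfl
  right_inv v := by
    ext i; simp

theorem map_top_of_range {G E : Type*} [Group G] [Group E] {j : G →* E} {F : Subgroup E}
    (h : j.range = F) : (⊤ : Subgroup G).map j = F := by
  rw [← h, MonoidHom.range_eq_map]

/-- Homomorphisms to `ℚ` from a subgroup which is the image of a free group. -/
def homQOfFree {ι E : Type*} [Group E] (j : FreeGroup ι →* E)
    (hj : Function.Injective j) {F : Subgroup E} (h : j.range = F) : homQ F ≃ₗ[ℚ] (ι → ℚ) :=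
  (LinearEquiv.ofEq _ _ (by rw [map_top_of_range h])).trans
    ((homQMap j hj ⊤).trans (homQFree ι))

theorem IsFreeGroup.exists_parametrization {E : Type*} [Group E] (F : Subgroup E) [IsFreeGroup F] :
    ∃ j : FreeGroup (IsFreeGroup.Generators F) →* E, Function.Injective j ∧ j.range = F := by
  refine ⟨F.subtype.comp (IsFreeGroup.toFreeGroup F).symm.toMonoidHom, ?_, ?_⟩
  · exact F.subtype_injective.comp (IsFreeGroup.toFreeGroup F).symm.injective
  · rw [MonoidHom.range_comp, MonoidHom.range_eq_top.2 (IsFreeGroup.toFreeGroup F).symm.surjective,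
      ← MonoidHom.range_eq_map, Subgroup.range_subtype]

theorem finite_generators_of_homQ {E : Type*} [Group E] (F : Subgroup E) [IsFreeGroup F]
    [FiniteDimensional ℚ (homQ F)] : Finite (IsFreeGroup.Generators F) := by
  obtain ⟨j, hj, h⟩ := IsFreeGroup.exists_parametrization F
  have : FiniteDimensional ℚ (IsFreeGroup.Generators F → ℚ) :=
    Module.Finite.equiv (homQOfFree j hj h)
  have h2 : FiniteDimensional ℚ (IsFreeGroup.Generators F →₀ ℚ) :=
    Module.Finite.of_injective (Finsupp.lcoeFun (R := ℚ)) (by exact DFunLike.coe_injective)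
  have := Module.finite_finsupp_iff (R := ℚ) (M := ℚ) (ι := IsFreeGroup.Generators F) |>.1 h2
  rcases this with h | h
  · infer_instance
  · exact (h.resolve_left (not_subsingleton ℚ)).2

theorem finrank_homQ_pos {E : Type*} [Group E] (F : Subgroup E) [IsFreeGroup F]
    [FiniteDimensional ℚ (homQ F)] (hF : F ≠ ⊥) : 0 < finrank ℚ (homQ F) := by
  have := finite_generators_of_homQ F
  have := Fintype.ofFinite (IsFreeGroup.Generators F)
  obtain ⟨j, hj, h⟩ := IsFreeGroup.exists_parametrization F
  rw [(homQOfFree j hj h).finrank_eq, Module.finrank_fintype_fun_eq_card]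
  by_contra h0
  have := Fintype.card_eq_zero_iff.1 (by omega : Fintype.card (IsFreeGroup.Generators F) = 0)
  apply hF
  rw [← h, eq_bot_iff]
  rintro _ ⟨k, rfl⟩
  rw [Subsingleton.elim k 1, map_one]
  exact one_mem _

theorem fg_of_finiteIndex {E : Type*} [Group E] (F : Subgroup E) [F.FiniteIndex] (hF : F.FG) :
    Group.FG E := by
  obtain ⟨S, hS, hSf⟩ := (Subgroup.fg_iff F).1 hF
  refine Group.fg_iff.2 ⟨S ∪ Set.range (fun q : E ⧸ F => q.out), ?_, hSf.union (Set.finite_range _)⟩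
  rw [eq_top_iff]
  intro e _
  have h1 : ((e : E ⧸ F).out)⁻¹ * e ∈ F := QuotientGroup.eq.1 (Quotient.out_eq (e : E ⧸ F))
  have h2 : F ≤ Subgroup.closure (S ∪ Set.range (fun q : E ⧸ F => q.out)) := by
    rw [← hS]; exact Subgroup.closure_mono Set.subset_union_left
  have h3 := mul_mem (Subgroup.subset_closure (Or.inr ⟨(e : E ⧸ F), rfl⟩) :
    (e : E ⧸ F).out ∈ Subgroup.closure (S ∪ Set.range (fun q : E ⧸ F => q.out))) (h2 h1)
  rwa [mul_inv_cancel_left] at h3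

theorem fg_of_homQ {E : Type*} [Group E] (F : Subgroup E) [IsFreeGroup F] [F.FiniteIndex]
    [FiniteDimensional ℚ (homQ F)] : Group.FG E := by
  have := finite_generators_of_homQ F
  obtain ⟨j, hj, h⟩ := IsFreeGroup.exists_parametrization F
  refine fg_of_finiteIndex F ?_
  rw [← h]
  exact (Group.fg_iff_subgroup_fg _).1 (Group.fg_range j)

end Free

universe u

theorem lef_of_free (k : ℕ) : ∀ {E : Type u} [Group E] (F : Subgroup E) [F.Normal] [F.FiniteIndex]
    [IsFreeGroup F] [FiniteDimensional ℚ (homQ F)] (_ : finrank ℚ (homQ F) = k) (t : E),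
    Lef F t := by
  induction k using Nat.strong_induction_on with
  | _ k ih =>
  intro E _ F _ _ _ _ hk t
  by_cases hF : F = ⊥
  · subst hF
    have hE : Finite E := by
      have : (⊥ : Subgroup E).index ≠ 0 := Subgroup.FiniteIndex.index_ne_zero
      rw [Subgroup.index_bot] at this
      exact (Nat.card_ne_zero.1 this).2
    intro ht
    have h0 : ∀ v : homQ (⊥ : Subgroup E), v = 0 := by
      intro v
      ext e
      by_cases he : e ∈ (⊥ : Subgroup E)
      · rw [Subgroup.mem_bot.1 he]; exact homQ_one v.2
      · exact v.2.1 e he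
    refine ⟨fun h => (h 1 (one_mem _) (isOfFinOrder_of_finite _)).elim, fun _ => ?_⟩
    have : (conjRep E t).restrict ht = 0 := by
      ext1 v; exact h0 _
    rw [this, map_zero]
    exact Nat.cast_nonneg _
  · have := fg_of_homQ F
    obtain ⟨X, D, _, _, T, hstab, htor, hdeg⟩ := exists_tree F hF
    have hfree : ∀ x : X, IsFreeGroup ↥(F ⊓ MulAction.stabilizer E x) := by
      intro x
      have h1 : IsFreeGroup ↥((F ⊓ MulAction.stabilizer E x).subgroupOf F) := inferInstance
      exact IsFreeGroup.ofMulEquiv (Subgroup.subgroupOfEquivOfLe inf_le_left)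
    refine T.lef t hstab htor fun x u hu hut => ?_
    have hfd : FiniteDimensional ℚ (homQ (F ⊓ MulAction.stabilizer E x)) := T.finite_vert x
    have hlt := T.finrank_vert_lt hdeg (fun x hx => by
      have : FiniteDimensional ℚ (homQ (F ⊓ MulAction.stabilizer E x)) := T.finite_vert x
      have := hfree x
      exact finrank_homQ_pos _ hx) x
    let S := MulAction.stabilizer E x
    let F' : Subgroup S := F.subgroupOf S
    have hmap : F'.map S.subtype = F ⊓ S := Subgroup.subgroupOf_map_subtype F S
    have e1 : homQ (F ⊓ S) ≃ₗ[ℚ] homQ F' :=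
      (LinearEquiv.ofEq _ _ (by rw [hmap])).trans (homQMap S.subtype S.subtype_injective F')
    have : FiniteDimensional ℚ (homQ F') := Module.Finite.equiv e1
    have : IsFreeGroup F' := by
      have := hfree x
      have h1 : F' ≃* ↥(F'.map S.subtype) := F'.equivMapOfInjective _ S.subtype_injective
      exact IsFreeGroup.ofMulEquiv (h1.trans (MulEquiv.subgroupCongr hmap)).symm
    have : F'.Normal := inferInstance
    have hl := ih (finrank ℚ (homQ F')) (by rw [← e1.finrank_eq, ← hk]; exact hlt) F' rfl
      ⟨u, hu⟩
    have h2 := hl.map (j := S.subtype) S.subtype_injective (fun k => by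
      have := normal_conj_iff (F := F') (⟨u, hu⟩ : S) k
      exact this)
    rw [hmap] at h2
    exact h2

end

namespace OutFG

/-- The class of an automorphism. -/
def mk {n : ℕ} : MulAut (FG n) →* OutFG n := QuotientGroup.mk' (InnFG n)

theorem mk_surjective {n : ℕ} : Function.Surjective (mk (n := n)) :=
  QuotientGroup.mk'_surjective _

theorem mk_eq_one {n : ℕ} {α : MulAut (FG n)} : mk α = 1 ↔ ∃ g, MulAut.conj g = α :=
  QuotientGroup.eq_one_iff α

theorem mk_conj {n : ℕ} (g : FG n) : mk (MulAut.conj g) = 1 := mk_eq_one.2 ⟨g, rfl⟩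

end OutFG

/-- Rational first cohomology of the free group. -/
abbrev H1 (n : ℕ) : Type := homQ (⊤ : Subgroup (FG n))

instance (n : ℕ) : FiniteDimensional ℚ (H1 n) := Module.Finite.equiv (homQFree (Fin n)).symm

theorem finrank_H1 (n : ℕ) : finrank ℚ (H1 n) = n := by
  rw [(homQFree (Fin n)).finrank_eq, Module.finrank_fintype_fun_eq_card, Fintype.card_fin]

/-- The action of automorphisms on first cohomology. -/
def autRep (n : ℕ) : Representation ℚ (MulAut (FG n)) (H1 n) where
  toFun α :=
    { toFun := fun h => ⟨fun k => h.1 (α⁻¹ k), fun k hk => (hk trivial).elim, fun a _ b _ => by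
        simp only [map_mul]; exact h.2.2 _ trivial _ trivial⟩
      map_add' := fun _ _ => rfl
      map_smul' := fun _ _ => rfl }
  map_one' := rfl
  map_mul' a b := by
    ext h k
    change h.1 ((a * b)⁻¹ k) = h.1 (b⁻¹ (a⁻¹ k))
    rw [mul_inv_rev]; rfl

theorem autRep_apply {n : ℕ} (α : MulAut (FG n)) (h : H1 n) (k : FG n) :
    (autRep n α h).1 k = h.1 (α⁻¹ k) := rfl

/-- The action of outer automorphisms on first cohomology. -/
def outRep (n : ℕ) : Representation ℚ (OutFG n) (H1 n) :=
  QuotientGroup.lift (InnFG n) (autRep n) (by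
    rintro _ ⟨g, rfl⟩
    ext h k
    rw [autRep_apply, ← map_inv, MulAut.conj_apply, inv_inv, h.2.2 _ trivial _ trivial,
      h.2.2 _ trivial _ trivial, homQ_inv h.2 trivial]
    simp)

theorem outRep_mk {n : ℕ} (α : MulAut (FG n)) : outRep n (OutFG.mk α) = autRep n α := rfl

theorem FreeGroup.commute_of_of {ι : Type*} [DecidableEq ι] {i j : ι} (hij : i ≠ j)
    {g : FreeGroup ι} (hi : ∀ k, g * FreeGroup.of k = FreeGroup.of k * g) : g = 1 := by
  by_contra hg
  have hw : g.toWord ≠ [] := fun h => hg (FreeGroup.toWord_eq_nil_iff.1 h)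
  obtain ⟨⟨x, b⟩, w, hxw⟩ := List.exists_cons_of_ne_nil hw
  obtain ⟨k, hk⟩ : ∃ k, x ≠ k := by
    by_cases h : x = i
    · exact ⟨j, by rw [h]; exact hij⟩
    · exact ⟨i, h⟩
  have h1 : (FreeGroup.of k * g).toWord = (k, true) :: g.toWord := by
    rw [FreeGroup.toWord_mul, FreeGroup.toWord_of, hxw, List.singleton_append,
      FreeGroup.reduce.cons, ← hxw, FreeGroup.reduce_toWord, hxw]
    simp [hk.symm]
  have h2 : ((g * FreeGroup.of k).toWord).Sublist (g.toWord ++ [(k, true)]) := by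
    rw [FreeGroup.toWord_mul, FreeGroup.toWord_of]
    exact FreeGroup.Red.sublist FreeGroup.reduce.red
  rw [hi, h1] at h2
  have h3 := h2.eq_of_length (by simp)
  rw [hxw, List.cons_append] at h3
  have := (List.cons.inj h3).1
  exact hk (congrArg Prod.fst this).symm

theorem freeGroup_conj_injective {m : ℕ} (hm : 2 ≤ m) :
    Function.Injective (MulAut.conj : FG m →* MulAut (FG m)) := by
  rw [injective_iff_map_eq_one]
  intro g hg
  refine FreeGroup.commute_of_of (i := (⟨0, by omega⟩ : Fin m)) (j := ⟨1, by omega⟩)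
    (fun h => by simp at h) fun k => ?_
  have := congrArg (fun α : MulAut (FG m) => α (FreeGroup.of k)) hg
  simp only [MulAut.conj_apply, MulAut.one_apply] at this
  rw [mul_inv_eq_iff_eq_mul] at this
  exact this

/-- Traces of finite order outer automorphisms. -/
theorem outRep_trace {m : ℕ} (hm : 2 ≤ m) {γ : OutFG m} (hγ : IsOfFinOrder γ) :
    ((∀ α, OutFG.mk α = γ → ¬ IsOfFinOrder α) → LinearMap.trace ℚ (H1 m) (outRep m γ) = 1) ∧
    ((∃ α, OutFG.mk α = γ ∧ IsOfFinOrder α) →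
      LinearMap.trace ℚ (H1 m) (outRep m γ) ≤ finrank ℚ (LinearMap.ker (outRep m γ - 1))) := by
  obtain ⟨t, rfl⟩ := OutFG.mk_surjective γ
  let E : Subgroup (MulAut (FG m)) := (Subgroup.zpowers (OutFG.mk t)).comap OutFG.mk
  have htE : t ∈ E := Subgroup.mem_zpowers (OutFG.mk t)
  have hinn : ∀ g : FG m, MulAut.conj g ∈ E := by
    intro g
    change OutFG.mk _ ∈ Subgroup.zpowers (OutFG.mk t)
    rw [OutFG.mk_conj]
    exact one_mem _
  let j : FG m →* E := MulAut.conj.codRestrict E hinn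
  have hj : Function.Injective j := fun a b h => freeGroup_conj_injective hm (congrArg Subtype.val h)
  let F : Subgroup E := j.range
  have hF : F = (InnFG m).subgroupOf E := by
    ext e
    rw [Subgroup.mem_subgroupOf]
    constructor
    · rintro ⟨g, rfl⟩; exact ⟨g, rfl⟩
    · rintro ⟨g, hg⟩; exact ⟨g, Subtype.ext hg⟩
  have hFn : F.Normal := by rw [hF]; infer_instance
  have hFk : F = (OutFG.mk.comp E.subtype).ker := by
    rw [hF]
    ext e
    rw [MonoidHom.mem_ker, Subgroup.mem_subgroupOf]
    exact (OutFG.mk_eq_one (α := e.1)).symm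
  have hFi : F.FiniteIndex := by
    have h1 : (OutFG.mk.comp E.subtype).range ≤ Subgroup.zpowers (OutFG.mk t) := by
      rintro _ ⟨e, rfl⟩; exact e.2
    have h2 : Finite (Subgroup.zpowers (OutFG.mk t)) := by
      exact (finite_zpowers.2 hγ).to_subtype
    have h3 : Finite (OutFG.mk.comp E.subtype).range :=
      Finite.of_injective _ (Subgroup.inclusion_injective h1)
    rw [hFk]
    exact Subgroup.finiteIndex_ker _
  have hFf : IsFreeGroup F := IsFreeGroup.ofMulEquiv (MonoidHom.ofInjective hj)
  have hFd : FiniteDimensional ℚ (homQ F) := Module.Finite.equiv (homQOfFree j hj rfl).symm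
  have hl := lef_of_free _ F rfl (⟨t, htE⟩ : E)
  let e : homQ F ≃ₗ[ℚ] H1 m := (LinearEquiv.ofEq _ _ (by rw [map_top_of_range rfl])).trans
    (homQMap j hj ⊤)
  have ht := conjRep_mem (normal_conj_iff (F := F) (⟨t, htE⟩ : E))
  obtain ⟨h1, h2⟩ := hl ht
  have key : ∀ v, e ((conjRep E ⟨t, htE⟩).restrict ht v) = outRep m (OutFG.mk t) (e v) := by
    intro v
    refine Subtype.ext (funext fun k => ?_)
    change v.1 _ = v.1 (j (t⁻¹ k))
    refine congrArg v.1 (Subtype.ext ?_)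
    change t⁻¹ * MulAut.conj k * t = MulAut.conj (t⁻¹ k)
    ext x
    simp
  rw [trace_eq_of_equiv e _ _ key] at h1 h2
  rw [finrank_ker_conj e ((conjRep E ⟨t, htE⟩).restrict ht - 1) (outRep m (OutFG.mk t) - 1)
    (fun v => by rw [LinearMap.sub_apply, map_sub, key]; rfl)] at h2
  constructor
  · intro h
    refine h1 fun f hf hfo => h (f.1 * t) ?_ ?_
    · rw [hFk] at hf
      rw [map_mul, show OutFG.mk f.1 = 1 from hf, one_mul]
    · exact E.subtype.isOfFinOrder hfo
  · rintro ⟨α, hα, hαo⟩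
    have hαt : OutFG.mk (α * t⁻¹) = 1 := by rw [map_mul, hα, ← map_mul, mul_inv_cancel, map_one]
    have hαE : α * t⁻¹ ∈ E := by
      change OutFG.mk _ ∈ Subgroup.zpowers (OutFG.mk t)
      rw [hαt]; exact one_mem _
    refine h2 ⟨⟨α * t⁻¹, hαE⟩, ?_, ?_⟩
    · rw [hFk]; exact hαt
    · rw [← E.subtype_injective.isOfFinOrder_iff]
      change IsOfFinOrder (α * t⁻¹ * t)
      rwa [inv_mul_cancel_right]

section PolyFun

variable {G : Type*} [Group G]

/-- Functions on `G` all of whose `d`-fold differences vanish. -/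
def polyFun (G : Type*) [Group G] : ℕ → Submodule ℚ (G → ℚ)
  | 0 => ⊥
  | d + 1 =>
    { carrier := {f | ∀ g, (fun x => f (g * x) - f x) ∈ polyFun G d}
      zero_mem' := fun g => by simp only [Pi.zero_apply, sub_zero]; exact (polyFun G d).zero_mem
      add_mem' := fun {a b} ha hb g => by
        convert (polyFun G d).add_mem (ha g) (hb g) using 1
        ext x; simp only [Pi.add_apply]; ring
      smul_mem' := fun c a ha g => by
        convert (polyFun G d).smul_mem c (ha g) using 1
        ext x; simp only [Pi.smul_apply, smul_eq_mul]; ring }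

theorem mem_polyFun_zero {f : G → ℚ} : f ∈ polyFun G 0 ↔ f = 0 := Iff.rfl

theorem polyFun_translate {d : ℕ} : ∀ {f : G → ℚ} (h : G), f ∈ polyFun G d →
    (fun x => f (h * x)) ∈ polyFun G d := by
  induction d with
  | zero => intro f h hf; rw [mem_polyFun_zero] at hf ⊢; subst hf; rfl
  | succ d ih =>
    intro f h hf g
    convert ih h (hf (h * g * h⁻¹)) using 1
    ext x
    simp [mul_assoc]

theorem polyFun_diff_of_torsion {d : ℕ} {f : G → ℚ} (hf : f ∈ polyFun G (d + 2)) {h : G}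
    (hh : ∀ v ∈ homQ (⊤ : Subgroup G), v h = 0) : (fun x => f (h * x) - f x) ∈ polyFun G d := by
  rw [← Submodule.Quotient.mk_eq_zero, ← Module.forall_dual_apply_eq_zero_iff ℚ]
  intro l
  refine hh (fun g => l (Submodule.Quotient.mk fun x => f (g * x) - f x))
    ⟨fun k hk => (hk trivial).elim, fun a _ b _ => ?_⟩
  rw [← map_add, ← Submodule.Quotient.mk_add]
  refine congrArg l ((Submodule.Quotient.eq _).2 ?_)
  convert hf a b using 1
  ext x
  simp only [Pi.sub_apply, Pi.add_apply, mul_assoc]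
  ring

theorem polyFun_comp_sub {α : G →* G} (hα : ∀ v ∈ homQ (⊤ : Subgroup G), ∀ g, v (α g) = v g)
    {d : ℕ} : ∀ {f : G → ℚ}, f ∈ polyFun G (d + 1) → (fun x => f (α x) - f x) ∈ polyFun G d := by
  induction d with
  | zero =>
    intro f hf
    rw [mem_polyFun_zero]
    ext x
    have h1 := congrFun (mem_polyFun_zero.1 (hf (α x * x⁻¹))) x
    simpa using h1
  | succ d ih =>
    intro f hf g
    have h1 := ih (hf (α g))
    have h2 : (fun x => f (α g * g⁻¹ * x) - f x) ∈ polyFun G d := by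
      refine polyFun_diff_of_torsion hf fun v hv => ?_
      rw [hv.2 _ trivial _ trivial, homQ_inv hv trivial, hα v hv]
      ring
    convert (polyFun G d).add_mem h1 (polyFun_translate g h2) using 1
    ext x
    simp only [Pi.add_apply, map_mul, mul_assoc, inv_mul_cancel_left]
    ring

theorem polyFun_comp_eq {α : G →* G} (hα : ∀ v ∈ homQ (⊤ : Subgroup G), ∀ g, v (α g) = v g)
    {N : ℕ} (hN : 0 < N) (hαN : ∀ g, (α^[N]) g = g) {d : ℕ} :
    ∀ {f : G → ℚ}, f ∈ polyFun G d → ∀ x, f (α x) = f x := by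
  induction d with
  | zero => intro f hf x; rw [mem_polyFun_zero.1 hf]; rfl
  | succ d ih =>
    intro f hf x
    have h1 := ih (polyFun_comp_sub hα hf)
    have h2 : ∀ k : ℕ, f (α^[k] x) = f x + k * (f (α x) - f x) := by
      intro k
      induction k with
      | zero => simp
      | succ k ihk =>
        have h3 : ∀ k : ℕ, f (α (α^[k] x)) - f (α^[k] x) = f (α x) - f x := by
          intro k
          induction k with
          | zero => rfl
          | succ k ihk' => rw [Function.iterate_succ_apply', h1, ihk']
        have := h3 k
        rw [Function.iterate_succ_apply']
        push_cast
        linarith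
    have h3 := h2 N
    rw [hαN] at h3
    have h4 : (N : ℚ) * (f (α x) - f x) = 0 := by linarith
    rcases mul_eq_zero.1 h4 with h | h
    · exact absurd h (by exact_mod_cast hN.ne')
    · linarith

end PolyFun

namespace FreeGroup

variable {ι : Type*} [DecidableEq ι]

/-- The permutations defining a function with prescribed differences. -/
def iterPerm (i₁ : ι) (f : FreeGroup ι → ℚ) (i : ι) : Equiv.Perm (FreeGroup ι × ℚ) where
  toFun p := (of i * p.1, p.2 + if i = i₁ then f p.1 else 0)
  invFun p := ((of i)⁻¹ * p.1, p.2 - if i = i₁ then f ((of i)⁻¹ * p.1) else 0)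
  left_inv p := by simp
  right_inv p := by simp

/-- Iterated integrals on the free group. -/
def iterInt : List ι → FreeGroup ι → ℚ
  | [] => fun _ => 1
  | i₁ :: I => fun g => (FreeGroup.lift (iterPerm i₁ (iterInt I)) g (1, 0)).2

theorem lift_iterPerm_fst (i₁ : ι) (f : FreeGroup ι → ℚ) (g : FreeGroup ι) (p : FreeGroup ι × ℚ) :
    (FreeGroup.lift (iterPerm i₁ f) g p).1 = g * p.1 := by
  induction g using FreeGroup.induction_on generalizing p with
  | C1 => simp
  | of i => simp [iterPerm]
  | inv_of i _ => simp [iterPerm, Equiv.Perm.inv_def]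
  | mul a b ha hb => rw [_root_.map_mul, Equiv.Perm.mul_apply, ha, hb, mul_assoc]

theorem iterInt_one (i : ι) (I : List ι) : iterInt (i :: I) 1 = 0 := by
  simp [iterInt]

theorem iterInt_of_mul (i₁ : ι) (I : List ι) (i : ι) (g : FreeGroup ι) :
    iterInt (i₁ :: I) (of i * g) = iterInt (i₁ :: I) g + if i = i₁ then iterInt I g else 0 := by
  have := lift_iterPerm_fst i₁ (iterInt I) g (1, 0)
  rw [mul_one] at this
  simp only [iterInt, _root_.map_mul, Equiv.Perm.mul_apply, lift_apply_of]
  simp only [iterPerm, Equiv.coe_fn_mk]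
  rw [this]

theorem iterInt_inv_of_mul (i₁ : ι) (I : List ι) (i : ι) (g : FreeGroup ι) :
    iterInt (i₁ :: I) ((of i)⁻¹ * g) =
      iterInt (i₁ :: I) g - if i = i₁ then iterInt I ((of i)⁻¹ * g) else 0 := by
  have := iterInt_of_mul i₁ I i ((of i)⁻¹ * g)
  rw [mul_inv_cancel_left] at this
  linarith

theorem iterInt_mem_polyFun (I : List ι) : ∃ d, iterInt I ∈ polyFun (FreeGroup ι) d := by
  induction I with
  | nil => exact ⟨1, fun g => by rw [mem_polyFun_zero]; ext x; simp [iterInt]⟩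
  | cons i₁ I ih =>
    obtain ⟨d, hd⟩ := ih
    refine ⟨d + 1, fun g => ?_⟩
    induction g using FreeGroup.induction_on with
    | C1 => simp only [one_mul, sub_self]; exact (polyFun (FreeGroup ι) d).zero_mem
    | of i =>
      simp only [iterInt_of_mul, add_sub_cancel_left]
      split_ifs
      · exact hd
      · exact (polyFun (FreeGroup ι) d).zero_mem
    | inv_of i _ =>
      simp only [iterInt_inv_of_mul, sub_sub_cancel_left]
      split_ifs
      · exact (polyFun (FreeGroup ι) d).neg_mem (polyFun_translate _ hd)
      · rw [neg_zero]; exact (polyFun (FreeGroup ι) d).zero_mem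
    | mul a b ha hb =>
      convert (polyFun (FreeGroup ι) d).add_mem (polyFun_translate b ha) hb using 1
      ext x
      simp [mul_assoc]

theorem iterInt_mul_of_head_ne {I : List ι} {i : ι} (h : ∀ j ∈ I.head?, j ≠ i) (b : Bool)
    (g : FreeGroup ι) : iterInt I (mk [(i, b)] * g) = iterInt I g := by
  cases I with
  | nil => rfl
  | cons j I =>
    have hj : i ≠ j := (h j rfl).symm
    cases b with
    | true => exact (iterInt_of_mul j I i g).trans (by simp [hj])
    | false => exact (iterInt_inv_of_mul j I i g).trans (by simp [hj])

theorem iterInt_mul_self {I : List ι} {i : ι} (h : ∀ j ∈ I.head?, j ≠ i) (b : Bool)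
    (g : FreeGroup ι) : iterInt (i :: I) (mk [(i, b)] * g) =
      iterInt (i :: I) g + (if b then 1 else -1) * iterInt I g := by
  have h2 := iterInt_mul_of_head_ne h b g
  cases b with
  | true => exact (iterInt_of_mul i I i g).trans (by simp)
  | false =>
    refine (iterInt_inv_of_mul i I i g).trans ?_
    have : (of i)⁻¹ = mk [(i, false)] := rfl
    rw [this, h2]
    simp [sub_eq_add_neg]

theorem iterInt_detect (L : List (ι × Bool)) : ∀ (i : ι) (b : Bool), IsReduced ((i, b) :: L) →
    ∃ (I : List ι) (e c : ℚ), (i :: I).IsChain (· ≠ ·) ∧ c ≠ 0 ∧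
      iterInt (i :: I) (mk ((i, b) :: L)) = e * c ∧ iterInt I (mk ((i, b) :: L)) = c ∧
      0 < (if b then 1 else -1) * e ∧
      (∀ J : List ι, J.IsChain (· ≠ ·) → I.length + 2 ≤ J.length →
        iterInt J (mk ((i, b) :: L)) = 0) ∧
      (∀ J : List ι, J.IsChain (· ≠ ·) → (∀ j ∈ J.head?, j ≠ i) → I.length + 1 ≤ J.length →
        iterInt J (mk ((i, b) :: L)) = 0) := by
  induction L with
  | nil =>
    intro i b _
    have hm : mk [(i, b)] = mk [(i, b)] * 1 := (mul_one _).symm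
    refine ⟨[], if b then 1 else -1, 1, by simp, one_ne_zero, ?_, rfl, by cases b <;> simp, ?_, ?_⟩
    · rw [hm, iterInt_mul_self (by simp), iterInt_one]; simp [iterInt]
    · intro J hJ hl
      obtain _ | ⟨j, _ | ⟨k, J⟩⟩ := J
      · simp at hl
      · simp at hl
      by_cases hji : j = i
      · subst hji
        rw [hm, iterInt_mul_self (by
          simp only [List.head?_cons, Option.mem_def, Option.some.injEq, forall_eq']
          exact (List.isChain_cons_cons.1 hJ).1.symm), iterInt_one, iterInt_one]
        simp
      · rw [hm, iterInt_mul_of_head_ne (by simpa using hji), iterInt_one]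
    · intro J _ hh hl
      obtain _ | ⟨j, J⟩ := J
      · simp at hl
      rw [hm, iterInt_mul_of_head_ne hh, iterInt_one]
  | cons kb L ih =>
    intro i b hred
    obtain ⟨k, b'⟩ := kb
    obtain ⟨I, e, c, hch, hc, h1, h2, he, h3, h4⟩ := ih k b' (List.IsChain.tail hred)
    have hm : mk ((i, b) :: (k, b') :: L) = mk [(i, b)] * mk ((k, b') :: L) := by
      rw [mul_mk]; rfl
    have hhead : ∀ {j : ι} {J : List ι}, (j :: J).IsChain (· ≠ ·) → ∀ l ∈ J.head?, l ≠ j := by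
      intro j J hJ l hl
      exact ((List.isChain_cons.1 hJ).1 l hl).symm
    by_cases hik : i = k
    · subst hik
      have hbb : b = b' := (isReduced_cons_cons.1 hred).1 rfl
      subst hbb
      refine ⟨I, e + (if b then 1 else -1), c, hch, hc, ?_, ?_, ?_, ?_, ?_⟩
      · rw [hm, iterInt_mul_self (hhead hch), h1, h2]; ring
      · rw [hm, iterInt_mul_of_head_ne (hhead hch), h2]
      · cases b <;> simp_all <;> linarith
      · intro J hJ hl
        obtain _ | ⟨j, J⟩ := J
        · simp at hl
        by_cases hji : j = i
        · subst hji
          rw [hm, iterInt_mul_self (hhead hJ), h3 _ hJ hl, h4 J hJ.tail (hhead hJ) (by simpa using hl)]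
          simp
        · rw [hm, iterInt_mul_of_head_ne (by simpa using hji), h3 _ hJ hl]
      · intro J hJ hh hl
        rw [hm, iterInt_mul_of_head_ne hh, h4 J hJ hh hl]
    · have hch' : (i :: k :: I).IsChain (· ≠ ·) := List.isChain_cons_cons.2 ⟨hik, hch⟩
      have hec : e * c ≠ 0 := mul_ne_zero (by rintro rfl; simp at he) hc
      refine ⟨k :: I, if b then 1 else -1, e * c, hch', hec, ?_, ?_, by cases b <;> simp, ?_, ?_⟩
      · rw [hm, iterInt_mul_self (hhead hch'), h1, h4 _ hch' (by simpa using hik) (by simp)]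
        ring
      · rw [hm, iterInt_mul_of_head_ne (hhead hch'), h1]
      · intro J hJ hl
        obtain _ | ⟨j, J⟩ := J
        · simp at hl
        simp only [List.length_cons] at hl
        by_cases hji : j = i
        · subst hji
          rw [hm, iterInt_mul_self (hhead hJ), h3 _ hJ (by simp; omega),
            h3 J hJ.tail (by omega)]
          simp
        · rw [hm, iterInt_mul_of_head_ne (by simpa using hji), h3 _ hJ (by simp; omega)]
      · intro J hJ hh hl
        rw [hm, iterInt_mul_of_head_ne hh, h3 J hJ hl]

theorem exists_polyFun_ne {w : FreeGroup ι} (hw : w ≠ 1) :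
    ∃ d, ∃ f ∈ polyFun (FreeGroup ι) d, f w ≠ f 1 := by
  have hw' : w.toWord ≠ [] := fun h => hw (toWord_eq_nil_iff.1 h)
  obtain ⟨⟨i, b⟩, L, hL⟩ := List.exists_cons_of_ne_nil hw'
  have hred : IsReduced w.toWord := isReduced_toWord
  rw [hL] at hred
  obtain ⟨I, e, c, -, hc, h1, -, he, -⟩ := iterInt_detect L i b hred
  obtain ⟨d, hd⟩ := iterInt_mem_polyFun (i :: I)
  refine ⟨d, _, hd, ?_⟩
  rw [iterInt_one, ← mk_toWord (x := w), hL, h1]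
  exact mul_ne_zero (by rintro rfl; simp at he) hc

end FreeGroup

/-- A finite order automorphism acting trivially on rational cohomology is trivial. -/
theorem MulAut.eq_one_of_isOfFinOrder {n : ℕ} {α : MulAut (FG n)} (h : IsOfFinOrder α)
    (hα : autRep n α = 1) : α = 1 := by
  obtain ⟨N, hN, hαN⟩ := isOfFinOrder_iff_pow_eq_one.1 h
  have hv : ∀ v ∈ homQ (⊤ : Subgroup (FG n)), ∀ g, v (α g) = v g := by
    intro v hv g
    have := congrFun (congrArg Subtype.val (LinearMap.congr_fun hα ⟨v, hv⟩)) (α g)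
    rw [autRep_apply, MulAut.inv_apply_self] at this
    exact this.symm
  have hit : ∀ g, ((α.toMonoidHom : FG n →* FG n)^[N]) g = g := by
    intro g
    have : ∀ k : ℕ, ((α.toMonoidHom : FG n →* FG n)^[k]) g = (α ^ k) g := by
      intro k
      induction k with
      | zero => rfl
      | succ k ih => rw [Function.iterate_succ_apply', ih, pow_succ']; rfl
    rw [this, hαN]; rfl
  ext x
  by_contra hx
  obtain ⟨d, f, hf, hne⟩ := FreeGroup.exists_polyFun_ne (w := x⁻¹ * α x)
    (fun h => hx (by rw [inv_mul_eq_one] at h; exact h.symm))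
  have := polyFun_comp_eq (α := α.toMonoidHom) hv hN hit (polyFun_translate x⁻¹ hf) x
  apply hne
  simpa using this

/-- A finite order outer automorphism acting trivially on rational cohomology is trivial. -/
theorem OutFG.eq_one_of_isOfFinOrder {m : ℕ} (hm : 2 ≤ m) {γ : OutFG m} (h : IsOfFinOrder γ)
    (hγ : outRep m γ = 1) : γ = 1 := by
  have h1 := (outRep_trace hm h).1
  rw [hγ, LinearMap.trace_one, finrank_H1] at h1
  by_contra hne
  have h2 : ∀ α, OutFG.mk α = γ → ¬ IsOfFinOrder α := by
    intro α hα hfin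
    apply hne
    rw [← hα, MulAut.eq_one_of_isOfFinOrder hfin (by rw [← outRep_mk, hα, hγ]), map_one]
  have h3 : m = 1 := by exact_mod_cast h1 h2
  omega

section Lcp

variable {α : Type*} [DecidableEq α]

/-- The length of the longest common prefix. -/
def lcp : List α → List α → ℕ
  | a :: l, b :: m => if a = b then lcp l m + 1 else 0
  | _, _ => 0

theorem lcp_comm (l m : List α) : lcp l m = lcp m l := by
  induction l generalizing m with
  | nil => cases m <;> rfl
  | cons a l ih =>
    cases m with
    | nil => rfl
    | cons b m => simp only [lcp, ih m, eq_comm]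

theorem min_lcp_le (l m k : List α) : min (lcp l m) (lcp m k) ≤ lcp l k := by
  induction l generalizing m k with
  | nil => cases m <;> simp [lcp]
  | cons a l ih =>
    cases m with
    | nil => simp [lcp]
    | cons b m =>
      cases k with
      | nil => simp [lcp]
      | cons c k =>
        simp only [lcp]
        have := ih m k
        split_ifs <;> simp_all

theorem take_eq_of_le_lcp {l m : List α} {k : ℕ} (h : k ≤ lcp l m) : l.take k = m.take k := by
  induction l generalizing m k with
  | nil => cases m <;> simp_all [lcp]
  | cons a l ih =>
    cases m with
    | nil => simp_all [lcp]
    | cons b m =>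
      cases k with
      | zero => simp
      | succ k =>
        simp only [lcp] at h
        split_ifs at h with hab
        · rw [List.take_succ_cons, List.take_succ_cons, hab,
            ih (m := m) (by omega)]
        · omega

end Lcp

namespace FreeGroup

variable {ι : Type*}

/-- The inverse letter. -/
def invLetter (s : ι × Bool) : ι × Bool := (s.1, !s.2)

theorem mk_invLetter (s : ι × Bool) : mk [invLetter s] = (mk [s])⁻¹ := by
  simp [invLetter, inv_mk, invRev]

theorem ne_invLetter_self (s : ι × Bool) : s ≠ invLetter s := by
  intro h
  have := congrArg Prod.snd h
  simp [invLetter] at this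

variable [DecidableEq ι]

/-- The length of the common prefix of two reduced words. -/
def gro (x y : FreeGroup ι) : ℕ := lcp x.toWord y.toWord

theorem gro_comm (x y : FreeGroup ι) : gro x y = gro y x := lcp_comm _ _

theorem min_gro_le (x y z : FreeGroup ι) : min (gro x y) (gro y z) ≤ gro x z := min_lcp_le _ _ _

theorem gro_eq_of_lt {x y z : FreeGroup ι} (h : gro z x < gro x y) : gro z y = gro z x := by
  have h1 := min_gro_le z x y
  have h2 := min_gro_le z y x
  rw [gro_comm y x] at h2
  omega

theorem norm_mk_of_isReduced {L : List (ι × Bool)} (h : IsReduced L) : norm (mk L) = L.length := by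
  rw [norm, toWord_mk, h.reduce_eq]

theorem norm_inv_mk_mul_mk {L M : List (ι × Bool)} (hL : IsReduced L) (hM : IsReduced M) :
    norm ((mk L)⁻¹ * mk M) + 2 * lcp L M = L.length + M.length := by
  induction L generalizing M with
  | nil =>
    have : (mk ([] : List (ι × Bool)))⁻¹ * mk M = mk M := by
      rw [← one_eq_mk, inv_one, one_mul]
    rw [this, norm_mk_of_isReduced hM]
    cases M <;> simp [lcp]
  | cons a L ih =>
    cases M with
    | nil =>
      have : (mk (a :: L))⁻¹ * mk ([] : List (ι × Bool)) = (mk (a :: L))⁻¹ := by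
        rw [← one_eq_mk, mul_one]
      rw [this, norm_inv_eq, norm_mk_of_isReduced hL]
      simp [lcp]
    | cons b M =>
      by_cases hab : a = b
      · subst hab
        have h1 : (mk (a :: L))⁻¹ * mk (a :: M) = (mk L)⁻¹ * mk M := by
          have h2 : ∀ N : List (ι × Bool), mk (a :: N) = mk [a] * mk N := fun N => by
            rw [mul_mk]; rfl
          rw [h2 L, h2 M]
          group
        have := ih (List.IsChain.tail hL) (show IsReduced M from List.IsChain.tail hM)
        simp only [lcp, if_true, List.length_cons]
        rw [h1]
        omega
      · have hred : IsReduced (invRev (a :: L) ++ b :: M) := by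
          refine List.IsChain.append (by
            have := isReduced_toWord (x := (mk (a :: L))⁻¹)
            rwa [toWord_inv, toWord_mk, hL.reduce_eq] at this) hM ?_
          intro x hx y hy
          rw [invRev_cons] at hx
          simp only [List.getLast?_append, List.head?_cons, Option.mem_def,
            Option.some.injEq] at hx hy
          subst hy
          have hx' : x = (a.1, !a.2) := by
            simpa [invRev] using hx.symm
          subst hx'
          intro h1
          simp only at h1 ⊢
          by_contra h2
          exact hab (Prod.ext h1 (by cases h3 : a.2 <;> cases h4 : b.2 <;> simp_all))
        rw [inv_mk, mul_mk, norm_mk_of_isReduced hred]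
        simp [lcp, hab]

theorem norm_inv_mul (x y : FreeGroup ι) : norm (x⁻¹ * y) + 2 * gro x y = norm x + norm y := by
  have := norm_inv_mk_mul_mk (isReduced_toWord (x := x)) (isReduced_toWord (x := y))
  rwa [mk_toWord, mk_toWord] at this

theorem two_mul_gro_inv_lt {x : FreeGroup ι} (hx : x ≠ 1) : 2 * gro x x⁻¹ < norm x := by
  by_contra! hle
  have hpos : 0 < x.toWord.length := by
    rw [List.length_pos_iff]; exact fun h => hx (toWord_eq_nil_iff.1 h)
  have hnx : norm x = x.toWord.length := rfl
  let i := (x.toWord.length - 1) / 2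
  have hi : i + 1 ≤ gro x x⁻¹ := by omega
  have ht := take_eq_of_le_lcp hi
  have hil : i < x.toWord.length := by omega
  have h1 : x.toWord[i]? = (x⁻¹).toWord[i]? := by
    have := congrArg (fun l => l[i]?) ht
    simpa using this
  rw [toWord_inv, List.getElem?_eq_getElem hil] at h1
  have hlen : (invRev x.toWord).length = x.toWord.length := invRev_length
  rw [List.getElem?_eq_getElem (by rw [hlen]; exact hil), Option.some.injEq] at h1
  have h2 : (invRev x.toWord)[i]'(by rw [hlen]; exact hil) =
      ((x.toWord[x.toWord.length - 1 - i]'(by omega)).1,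
        !(x.toWord[x.toWord.length - 1 - i]'(by omega)).2) := by
    simp [invRev]
  rw [h2] at h1
  have hred : IsReduced x.toWord := isReduced_toWord
  rcases Nat.even_or_odd' (x.toWord.length - 1) with ⟨k, hk | hk⟩
  · have : x.toWord.length - 1 - i = i := by omega
    simp only [this] at h1
    have := congrArg Prod.snd h1
    simp at this
  · have h3 : x.toWord.length - 1 - i = i + 1 := by omega
    simp only [h3] at h1
    have h4 := List.isChain_iff_getElem.1 hred i (by omega)
    have h5 := h4 (by rw [h1])
    rw [h1] at h5
    simp at h5

/-- Products of Nielsen reduced elements do not cancel. -/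
theorem gro_map_mk {H : Type*} [DecidableEq H] (f : FreeGroup ι →* FreeGroup H)
    (h1 : ∀ s t, s ≠ t → 2 * gro (f (mk [s])) (f (mk [t])) ≤ norm (f (mk [s])))
    (h2 : ∀ s t₁ t₂, t₁ ≠ s → t₂ ≠ invLetter s →
      gro (f (mk [s])) (f (mk [t₁])) + gro (f (mk [s]))⁻¹ (f (mk [t₂])) < norm (f (mk [s])))
    (L : List (ι × Bool)) : ∀ t, IsReduced (t :: L) →
      (∀ s, s ≠ t → gro (f (mk [s])) (f (mk (t :: L))) = gro (f (mk [s])) (f (mk [t]))) ∧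
      (L ≠ [] → 2 ≤ norm (f (mk (t :: L)))) := by
  induction L with
  | nil => exact fun t _ => ⟨fun s _ => rfl, fun h => (h rfl).elim⟩
  | cons t₂ L ih =>
    intro t hred
    have hpos : ∀ s, 0 < norm (f (mk [s])) := fun s => by
      have := h2 s _ _ (ne_invLetter_self s).symm (ne_invLetter_self s)
      omega
    have hne : invLetter t ≠ t₂ := by
      rintro rfl
      have := (isReduced_cons_cons.1 hred).1 rfl
      simp [invLetter] at this
    obtain ⟨ih1, ih2⟩ := ih t₂ (List.IsChain.tail hred)
    have hP : f (mk (t :: t₂ :: L)) = f (mk [t]) * f (mk (t₂ :: L)) := by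
      rw [← _root_.map_mul, mul_mk]; rfl
    have h3 := ih1 _ hne
    rw [mk_invLetter, _root_.map_inv] at h3
    have h4 := norm_inv_mul (f (mk [t]))⁻¹ (f (mk (t₂ :: L)))
    rw [inv_inv, ← hP, h3, norm_inv_eq] at h4
    have h5 := norm_inv_mul (f (mk [t])) (f (mk (t :: t₂ :: L)))
    rw [hP, inv_mul_cancel_left, ← hP] at h5
    constructor
    · intro s hs
      refine gro_eq_of_lt ?_
      have h6 := h2 t s t₂ hs hne.symm
      rw [gro_comm (f (mk [s]))]
      omega
    · intro _
      have h6 := h1 _ _ hne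
      have h7 := h1 _ _ hne.symm
      rw [mk_invLetter, _root_.map_inv] at h6 h7
      rw [norm_inv_eq] at h6
      rw [gro_comm] at h7
      have h8 := hpos t
      have h9 := hpos t₂
      by_cases hL : L = []
      · subst hL
        omega
      · have := ih2 hL
        omega

end FreeGroup

namespace FreeGroup

section Val

variable {A : Type*} [Fintype A]

/-- A list as a number. -/
def listVal : List A → ℕ
  | [] => 0
  | a :: l => (Fintype.equivFin A a : ℕ) * Fintype.card A ^ l.length + listVal l

theorem listVal_append (l m : List A) :
    listVal (l ++ m) = listVal l * Fintype.card A ^ m.length + listVal m := by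
  induction l with
  | nil => simp [listVal]
  | cons a l ih => simp only [List.cons_append, listVal, ih, List.length_append]; ring

theorem listVal_lt (l : List A) : listVal l < Fintype.card A ^ l.length := by
  induction l with
  | nil => simp [listVal]
  | cons a l ih =>
    have := (Fintype.equivFin A a).2
    simp only [listVal, List.length_cons, pow_succ]
    nlinarith [Nat.pos_of_ne_zero (show Fintype.card A ^ l.length ≠ 0 by omega)]

theorem listVal_inj {l m : List A} (hl : l.length = m.length) (h : listVal l = listVal m) :
    l = m := by
  induction l generalizing m with
  | nil => exact (List.length_eq_zero_iff.1 hl.symm).symm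
  | cons a l ih =>
    cases m with
    | nil => simp at hl
    | cons b m =>
      have hl' : l.length = m.length := by simpa using hl
      simp only [listVal, hl'] at h
      have h1 := listVal_lt l
      have h2 := listVal_lt m
      rw [hl'] at h1
      have h3 : (Fintype.equivFin A a : ℕ) = Fintype.equivFin A b := by
        have e1 := congrArg (· / Fintype.card A ^ m.length) h
        change _ / _ = _ / _ at e1
        rwa [mul_comm, Nat.mul_add_div (by omega), Nat.div_eq_of_lt h1, mul_comm,
          Nat.mul_add_div (by omega), Nat.div_eq_of_lt h2, add_zero, add_zero] at e1
      rw [h3] at h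
      rw [(Fintype.equivFin A).injective (Fin.ext h3), ih hl' (by omega)]

end Val

variable {ι : Type*} [Fintype ι] [DecidableEq ι]

/-- The number given by the initial half of the reduced word. -/
def halfVal (x : FreeGroup ι) : ℕ := listVal (x.toWord.take ((norm x + 1) / 2))

theorem toWord_eq_of_norm {L : List (ι × Bool)} (h : norm (mk L) = L.length) :
    (mk L).toWord = L := by
  have : ((mk L).toWord).Sublist L := by rw [toWord_mk]; exact Red.sublist reduce.red
  exact this.eq_of_length h

theorem listVal_le_of_halfVal {p q s : List (ι × Bool)} (hl : p.length = q.length)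
    (hs : q.length ≤ s.length) (hp : norm (mk (p ++ s)) = (p ++ s).length)
    (hq : norm (mk (q ++ s)) = (q ++ s).length)
    (h : halfVal (mk (q ++ s)) + halfVal (mk (q ++ s))⁻¹ ≤
      halfVal (mk (p ++ s)) + halfVal (mk (p ++ s))⁻¹) : listVal q ≤ listVal p := by
  have key : ∀ r : List (ι × Bool), r.length = q.length → norm (mk (r ++ s)) = (r ++ s).length →
      halfVal (mk (r ++ s)) = listVal r * Fintype.card (ι × Bool) ^
        (s.take ((q.length + s.length + 1) / 2 - q.length)).length +
        listVal (s.take ((q.length + s.length + 1) / 2 - q.length)) ∧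
      halfVal (mk (r ++ s))⁻¹ =
        listVal ((invRev s).take ((q.length + s.length + 1) / 2)) := by
    intro r hr hn
    have hw := toWord_eq_of_norm hn
    constructor
    · rw [halfVal, hw, hn, List.length_append, hr, List.take_append, hr,
        List.take_of_length_le (by omega), listVal_append]
    · rw [halfVal, norm_inv_eq, toWord_inv, hw, hn, List.length_append, hr, invRev_append,
        List.take_append_of_le_length (by rw [invRev_length]; omega)]
  obtain ⟨h1, h2⟩ := key p hl hp
  obtain ⟨h3, h4⟩ := key q rfl hq
  rw [h1, h2, h3, h4] at h
  have hpos : 0 < Fintype.card (ι × Bool) ^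
      (s.take ((q.length + s.length + 1) / 2 - q.length)).length := by
    by_contra h0
    have h5 := listVal_lt (s.take ((q.length + s.length + 1) / 2 - q.length))
    omega
  exact Nat.le_of_mul_le_mul_right (by omega) hpos

theorem norm_add_eq_of_halfVal {x z w : FreeGroup ι} {h : ℕ} (hx : norm x = 2 * h)
    (hw : h ≤ gro x w) (hz : h ≤ gro x⁻¹ z) (hzn : 2 * h ≤ norm z) (hwn : 2 * h ≤ norm w)
    (hxz : norm (x * z) = norm z) (hxw : norm (x⁻¹ * w) = norm w)
    (h1 : halfVal z + halfVal z⁻¹ ≤ halfVal (x * z) + halfVal (x * z)⁻¹)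
    (h2 : halfVal w + halfVal w⁻¹ ≤ halfVal (x⁻¹ * w) + halfVal (x⁻¹ * w)⁻¹) : x = 1 := by
  have hxl : x.toWord.length = 2 * h := hx
  let p := x.toWord.take h
  let q := invRev (x.toWord.drop h)
  have hpl : p.length = h := by simp only [p, List.length_take]; omega
  have hql : q.length = h := by simp only [q, invRev_length, List.length_drop]; omega
  have hxpq : x = mk p * (mk q)⁻¹ := by
    rw [inv_mk, invRev_invRev, mul_mk, List.take_append_drop, mk_toWord]
  have hxq : (x⁻¹).toWord.take h = q := by
    have : (x⁻¹).toWord = q ++ invRev p := by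
      rw [toWord_inv, ← invRev_append, List.take_append_drop]
    rw [this, List.take_left' hql]
  have hzq : z.toWord = q ++ z.toWord.drop h := by
    rw [← hxq, take_eq_of_le_lcp hz, List.take_append_drop]
  have hwp : w.toWord = p ++ w.toWord.drop h := by
    change _ = x.toWord.take h ++ _
    rw [take_eq_of_le_lcp hw, List.take_append_drop]
  have hz' : z = mk (q ++ z.toWord.drop h) := by rw [← hzq, mk_toWord]
  have hw' : w = mk (p ++ w.toWord.drop h) := by rw [← hwp, mk_toWord]
  have hxz' : x * z = mk (p ++ z.toWord.drop h) := by
    nth_rewrite 1 [hz']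
    rw [hxpq, ← mul_mk, ← mul_mk]
    group
  have hxw' : x⁻¹ * w = mk (q ++ w.toWord.drop h) := by
    nth_rewrite 1 [hw']
    rw [hxpq, ← mul_mk, ← mul_mk]
    group
  have hzl : z.toWord.length = norm z := rfl
  have hwl : w.toWord.length = norm w := rfl
  generalize z.toWord.drop h = s, (by rw [List.length_drop] : (z.toWord.drop h).length = _) = hs
    at *
  generalize w.toWord.drop h = r, (by rw [List.length_drop] : (w.toWord.drop h).length = _) = hr
    at *
  have e1 := listVal_le_of_halfVal (p := p) (q := q) (s := s) (by omega) (by omega)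
    (by rw [← hxz', hxz, List.length_append]; omega)
    (by rw [← hz', List.length_append]; omega) (by rw [← hz', ← hxz']; exact h1)
  have e2 := listVal_le_of_halfVal (p := q) (q := p) (s := r) (by omega) (by omega)
    (by rw [← hxw', hxw, List.length_append]; omega)
    (by rw [← hw', List.length_append]; omega) (by rw [← hw', ← hxw']; exact h2)
  rw [hxpq, listVal_inj (by omega) (le_antisymm e2 e1), mul_inv_cancel]

/-- Automorphisms which are minimal with respect to Nielsen moves permute the letters. -/
theorem exists_letter_of_minimal (f : MulAut (FreeGroup ι))
    (h1 : ∀ s t : ι × Bool, s.1 ≠ t.1 → norm (f (mk [s])) ≤ norm (f (mk [t]) * f (mk [s])))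
    (h2 : ∀ s t : ι × Bool, s.1 ≠ t.1 → norm (f (mk [t]) * f (mk [s])) = norm (f (mk [s])) →
      halfVal (f (mk [s])) + halfVal (f (mk [s]))⁻¹ ≤
        halfVal (f (mk [t]) * f (mk [s])) + halfVal (f (mk [t]) * f (mk [s]))⁻¹) (i : ι) :
    ∃ s, f (mk [s]) = of i := by
  have hne1 : ∀ s, f (mk [s]) ≠ 1 := by
    intro s hs
    rw [map_eq_one_iff f f.injective] at hs
    obtain ⟨i, b⟩ := s
    have h3 : norm (mk [(i, b)]) = 1 := norm_mk_of_isReduced (by simp [IsReduced])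
    rw [hs, norm_one] at h3
    exact zero_ne_one h3
  have hinv : ∀ s : ι × Bool, f (mk [invLetter s]) = (f (mk [s]))⁻¹ := fun s => by
    rw [mk_invLetter, _root_.map_inv]
  have ht : ∀ s t : ι × Bool, s ≠ t → s.1 = t.1 → t = invLetter s := by
    rintro ⟨i, b⟩ ⟨j, c⟩ hst hij
    obtain rfl : i = j := hij
    cases b <;> cases c <;> simp_all [invLetter]
  have hg : ∀ s t : ι × Bool, s.1 ≠ t.1 → 2 * gro (f (mk [s])) (f (mk [t])) ≤ norm (f (mk [s])) := by
    intro s t hst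
    have h3 := h1 t (invLetter s) (fun h => hst h.symm)
    have h4 := norm_inv_mul (f (mk [s])) (f (mk [t]))
    rw [hinv] at h3
    omega
  have hN1 : ∀ s t : ι × Bool, s ≠ t → 2 * gro (f (mk [s])) (f (mk [t])) ≤ norm (f (mk [s])) := by
    intro s t hst
    by_cases hs : s.1 = t.1
    · rw [ht s t hst hs, hinv]
      exact (two_mul_gro_inv_lt (hne1 s)).le
    · exact hg s t hs
  have hN2 : ∀ s t₁ t₂, t₁ ≠ s → t₂ ≠ invLetter s →
      gro (f (mk [s])) (f (mk [t₁])) + gro (f (mk [s]))⁻¹ (f (mk [t₂])) < norm (f (mk [s])) := by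
    intro s t₁ t₂ ht1 ht2
    have a1 := hN1 s t₁ ht1.symm
    have a2 := hN1 (invLetter s) t₂ ht2.symm
    rw [hinv, norm_inv_eq] at a2
    by_contra! hge
    have b1 : s.1 ≠ t₁.1 := by
      intro h
      have := two_mul_gro_inv_lt (hne1 s)
      rw [← hinv, ← ht s t₁ ht1.symm h] at this
      omega
    have b2 : s.1 ≠ t₂.1 := by
      intro h
      have := two_mul_gro_inv_lt (hne1 (invLetter s))
      rw [← hinv, ← ht (invLetter s) t₂ ht2.symm h, hinv, norm_inv_eq] at this
      omega
    have c1 := hg t₁ s b1.symm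
    have c2 := hg t₂ (invLetter s) b2.symm
    rw [gro_comm] at c1 c2
    rw [hinv] at c2
    have d1 := norm_inv_mul (f (mk [s])) (f (mk [t₁]))
    have d2 := norm_inv_mul (f (mk [s]))⁻¹ (f (mk [t₂]))
    rw [inv_inv, norm_inv_eq] at d2
    have e1 := h2 t₁ (invLetter s) b1.symm (by rw [hinv]; omega)
    rw [hinv] at e1
    exact hne1 s (norm_add_eq_of_halfVal (h := gro (f (mk [s])) (f (mk [t₁])))
      (z := f (mk [t₂])) (w := f (mk [t₁])) (by omega) le_rfl (by omega) (by omega) (by omega)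
      (by omega) (by omega) (h2 t₂ s b2.symm (by omega)) e1)
  have hw := isReduced_toWord (x := f.symm (of i))
  have hfi : f (mk (f.symm (of i)).toWord) = of i := by rw [mk_toWord]; simp
  have hof : norm (of i) = 1 := norm_of i
  obtain hnil | ⟨t, L, hL⟩ : (f.symm (of i)).toWord = [] ∨ ∃ t L, (f.symm (of i)).toWord = t :: L := by
    cases (f.symm (of i)).toWord <;> simp
  · rw [hnil, ← one_eq_mk, _root_.map_one] at hfi
    rw [← hfi, norm_one] at hof
    exact (zero_ne_one hof).elim
  · rw [hL] at hw hfi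
    refine ⟨t, ?_⟩
    by_cases hLn : L = []
    · rw [← hfi, hLn]
    · have := (gro_map_mk f.toMonoidHom hN1 hN2 L t hw).2 hLn
      change 2 ≤ norm (f _) at this
      rw [hfi] at this
      omega

end FreeGroup

section

open FreeGroup

namespace FreeAut

variable {ι : Type*}

theorem ext_of {α β : MulAut (FreeGroup ι)} (h : ∀ k, α (of k) = β (of k)) : α = β := by
  ext x
  have : α.toMonoidHom = β.toMonoidHom := FreeGroup.ext_hom _ _ h
  exact DFunLike.congr_fun this x

/-- The automorphism with prescribed values on generators and on the generators of its inverse. -/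
def ofMaps (f g : ι → FreeGroup ι) (hfg : ∀ k, lift g (f k) = of k)
    (hgf : ∀ k, lift f (g k) = of k) : MulAut (FreeGroup ι) :=
  MonoidHom.toMulEquiv (lift f) (lift g) (FreeGroup.ext_hom _ _ fun k => by simp [hfg])
    (FreeGroup.ext_hom _ _ fun k => by simp [hgf])

theorem ofMaps_of (f g : ι → FreeGroup ι) (hfg hgf) (k : ι) :
    ofMaps f g hfg hgf (of k) = f k := by
  simp [ofMaps]

theorem ofMaps_inv_of (f g : ι → FreeGroup ι) (hfg hgf) (k : ι) :
    (ofMaps f g hfg hgf)⁻¹ (of k) = g k := by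
  change lift g (of k) = g k
  simp

/-- The automorphism permuting the generators. -/
def perm (π : Equiv.Perm ι) : MulAut (FreeGroup ι) := freeGroupCongr π

theorem perm_of (π : Equiv.Perm ι) (k : ι) : perm π (of k) = of (π k) := by
  simp [perm]

variable [DecidableEq ι]

/-- The right transvection `a_i ↦ a_i a_j`. -/
def rho (i j : ι) : MulAut (FreeGroup ι) :=
  if h : i = j then 1 else
    ofMaps (fun k => if k = i then of i * of j else of k)
      (fun k => if k = i then of i * (of j)⁻¹ else of k)
      (fun k => by by_cases hk : k = i <;> simp [hk, Ne.symm h])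
      (fun k => by by_cases hk : k = i <;> simp [hk, Ne.symm h])

/-- The left transvection `a_i ↦ a_j a_i`. -/
def lam (i j : ι) : MulAut (FreeGroup ι) :=
  if h : i = j then 1 else
    ofMaps (fun k => if k = i then of j * of i else of k)
      (fun k => if k = i then (of j)⁻¹ * of i else of k)
      (fun k => by by_cases hk : k = i <;> simp [hk, Ne.symm h])
      (fun k => by by_cases hk : k = i <;> simp [hk, Ne.symm h])

/-- The inversion of the generator `a_i`. -/
def eps (i : ι) : MulAut (FreeGroup ι) :=
  ofMaps (fun k => if k = i then (of i)⁻¹ else of k) (fun k => if k = i then (of i)⁻¹ else of k)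
    (fun k => by by_cases hk : k = i <;> simp [hk])
    (fun k => by by_cases hk : k = i <;> simp [hk])

theorem rho_self {i j : ι} (h : i ≠ j) : rho i j (of i) = of i * of j := by
  simp [rho, h, ofMaps_of]

theorem rho_of_ne {i j k : ι} (h : k ≠ i) : rho i j (of k) = of k := by
  by_cases hij : i = j <;> simp [rho, hij, h, ofMaps_of]

theorem rho_inv_self {i j : ι} (h : i ≠ j) : (rho i j)⁻¹ (of i) = of i * (of j)⁻¹ := by
  rw [rho, dif_neg h, ofMaps_inv_of, if_pos rfl]

theorem rho_inv_of_ne {i j k : ι} (h : k ≠ i) : (rho i j)⁻¹ (of k) = of k := by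
  rw [MulAut.inv_apply, MulEquiv.symm_apply_eq, rho_of_ne h]

theorem lam_self {i j : ι} (h : i ≠ j) : lam i j (of i) = of j * of i := by
  simp [lam, h, ofMaps_of]

theorem lam_of_ne {i j k : ι} (h : k ≠ i) : lam i j (of k) = of k := by
  by_cases hij : i = j <;> simp [lam, hij, h, ofMaps_of]

theorem lam_inv_self {i j : ι} (h : i ≠ j) : (lam i j)⁻¹ (of i) = (of j)⁻¹ * of i := by
  rw [lam, dif_neg h, ofMaps_inv_of, if_pos rfl]

theorem lam_inv_of_ne {i j k : ι} (h : k ≠ i) : (lam i j)⁻¹ (of k) = of k := by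
  rw [MulAut.inv_apply, MulEquiv.symm_apply_eq, lam_of_ne h]

theorem eps_self (i : ι) : eps i (of i) = (of i)⁻¹ := by
  simp [eps, ofMaps_of]

theorem eps_of_ne {i k : ι} (h : k ≠ i) : eps i (of k) = of k := by
  simp [eps, h, ofMaps_of]

theorem eps_mul_self (i : ι) : eps i * eps i = 1 := by
  refine ext_of fun k => ?_
  by_cases hk : k = i
  · subst hk; simp [eps_self]
  · simp [eps_of_ne hk]

theorem eps_inv (i : ι) : (eps i)⁻¹ = eps i := inv_eq_of_mul_eq_one_left (eps_mul_self i)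

theorem eps_comm (i j : ι) : Commute (eps i) (eps j) := by
  refine ext_of fun k => ?_
  by_cases hi : k = i <;> by_cases hj : k = j
  · subst hi; subst hj; rfl
  · subst hi; simp [eps_self, eps_of_ne hj]
  · subst hj; simp [eps_self, eps_of_ne hi]
  · simp [eps_of_ne hi, eps_of_ne hj]

end FreeAut

namespace FreeAut

variable {ι : Type*} [DecidableEq ι]

variable (ι) in
/-- The subgroup generated by the transvections. -/
def transvections : Subgroup (MulAut (FreeGroup ι)) :=
  Subgroup.closure {g | ∃ i j, i ≠ j ∧ (g = rho i j ∨ g = lam i j)}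

theorem rho_mem_transvections {i j : ι} (h : i ≠ j) : rho i j ∈ transvections ι :=
  Subgroup.subset_closure ⟨i, j, h, Or.inl rfl⟩

theorem lam_mem_transvections {i j : ι} (h : i ≠ j) : lam i j ∈ transvections ι :=
  Subgroup.subset_closure ⟨i, j, h, Or.inr rfl⟩

theorem mk_true {ι : Type*} (i : ι) : FreeGroup.mk [(i, true)] = of i := rfl

theorem mk_false {ι : Type*} (i : ι) : FreeGroup.mk [(i, false)] = (of i)⁻¹ := rfl

theorem map_letter_of_ne {ι : Type*} {γ : MulAut (FreeGroup ι)} {i : ι} (h : ∀ k, k ≠ i → γ (of k) = of k)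
    (r : ι × Bool) (hr : r.1 ≠ i) : γ (FreeGroup.mk [r]) = FreeGroup.mk [r] := by
  obtain ⟨k, b⟩ := r
  cases b
  · rw [mk_false, _root_.map_inv, h k hr]
  · rw [mk_true, h k hr]

theorem exists_transvection (s t : ι × Bool) (h : s.1 ≠ t.1) :
    ∃ γ ∈ transvections ι, γ (FreeGroup.mk [s]) = FreeGroup.mk [t] * FreeGroup.mk [s] ∧
      ∀ r : ι × Bool, r.1 ≠ s.1 → γ (FreeGroup.mk [r]) = FreeGroup.mk [r] := by
  obtain ⟨i, b⟩ := s
  obtain ⟨j, c⟩ := t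
  have h : i ≠ j := h
  cases b <;> cases c
  · refine ⟨rho i j, rho_mem_transvections h, ?_, map_letter_of_ne fun k => rho_of_ne⟩
    rw [mk_false, mk_false, _root_.map_inv, rho_self h, mul_inv_rev]
  · refine ⟨(rho i j)⁻¹, inv_mem (rho_mem_transvections h), ?_,
      map_letter_of_ne fun k => rho_inv_of_ne⟩
    rw [mk_false, mk_true, _root_.map_inv, rho_inv_self h, mul_inv_rev, inv_inv]
  · refine ⟨(lam i j)⁻¹, inv_mem (lam_mem_transvections h), ?_,
      map_letter_of_ne fun k => lam_inv_of_ne⟩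
    rw [mk_false, mk_true, lam_inv_self h]
  · refine ⟨lam i j, lam_mem_transvections h, ?_, map_letter_of_ne fun k => lam_of_ne⟩
    rw [mk_true, mk_true, lam_self h]

variable [Fintype ι]

theorem sum_letters_transvection (Φ : FreeGroup ι → ℕ) (f γ : MulAut (FreeGroup ι))
    (s t : ι × Bool) (h1 : γ (FreeGroup.mk [s]) = FreeGroup.mk [t] * FreeGroup.mk [s])
    (h2 : ∀ r : ι × Bool, r.1 ≠ s.1 → γ (FreeGroup.mk [r]) = FreeGroup.mk [r]) :
    ∑ r, Φ ((f * γ) (FreeGroup.mk [r])) +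
        (Φ (f (FreeGroup.mk [s])) + Φ (f (FreeGroup.mk [s]))⁻¹) =
      ∑ r, Φ (f (FreeGroup.mk [r])) +
        (Φ (f (FreeGroup.mk [t]) * f (FreeGroup.mk [s])) +
          Φ (f (FreeGroup.mk [t]) * f (FreeGroup.mk [s]))⁻¹) := by
  have hp : ∀ F : ι × Bool → ℕ, ∑ r, F r = ∑ r ∈ Finset.univ \ {s, invLetter s}, F r +
      (F s + F (invLetter s)) := by
    intro F
    rw [← Finset.sum_pair (ne_invLetter_self s), Finset.sum_sdiff (Finset.subset_univ _)]
  have hs : γ (FreeGroup.mk [invLetter s]) = (FreeGroup.mk [t] * FreeGroup.mk [s])⁻¹ := by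
    rw [mk_invLetter, _root_.map_inv, h1]
  rw [hp, hp (fun r => Φ (f (FreeGroup.mk [r])))]
  have : ∑ r ∈ Finset.univ \ {s, invLetter s}, Φ ((f * γ) (FreeGroup.mk [r])) =
      ∑ r ∈ Finset.univ \ {s, invLetter s}, Φ (f (FreeGroup.mk [r])) := by
    refine Finset.sum_congr rfl fun r hr => ?_
    have hr' : r.1 ≠ s.1 := by
      intro h
      obtain ⟨i, b⟩ := s
      obtain ⟨j, c⟩ := r
      obtain rfl : j = i := h
      simp [invLetter] at hr
    rw [MulAut.mul_apply, h2 r hr']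
  rw [this, MulAut.mul_apply, MulAut.mul_apply, h1, hs, mk_invLetter]
  simp only [_root_.map_mul, _root_.map_inv]
  ring

/-- Modulo transvections, every automorphism sends generators to letters. -/
theorem exists_mul_letter (α : MulAut (FreeGroup ι)) :
    ∃ β ∈ transvections ι, ∀ i, ∃ s, (β * α) (of i) = FreeGroup.mk [s] := by
  let P : transvections ι → ℕ ×ₗ ℕ := fun β =>
    toLex (∑ r, norm ((α⁻¹ * β.1) (FreeGroup.mk [r])), ∑ r, halfVal ((α⁻¹ * β.1) (FreeGroup.mk [r])))
  obtain ⟨β, -, hβ⟩ := exists_minimalFor_of_wellFoundedLT (fun _ : transvections ι => True) P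
    ⟨1, trivial⟩
  have hmin : ∀ γ (hγ : γ ∈ transvections ι), P β ≤ P (β * ⟨γ, hγ⟩) := by
    intro γ hγ
    rcases le_total (P β) (P (β * ⟨γ, hγ⟩)) with h | h
    · exact h
    · exact hβ trivial h
  have key : ∀ i, ∃ s, (α⁻¹ * β.1) (FreeGroup.mk [s]) = of i := by
    refine exists_letter_of_minimal (α⁻¹ * β.1) ?_ ?_
    · intro s t hst
      obtain ⟨γ, hγ, h1, h2⟩ := exists_transvection s t hst
      have h3 := sum_letters_transvection norm (α⁻¹ * β.1) γ s t h1 h2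
      have h4 := Prod.Lex.le_iff.1 (hmin γ hγ)
      simp only [norm_inv_eq] at h3
      have h5 : (∑ r, norm ((α⁻¹ * β.1) (FreeGroup.mk [r]))) ≤
          ∑ r, norm ((α⁻¹ * β.1 * γ) (FreeGroup.mk [r])) := by
        rcases h4 with h4 | h4
        · exact h4.le
        · exact h4.1.le
      omega
    · intro s t hst heq
      obtain ⟨γ, hγ, h1, h2⟩ := exists_transvection s t hst
      have h3 := sum_letters_transvection norm (α⁻¹ * β.1) γ s t h1 h2
      have h3' := sum_letters_transvection halfVal (α⁻¹ * β.1) γ s t h1 h2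
      have h4 := Prod.Lex.le_iff.1 (hmin γ hγ)
      simp only [norm_inv_eq] at h3
      have h6 : (∑ r, norm ((α⁻¹ * β.1) (FreeGroup.mk [r]))) =
          ∑ r, norm ((α⁻¹ * β.1 * γ) (FreeGroup.mk [r])) := by omega
      have h5 : (∑ r, halfVal ((α⁻¹ * β.1) (FreeGroup.mk [r]))) ≤
          ∑ r, halfVal ((α⁻¹ * β.1 * γ) (FreeGroup.mk [r])) := by
        rcases h4 with h4 | h4
        · exact absurd h6 h4.ne
        · exact h4.2
      omega
  refine ⟨β.1⁻¹, inv_mem β.2, fun i => ?_⟩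
  obtain ⟨s, hs⟩ := key i
  refine ⟨s, ?_⟩
  rw [← hs, ← MulAut.mul_apply]
  simp [-MulAut.inv_apply]

end FreeAut

namespace FreeAut

variable {ι : Type*} [DecidableEq ι]

theorem eps_rho_eps_snd {i j : ι} (h : i ≠ j) : eps j * rho i j * eps j * rho i j = 1 := by
  refine ext_of fun m => ?_
  by_cases hi : m = i
  · subst hi; simp [rho_self, rho_of_ne, eps_of_ne, eps_self, h, h.symm]
  · by_cases hj : m = j
    · subst hj; simp [rho_of_ne, eps_self, h.symm]
    · simp [rho_of_ne, eps_of_ne, hi, hj]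

theorem eps_rho_eps_fst {i j : ι} (h : i ≠ j) : eps i * rho i j * eps i * lam i j = 1 := by
  refine ext_of fun m => ?_
  by_cases hi : m = i
  · subst hi; simp [rho_self, rho_of_ne, lam_self, eps_of_ne, eps_self, h, h.symm]
  · simp [rho_of_ne, lam_of_ne, eps_of_ne, hi]

theorem eps_rho_comm {i j k : ι} (hi : k ≠ i) (hj : k ≠ j) : Commute (eps k) (rho i j) := by
  by_cases h : i = j
  · rw [rho, dif_pos h]; exact Commute.one_right _
  refine ext_of fun m => ?_
  by_cases hm : m = i
  · subst hm; simp [rho_self, eps_of_ne, h, hi.symm, hj.symm]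
  · by_cases hk : m = k
    · subst hk; simp [rho_of_ne, eps_self, hi]
    · simp [rho_of_ne, eps_of_ne, hm, hk]

theorem rho_lam_comm (i : ι) {j k : ι} (hj : i ≠ j) (hk : i ≠ k) :
    Commute (rho i j) (lam i k) := by
  refine ext_of fun m => ?_
  by_cases hm : m = i
  · subst hm; simp [rho_self, lam_self, rho_of_ne, lam_of_ne, hj, hk, hj.symm, hk.symm, mul_assoc]
  · simp [rho_of_ne, lam_of_ne, hm]

theorem rho_comm_snd {i j k : ι} (hi : i ≠ k) (hj : j ≠ k) : Commute (rho i k) (rho j k) := by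
  by_cases h : i = j
  · rw [h]
  refine ext_of fun m => ?_
  by_cases hm : m = i
  · subst hm; simp [rho_self, rho_of_ne, hi, h, hj.symm]
  · by_cases hmj : m = j
    · subst hmj; simp [rho_self, rho_of_ne, hj, hm, hi.symm]
    · simp [rho_of_ne, hm, hmj]

theorem rho_mul_rho {i j k : ι} (hij : i ≠ j) (hik : i ≠ k) (hjk : j ≠ k) :
    rho j k * rho i j = rho i j * rho i k * rho j k := by
  refine ext_of fun m => ?_
  by_cases hm : m = i
  · subst hm; simp [rho_self, rho_of_ne, hij, hik, hjk, hik.symm, mul_assoc]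
  · by_cases hmj : m = j
    · subst hmj; simp [rho_self, rho_of_ne, hjk, hm, hik.symm]
    · simp [rho_of_ne, hm, hmj]

theorem perm_mul (π ρ : Equiv.Perm ι) : perm (π * ρ) = perm π * perm ρ := by
  refine ext_of fun m => ?_
  simp [perm_of]

theorem perm_one : perm (1 : Equiv.Perm ι) = 1 := by
  refine ext_of fun m => ?_
  simp [perm_of]

theorem perm_rho (π : Equiv.Perm ι) (i j : ι) :
    perm π * rho i j = rho (π i) (π j) * perm π := by
  by_cases h : i = j
  · simp [rho, h]
  have h' : π i ≠ π j := fun e => h (π.injective e)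
  refine ext_of fun m => ?_
  by_cases hm : m = i
  · subst hm; simp [rho_self, perm_of, h, h']
  · have : π m ≠ π i := fun e => hm (π.injective e)
    simp [rho_of_ne, perm_of, hm, this]

theorem perm_eps (π : Equiv.Perm ι) (i : ι) : perm π * eps i = eps (π i) * perm π := by
  refine ext_of fun m => ?_
  by_cases hm : m = i
  · subst hm; simp [eps_self, perm_of]
  · have : π m ≠ π i := fun e => hm (π.injective e)
    simp [eps_of_ne, perm_of, hm, this]

/-- An automorphism of order three supported on two generators. -/
def rot (i j : ι) : MulAut (FreeGroup ι) := rho i j * eps i * perm (Equiv.swap i j)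

theorem rot_fst {i j : ι} (h : i ≠ j) : rot i j (of i) = of j := by
  simp [rot, perm_of, rho_of_ne, eps_of_ne, h.symm]

theorem rot_snd {i j : ι} (h : i ≠ j) : rot i j (of j) = (of j)⁻¹ * (of i)⁻¹ := by
  simp [rot, perm_of, rho_self, eps_self, h]

theorem rot_of_ne {i j k : ι} (hi : k ≠ i) (hj : k ≠ j) : rot i j (of k) = of k := by
  simp [rot, perm_of, Equiv.swap_apply_of_ne_of_ne hi hj, rho_of_ne, eps_of_ne, hi]

theorem rot_mul_mul {i j : ι} (h : i ≠ j) : rot i j * rot i j * rot i j = 1 := by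
  refine ext_of fun m => ?_
  by_cases hi : m = i
  · subst hi; simp [rot_fst, rot_snd, h]
  · by_cases hj : m = j
    · subst hj; simp [rot_fst, rot_snd, h]
    · simp [rot_of_ne, hi, hj]

/-- The automorphism `a_i ↦ a_i a_j` for all `i ∈ s`, `i ≠ j`. -/
def multi (s : Finset ι) (j : ι) : MulAut (FreeGroup ι) :=
  ofMaps (fun k => if k ∈ s ∧ k ≠ j then of k * of j else of k)
    (fun k => if k ∈ s ∧ k ≠ j then of k * (of j)⁻¹ else of k)
    (fun k => by by_cases hk : k ∈ s ∧ k ≠ j <;> simp [hk])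
    (fun k => by by_cases hk : k ∈ s ∧ k ≠ j <;> simp [hk])

theorem multi_of_mem {s : Finset ι} {j k : ι} (h : k ∈ s) (hk : k ≠ j) :
    multi s j (of k) = of k * of j := by
  simp [multi, ofMaps_of, h, hk]

theorem multi_self (s : Finset ι) (j : ι) : multi s j (of j) = of j := by
  simp [multi, ofMaps_of]

theorem multi_of_notMem {s : Finset ι} {j k : ι} (h : k ∉ s) :
    multi s j (of k) = of k := by
  simp [multi, ofMaps_of, h]

theorem multi_empty (j : ι) : multi ∅ j = 1 := by
  refine ext_of fun m => ?_
  simp [multi_of_notMem]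

theorem multi_insert {s : Finset ι} {i j : ι} (hi : i ∉ s) (hij : i ≠ j) :
    multi (insert i s) j = rho i j * multi s j := by
  refine ext_of fun m => ?_
  by_cases hmi : m = i
  · subst hmi
    rw [multi_of_mem (Finset.mem_insert_self _ _) hij, MulAut.mul_apply, multi_of_notMem hi,
      rho_self hij]
  · by_cases hmj : m = j
    · subst hmj; simp [multi_self, rho_of_ne, hmi]
    · by_cases hms : m ∈ s
      · rw [multi_of_mem (Finset.mem_insert_of_mem hms) hmj, MulAut.mul_apply,
          multi_of_mem hms hmj]
        simp [rho_of_ne, hmi, hij.symm]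
      · rw [MulAut.mul_apply, multi_of_notMem hms, multi_of_notMem (by simp [hmi, hms]),
          rho_of_ne hmi]

theorem rho_multi {s : Finset ι} {i j : ι} (hij : i ≠ j) (hi : i ∉ s) (hj : j ∉ s) :
    rho i j * multi s i = multi s i * multi (insert i s) j := by
  refine ext_of fun m => ?_
  by_cases hmi : m = i
  · subst hmi
    simp [multi_self, rho_self, multi_of_mem, multi_of_notMem, hij, hj]
  · by_cases hms : m ∈ s
    · have hmj : m ≠ j := fun e => hj (e ▸ hms)
      simp [multi_of_mem, hms, hmi, hmj, rho_of_ne, rho_self, multi_of_notMem, hj, hij, mul_assoc]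
    · by_cases hmj : m = j
      · subst hmj; simp [multi_of_notMem, hms, rho_of_ne, hmi]
      · simp [multi_of_notMem, hms, rho_of_ne, hmi]

/-- The automorphism inverting the generators in `s`. -/
def epsSet (s : Finset ι) : MulAut (FreeGroup ι) :=
  ofMaps (fun k => if k ∈ s then (of k)⁻¹ else of k) (fun k => if k ∈ s then (of k)⁻¹ else of k)
    (fun k => by by_cases hk : k ∈ s <;> simp [hk])
    (fun k => by by_cases hk : k ∈ s <;> simp [hk])

theorem epsSet_of_mem {s : Finset ι} {k : ι} (h : k ∈ s) : epsSet s (of k) = (of k)⁻¹ := by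
  simp [epsSet, ofMaps_of, h]

theorem epsSet_of_notMem {s : Finset ι} {k : ι} (h : k ∉ s) : epsSet s (of k) = of k := by
  simp [epsSet, ofMaps_of, h]

theorem epsSet_empty : epsSet (∅ : Finset ι) = 1 := by
  refine ext_of fun m => ?_
  simp [epsSet_of_notMem]

theorem epsSet_insert {s : Finset ι} {i : ι} (h : i ∉ s) :
    epsSet (insert i s) = eps i * epsSet s := by
  refine ext_of fun m => ?_
  by_cases hm : m = i
  · subst hm; simp [epsSet_of_mem, epsSet_of_notMem, h, eps_self]
  · by_cases hs : m ∈ s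
    · simp [epsSet_of_mem, hs, eps_of_ne, hm]
    · simp [epsSet_of_notMem, hs, eps_of_ne, hm]

theorem epsSet_mul_self (s : Finset ι) : epsSet s * epsSet s = 1 := by
  refine ext_of fun m => ?_
  by_cases hs : m ∈ s
  · simp [epsSet_of_mem, hs]
  · simp [epsSet_of_notMem, hs]

theorem rot_epsSet {s : Finset ι} {i j : ι} (h : i ≠ j) (hi : i ∉ s) (hj : j ∉ s) :
    Commute (rot i j) (epsSet s) := by
  refine ext_of fun m => ?_
  by_cases hmi : m = i
  · subst hmi; simp [rot_fst, epsSet_of_notMem, h, hi, hj]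
  · by_cases hmj : m = j
    · subst hmj; simp [rot_snd, epsSet_of_notMem, h, hi, hj]
    · by_cases hs : m ∈ s
      · simp [rot_of_ne, epsSet_of_mem, hmi, hmj, hs]
      · simp [rot_of_ne, epsSet_of_notMem, hmi, hmj, hs]

theorem rot_conj {i j : ι} (h : i ≠ j) :
    eps i * eps j * perm (Equiv.swap i j) * rot i j =
      rot i j * rot i j * (eps i * eps j * perm (Equiv.swap i j)) := by
  refine ext_of fun m => ?_
  by_cases hmi : m = i
  · subst hmi; simp [rot_fst, rot_snd, h, perm_of, eps_self, eps_of_ne, h.symm]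
  · by_cases hmj : m = j
    · subst hmj; simp [rot_fst, rot_snd, h, perm_of, eps_self, eps_of_ne, h.symm]
    · simp [rot_of_ne, hmi, hmj, perm_of, Equiv.swap_apply_of_ne_of_ne hmi hmj, eps_of_ne]

section Fintype

variable [Fintype ι]

theorem epsSet_univ_rho_lam {i j : ι} (h : i ≠ j) :
    Commute (epsSet Finset.univ) (rho i j * lam i j) := by
  refine ext_of fun m => ?_
  by_cases hmi : m = i
  · subst hmi
    simp [epsSet_of_mem, rho_self, lam_self, rho_of_ne, h, h.symm, mul_assoc]
  · simp [epsSet_of_mem, rho_of_ne, lam_of_ne, hmi]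

theorem epsSet_univ_multi (j : ι) :
    epsSet Finset.univ * multi Finset.univ j =
      MulAut.conj (of j) * (multi Finset.univ j * epsSet Finset.univ) := by
  refine ext_of fun m => ?_
  by_cases hm : m = j
  · subst hm; simp [epsSet_of_mem, multi_self]
  · simp [epsSet_of_mem, multi_of_mem, hm]

theorem multi_erase (j : ι) : multi (Finset.univ.erase j) j = multi Finset.univ j := by
  refine ext_of fun m => ?_
  by_cases hm : m = j
  · subst hm; simp [multi_self]
  · simp [multi_of_mem, hm]

theorem perm_epsSet_univ (π : Equiv.Perm ι) :
    Commute (perm π) (epsSet Finset.univ) := by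
  refine ext_of fun m => ?_
  simp [epsSet_of_mem, perm_of]

theorem eps_epsSet (s : Finset ι) (i : ι) : Commute (eps i) (epsSet s) := by
  refine ext_of fun m => ?_
  by_cases hm : m = i <;> by_cases hs : m ∈ s
  · subst hm; simp [epsSet_of_mem, hs, eps_self]
  · subst hm; simp [epsSet_of_notMem, hs, eps_self]
  · simp [epsSet_of_mem, hs, eps_of_ne, hm]
  · simp [epsSet_of_notMem, hs, eps_of_ne, hm]

end Fintype

/-- The generators together with a base point `none` going to `1`. -/
def pt : Option ι → FreeGroup ι
  | none => 1
  | some i => of i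

/-- The endomorphism attached to a self-map of the pointed set of generators. -/
def autEnd (g : Option ι → Option ι) : FreeGroup ι →* FreeGroup ι :=
  FreeGroup.lift fun i => pt (g (some i)) * (pt (g none))⁻¹

theorem autEnd_pt (g : Option ι → Option ι) (x : Option ι) :
    autEnd g (pt x) = pt (g x) * (pt (g none))⁻¹ := by
  cases x <;> simp [pt, autEnd]

theorem autEnd_comp (g h : Option ι → Option ι) :
    (autEnd g).comp (autEnd h) = autEnd (g ∘ h) := by
  refine FreeGroup.ext_hom _ _ fun i => ?_
  have : autEnd h (of i) = _ := autEnd_pt h (some i)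
  have h2 : autEnd (g ∘ h) (of i) = _ := autEnd_pt (g ∘ h) (some i)
  rw [MonoidHom.comp_apply, this, h2, _root_.map_mul, _root_.map_inv, autEnd_pt, autEnd_pt]
  simp

theorem autEnd_id : autEnd (id : Option ι → Option ι) = MonoidHom.id _ := by
  refine FreeGroup.ext_hom _ _ fun i => ?_
  simp [autEnd, pt]

/-- The action of the symmetric group on the pointed set of generators by automorphisms. -/
def aut : Equiv.Perm (Option ι) →* MulAut (FreeGroup ι) where
  toFun g := MonoidHom.toMulEquiv (autEnd g) (autEnd g.symm)
    (by rw [autEnd_comp, Equiv.symm_comp_self, autEnd_id])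
    (by rw [autEnd_comp, Equiv.self_comp_symm, autEnd_id])
  map_one' := by
    ext x
    exact DFunLike.congr_fun (autEnd_id (ι := ι)) x
  map_mul' g h := by
    ext x
    exact (DFunLike.congr_fun (autEnd_comp g h) x).symm

theorem aut_of (g : Equiv.Perm (Option ι)) (i : ι) :
    aut g (of i) = pt (g (some i)) * (pt (g none))⁻¹ := autEnd_pt g (some i)

theorem aut_optionCongr (π : Equiv.Perm ι) : aut (Equiv.optionCongr π) = perm π := by
  refine ext_of fun m => ?_
  simp [aut_of, perm_of, pt]

theorem aut_swap [Fintype ι] (a : ι) :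
    aut (Equiv.swap none (some a)) = eps a * multi Finset.univ a := by
  refine ext_of fun m => ?_
  by_cases hm : m = a
  · subst hm; simp [aut_of, pt, multi_self, eps_self]
  · have : Equiv.swap none (some a) (some m) = some m :=
      Equiv.swap_apply_of_ne_of_ne (by simp) (by simpa using hm)
    simp [aut_of, this, pt, multi_of_mem, hm, eps_of_ne, eps_self]

theorem rho_comm_of_ne {i j k l : ι} (hij : i ≠ j) (hkl : k ≠ l) (hik : i ≠ k) (hil : i ≠ l)
    (hjk : j ≠ k) : Commute (rho i j) (rho k l) := by
  refine ext_of fun m => ?_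
  by_cases hm : m = i
  · subst hm; simp [rho_self, rho_of_ne, hij, hik, hjk]
  · by_cases hmk : m = k
    · subst hmk; simp [rho_self, rho_of_ne, hkl, hm, hil.symm]
    · simp [rho_of_ne, hm, hmk]

section Cycle

variable {k : ℕ}

/-- A cyclic permutation of all the points. -/
def cyc (k : ℕ) : Equiv.Perm (Option (Fin (k + 1))) :=
  Equiv.swap none (some 0) * Equiv.optionCongr (finRotate (k + 1))

theorem cyc_none : cyc k none = some 0 := by simp [cyc]

theorem cyc_last : cyc k (some (Fin.last k)) = none := by simp [cyc]

theorem cyc_of_lt {i : ℕ} (hi : i < k) :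
    cyc k (some ⟨i, by omega⟩) = some ⟨i + 1, by omega⟩ := by
  have : finRotate (k + 1) ⟨i, by omega⟩ = ⟨i + 1, by omega⟩ := finRotate_of_lt hi
  simp only [cyc, Equiv.Perm.mul_apply, Equiv.optionCongr_apply, Option.map_some, this]
  exact Equiv.swap_apply_of_ne_of_ne (by simp) (by simp [Fin.ext_iff])

theorem cyc_pow_none {i : ℕ} (hi : i < k + 1) : (cyc k ^ (i + 1)) none = some ⟨i, hi⟩ := by
  induction i with
  | zero => simpa using cyc_none
  | succ i ih =>
    rw [pow_succ', Equiv.Perm.mul_apply, ih (by omega), cyc_of_lt (by omega)]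

theorem cyc_pow : cyc k ^ (k + 2) = 1 := by
  have h0 : (cyc k ^ (k + 2)) none = none := by
    rw [pow_succ', Equiv.Perm.mul_apply, cyc_pow_none (by omega)]
    exact cyc_last
  ext1 x
  cases x with
  | none => simpa using h0
  | some i =>
    rw [← cyc_pow_none i.2, ← Equiv.Perm.mul_apply, ← pow_add, add_comm (k + 2), pow_add,
      Equiv.Perm.mul_apply, h0]
    simp

theorem aut_cyc_pow : aut (cyc k) ^ (k + 2) = 1 := by
  rw [← _root_.map_pow, cyc_pow, _root_.map_one]

theorem aut_cyc : aut (cyc k) = aut (Equiv.swap none (some 0)) * perm (finRotate (k + 1)) := by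
  rw [cyc, _root_.map_mul, aut_optionCongr]

end Cycle

end FreeAut

end

section Weights

variable {κ V : Type*} [AddCommGroup V] [Module ℚ V]

open scoped Classical in
/-- The simultaneous eigenspace of a family of involutions: eigenvalue `-1` on `I`, `1` off `I`. -/
def wt (e : κ → End ℚ V) (I : Finset κ) : Submodule ℚ V :=
  ⨅ i, End.eigenspace (e i) (if i ∈ I then -1 else 1)

open scoped Classical in
theorem mem_wt {e : κ → End ℚ V} {I : Finset κ} {v : V} :
    v ∈ wt e I ↔ ∀ i, e i v = (if i ∈ I then (-1 : ℚ) else 1) • v := by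
  simp [wt, Submodule.mem_iInf]

theorem mem_wt_iff {e : κ → End ℚ V} {I : Finset κ} {v : V} :
    v ∈ wt e I ↔ (∀ i ∈ I, e i v = -v) ∧ ∀ i ∉ I, e i v = v := by
  rw [mem_wt]
  refine ⟨fun h => ⟨fun i hi => by simp [h i, hi], fun i hi => by simp [h i, hi]⟩,
    fun h i => ?_⟩
  by_cases hi : i ∈ I
  · simp [h.1 i hi, hi]
  · simp [h.2 i hi, hi]

theorem iSup_wt [Fintype κ] {e : κ → End ℚ V} (hsq : ∀ i, e i * e i = 1)
    (hc : ∀ i j, Commute (e i) (e j)) : ⨆ I, wt e I = ⊤ := by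
  classical
  have key : ∀ s : Finset κ, ∀ v : V, (∀ i ∉ s, e i v = v ∨ e i v = -v) → v ∈ ⨆ I, wt e I := by
    intro s
    induction s using Finset.induction_on with
    | empty =>
      intro v hv
      refine Submodule.mem_iSup_of_mem (Finset.univ.filter fun i => e i v ≠ v) ?_
      rw [mem_wt_iff]
      refine ⟨fun i hi => (hv i (by simp)).resolve_left (by simpa using hi), fun i hi => ?_⟩
      simpa using hi
    | insert j s hj ih =>
      intro v hv
      have hjj : e j (e j v) = v := DFunLike.congr_fun (hsq j) v
      have hij : ∀ i, e i (e j v) = e j (e i v) := fun i => DFunLike.congr_fun (hc i j) v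
      have h1 : v + e j v ∈ ⨆ I, wt e I := by
        refine ih _ fun i hi => ?_
        by_cases hij' : i = j
        · subst hij'; left; rw [map_add, hjj, add_comm]
        · rcases hv i (by simp [hi, hij']) with h | h
          · left; rw [map_add, hij, h]
          · right; rw [map_add, hij, h, map_neg, neg_add]
      have h2 : v - e j v ∈ ⨆ I, wt e I := by
        refine ih _ fun i hi => ?_
        by_cases hij' : i = j
        · subst hij'; right; rw [map_sub, hjj, neg_sub]
        · rcases hv i (by simp [hi, hij']) with h | h
          · left; rw [map_sub, hij, h]
          · right; rw [map_sub, hij, h, map_neg, neg_sub_neg, neg_sub]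
      have : v = (2⁻¹ : ℚ) • (v + e j v) + (2⁻¹ : ℚ) • (v - e j v) := by module
      rw [this]
      exact add_mem (Submodule.smul_mem _ _ h1) (Submodule.smul_mem _ _ h2)
  exact top_unique fun v _ => key Finset.univ v (by simp)

theorem iSupIndep_wt {e : κ → End ℚ V} (hc : ∀ i j, Commute (e i) (e j)) :
    iSupIndep (wt e) := by
  classical
  have h := End.independent_iInf_maxGenEigenspace_of_forall_mapsTo e
    (fun i j φ => End.mapsTo_maxGenEigenspace_of_comm (hc j i) φ)
  have hinj : Function.Injective (fun (I : Finset κ) (i : κ) => if i ∈ I then (-1 : ℚ) else 1) := by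
    intro I J hIJ
    ext i
    have := congrFun hIJ i
    by_cases h1 : i ∈ I <;> by_cases h2 : i ∈ J <;> simp [h1, h2] at this ⊢ <;> norm_num at this
  refine (h.comp hinj).mono fun I => ?_
  refine iInf_mono fun i => ?_
  convert ((e i).genEigenspace (if i ∈ I then -1 else 1)).monotone
    (le_top : (1 : ℕ∞) ≤ ⊤) using 1

theorem isInternal_wt [Fintype κ] [DecidableEq κ] {e : κ → End ℚ V} (hsq : ∀ i, e i * e i = 1)
    (hc : ∀ i j, Commute (e i) (e j)) : DirectSum.IsInternal (wt e) :=
  (DirectSum.isInternal_submodule_iff_iSupIndep_and_iSup_eq_top _).2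
    ⟨iSupIndep_wt hc, iSup_wt hsq hc⟩

variable [FiniteDimensional ℚ V]

theorem DirectSum.IsInternal.finrank_eq {ι : Type*} [Fintype ι] [DecidableEq ι]
    {N : ι → Submodule ℚ V} (h : DirectSum.IsInternal N) :
    finrank ℚ V = ∑ i, finrank ℚ (N i) := by
  have := LinearMap.trace_eq_sum_trace_restrict h (f := LinearMap.id) (fun i x hx => hx)
  rw [LinearMap.trace_id] at this
  have h2 : ∀ i, LinearMap.trace ℚ (N i) (LinearMap.restrict LinearMap.id
      (fun x hx => hx : ∀ x ∈ N i, LinearMap.id (R := ℚ) x ∈ N i)) = finrank ℚ (N i) := by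
    intro i
    rw [← LinearMap.trace_id]; rfl
  simp only [h2] at this
  exact_mod_cast this

theorem sum_finrank_wt [Fintype κ] {e : κ → End ℚ V} (hsq : ∀ i, e i * e i = 1)
    (hc : ∀ i j, Commute (e i) (e j)) : finrank ℚ V = ∑ I, finrank ℚ (wt e I) := by
  classical
  exact (isInternal_wt hsq hc).finrank_eq

end Weights

section DimensionLemma

variable {κ V : Type*} [Fintype κ] [DecidableEq κ] [AddCommGroup V] [Module ℚ V]
  [FiniteDimensional ℚ V]

/-- A family of involutions satisfying the relations of elementary matrices over the field with two
elements is trivial on a space of small dimension. -/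
theorem eq_one_of_finrank_lt {R : κ → κ → End ℚ V}
    (h2 : ∀ i j, i ≠ j → R i j * R i j = 1)
    (hc : ∀ i j k, i ≠ j → i ≠ k → Commute (R i j) (R i k))
    (hs : ∀ i j k, i ≠ k → j ≠ k → Commute (R i k) (R j k))
    (hr : ∀ i j k, i ≠ j → i ≠ k → j ≠ k → R j k * R i j = R i j * R i k * R j k)
    (hd : ∀ i j k l, i ≠ j → k ≠ l → i ≠ k → i ≠ l → j ≠ k → Commute (R i j) (R k l))
    (hdim : finrank ℚ V + 1 < 2 ^ (Fintype.card κ - 1)) {i j : κ} (hij : i ≠ j) :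
    R i j = 1 := by
  set e : {k // k ≠ i} → End ℚ V := fun k => R i k with he
  have hsq : ∀ k, e k * e k = 1 := fun k => h2 _ _ k.2.symm
  have hec : ∀ k l, Commute (e k) (e l) := fun k l => hc _ _ _ k.2.symm l.2.symm
  have key : ∀ J, ∀ k ∈ J, ∀ l, l ≠ k → ∀ v ∈ wt e J,
      (∀ p ≠ l, e p (R l k v) = R l k (e p v)) ∧ e l (R l k v) = - R l k (e l v) := by
    intro J k hk l hlk v hv
    have hlk' : (l : κ) ≠ k := fun h => hlk (Subtype.ext h)
    refine ⟨fun p hp => ?_, ?_⟩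
    · by_cases hpk : p = k
      · subst hpk
        exact DFunLike.congr_fun (hs _ _ _ p.2.symm hlk') v
      · have hlp : (p : κ) ≠ l := fun h => hp (Subtype.ext h)
        exact DFunLike.congr_fun (hd i p l k p.2.symm hlk' l.2.symm k.2.symm hlp) v
    · have h1 := DFunLike.congr_fun (hr i l k l.2.symm k.2.symm hlk') v
      have h3 := DFunLike.congr_fun (hs i l k k.2.symm hlk') v
      have h4 : e k v = -v := (mem_wt_iff.1 hv).1 k hk
      simp only [End.mul_apply, he] at h1 h3 h4 ⊢
      rw [h3, h4] at h1
      rw [h1, map_neg, map_neg, neg_neg]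
  have hne : ∀ J K : Finset {k // k ≠ i}, ∀ k ∈ J, ∀ l, l ≠ k → (∀ p ≠ l, p ∈ K ↔ p ∈ J) →
      (l ∈ K ↔ l ∉ J) → wt e J ≠ ⊥ → wt e K ≠ ⊥ := by
    intro J K k hk l hlk hK hlK hJ
    obtain ⟨v, hv, hv0⟩ := Submodule.exists_mem_ne_zero_of_ne_bot hJ
    refine (Submodule.ne_bot_iff _).2 ⟨R l k v, ?_, ?_⟩
    · obtain ⟨h5, h6⟩ := key J k hk l hlk v hv
      rw [mem_wt_iff] at hv ⊢
      refine ⟨fun p hp => ?_, fun p hp => ?_⟩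
      · by_cases hpl : p = l
        · subst hpl; rw [h6, hv.2 _ (hlK.1 hp)]
        · rw [h5 p hpl, hv.1 _ ((hK p hpl).1 hp), map_neg]
      · by_cases hpl : p = l
        · subst hpl
          rw [h6, hv.1 _ (by by_contra h; exact hp (hlK.2 h)), map_neg, neg_neg]
        · rw [h5 p hpl, hv.2 _ (fun h => hp ((hK p hpl).2 h))]
    · intro h0
      have := DFunLike.congr_fun (h2 l k (fun h => hlk (Subtype.ext h))) v
      rw [End.mul_apply, h0, map_zero] at this
      exact hv0 this.symm
  by_cases hall : ∀ J : Finset {k // k ≠ i}, J ≠ ∅ → wt e J = ⊥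
  · have htop := iSup_wt hsq hec
    have h0 : wt e ∅ = ⊤ := by
      refine top_unique (htop.symm.le.trans (iSup_le fun J => ?_))
      by_cases hJ : J = ∅
      · rw [hJ]
      · rw [hall J hJ]; exact bot_le
    ext v
    exact (mem_wt_iff.1 (h0.symm ▸ Submodule.mem_top : v ∈ wt e ∅)).2 ⟨j, hij.symm⟩ (by simp)
  exfalso
  push Not at hall
  obtain ⟨J, hJ0, hJ⟩ := hall
  have huniv : wt e Finset.univ ≠ ⊥ := by
    obtain ⟨M, ⟨hM0, hM⟩, hmax⟩ := exists_maximalFor_of_wellFoundedGT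
      (fun J : Finset {k // k ≠ i} => J ≠ ∅ ∧ wt e J ≠ ⊥) id ⟨J, hJ0.ne_empty, hJ⟩
    obtain ⟨k, hk⟩ := Finset.nonempty_iff_ne_empty.2 hM0
    suffices M = Finset.univ by rwa [← this]
    refine Finset.eq_univ_of_forall fun l => ?_
    by_contra hl
    have := hmax (j := insert l M) ⟨by simp, hne M _ k hk l (fun h => hl (h ▸ hk))
      (fun p hp => by simp [hp]) (by simp [hl]) hM⟩ (Finset.subset_insert l M)
    exact hl (this (Finset.mem_insert_self l M))
  have hall : ∀ K : Finset {k // k ≠ i}, K ≠ ∅ → wt e K ≠ ⊥ := by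
    intro K hK
    obtain ⟨M, ⟨hM0, hM⟩, hmin⟩ := exists_minimalFor_of_wellFoundedLT
      (fun J : Finset {k // k ≠ i} => K ⊆ J ∧ wt e J ≠ ⊥) id ⟨Finset.univ, by simp, huniv⟩
    obtain ⟨k, hk⟩ := Finset.nonempty_iff_ne_empty.2 hK
    suffices M = K by rwa [← this]
    refine Finset.Subset.antisymm (fun l hl => ?_) hM0
    by_contra hlK
    have hlk : l ≠ k := fun h => hlK (h ▸ hk)
    have := hmin (j := M.erase l) ⟨fun p hp => Finset.mem_erase.2 ⟨fun h => hlK (h ▸ hp), hM0 hp⟩,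
      hne M _ k (hM0 hk) l hlk (fun p hp => by simp [hp]) (by simp [hl]) hM⟩
        (Finset.erase_subset l M)
    exact Finset.notMem_erase l M (this hl)
  have hsum := sum_finrank_wt hsq hec
  have hle : ((Finset.univ : Finset (Finset {k // k ≠ i})).erase ∅).card ≤ finrank ℚ V := by
    rw [hsum, Finset.card_eq_sum_ones]
    refine (Finset.sum_le_sum fun K hK => ?_).trans
      (Finset.sum_le_sum_of_subset (Finset.erase_subset _ _))
    exact Submodule.one_le_finrank_iff.2 (hall K (Finset.ne_of_mem_erase hK))
  rw [Finset.card_erase_of_mem (Finset.mem_univ _), Finset.card_univ, Fintype.card_finset,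
    Fintype.card_subtype_compl, Fintype.card_subtype_eq] at hle
  omega

/-- The version of `eq_one_of_finrank_lt` for operators living on the range of an idempotent. -/
theorem eq_of_finrank_range_lt {P : End ℚ V} (hP : P * P = P) {R : κ → κ → End ℚ V}
    (hl : ∀ i j, P * R i j = R i j) (hrt : ∀ i j, R i j * P = R i j)
    (h2 : ∀ i j, i ≠ j → R i j * R i j = P)
    (hc : ∀ i j k, i ≠ j → i ≠ k → Commute (R i j) (R i k))
    (hs : ∀ i j k, i ≠ k → j ≠ k → Commute (R i k) (R j k))
    (hr : ∀ i j k, i ≠ j → i ≠ k → j ≠ k → R j k * R i j = R i j * R i k * R j k)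
    (hd : ∀ i j k l, i ≠ j → k ≠ l → i ≠ k → i ≠ l → j ≠ k → Commute (R i j) (R k l))
    (hdim : finrank ℚ (LinearMap.range P) + 1 < 2 ^ (Fintype.card κ - 1)) {i j : κ}
    (hij : i ≠ j) : R i j = P := by
  have hinv : ∀ i j, ∀ v ∈ LinearMap.range P, R i j v ∈ LinearMap.range P :=
    fun i j v _ => ⟨R i j v, DFunLike.congr_fun (hl i j) v⟩
  have key := eq_one_of_finrank_lt (R := fun i j => (R i j).restrict (hinv i j))
    (fun i j h => by
      ext ⟨_, v, rfl⟩
      have h1 := DFunLike.congr_fun (h2 i j h) (P v)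
      have h3 := DFunLike.congr_fun hP v
      simp only [End.mul_apply] at h1 h3
      simp [h1, h3])
    (fun i j k h h' => by
      ext v; exact DFunLike.congr_fun (hc i j k h h') v.1)
    (fun i j k h h' => by
      ext v; exact DFunLike.congr_fun (hs i j k h h') v.1)
    (fun i j k h h' h'' => by
      ext v; exact DFunLike.congr_fun (hr i j k h h' h'') v.1)
    (fun i j k l h h' h3 h4 h5 => by
      ext v; exact DFunLike.congr_fun (hd i j k l h h' h3 h4 h5) v.1) hdim hij
  ext v
  have := congrArg Subtype.val (DFunLike.congr_fun key ⟨P v, v, rfl⟩)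
  rw [← hrt]
  exact this

end DimensionLemma

open FreeGroup FreeAut

section

variable {ι V : Type*} [Fintype ι] [DecidableEq ι] [AddCommGroup V] [Module ℚ V]

/-- Rational representations of the automorphism group of a free group. -/
abbrev FreeRep (ι V : Type*) [AddCommGroup V] [Module ℚ V] : Type _ :=
  MulAut (FreeGroup ι) →* End ℚ V

/-- The trace of an idempotent is its rank. -/
theorem trace_eq_finrank_range [FiniteDimensional ℚ V] {P : End ℚ V} (hP : P * P = P) :
    LinearMap.trace ℚ V P = finrank ℚ (LinearMap.range P) :=
  LinearMap.IsProj.trace ⟨fun v => ⟨v, rfl⟩, by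
    rintro _ ⟨v, rfl⟩; exact DFunLike.congr_fun hP v⟩

/-- Every left transvection is conjugate to a right one by sign changes. -/
theorem FreeAut.lam_eq_conj {i j : ι} (hij : i ≠ j) :
    lam i j = eps i * eps j * rho i j * eps j * eps i := by
  have h1 := eps_rho_eps_fst hij
  have h2 := eps_rho_eps_snd hij
  have h3 : lam i j = (eps i * rho i j * eps i)⁻¹ := (inv_eq_of_mul_eq_one_right h1).symm
  have h4 : (rho i j)⁻¹ = eps j * rho i j * eps j := (eq_inv_of_mul_eq_one_left h2).symm
  rw [h3, mul_inv_rev, mul_inv_rev, h4, eps_inv]; group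

/-- The projection onto the `-1`-eigenspace of the inversion of the `i`-th generator. -/
def lowP (R : FreeRep ι V) (i : ι) : End ℚ V := (2⁻¹ : ℚ) • (1 - R (eps i))

/-- The complement of the projections `lowP R i`. -/
def lowP0 (R : FreeRep ι V) : End ℚ V := 1 - ∑ i, lowP R i

/-- A small representation of `Out(F_n)` on which the products `(e_i - 1) (e_j - 1)` vanish. -/
structure IsLow (R : FreeRep ι V) : Prop where
  inner : ∀ g, R (MulAut.conj g) = 1
  low : ∀ i j, i ≠ j → (R (eps i) - 1) * (R (eps j) - 1) = 0
  dim : 2 * finrank ℚ V < Fintype.card ι * (Fintype.card ι + 1)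
  card : 6 ≤ Fintype.card ι

namespace IsLow

variable {R : FreeRep ι V}

theorem eps_sq (R : FreeRep ι V) (i : ι) : R (eps i) * R (eps i) = 1 := by
  rw [← _root_.map_mul, eps_mul_self, _root_.map_one]

theorem eps_eq (R : FreeRep ι V) (i : ι) :
    R (eps i) = 1 - (2 : ℚ) • lowP R i := by
  rw [lowP]; module

theorem P_sq (R : FreeRep ι V) (i : ι) : lowP R i * lowP R i = lowP R i := by
  rw [lowP, smul_mul_smul_comm, sub_mul, mul_sub, mul_sub, eps_sq]
  simp only [mul_one, one_mul]
  module

theorem P_mul_P (h : IsLow R) {i j : ι} (hij : i ≠ j) : lowP R i * lowP R j = 0 := by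
  have := h.low i j hij
  rw [lowP, lowP, smul_mul_smul_comm, ← neg_sub, ← neg_sub (R (eps j)), neg_mul_neg, this,
    smul_zero]

theorem eps_P (R : FreeRep ι V) (i : ι) :
    R (eps i) * lowP R i = - lowP R i := by
  rw [eps_eq, sub_mul, smul_mul_assoc, P_sq, one_mul]; module

theorem eps_P_of_ne (h : IsLow R) {i j : ι} (hij : i ≠ j) : R (eps i) * lowP R j = lowP R j := by
  rw [eps_eq, sub_mul, smul_mul_assoc, h.P_mul_P hij, one_mul]; module

theorem P_eps_of_ne (h : IsLow R) {i j : ι} (hij : i ≠ j) : lowP R j * R (eps i) = lowP R j := by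
  rw [eps_eq, mul_sub, mul_smul_comm, h.P_mul_P hij.symm, mul_one]; module

theorem perm_P (R : FreeRep ι V) (π : Equiv.Perm ι) (i : ι) :
    R (perm π) * lowP R i = lowP R (π i) * R (perm π) := by
  rw [lowP, lowP, mul_smul_comm, smul_mul_assoc, mul_sub, sub_mul, ← _root_.map_mul, perm_eps,
    _root_.map_mul, mul_one, one_mul]

theorem perm_P0 (R : FreeRep ι V) (π : Equiv.Perm ι) :
    Commute (R (perm π)) (lowP0 R) := by
  rw [Commute, SemiconjBy, lowP0, mul_sub, sub_mul, mul_one, one_mul, Finset.mul_sum,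
    Finset.sum_mul]
  congr 1
  simp only [perm_P]
  exact Equiv.sum_comp π fun i => lowP R i * R (perm π)

theorem rho_P_comm (R : FreeRep ι V) {i j l : ι} (hi : l ≠ i) (hj : l ≠ j) :
    Commute (R (rho i j)) (lowP R l) := by
  have : Commute (R (rho i j)) (R (eps l)) := ((eps_rho_comm hi hj).map R).symm
  exact ((Commute.one_right _).sub_right this).smul_right _

theorem sum_P_mul_P (h : IsLow R) (i : ι) : (∑ j, lowP R j) * lowP R i = lowP R i := by
  rw [Finset.sum_mul, Finset.sum_eq_single i (fun j _ hj => h.P_mul_P hj) (by simp), P_sq]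

theorem P_mul_sum_P (h : IsLow R) (i : ι) : lowP R i * (∑ j, lowP R j) = lowP R i := by
  rw [Finset.mul_sum, Finset.sum_eq_single i (fun j _ hj => h.P_mul_P hj.symm) (by simp), P_sq]

theorem P0_mul_P (h : IsLow R) (i : ι) : lowP0 R * lowP R i = 0 := by
  rw [lowP0, sub_mul, one_mul, h.sum_P_mul_P, sub_self]

theorem P_mul_P0 (h : IsLow R) (i : ι) : lowP R i * lowP0 R = 0 := by
  rw [lowP0, mul_sub, mul_one, h.P_mul_sum_P, sub_self]

theorem P0_sq (h : IsLow R) : lowP0 R * lowP0 R = lowP0 R := by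
  have h0 : lowP0 R * ∑ i, lowP R i = 0 := by
    rw [Finset.mul_sum]; exact Finset.sum_eq_zero fun i _ => h.P0_mul_P i
  have h1 : lowP0 R * (1 - ∑ i, lowP R i) = lowP0 R := by rw [mul_sub, h0, mul_one, sub_zero]
  exact h1

theorem eps_P0 (h : IsLow R) (i : ι) : R (eps i) * lowP0 R = lowP0 R := by
  rw [eps_eq, sub_mul, smul_mul_assoc, h.P_mul_P0, one_mul, smul_zero, sub_zero]

theorem P0_eps (h : IsLow R) (i : ι) : lowP0 R * R (eps i) = lowP0 R := by
  rw [eps_eq, mul_sub, mul_smul_comm, h.P0_mul_P, mul_one, smul_zero, sub_zero]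

theorem P0_add_sum (R : FreeRep ι V) : lowP0 R + ∑ i, lowP R i = 1 :=
  sub_add_cancel _ _

theorem epsSet_eq (h : IsLow R) (s : Finset ι) :
    R (epsSet s) = 1 - (2 : ℚ) • ∑ i ∈ s, lowP R i := by
  induction s using Finset.induction_on with
  | empty => simp [epsSet_empty]
  | insert i s hi ih =>
    have h0 : lowP R i * ∑ j ∈ s, lowP R j = 0 := by
      rw [Finset.mul_sum]
      exact Finset.sum_eq_zero fun j hj => h.P_mul_P fun e => hi (e ▸ hj)
    rw [epsSet_insert hi, _root_.map_mul, ih, eps_eq, sub_mul, Finset.sum_insert hi,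
      one_mul, mul_sub, mul_one, smul_mul_smul_comm, h0, smul_zero, sub_zero]
    module

theorem epsSet_univ (h : IsLow R) : R (epsSet Finset.univ) = (2 : ℚ) • lowP0 R - 1 := by
  rw [h.epsSet_eq, lowP0]; module

theorem commute_P0 (h : IsLow R) {x : End ℚ V} (hx : Commute (R (epsSet Finset.univ)) x) :
    Commute (lowP0 R) x := by
  have : lowP0 R = (2⁻¹ : ℚ) • (R (epsSet Finset.univ) + 1) := by rw [h.epsSet_univ]; module
  rw [this]
  exact (hx.add_left (Commute.one_left _)).smul_left _

theorem multi_P0 (h : IsLow R) (j : ι) : Commute (lowP0 R) (R (multi Finset.univ j)) := by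
  refine h.commute_P0 ?_
  rw [Commute, SemiconjBy, ← _root_.map_mul, epsSet_univ_multi, _root_.map_mul, h.inner, one_mul,
    _root_.map_mul]

theorem rho_lam_P0 (h : IsLow R) {i j : ι} (hij : i ≠ j) :
    Commute (lowP0 R) (R (rho i j) * R (lam i j)) := by
  refine h.commute_P0 ?_
  rw [← _root_.map_mul]
  exact (epsSet_univ_rho_lam hij).map R

theorem lam_eq (R : FreeRep ι V) {i j : ι} (hij : i ≠ j) :
    R (lam i j) = R (eps i) * R (eps j) * R (rho i j) * R (eps j) * R (eps i) := by
  rw [lam_eq_conj hij]; simp only [_root_.map_mul]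

section Dim

variable [FiniteDimensional ℚ V]

theorem trace_P (R : FreeRep ι V) (i : ι) :
    LinearMap.trace ℚ V (lowP R i) = finrank ℚ (LinearMap.range (lowP R i)) :=
  trace_eq_finrank_range (P_sq R i)

theorem trace_P0 (h : IsLow R) :
    LinearMap.trace ℚ V (lowP0 R) = finrank ℚ (LinearMap.range (lowP0 R)) :=
  trace_eq_finrank_range h.P0_sq

theorem trace_P_eq (R : FreeRep ι V) (i j : ι) :
    LinearMap.trace ℚ V (lowP R i) = LinearMap.trace ℚ V (lowP R j) := by
  have h1 : R (perm (Equiv.swap i j)) * R (perm (Equiv.swap i j)) = 1 := by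
    rw [← _root_.map_mul, ← perm_mul, Equiv.swap_mul_self, perm_one, _root_.map_one]
  have h2 : lowP R j = R (perm (Equiv.swap i j)) * lowP R i * R (perm (Equiv.swap i j)) := by
    rw [perm_P, Equiv.swap_apply_left, mul_assoc, h1, mul_one]
  rw [h2, mul_assoc, LinearMap.trace_mul_comm, mul_assoc, h1, mul_one]

theorem finrank_eq (R : FreeRep ι V) (i : ι) :
    (finrank ℚ V : ℚ) =
      LinearMap.trace ℚ V (lowP0 R) + Fintype.card ι * LinearMap.trace ℚ V (lowP R i) := by
  rw [← LinearMap.trace_one, ← P0_add_sum R, map_add, map_sum,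
    Finset.sum_congr rfl (fun j _ => trace_P_eq R j i)]
  simp

theorem finrank_range_P_lt (h : IsLow R) (i : ι) :
    2 * finrank ℚ (LinearMap.range (lowP R i)) ≤ Fintype.card ι := by
  have h1 := finrank_eq R i
  rw [trace_P, h.trace_P0] at h1
  have h2 : finrank ℚ V = finrank ℚ (LinearMap.range (lowP0 R)) +
    Fintype.card ι * finrank ℚ (LinearMap.range (lowP R i)) := by exact_mod_cast h1
  have h3 := h.dim
  have h4 := h.card
  by_contra hc
  push Not at hc
  nlinarith

end Dim

end IsLow

end

/-- A property of permutations fixing a point, checked on transpositions. -/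
theorem Equiv.Perm.induction_fixing {ι : Type*} [Fintype ι] [DecidableEq ι] {a : ι}
    {p : Equiv.Perm ι → Prop} (h1 : p 1)
    (hmul : ∀ i j, i ≠ j → a ≠ i → a ≠ j → ∀ π, p π → p (Equiv.swap i j * π))
    (π : Equiv.Perm ι) (hπ : π a = a) : p π := by
  induction hk : π.support.card using Nat.strong_induction_on generalizing π with
  | _ k ih =>
    subst hk
    by_cases hone : π = 1
    · rw [hone]; exact h1
    obtain ⟨x, hx⟩ : ∃ x, π x ≠ x := by
      by_contra! hc
      exact hone (Equiv.ext hc)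
    have hax : a ≠ x := fun e => hx (e ▸ hπ)
    have hapx : a ≠ π x := fun e => hax (π.injective (hπ.trans e))
    have h2 := ih _ (Equiv.Perm.card_support_swap_mul hx) (Equiv.swap x (π x) * π)
      (by rw [Equiv.Perm.mul_apply, hπ, Equiv.swap_apply_of_ne_of_ne hax hapx]) rfl
    have := hmul x (π x) hx.symm hax hapx _ h2
    rwa [← mul_assoc, Equiv.swap_mul_self, one_mul] at this

namespace IsLow

variable {ι V : Type*} [Fintype ι] [DecidableEq ι] [AddCommGroup V] [Module ℚ V]
  {R : FreeRep ι V}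

theorem lam_P (h : IsLow R) {i j l : ι} (hij : i ≠ j) (hi : l ≠ i) (hj : l ≠ j) :
    R (lam i j) * lowP R l = R (rho i j) * lowP R l := by
  have c := (rho_P_comm R hi hj).eq
  rw [lam_eq R hij, mul_assoc, h.eps_P_of_ne hi.symm, mul_assoc, h.eps_P_of_ne hj.symm,
    mul_assoc, c, ← mul_assoc, mul_assoc (R (eps i)), h.eps_P_of_ne hj.symm,
    h.eps_P_of_ne hi.symm]

theorem rho_sq_P (h : IsLow R) {i j l : ι} (hij : i ≠ j) (hi : l ≠ i) (hj : l ≠ j) :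
    R (rho i j) * (R (rho i j) * lowP R l) = lowP R l := by
  have c := (rho_P_comm R hi hj).eq
  have h1 : R (eps j) * R (rho i j) * R (eps j) * R (rho i j) = 1 := by
    simp only [← _root_.map_mul]
    rw [eps_rho_eps_snd hij, _root_.map_one]
  calc R (rho i j) * (R (rho i j) * lowP R l)
      = lowP R l * R (rho i j) * R (rho i j) := by rw [c, ← mul_assoc, c]
    _ = R (eps j) * (lowP R l * R (rho i j)) * R (rho i j) := by
        rw [← mul_assoc (R (eps j)), h.eps_P_of_ne hj.symm]
    _ = R (eps j) * R (rho i j) * (R (eps j) * lowP R l) * R (rho i j) := by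
        rw [← c, h.eps_P_of_ne hj.symm]; simp only [mul_assoc]
    _ = R (eps j) * R (rho i j) * R (eps j) * R (rho i j) * lowP R l := by
        simp only [mul_assoc, c]
    _ = lowP R l := by rw [h1, one_mul]

variable [FiniteDimensional ℚ V]

theorem rho_P (h : IsLow R) {i j l : ι} (hij : i ≠ j) (hi : l ≠ i) (hj : l ≠ j) :
    R (rho i j) * lowP R l = lowP R l := by
  have c : ∀ i j : {k // k ≠ l}, R (rho i j) * lowP R l = lowP R l * R (rho i j) :=
    fun i j => (rho_P_comm R i.2.symm j.2.symm).eq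
  have hne : ∀ {i j : {k // k ≠ l}}, i ≠ j → (i : ι) ≠ j := fun h e => h (Subtype.ext e)
  have hm : ∀ (x : End ℚ V) (i j : {k // k ≠ l}), x * lowP R l * (R (rho i j) * lowP R l) =
      x * R (rho i j) * lowP R l := by
    intro x i j
    rw [c, mul_assoc, ← mul_assoc (lowP R l), P_sq, ← c, mul_assoc]
  refine eq_of_finrank_range_lt (P := lowP R l) (κ := {k // k ≠ l}) (P_sq R l)
    (R := fun i j => R (rho i j) * lowP R l)
    (fun i j => by rw [c, ← mul_assoc, P_sq]) (fun i j => by rw [mul_assoc, P_sq])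
    (fun i j hij => ?_) (fun i j k hij hik => ?_) (fun i j k hij hik => ?_)
    (fun i j k hij hik hjk => ?_) (fun i j k l' h1 h2 h3 h4 h5 => ?_) ?_
    (i := ⟨i, hi.symm⟩) (j := ⟨j, hj.symm⟩) (fun e => hij (congrArg Subtype.val e))
  · rw [hm, mul_assoc, h.rho_sq_P (hne hij) i.2.symm j.2.symm]
  · have h1 : R (rho i j) * R (lam i k) = R (lam i k) * R (rho i j) :=
      ((rho_lam_comm _ (hne hij) (hne hik)).map R).eq
    have h2 := h.lam_P (hne hik) i.2.symm k.2.symm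
    rw [Commute, SemiconjBy, hm, hm, mul_assoc, ← h2, ← mul_assoc, h1, mul_assoc, c, ← mul_assoc,
      h2, mul_assoc, ← c, mul_assoc]
  · rw [Commute, SemiconjBy, hm, hm, ← _root_.map_mul, (rho_comm_snd (hne hij) (hne hik)).eq,
      _root_.map_mul]
  · rw [hm, hm, hm]
    simp only [← _root_.map_mul]
    rw [rho_mul_rho (hne hij) (hne hik) (hne hjk)]
  · rw [Commute, SemiconjBy, hm, hm, ← _root_.map_mul,
      (rho_comm_of_ne (hne h1) (hne h2) (hne h3) (hne h4) (hne h5)).eq, _root_.map_mul]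
  · have h1 := h.finrank_range_P_lt l
    have h2 := h.card
    rw [Fintype.card_subtype_compl, Fintype.card_subtype_eq]
    obtain ⟨k, hk⟩ : ∃ k, Fintype.card ι = k + 6 := ⟨_, (Nat.sub_add_cancel h2).symm⟩
    rw [hk] at h1 ⊢
    have h3 : k < 2 ^ k := Nat.lt_two_pow_self
    have h4 : 2 ^ (k + 6 - 1 - 1) = 16 * 2 ^ k := by
      rw [show k + 6 - 1 - 1 = k + 4 by omega, pow_add]; ring
    omega

theorem P_rho (h : IsLow R) {i j l : ι} (hij : i ≠ j) (hi : l ≠ i) (hj : l ≠ j) :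
    lowP R l * R (rho i j) = lowP R l := by
  rw [← (rho_P_comm R hi hj).eq, h.rho_P hij hi hj]

/-- A swap acts trivially wherever the corresponding transvection and sign change do. -/
theorem swap_mul_eq (R : FreeRep ι V) {i j : ι} (hij : i ≠ j)
    {Q : End ℚ V} (hQ : Commute (R (perm (Equiv.swap i j))) Q)
    (h : R (rho i j) * R (eps i) * Q = Q) : R (perm (Equiv.swap i j)) * Q = Q := by
  set T := R (perm (Equiv.swap i j))
  have hT : T * T = 1 := by
    rw [← _root_.map_mul, ← perm_mul, Equiv.swap_mul_self, perm_one, _root_.map_one]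
  have h3 : R (rot i j) * R (rot i j) * R (rot i j) = 1 := by
    rw [← _root_.map_mul, ← _root_.map_mul, rot_mul_mul hij, _root_.map_one]
  have hr : R (rot i j) = R (rho i j) * R (eps i) * T := by simp [rot, T]
  have h4 : R (rot i j) * Q = Q * T := by
    rw [hr, mul_assoc, hQ.eq, ← mul_assoc, h]
  calc T * Q = Q * T * T * T := by rw [mul_assoc Q, hT, mul_one, hQ.eq]
    _ = R (rot i j) * R (rot i j) * R (rot i j) * Q := by
      have a1 : R (rot i j) * (R (rot i j) * Q) = Q * T * T := by rw [h4, ← mul_assoc, h4]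
      have a2 : R (rot i j) * (R (rot i j) * (R (rot i j) * Q)) = Q * T * T * T := by
        rw [a1, ← mul_assoc, ← mul_assoc, h4]
      rw [← a2, mul_assoc _ _ Q, mul_assoc]
    _ = Q := by rw [h3, one_mul]

theorem perm_mul_P (h : IsLow R) {π : Equiv.Perm ι} {l : ι} (hπ : π l = l) :
    R (perm π) * lowP R l = lowP R l := by
  refine Equiv.Perm.induction_fixing (a := l) (p := fun π => R (perm π) * lowP R l = lowP R l)
    (by rw [perm_one, _root_.map_one, one_mul]) (fun i j hij hi hj π hπ => ?_) π hπ
  rw [perm_mul, _root_.map_mul, mul_assoc, hπ]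
  refine swap_mul_eq R hij ?_ ?_
  · rw [Commute, SemiconjBy, perm_P, Equiv.swap_apply_of_ne_of_ne hi hj]
  · rw [mul_assoc, h.eps_P_of_ne hi.symm, h.rho_P hij hi hj]

theorem P_mul_perm (h : IsLow R) {π : Equiv.Perm ι} {l : ι} (hπ : π l = l) :
    lowP R l * R (perm π) = lowP R l := by
  have := perm_P R π l
  rw [hπ] at this
  rw [← this, h.perm_mul_P hπ]

theorem multi_P (h : IsLow R) {s : Finset ι} {j l : ι} (hs : l ∉ s) (hj : l ≠ j) :
    R (multi s j) * lowP R l = lowP R l ∧ lowP R l * R (multi s j) = lowP R l := by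
  induction s using Finset.induction_on with
  | empty => simp [multi_empty]
  | insert i s hi ih =>
    obtain ⟨h1, h2⟩ := ih fun e => hs (Finset.mem_insert_of_mem e)
    have hli : l ≠ i := fun e => hs (e ▸ Finset.mem_insert_self _ _)
    by_cases hij : i = j
    · have : multi (insert i s) j = multi s j := by
        subst hij
        refine ext_of fun m => ?_
        by_cases hm : m = i
        · subst hm; simp [multi_self]
        · by_cases hms : m ∈ s
          · simp [multi_of_mem, hms, hm]
          · simp [multi_of_notMem, hms, hm]
      rw [this]; exact ⟨h1, h2⟩
    · rw [multi_insert hi hij, _root_.map_mul, mul_assoc, h1, ← mul_assoc,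
        h.P_rho hij hli hj, h.rho_P hij hli hj, h2]
      exact ⟨rfl, rfl⟩

theorem multi_univ_eq {i j : ι} (hij : i ≠ j) :
    multi Finset.univ j = rho i j * multi (Finset.univ.erase i) j := by
  rw [← multi_insert (Finset.notMem_erase _ _) hij, Finset.insert_erase (Finset.mem_univ i)]

theorem multi_univ_P (h : IsLow R) {i j : ι} (hij : i ≠ j) :
    R (multi Finset.univ j) * lowP R i = R (rho i j) * lowP R i := by
  rw [multi_univ_eq hij, _root_.map_mul, mul_assoc, (h.multi_P (Finset.notMem_erase _ _) hij).1]

theorem rho_comm_multi (s : Finset ι) {i j : ι} (hij : i ≠ j) :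
    Commute (rho i j) (multi s j) := by
  induction s using Finset.induction_on with
  | empty => rw [multi_empty]; exact Commute.one_right _
  | insert k s hk ih =>
    by_cases hkj : k = j
    · have : multi (insert k s) j = multi s j := by
        subst hkj
        refine ext_of fun m => ?_
        by_cases hm : m = k
        · subst hm; simp [multi_self]
        · by_cases hms : m ∈ s
          · simp [multi_of_mem, hms, hm]
          · simp [multi_of_notMem, hms, hm]
      rwa [this]
    · rw [multi_insert hk hkj]
      exact (rho_comm_snd hij hkj).mul_right ih

theorem P_multi_univ (h : IsLow R) {i j : ι} (hij : i ≠ j) :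
    lowP R i * R (multi Finset.univ j) = lowP R i * R (rho i j) := by
  rw [multi_univ_eq hij, (rho_comm_multi _ hij).eq, _root_.map_mul, ← mul_assoc,
    (h.multi_P (Finset.notMem_erase _ _) hij).2]

end IsLow

section

variable {ι V : Type*} [Fintype ι] [DecidableEq ι] [AddCommGroup V] [Module ℚ V]

/-- Vectors in the range of `lowP R a` fixed by all transvections `rho j a`. -/
def lowZ (R : FreeRep ι V) (a : ι) : Submodule ℚ V :=
  LinearMap.ker (lowP R a - 1) ⊓ ⨅ j : {j // j ≠ a}, LinearMap.ker (R (rho j a) - 1)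

theorem mem_lowZ {R : FreeRep ι V} {a : ι} {u : V} :
    u ∈ lowZ R a ↔ lowP R a u = u ∧ ∀ j, j ≠ a → R (rho j a) u = u := by
  simp [lowZ, Submodule.mem_iInf, sub_eq_zero]

namespace IsLow

variable {R : FreeRep ι V} [FiniteDimensional ℚ V]

theorem mul_apply_of_eq {x y z : End ℚ V} (h : x * y = z) (v : V) : x (y v) = z v :=
  DFunLike.congr_fun h v

theorem R_mul (R : FreeRep ι V) (g k : MulAut (FreeGroup ι)) (v : V) :
    R (g * k) v = R g (R k v) := by rw [_root_.map_mul]; rfl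

theorem R_injective (R : FreeRep ι V) (g : MulAut (FreeGroup ι)) :
    Function.Injective (R g) := by
  intro v w hvw
  have := congrArg (R g⁻¹) hvw
  rwa [← R_mul, ← R_mul, inv_mul_cancel, _root_.map_one] at this

theorem decomp (R : FreeRep ι V) (v : V) :
    v = lowP0 R v + ∑ i, lowP R i v := by
  conv_lhs => rw [← End.one_apply (R := ℚ) v, ← P0_add_sum R]
  simp

theorem P_apply_of_ne (h : IsLow R) {i j : ι} (hij : i ≠ j) {u : V} (hu : lowP R j u = u) :
    lowP R i u = 0 := by
  rw [← hu]; exact mul_apply_of_eq (h.P_mul_P hij) u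

theorem P0_apply (h : IsLow R) {j : ι} {u : V} (hu : lowP R j u = u) : lowP0 R u = 0 := by
  rw [← hu]; exact mul_apply_of_eq (h.P0_mul_P j) u

theorem rho_apply (h : IsLow R) {i j l : ι} (hij : i ≠ j) (hi : l ≠ i) (hj : l ≠ j) {u : V}
    (hu : lowP R l u = u) : R (rho i j) u = u := by
  rw [← hu]; exact mul_apply_of_eq (h.rho_P hij hi hj) u

theorem perm_apply (h : IsLow R) {π : Equiv.Perm ι} {l : ι} (hπ : π l = l) {u : V}
    (hu : lowP R l u = u) : R (perm π) u = u := by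
  rw [← hu]; exact mul_apply_of_eq (h.perm_mul_P hπ) u

theorem P_idem (R : FreeRep ι V) (i : ι) (u : V) :
    lowP R i (lowP R i u) = lowP R i u := mul_apply_of_eq (P_sq R i) u

theorem P_rho_P0 (h : IsLow R) {i j : ι} (hij : i ≠ j) :
    lowP R i * R (rho i j) * lowP0 R = 0 := by
  rw [← h.P_multi_univ hij, mul_assoc, ← (h.multi_P0 j).eq, ← mul_assoc, h.P_mul_P0, zero_mul]

theorem P0_rho_P (h : IsLow R) {i j : ι} (hij : i ≠ j) :
    lowP0 R * R (rho i j) * lowP R i = 0 := by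
  rw [mul_assoc, ← h.multi_univ_P hij, ← mul_assoc, (h.multi_P0 j).eq, mul_assoc, h.P0_mul_P,
    mul_zero]

theorem rho_P0_decomp (h : IsLow R) {i j : ι} (hij : i ≠ j) {x : V} (hx : lowP0 R x = x) :
    R (rho i j) x = lowP0 R (R (rho i j) x) + lowP R j (R (rho i j) x) := by
  conv_lhs => rw [decomp R (R (rho i j) x)]
  congr 1
  refine Finset.sum_eq_single j (fun k _ hk => ?_) (by simp)
  by_cases hki : k = i
  · subst hki
    rw [← hx]; exact DFunLike.congr_fun (h.P_rho_P0 hij) x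
  · rw [← hx, mul_apply_of_eq (h.P_rho hij hki hk)]
    exact mul_apply_of_eq (h.P_mul_P0 k) x

theorem exists_ne (h : IsLow R) (s : Finset ι) (hs : s.card ≤ 5) : ∃ k, k ∉ s := by
  by_contra! hc
  have h1 := Finset.card_le_card (fun i _ => hc i : Finset.univ ⊆ s)
  rw [Finset.card_univ] at h1
  have := h.card
  omega

theorem exists_ne_ne (h : IsLow R) (a b : ι) : ∃ c, c ≠ a ∧ c ≠ b := by
  simpa using h.exists_ne {a, b} (Finset.card_le_two.trans (by norm_num))

theorem P_rho_P_rho (h : IsLow R) {i a j : ι} (hia : i ≠ a) (hja : j ≠ a) {x : V}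
    (hx : lowP0 R x = x) : lowP R j (R (rho j a) (lowP R a (R (rho i a) x))) = 0 := by
  have main : lowP R i (R (rho i a) (lowP R a (R (rho i a) x))) = 0 := by
    have hS := DFunLike.congr_fun (h.rho_lam_P0 hia).eq x
    simp only [End.mul_apply] at hS
    have hex : ∀ k, R (eps k) x = x := fun k => by
      rw [← hx]; exact mul_apply_of_eq (h.eps_P0 k) x
    have hl : R (lam i a) x = lowP0 R (R (rho i a) x) - lowP R a (R (rho i a) x) := by
      rw [lam_eq R hia]
      simp only [End.mul_apply, hex]
      conv_lhs => rw [h.rho_P0_decomp hia hx]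
      rw [map_add, map_add, mul_apply_of_eq (h.eps_P0 a), mul_apply_of_eq (h.eps_P0 i),
        mul_apply_of_eq (eps_P R a), LinearMap.neg_apply, map_neg,
        mul_apply_of_eq (h.eps_P_of_ne hia), sub_eq_add_neg]
    have h1 : lowP R i (R (rho i a) (R (lam i a) x)) = 0 := by
      rw [hx] at hS
      rw [← hS]; exact mul_apply_of_eq (h.P_mul_P0 i) _
    rw [hl, map_sub, map_sub] at h1
    have h2 : lowP R i (R (rho i a) (lowP0 R (R (rho i a) x))) = 0 :=
      DFunLike.congr_fun (h.P_rho_P0 hia) _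
    rw [h2, zero_sub, neg_eq_zero] at h1
    exact h1
  set τ := Equiv.swap i j
  have hτa : τ a = a := Equiv.swap_apply_of_ne_of_ne hia.symm hja.symm
  have h1 : lowP R a (R (perm τ) (R (rho i a) x)) = lowP R a (R (rho i a) x) :=
    mul_apply_of_eq (h.P_mul_perm hτa) _
  have h2 : R (perm τ) (lowP R a (R (rho i a) x)) = lowP R a (R (rho i a) x) :=
    mul_apply_of_eq (h.perm_mul_P hτa) _
  rw [← h2, ← R_mul]
  have h3 : rho j a * perm τ = perm τ * rho i a := by
    rw [perm_rho, Equiv.swap_apply_left, hτa]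
  have h4 : lowP R j * R (perm τ) = R (perm τ) * lowP R i := by
    rw [perm_P, Equiv.swap_apply_left]
  rw [h3, R_mul, mul_apply_of_eq h4, End.mul_apply, main, map_zero]

theorem mem_Z_of_P_rho (h : IsLow R) {a : ι} {u : V} (hu : lowP R a u = u)
    (hj : ∀ j, j ≠ a → lowP R j (R (rho j a) u) = 0) : u ∈ lowZ R a := by
  set t := R (multi Finset.univ a) u with ht
  have ht' : lowP R a t = t := by
    have h1 := decomp R t
    have h0 : lowP0 R t = 0 := by
      rw [ht, mul_apply_of_eq (h.multi_P0 a).eq, End.mul_apply, h.P0_apply hu, map_zero]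
    rw [h0, zero_add, Finset.sum_eq_single a (fun j _ hja => ?_) (by simp)] at h1
    · exact h1.symm
    · rw [ht, mul_apply_of_eq (h.P_multi_univ hja)]; exact hj j hja
  have hrho : ∀ j, j ≠ a → R (rho j a) u = t := by
    intro j hja
    set s := (Finset.univ.erase a).erase j
    have hY := h.multi_P (s := s) (j := j) (l := a) (by simp [s]) hja.symm
    have hr : rho j a * multi s j = multi s j * multi Finset.univ a := by
      rw [rho_multi hja (by simp [s]) (by simp [s]),
        Finset.insert_erase (by simpa using hja), multi_erase]
    have h1 : R (multi s j) u = u := by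
      rw [← hu]; exact mul_apply_of_eq hY.1 u
    have h2 : R (multi s j) t = t := by
      rw [← ht']; exact mul_apply_of_eq hY.1 t
    rw [← h1, ← R_mul, hr, R_mul, ← ht, h2]
  have hut : ∃ i, i ≠ a ∧ R (rho i a) t = t := by
    obtain ⟨j, hja⟩ := h.exists_ne {a} (by simp)
    rw [Finset.mem_singleton] at hja
    obtain ⟨i, hi⟩ := h.exists_ne_ne a j
    refine ⟨i, hi.1, ?_⟩
    have h1 := congrArg (fun g => R g u) (rho_mul_rho hi.2 hi.1 hja)
    simp only [R_mul] at h1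
    rw [h.rho_apply hi.2 (Ne.symm hi.1) (Ne.symm hja) hu, hrho j hja] at h1
    refine R_injective R (rho i j) ?_
    rw [← h1, h.rho_apply hi.2 (Ne.symm hi.1) (Ne.symm hja) ht']
  obtain ⟨i, hia, hi⟩ := hut
  have htu : t = u := by
    refine R_injective R (rho i a) ?_
    rw [hi, hrho i hia]
  exact mem_lowZ.2 ⟨hu, fun j hja => (hrho j hja).trans htu⟩

theorem rho_sub_mem_Z (h : IsLow R) {a b : ι} (hab : a ≠ b) {w : V} (hw : w ∈ lowZ R a) :
    R (rho a b) w - w ∈ lowZ R b := by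
  obtain ⟨hwa, hwj⟩ := mem_lowZ.1 hw
  obtain ⟨c, hca, hcb⟩ := h.exists_ne_ne a b
  -- the component of `R (rho a b)` in the range of `lowP R a`
  have hdec : ∀ u, lowP R a u = u →
      R (rho a b) u = lowP R a (R (rho a b) u) + lowP R b (R (rho a b) u) := by
    intro u hu
    conv_lhs => rw [decomp R (R (rho a b) u)]
    have h0 : lowP0 R (R (rho a b) u) = 0 := by
      rw [← hu]; exact DFunLike.congr_fun (h.P0_rho_P hab) u
    rw [h0, zero_add, ← Finset.sum_pair (f := fun i => lowP R i (R (rho a b) u)) hab]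
    refine (Finset.sum_subset (Finset.subset_univ _) fun k _ hk => ?_).symm
    simp only [Finset.mem_singleton, Finset.mem_insert, not_or] at hk
    rw [mul_apply_of_eq (h.P_rho hab hk.1 hk.2)]
    exact h.P_apply_of_ne hk.1 hu
  set d := lowP R a (R (rho a b) w) with hd
  set f := lowP R b (R (rho a b) w) with hf
  have hda : lowP R a d = d := P_idem R a _
  have hfb : lowP R b f = f := P_idem R b _
  have hsum : R (rho a b) w = d + f := hdec w hwa
  have hfj : ∀ i, i ≠ a → i ≠ b → R (rho i b) f = f := by
    intro i hia hib
    have h1 := congrArg (fun g => R g w) (rho_comm_snd hib hab).eq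
    simp only [R_mul] at h1
    rw [h.rho_apply hib (Ne.symm hia) hab hwa, hsum, map_add,
      h.rho_apply hib (Ne.symm hia) hab hda] at h1
    exact add_left_cancel h1
  have hswap : ∀ i j k : ι, i ≠ k → j ≠ k → ∀ u, lowP R k u = u → R (rho i k) u = u →
      R (rho j k) u = u := by
    intro i j k hik hjk u hu hiu
    have hk : Equiv.swap i j k = k := Equiv.swap_apply_of_ne_of_ne hik.symm hjk.symm
    have h3 : perm (Equiv.swap i j) * rho i k = rho j k * perm (Equiv.swap i j) := by
      rw [perm_rho, Equiv.swap_apply_left, hk]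
    have h4 := congrArg (fun g => R g u) h3
    simp only [R_mul] at h4
    rw [h.perm_apply hk hu, hiu, h.perm_apply hk hu] at h4
    exact h4.symm
  have hfZ : f ∈ lowZ R b := mem_lowZ.2 ⟨hfb, fun j hjb =>
    hswap c j b hcb hjb f hfb (hfj c hca hcb)⟩
  suffices hdw : d = w by rw [hsum, hdw, add_sub_cancel_left]; exact hfZ
  -- the component does not depend on the index
  have hPac : ∀ u, lowP R a u = u → lowP R a (R (rho a c) u) = lowP R a (R (rho a b) u) := by
    intro u hu
    have hk : Equiv.swap b c a = a := Equiv.swap_apply_of_ne_of_ne hab (Ne.symm hca)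
    have h3 : perm (Equiv.swap b c) * rho a b = rho a c * perm (Equiv.swap b c) := by
      rw [perm_rho, Equiv.swap_apply_left, hk]
    have h4 := congrArg (fun g => lowP R a (R g u)) h3
    simp only [R_mul] at h4
    rw [h.perm_apply hk hu, mul_apply_of_eq (h.P_mul_perm hk)] at h4
    exact h4.symm
  have hdd : lowP R a (R (rho a b) d) = d := by
    have h1 := congrArg (fun g => lowP R a (R g w)) (rho_mul_rho (Ne.symm hca) hab hcb)
    simp only [R_mul] at h1
    rw [h.rho_apply hcb (Ne.symm hca) hab hwa, mul_apply_of_eq (h.P_rho hcb (Ne.symm hca) hab),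
      hPac w hwa, hsum, map_add, map_add, map_add, hda, hPac d hda,
      h.rho_apply (Ne.symm hca) hab.symm (Ne.symm hcb) hfb, h.P_apply_of_ne hab hfb, add_zero,
      add_zero] at h1
    exact h1.symm
  have hdw : lowP R a (R (rho a b) d) = w := by
    have h1 := congrArg (fun g => R g w) (eps_rho_eps_snd hab)
    simp only [R_mul, _root_.map_one, End.one_apply] at h1
    have hed : R (eps b) d = d := by
      rw [← hda]; exact mul_apply_of_eq (h.eps_P_of_ne hab.symm) d
    have hef : R (eps b) f = -f := by
      rw [← hfb]; exact mul_apply_of_eq (eps_P R b) f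
    have hrf : R (rho a b) f = f := (mem_lowZ.1 hfZ).2 a hab
    rw [hsum, map_add, hed, hef, map_add, map_neg, hrf] at h1
    have h2 := congrArg (lowP R a) h1
    rw [mul_apply_of_eq (h.P_eps_of_ne hab.symm), map_add, map_neg, h.P_apply_of_ne hab hfb,
      neg_zero, add_zero, hwa] at h2
    exact h2
  exact hdd.symm.trans hdw

end IsLow

end

section

variable {ι V : Type*} [Fintype ι] [DecidableEq ι] [AddCommGroup V] [Module ℚ V]

/-- Automorphisms acting upper triangularly with respect to `⨆ a, lowZ R a` and the range of
`lowP0 R`. -/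
def LowGood (R : FreeRep ι V) (g : MulAut (FreeGroup ι)) : Prop :=
  (∀ w ∈ ⨆ a, lowZ R a, R g w ∈ ⨆ a, lowZ R a) ∧
    ∀ x, lowP0 R x = x → R g x - lowP0 R (R g x) ∈ ⨆ a, lowZ R a

/-- The diagonal component of the action on the range of `lowP0 R`. -/
def lowC (R : FreeRep ι V) (g : MulAut (FreeGroup ι)) : End ℚ V :=
  lowP0 R * R g * lowP0 R

namespace IsLow

variable {R : FreeRep ι V} [FiniteDimensional ℚ V]

theorem P0_of_mem (h : IsLow R) {w : V} (hw : w ∈ ⨆ a, lowZ R a) : lowP0 R w = 0 := by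
  suffices h1 : ⨆ a, lowZ R a ≤ LinearMap.ker (lowP0 R) from h1 hw
  exact iSup_le fun a w hw => h.P0_apply (mem_lowZ.1 hw).1

theorem P0_idem (h : IsLow R) (x : V) : lowP0 R (lowP0 R x) = lowP0 R x :=
  mul_apply_of_eq h.P0_sq x

theorem good_mul (h : IsLow R) {g k : MulAut (FreeGroup ι)} (hg : LowGood R g)
    (hk : LowGood R k) : LowGood R (g * k) := by
  refine ⟨fun w hw => ?_, fun x hx => ?_⟩
  · rw [R_mul]; exact hg.1 _ (hk.1 _ hw)
  · have h1 := hk.2 x hx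
    have h2 := hg.2 _ (h.P0_idem (R k x))
    have h3 := hg.1 _ h1
    have h4 := h.P0_of_mem h3
    rw [map_sub, map_sub, sub_eq_zero] at h4
    rw [R_mul, h4]
    rw [map_sub] at h3
    have := add_mem h2 h3
    rwa [sub_add_sub_comm, add_comm (R g _) (R g _), add_sub_add_right_eq_sub] at this

theorem lowC_mul (h : IsLow R) {g k : MulAut (FreeGroup ι)} (hg : LowGood R g)
    (hk : LowGood R k) : lowC R (g * k) = lowC R g * lowC R k := by
  ext v
  simp only [lowC, End.mul_apply, R_mul, h.P0_idem]
  have h4 := h.P0_of_mem (hg.1 _ (hk.2 _ (h.P0_idem v)))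
  rwa [map_sub, map_sub, sub_eq_zero] at h4

theorem lowC_one (h : IsLow R) : lowC R 1 = lowP0 R := by
  rw [lowC, _root_.map_one, mul_one, h.P0_sq]

theorem good_of_preserves {g : MulAut (FreeGroup ι)}
    (hZ : ∀ a, ∀ w ∈ lowZ R a, R g w ∈ ⨆ a, lowZ R a) (hc : Commute (R g) (lowP0 R)) :
    LowGood R g := by
  refine ⟨fun w hw => ?_, fun x hx => ?_⟩
  · suffices h1 : ⨆ a, lowZ R a ≤ (⨆ a, lowZ R a).comap (R g) from h1 hw
    exact iSup_le hZ
  · have h1 := DFunLike.congr_fun hc.eq x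
    simp only [End.mul_apply] at h1
    rw [hx] at h1
    rw [← h1, sub_self]
    exact zero_mem _

theorem good_eps (h : IsLow R) (i : ι) : LowGood R (eps i) := by
  refine good_of_preserves (fun a w hw => ?_) ?_
  · have hwa := (mem_lowZ.1 hw).1
    by_cases hia : i = a
    · subst hia
      have : R (eps i) w = -w := by rw [← hwa]; exact mul_apply_of_eq (eps_P R i) w
      rw [this]
      exact neg_mem (Submodule.mem_iSup_of_mem i hw)
    · have : R (eps i) w = w := by rw [← hwa]; exact mul_apply_of_eq (h.eps_P_of_ne hia) w
      rw [this]
      exact Submodule.mem_iSup_of_mem a hw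
  · rw [Commute, SemiconjBy, h.eps_P0, h.P0_eps]

theorem good_perm (π : Equiv.Perm ι) : LowGood R (perm π) := by
  refine good_of_preserves (fun a w hw => ?_) (perm_P0 R π)
  obtain ⟨hwa, hwj⟩ := mem_lowZ.1 hw
  refine Submodule.mem_iSup_of_mem (π a) (mem_lowZ.2 ⟨?_, fun j hj => ?_⟩)
  · rw [mul_apply_of_eq (perm_P R π a).symm, End.mul_apply, hwa]
  · obtain ⟨k, rfl⟩ := π.surjective j
    rw [← R_mul, ← perm_rho, R_mul, hwj k (fun e => hj (e ▸ rfl))]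

theorem good_rho (h : IsLow R) {i j : ι} (hij : i ≠ j) : LowGood R (rho i j) := by
  refine ⟨fun w hw => ?_, fun x hx => ?_⟩
  · suffices h1 : ⨆ a, lowZ R a ≤ (⨆ a, lowZ R a).comap (R (rho i j)) from h1 hw
    refine iSup_le fun a w hw => ?_
    have hwa := Submodule.mem_iSup_of_mem (p := lowZ R) a hw
    change R (rho i j) w ∈ ⨆ a, lowZ R a
    by_cases hia : i = a
    · subst hia
      have := add_mem (Submodule.mem_iSup_of_mem (p := lowZ R) j (h.rho_sub_mem_Z hij hw)) hwa
      rwa [sub_add_cancel] at this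
    · by_cases hja : j = a
      · subst hja
        rwa [(mem_lowZ.1 hw).2 i hij]
      · rwa [h.rho_apply hij (Ne.symm hia) (Ne.symm hja) (mem_lowZ.1 hw).1]
  · have h1 := h.rho_P0_decomp hij hx
    rw [sub_eq_of_eq_add' h1]
    exact Submodule.mem_iSup_of_mem j (h.mem_Z_of_P_rho (P_idem R j _)
      fun k hk => h.P_rho_P_rho hij hk hx)

theorem lowC_eps (h : IsLow R) (i : ι) : lowC R (eps i) = lowP0 R := by
  rw [lowC, h.P0_eps, h.P0_sq]

theorem P0_lowC (h : IsLow R) (g : MulAut (FreeGroup ι)) : lowP0 R * lowC R g = lowC R g := by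
  rw [lowC, ← mul_assoc, ← mul_assoc, h.P0_sq]

theorem lowC_P0 (h : IsLow R) (g : MulAut (FreeGroup ι)) : lowC R g * lowP0 R = lowC R g := by
  rw [lowC, mul_assoc, h.P0_sq]

theorem lowC_rho (h : IsLow R) {i j : ι} (hij : i ≠ j) : lowC R (rho i j) = lowP0 R := by
  have hlam : ∀ {i j : ι}, i ≠ j →
      LowGood R (lam i j) ∧ lowC R (lam i j) = lowC R (rho i j) := by
    intro i j hij
    have g1 := h.good_mul (h.good_eps i) (h.good_eps j)
    have g2 := h.good_mul g1 (h.good_rho hij)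
    have g3 := h.good_mul g2 (h.good_eps j)
    rw [lam_eq_conj hij]
    refine ⟨h.good_mul g3 (h.good_eps i), ?_⟩
    rw [h.lowC_mul g3 (h.good_eps i), h.lowC_mul g2 (h.good_eps j),
      h.lowC_mul g1 (h.good_rho hij), h.lowC_mul (h.good_eps i) (h.good_eps j)]
    simp only [h.lowC_eps, h.P0_sq, h.P0_lowC, h.lowC_P0]
  have hcomm : ∀ {g k}, LowGood R g → LowGood R k → Commute g k →
      Commute (lowC R g) (lowC R k) := by
    intro g k hg hk hc
    rw [Commute, SemiconjBy, ← h.lowC_mul hg hk, hc.eq, h.lowC_mul hk hg]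
  refine eq_of_finrank_range_lt h.P0_sq (R := fun i j => lowC R (rho i j))
    (fun i j => h.P0_lowC _) (fun i j => h.lowC_P0 _) (fun i j hij => ?_)
    (fun i j k hij hik => ?_)
    (fun i j k hij hik => hcomm (h.good_rho hij) (h.good_rho hik) (rho_comm_snd hij hik))
    (fun i j k hij hik hjk => ?_)
    (fun i j k l h1 h2 h3 h4 h5 => hcomm (h.good_rho h1) (h.good_rho h2)
      (rho_comm_of_ne h1 h2 h3 h4 h5)) ?_ hij
  · have g1 := h.good_mul (h.good_eps j) (h.good_rho hij)
    have g2 := h.good_mul g1 (h.good_eps j)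
    have h1 := congrArg (lowC R) (eps_rho_eps_snd hij)
    rw [h.lowC_mul g2 (h.good_rho hij), h.lowC_mul g1 (h.good_eps j),
      h.lowC_mul (h.good_eps j) (h.good_rho hij), h.lowC_one] at h1
    simpa only [h.lowC_eps, h.P0_lowC, h.lowC_P0] using h1
  · rw [← (hlam hik).2]
    exact hcomm (h.good_rho hij) (hlam hik).1 (rho_lam_comm i hij hik)
  · rw [← h.lowC_mul (h.good_rho hjk) (h.good_rho hij), rho_mul_rho hij hik hjk,
      h.lowC_mul (h.good_mul (h.good_rho hij) (h.good_rho hik)) (h.good_rho hjk),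
      h.lowC_mul (h.good_rho hij) (h.good_rho hik)]
  · have h1 := h.dim
    have h2 := h.card
    have h3 := Submodule.finrank_le (LinearMap.range (lowP0 R))
    obtain ⟨k, hk⟩ : ∃ k, Fintype.card ι = k + 6 := ⟨_, (Nat.sub_add_cancel h2).symm⟩
    rw [hk] at h1 ⊢
    have h4 : ∀ k : ℕ, (k + 6) * (k + 6 + 1) + 2 ≤ 2 * 2 ^ (k + 5) := by
      intro k
      induction k with
      | zero => norm_num
      | succ k ih => rw [show k + 1 + 5 = (k + 5) + 1 by omega, pow_succ]; nlinarith
    have h5 := h4 k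
    rw [show k + 6 - 1 = k + 5 by omega]
    omega

theorem multi_mul_P0 (h : IsLow R) (j : ι) : R (multi Finset.univ j) * lowP0 R = lowP0 R := by
  have h1 : ∀ s : Finset ι, j ∉ s → LowGood R (multi s j) ∧ lowC R (multi s j) = lowP0 R := by
    intro s
    induction s using Finset.induction_on with
    | empty =>
      intro _
      rw [multi_empty]
      exact ⟨good_of_preserves (fun a w hw => by
        rw [_root_.map_one]; exact Submodule.mem_iSup_of_mem a hw)
        (by rw [_root_.map_one]; exact Commute.one_left _), h.lowC_one⟩
    | insert i s hi ih =>
      intro hj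
      have hij : i ≠ j := fun e => hj (e ▸ Finset.mem_insert_self _ _)
      obtain ⟨h1, h2⟩ := ih fun e => hj (Finset.mem_insert_of_mem e)
      rw [multi_insert hi hij, h.lowC_mul (h.good_rho hij) h1, h.lowC_rho hij, h2, h.P0_sq]
      exact ⟨h.good_mul (h.good_rho hij) h1, rfl⟩
  have h2 := (h1 (Finset.univ.erase j) (by simp)).2
  rw [multi_erase, lowC, (h.multi_P0 j).eq, mul_assoc, h.P0_sq] at h2
  exact h2

theorem perm_mul_P0 (h : IsLow R) (π : Equiv.Perm ι) : R (perm π) * lowP0 R = lowP0 R := by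
  induction π using Equiv.Perm.swap_induction_on with
  | one => rw [perm_one, _root_.map_one, one_mul]
  | swap_mul π i j hij ih =>
    rw [perm_mul, _root_.map_mul, mul_assoc, ih]
    set T := perm (Equiv.swap i j) with hT
    have hTc : lowC R T = R T * lowP0 R := by
      rw [lowC, ← (perm_P0 R _).eq, mul_assoc, h.P0_sq]
    have hgood := h.good_mul (h.good_rho hij) (h.good_eps i)
    have hrot : lowC R (rot i j) = lowC R T := by
      rw [rot, h.lowC_mul hgood (good_perm _), h.lowC_mul (h.good_rho hij) (h.good_eps i),
        h.lowC_eps, h.lowC_rho hij, h.P0_sq, h.P0_lowC]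
    have hrg : LowGood R (rot i j) := h.good_mul hgood (good_perm _)
    have h3 := congrArg (lowC R) (rot_mul_mul hij)
    have hTT : T * T = 1 := by rw [hT, ← perm_mul, Equiv.swap_mul_self, perm_one]
    rw [h.lowC_mul (h.good_mul hrg hrg) hrg, h.lowC_mul hrg hrg, hrot,
      ← h.lowC_mul (good_perm _) (good_perm _), hTT, h.lowC_one, h.P0_lowC, hTc] at h3
    exact h3

end IsLow

end

section

variable {ι V : Type*} [Fintype ι] [DecidableEq ι] [AddCommGroup V] [Module ℚ V]

/-- The action of the transposition of `Option ι` exchanging `none` and `some a`. -/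
def lowA (R : FreeRep ι V) (a : ι) : End ℚ V :=
  R (aut (Equiv.swap none (some a)))

/-- The blocks of `lowA`. -/
def lowB (R : FreeRep ι V) (a i j : ι) : End ℚ V :=
  lowP R i * lowA R a * lowP R j

/-- The action of a permutation of the generators. -/
def lowT (R : FreeRep ι V) (π : Equiv.Perm ι) : End ℚ V := R (perm π)

/-- The block of `lowA` from the `a`-th to any other summand, transported to the `a`-th one. -/
def lowE (R : FreeRep ι V) (a c : ι) : End ℚ V :=
  lowP R a * lowT R (Equiv.swap a c) * lowA R a * lowP R a

/-- The block of `lowA` from any other summand to the `a`-th, transported to the `a`-th one. -/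
def lowF (R : FreeRep ι V) (a c : ι) : End ℚ V :=
  lowP R a * lowA R a * lowT R (Equiv.swap a c) * lowP R a

namespace IsLow

variable {R : FreeRep ι V} [FiniteDimensional ℚ V]

theorem A_sq (R : FreeRep ι V) (a : ι) : lowA R a * lowA R a = 1 := by
  rw [lowA, ← _root_.map_mul, ← _root_.map_mul, Equiv.swap_mul_self, _root_.map_one,
    _root_.map_one]

theorem T_mul (R : FreeRep ι V) (π ψ : Equiv.Perm ι) :
    lowT R (π * ψ) = lowT R π * lowT R ψ := by
  rw [lowT, perm_mul, _root_.map_mul]; rfl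

theorem T_sq (R : FreeRep ι V) (a c : ι) :
    lowT R (Equiv.swap a c) * lowT R (Equiv.swap a c) = 1 := by
  rw [← T_mul, Equiv.swap_mul_self, lowT, perm_one, _root_.map_one]

theorem T_A (R : FreeRep ι V) (π : Equiv.Perm ι) (a : ι) :
    lowT R π * lowA R a = lowA R (π a) * lowT R π := by
  rw [lowA, lowT, lowA, ← _root_.map_mul, ← _root_.map_mul, ← aut_optionCongr,
    ← _root_.map_mul, ← _root_.map_mul, Equiv.mul_swap_eq_swap_mul]
  rfl

theorem braid (R : FreeRep ι V) {a c : ι} (hac : c ≠ a) :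
    lowT R (Equiv.swap a c) * lowA R a * lowT R (Equiv.swap a c) =
      lowA R a * lowT R (Equiv.swap a c) * lowA R a := by
  have h1 : (Equiv.optionCongr (Equiv.swap a c) : Equiv.Perm (Option ι)) =
      Equiv.swap (some a) (some c) := by
    rw [Equiv.optionCongr_swap]
  simp only [lowA, lowT, ← _root_.map_mul, ← aut_optionCongr, h1]
  congr 2
  rw [Equiv.mul_swap_eq_swap_mul (Equiv.swap (some a) (some c)), Equiv.swap_apply_left, mul_assoc,
    Equiv.swap_mul_self, mul_one, Equiv.swap_apply_of_ne_of_ne (by simp) (by simp),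
    Equiv.mul_swap_eq_swap_mul (Equiv.swap none (some a)), Equiv.swap_apply_right,
    mul_assoc, Equiv.swap_mul_self, mul_one,
    Equiv.swap_apply_of_ne_of_ne (by simp) (by simpa using hac)]

theorem A_P0 (h : IsLow R) (a : ι) : lowA R a * lowP0 R = lowP0 R := by
  rw [lowA, aut_swap, _root_.map_mul, mul_assoc, h.multi_mul_P0, h.eps_P0]

theorem P0_A (h : IsLow R) (a : ι) : lowP0 R * lowA R a = lowP0 R := by
  rw [lowA, aut_swap, _root_.map_mul, ← mul_assoc, h.P0_eps, (h.multi_P0 a).eq, h.multi_mul_P0]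

theorem T_P (R : FreeRep ι V) (π : Equiv.Perm ι) (i : ι) :
    lowT R π * lowP R i = lowP R (π i) * lowT R π := perm_P R π i

theorem P_T (R : FreeRep ι V) (a c i : ι) :
    lowP R i * lowT R (Equiv.swap a c) =
      lowT R (Equiv.swap a c) * lowP R (Equiv.swap a c i) := by
  rw [T_P, Equiv.swap_apply_self]

theorem P_T_left (R : FreeRep ι V) (a c : ι) :
    lowP R a * lowT R (Equiv.swap a c) = lowT R (Equiv.swap a c) * lowP R c := by
  rw [T_P, Equiv.swap_apply_right]

theorem P_T_right (R : FreeRep ι V) (a c : ι) :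
    lowP R c * lowT R (Equiv.swap a c) = lowT R (Equiv.swap a c) * lowP R a := by
  rw [T_P, Equiv.swap_apply_left]

theorem T_swap_conj (R : FreeRep ι V) {a c d : ι} (hc : c ≠ a) (hd : d ≠ a) :
    lowT R (Equiv.swap a d) =
      lowT R (Equiv.swap c d) * lowT R (Equiv.swap a c) * lowT R (Equiv.swap c d) := by
  rw [← T_mul, ← T_mul, Equiv.mul_swap_eq_swap_mul (Equiv.swap c d), Equiv.swap_apply_left,
    Equiv.swap_apply_of_ne_of_ne hc.symm hd.symm, mul_assoc, Equiv.swap_mul_self, mul_one]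

theorem B_eq_zero (h : IsLow R) {a b c : ι} (hb : b ≠ a) (hc : c ≠ a) (hbc : c ≠ b) :
    lowB R a c b = 0 := by
  rw [lowB, lowA, aut_swap, _root_.map_mul, ← mul_assoc, h.P_eps_of_ne hc.symm, h.P_multi_univ hc,
    mul_assoc, h.rho_P hc hbc.symm hb, h.P_mul_P hbc]

theorem sum_block (h : IsLow R) (a i j : ι) (X : End ℚ V) :
    lowP R i * lowA R a * X * lowP R j = ∑ k, lowB R a i k * (lowP R k * X * lowP R j) := by
  have h1 : ∀ k, lowB R a i k * (lowP R k * X * lowP R j) =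
      lowP R i * lowA R a * lowP R k * (X * lowP R j) := by
    intro k
    rw [lowB]
    simp only [mul_assoc]
    rw [← mul_assoc (lowP R k) (lowP R k), P_sq]
  rw [Finset.sum_congr rfl fun k _ => h1 k, ← Finset.sum_mul, ← Finset.mul_sum,
    eq_sub_of_add_eq' (P0_add_sum R), mul_sub, mul_one, mul_assoc _ _ (lowP0 R), h.A_P0,
    h.P_mul_P0, sub_zero, mul_assoc]

theorem sum_sq (h : IsLow R) (a i j : ι) :
    lowP R i * lowP R j = ∑ k, lowB R a i k * lowB R a k j := by
  rw [← mul_one (lowP R i), ← A_sq R a, ← mul_assoc]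
  exact h.sum_block a i j _

theorem sum_braid (h : IsLow R) {a c : ι} (hac : c ≠ a) (i j : ι) :
    lowT R (Equiv.swap a c) * lowB R a (Equiv.swap a c i) (Equiv.swap a c j) *
      lowT R (Equiv.swap a c) =
    ∑ k, lowB R a i k * (lowT R (Equiv.swap a c) * lowB R a (Equiv.swap a c k) j) := by
  have h1 : ∀ k, lowT R (Equiv.swap a c) * lowB R a (Equiv.swap a c k) j =
      lowP R k * (lowT R (Equiv.swap a c) * lowA R a) * lowP R j := by
    intro k
    rw [lowB, ← mul_assoc, ← mul_assoc, T_P, Equiv.swap_apply_self, mul_assoc (lowP R k)]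
  simp only [h1]
  rw [← h.sum_block, mul_assoc (lowP R i), ← mul_assoc (lowA R a), ← braid R hac, mul_assoc]
  simp only [mul_assoc]
  rw [T_P, ← mul_assoc (lowP R i), P_T, lowB]
  simp only [mul_assoc]

theorem E_eq (h : IsLow R) {a c d : ι} (hc : c ≠ a) (hd : d ≠ a) : lowE R a c = lowE R a d := by
  have h2 : Equiv.swap c d a = a := Equiv.swap_apply_of_ne_of_ne hc.symm hd.symm
  have h3 := T_A R (Equiv.swap c d) a
  rw [h2] at h3
  have h4 : lowT R (Equiv.swap c d) * lowP R a = lowP R a := h.perm_mul_P h2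
  have h5 : lowP R a * lowT R (Equiv.swap c d) = lowP R a := h.P_mul_perm h2
  rw [lowE, lowE, T_swap_conj R hc hd, ← mul_assoc, ← mul_assoc, h5,
    mul_assoc _ (lowT R (Equiv.swap c d)), h3, ← mul_assoc,
    mul_assoc _ (lowT R (Equiv.swap c d)) (lowP R a), h4]

theorem F_eq (h : IsLow R) {a c d : ι} (hc : c ≠ a) (hd : d ≠ a) : lowF R a c = lowF R a d := by
  have h2 : Equiv.swap c d a = a := Equiv.swap_apply_of_ne_of_ne hc.symm hd.symm
  have h3 := T_A R (Equiv.swap c d) a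
  rw [h2] at h3
  have h4 : lowT R (Equiv.swap c d) * lowP R a = lowP R a := h.perm_mul_P h2
  have h5 : lowP R a * lowT R (Equiv.swap c d) = lowP R a := h.P_mul_perm h2
  rw [lowF, lowF, T_swap_conj R hc hd]
  calc lowP R a * lowA R a * lowT R (Equiv.swap a c) * lowP R a
      = (lowP R a * lowT R (Equiv.swap c d)) * lowA R a * lowT R (Equiv.swap a c) *
        (lowT R (Equiv.swap c d) * lowP R a) := by rw [h4, h5]
    _ = _ := by rw [mul_assoc (lowP R a), h3]; simp only [mul_assoc]

theorem B_fst (R : FreeRep ι V) (a c : ι) :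
    lowB R a a c = lowF R a c * lowT R (Equiv.swap a c) := by
  rw [lowF, mul_assoc _ (lowP R a), P_T_left, mul_assoc, ← mul_assoc (lowT R _), T_sq, one_mul, lowB]

theorem B_snd (R : FreeRep ι V) (a c : ι) :
    lowB R a c a = lowT R (Equiv.swap a c) * lowE R a c := by
  rw [lowE, ← mul_assoc, ← mul_assoc, ← mul_assoc, T_P, Equiv.swap_apply_left,
    mul_assoc (lowP R c), T_sq, mul_one, lowB]

theorem F_P (R : FreeRep ι V) (a c : ι) :
    lowF R a c * lowP R a = lowF R a c := by
  simp only [lowF, mul_assoc, P_sq]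

theorem E_P (R : FreeRep ι V) (a c : ι) :
    lowE R a c * lowP R a = lowE R a c := by
  simp only [lowE, mul_assoc, P_sq]

theorem P_B (R : FreeRep ι V) (a i j : ι) :
    lowP R i * lowB R a i j = lowB R a i j := by
  simp only [lowB, ← mul_assoc, P_sq]

theorem B_P (R : FreeRep ι V) (a i j : ι) :
    lowB R a i j * lowP R j = lowB R a i j := by
  simp only [lowB, mul_assoc, P_sq]

theorem T_P_of_ne (h : IsLow R) {a c b : ι} (hb : b ≠ a) (hbc : b ≠ c) :
    lowT R (Equiv.swap a c) * lowP R b = lowP R b :=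
  h.perm_mul_P (Equiv.swap_apply_of_ne_of_ne hb hbc)

theorem T_cancel (R : FreeRep ι V) {a c : ι} {X Y : End ℚ V}
    (hXY : lowT R (Equiv.swap a c) * X = lowT R (Equiv.swap a c) * Y) : X = Y := by
  have := congrArg (lowT R (Equiv.swap a c) * ·) hXY
  simpa only [← mul_assoc, T_sq, one_mul] using this

theorem cancel_T (R : FreeRep ι V) {a c : ι} {X Y : End ℚ V}
    (hXY : X * lowT R (Equiv.swap a c) = Y * lowT R (Equiv.swap a c)) : X = Y := by
  have := congrArg (· * lowT R (Equiv.swap a c)) hXY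
  simpa only [mul_assoc, T_sq, mul_one] using this

theorem E_mul_F (h : IsLow R) {a c : ι} (hc : c ≠ a) : lowE R a c * lowF R a c = 0 := by
  obtain ⟨b, hb⟩ := h.exists_ne_ne a c
  have h1 := h.sum_sq a c b
  rw [h.P_mul_P (Ne.symm hb.2), Finset.sum_eq_single a, B_snd, B_fst, h.F_eq hb.1 hc, mul_assoc,
    ← mul_assoc (lowE R a c)] at h1
  · exact (cancel_T R (T_cancel R (a := a) (c := c) (by rw [zero_mul, mul_zero, ← h1]) :
      lowE R a c * lowF R a c * lowT R (Equiv.swap a b) = 0 * lowT R (Equiv.swap a b)))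
  · intro k _ hk
    by_cases hkb : k = b
    · rw [hkb, h.B_eq_zero hb.1 hc (Ne.symm hb.2), zero_mul]
    · rw [h.B_eq_zero hb.1 hk hkb, mul_zero]
  · simp

theorem B_self_sq (h : IsLow R) {a c : ι} (hc : c ≠ a) :
    lowB R a c c * lowB R a c c = lowP R c := by
  have h1 := h.sum_sq a c c
  rw [← Finset.sum_subset (Finset.subset_univ {a, c}), Finset.sum_pair hc.symm, P_sq, B_snd, B_fst,
    mul_assoc, ← mul_assoc (lowE R a c), h.E_mul_F hc, zero_mul, mul_zero, zero_add] at h1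
  · exact h1.symm
  · intro k _ hk
    simp only [Finset.mem_insert, Finset.mem_singleton, not_or] at hk
    rw [h.B_eq_zero hc hk.1 hk.2, mul_zero]

theorem B_self (h : IsLow R) {a b : ι} (hb : b ≠ a) : lowB R a b b = lowP R b := by
  obtain ⟨c, hc⟩ := h.exists_ne_ne a b
  have hbc : b ≠ c := Ne.symm hc.2
  have h1 := h.sum_braid hc.1 b b
  have h2 : Equiv.swap a c b = b := Equiv.swap_apply_of_ne_of_ne hb hbc
  rw [h2, Finset.sum_eq_single b, h2] at h1
  · rw [← P_B, ← mul_assoc, h.T_P_of_ne hb hbc, P_B, h.B_self_sq hb, ← B_P, mul_assoc,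
      show lowP R b * lowT R (Equiv.swap a c) = lowP R b from h.P_mul_perm h2, B_P] at h1
    exact h1
  · intro k _ hk
    by_cases hka : k = a
    · rw [hka, Equiv.swap_apply_left, h.B_eq_zero hb hc.1 hc.2, mul_zero, mul_zero]
    · rw [h.B_eq_zero hka hb (Ne.symm hk), zero_mul]
  · simp

theorem F_eq_add (h : IsLow R) {a c : ι} (hc : c ≠ a) :
    lowF R a c = lowB R a a a + lowE R a c * lowE R a c := by
  have h1 := h.sum_braid hc c a
  rw [Equiv.swap_apply_left, Equiv.swap_apply_right,
    ← Finset.sum_subset (Finset.subset_univ {a, c}), Finset.sum_pair hc.symm,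
    Equiv.swap_apply_left, Equiv.swap_apply_right, B_fst, B_snd, h.B_self hc, ← mul_assoc (lowT R _)
    (lowT R _), T_sq, one_mul, ← mul_assoc, mul_assoc _ (lowT R _), T_sq, mul_one,
    ← mul_assoc (lowP R c)] at h1
  · rw [P_T_right, mul_assoc _ (lowP R a), P_B,
      mul_assoc, ← mul_add] at h1
    rw [T_cancel R h1, add_comm]
  · intro k _ hk
    simp only [Finset.mem_insert, Finset.mem_singleton, not_or] at hk
    rw [h.B_eq_zero hk.1 hc (Ne.symm hk.2), zero_mul]

theorem B_B_snd (h : IsLow R) {a b c : ι} (hb : b ≠ a) (hbc : b ≠ c) :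
    lowT R (Equiv.swap a c) * lowB R a b a = lowB R a b a := by
  rw [← P_B, ← mul_assoc, h.T_P_of_ne hb hbc]

theorem E_sq (h : IsLow R) {a c : ι} (hc : c ≠ a) :
    lowE R a c * lowE R a c = - lowE R a c := by
  obtain ⟨b, hb⟩ := h.exists_ne_ne a c
  have h1 := h.sum_braid hc b a
  have h2 : Equiv.swap a c b = b := Equiv.swap_apply_of_ne_of_ne hb.1 hb.2
  rw [h2, Equiv.swap_apply_left, h.B_eq_zero hc hb.1 hb.2, mul_zero, zero_mul,
    ← Finset.sum_subset (Finset.subset_univ {a, b}), Finset.sum_pair (Ne.symm hb.1), h2,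
    Equiv.swap_apply_left, h.B_self hb.1, h.B_B_snd hb.1 hb.2, P_B, B_snd, B_snd, h.E_eq hb.1 hc,
    ← mul_assoc (lowT R (Equiv.swap a c)), T_sq, one_mul, mul_assoc, ← mul_add] at h1
  · refine eq_neg_of_add_eq_zero_left (T_cancel R (a := a) (c := b) ?_)
    rw [← h1, mul_zero]
  · intro k _ hk
    simp only [Finset.mem_insert, Finset.mem_singleton, not_or] at hk
    rw [h.B_eq_zero hk.1 hb.1 (Ne.symm hk.2), zero_mul]

theorem F_sq (h : IsLow R) {a c : ι} (hc : c ≠ a) :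
    lowF R a c * lowF R a c = - lowF R a c := by
  obtain ⟨b, hb⟩ := h.exists_ne_ne a c
  have h1 := h.sum_braid hc a b
  have h2 : Equiv.swap a c b = b := Equiv.swap_apply_of_ne_of_ne hb.1 hb.2
  rw [h2, Equiv.swap_apply_left, h.B_eq_zero hb.1 hc (Ne.symm hb.2), mul_zero, zero_mul,
    ← Finset.sum_subset (Finset.subset_univ {c, b}), Finset.sum_pair (Ne.symm hb.2), h2,
    Equiv.swap_apply_right, h.B_self hb.1, h.T_P_of_ne hb.1 hb.2, B_P, B_fst, B_fst,
    h.F_eq hb.1 hc, mul_assoc (lowF R a c), ← mul_assoc (lowT R (Equiv.swap a c)), T_sq, one_mul,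
    ← mul_assoc, ← add_mul] at h1
  · refine eq_neg_of_add_eq_zero_left (cancel_T R (a := a) (c := b) ?_)
    rw [← h1, zero_mul]
  · intro k _ hk
    simp only [Finset.mem_insert, Finset.mem_singleton, not_or] at hk
    by_cases hka : k = a
    · rw [hka, Equiv.swap_apply_left, h.B_eq_zero hb.1 hc (Ne.symm hb.2), mul_zero, mul_zero]
    · rw [Equiv.swap_apply_of_ne_of_ne hka hk.1, h.B_eq_zero hb.1 hka hk.2, mul_zero, mul_zero]

/-- The trace of the blocks of `lowA`, up to the contribution of `lowP0 R`. -/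
theorem trace_E_add_F (h : IsLow R) {a c : ι} (hc : c ≠ a) :
    LinearMap.trace ℚ V (lowE R a c) + LinearMap.trace ℚ V (lowF R a c) =
      - LinearMap.trace ℚ V (lowP R a) := by
  have h1 := h.sum_sq a a a
  have hF : ∀ d ∈ Finset.univ.erase a,
      lowB R a a d * lowB R a d a = lowF R a c * lowE R a c := by
    intro d hd
    have hd' := Finset.ne_of_mem_erase hd
    rw [B_fst, B_snd, mul_assoc, ← mul_assoc (lowT R _), T_sq, one_mul, h.F_eq hd' hc,
      h.E_eq hd' hc]
  have hG : lowB R a a a = lowE R a c + lowF R a c := by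
    rw [h.F_eq_add hc, h.E_sq hc]; abel
  have hEF := h.E_mul_F hc
  rw [P_sq, ← Finset.add_sum_erase _ _ (Finset.mem_univ a), Finset.sum_congr rfl hF, hG,
    Finset.sum_const] at h1
  have h2 := congrArg (LinearMap.trace ℚ V) h1
  have h3 : LinearMap.trace ℚ V (lowF R a c * lowE R a c) = 0 := by
    rw [LinearMap.trace_mul_comm, hEF, map_zero]
  simp only [add_mul, mul_add, h.E_sq hc, h.F_sq hc, hEF, map_add, map_neg, map_zero, map_nsmul,
    h3, smul_zero] at h2
  linarith

theorem trace_A_T (h : IsLow R) {a : ι} {r : Equiv.Perm ι} (hr : ∀ i, r i ≠ i) :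
    LinearMap.trace ℚ V (lowA R a * lowT R r) =
      LinearMap.trace ℚ V (lowP0 R) - LinearMap.trace ℚ V (lowP R a) := by
  have h0 : lowP0 R * (lowA R a * lowT R r) = lowP0 R := by
    rw [← mul_assoc, h.P0_A, lowT, ← perm_P0 R r, h.perm_mul_P0 r]
  have hi : ∀ i, LinearMap.trace ℚ V (lowP R i * (lowA R a * lowT R r)) =
      LinearMap.trace ℚ V (lowB R a i (r i) * lowT R r) := by
    intro i
    rw [← P_sq R i, mul_assoc, LinearMap.trace_mul_comm, lowB]
    congr 1
    simp only [mul_assoc]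
    rw [T_P]
  have hc : r.symm a ≠ a := fun e => hr a (by conv_lhs => rw [← e, Equiv.apply_symm_apply])
  have h1 : lowB R a a (r a) * lowT R r = lowF R a (r a) := by
    rw [B_fst, mul_assoc, ← T_mul, ← F_P, mul_assoc]
    congr 1
    exact h.P_mul_perm (by simp)
  have h2 : LinearMap.trace ℚ V (lowB R a (r.symm a) a * lowT R r) =
      LinearMap.trace ℚ V (lowE R a (r.symm a)) := by
    rw [B_snd, mul_assoc, LinearMap.trace_mul_comm, mul_assoc, ← T_mul, ← E_P, mul_assoc]
    congr 2
    exact h.P_mul_perm (by simp)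
  have h3 : lowA R a * lowT R r = lowP0 R * (lowA R a * lowT R r) +
      ∑ i, lowP R i * (lowA R a * lowT R r) := by
    rw [← Finset.sum_mul, ← add_mul, P0_add_sum, one_mul]
  rw [h3, map_add, h0, map_sum, Finset.sum_congr rfl fun i _ => hi i,
    ← Finset.sum_subset (Finset.subset_univ {a, r.symm a}), Finset.sum_pair (Ne.symm hc),
    Equiv.apply_symm_apply, h1, h2, h.E_eq hc (hr a), add_comm (LinearMap.trace ℚ V (lowF _ _ _)),
    h.trace_E_add_F (hr a), sub_eq_add_neg]
  intro k _ hk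
  simp only [Finset.mem_insert, Finset.mem_singleton, not_or] at hk
  rw [h.B_eq_zero (fun e => hk.2 (by rw [← e, Equiv.symm_apply_apply])) hk.1 (hr k).symm, zero_mul,
    map_zero]

end IsLow

namespace FreeAut

/-- The composition of the inversion of all generators with the automorphism of order `k + 2`. -/
def gam (k : ℕ) : MulAut (FreeGroup (Fin (k + 1))) := epsSet Finset.univ * aut (cyc k)

end FreeAut

namespace IsLow

variable {k : ℕ} {R : FreeRep (Fin (k + 1)) V} [FiniteDimensional ℚ V]

theorem aut_cyc_eq (R : FreeRep (Fin (k + 1)) V) :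
    R (aut (cyc k)) = lowA R 0 * lowT R (finRotate (k + 1)) := by
  rw [aut_cyc, _root_.map_mul]; rfl

theorem cyc_P0 (h : IsLow R) : R (aut (cyc k)) * lowP0 R = lowP0 R := by
  rw [aut_cyc_eq, mul_assoc, lowT, h.perm_mul_P0, h.A_P0]

theorem P0_cyc (h : IsLow R) : lowP0 R * R (aut (cyc k)) = lowP0 R := by
  rw [aut_cyc_eq, ← mul_assoc, h.P0_A, lowT, ← perm_P0 R, h.perm_mul_P0]

theorem trace_gam (h : IsLow R) :
    LinearMap.trace ℚ V (R (gam k)) = finrank ℚ (LinearMap.range (lowP0 R)) +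
      finrank ℚ (LinearMap.range (lowP R 0)) := by
  have hr : ∀ i, finRotate (k + 1) i ≠ i := by
    have := h.card
    rw [Fintype.card_fin] at this
    intro i hi
    rw [finRotate_apply] at hi
    have h1 : (1 : Fin (k + 1)) = 0 := add_eq_left.1 hi
    have h2 := congrArg Fin.val h1
    rw [Fin.val_one', Fin.val_zero, Nat.mod_eq_of_lt (by omega)] at h2
    omega
  rw [gam, _root_.map_mul, h.epsSet_univ, sub_mul, smul_mul_assoc, h.P0_cyc, one_mul, map_sub,
    map_smul, aut_cyc_eq, h.trace_A_T hr, ← h.trace_P0, ← trace_P, smul_eq_mul]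
  ring

theorem finrank_ker_gam (h : IsLow R) (hk : Even (k + 1)) :
    finrank ℚ (LinearMap.ker (R (gam k) - 1)) = finrank ℚ (LinearMap.range (lowP0 R)) := by
  have hD := h.epsSet_univ
  have hc : Commute (R (epsSet Finset.univ)) (R (aut (cyc k))) := by
    rw [hD, Commute, SemiconjBy, sub_mul, mul_sub, smul_mul_assoc, mul_smul_comm, h.P0_cyc,
      h.cyc_P0, one_mul, mul_one]
  have hD2 : R (epsSet Finset.univ) * R (epsSet Finset.univ) = 1 := by
    rw [← _root_.map_mul, epsSet_mul_self, _root_.map_one]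
  have hpow : R (gam k) ^ (k + 2) = R (epsSet Finset.univ) := by
    obtain ⟨l, hl⟩ := hk
    rw [gam, _root_.map_mul, hc.mul_pow, ← _root_.map_pow R (aut (cyc k)), aut_cyc_pow,
      _root_.map_one, mul_one, show k + 2 = 2 * l + 1 by omega, pow_succ, pow_mul, pow_two, hD2,
      one_pow, one_mul]
  suffices h1 : LinearMap.ker (R (gam k) - 1) = LinearMap.range (lowP0 R) by rw [h1]
  ext x
  rw [LinearMap.mem_ker, LinearMap.sub_apply, sub_eq_zero, End.one_apply]
  have key : R (epsSet Finset.univ) x = x → lowP0 R x = x := by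
    intro hx
    rw [hD, LinearMap.sub_apply, LinearMap.smul_apply, End.one_apply, sub_eq_iff_eq_add,
      ← two_smul ℚ x] at hx
    exact smul_right_injective V two_ne_zero hx
  constructor
  · intro hx
    refine ⟨x, key ?_⟩
    rw [← hpow]
    generalize k + 2 = N
    induction N with
    | zero => rfl
    | succ N ih => rw [pow_succ, End.mul_apply, hx, ih]
  · rintro ⟨y, rfl⟩
    rw [gam, _root_.map_mul, End.mul_apply, mul_apply_of_eq h.cyc_P0, hD, LinearMap.sub_apply,
      LinearMap.smul_apply, h.P0_idem, End.one_apply, two_smul, add_sub_cancel_right]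

theorem finrank_eq_add (h : IsLow R) : finrank ℚ V = finrank ℚ (LinearMap.range (lowP0 R)) +
    (k + 1) * finrank ℚ (LinearMap.range (lowP R 0)) := by
  have h1 := finrank_eq R 0
  rw [trace_P, h.trace_P0, Fintype.card_fin] at h1
  exact_mod_cast h1

theorem eps_eq_one (h : finrank ℚ (LinearMap.range (lowP R 0)) = 0) (i : Fin (k + 1)) :
    R (eps i) = 1 := by
  have h1 := trace_P_eq R 0 i
  rw [trace_P, trace_P, h, Nat.cast_zero, eq_comm, Nat.cast_eq_zero, Submodule.finrank_eq_zero,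
    LinearMap.range_eq_bot] at h1
  rw [eps_eq, h1, smul_zero, sub_zero]

end IsLow

end

namespace FreeAut

/-- Automorphisms sending generators to letters. -/
def letterAuts (ι : Type*) : Set (MulAut (FreeGroup ι)) :=
  {γ | ∀ i, ∃ s, γ (of i) = FreeGroup.mk [s]}

theorem letterAuts_finite (ι : Type*) [Finite ι] : (letterAuts ι).Finite := by
  have h1 : (Set.pi Set.univ fun _ : ι =>
      Set.range fun s : ι × Bool => FreeGroup.mk [s]).Finite :=
    Set.Finite.pi fun _ => Set.finite_range _
  refine Set.Finite.of_finite_image (f := fun (γ : MulAut (FreeGroup ι)) i => γ (of i))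
    (h1.subset ?_) fun α _ β _ hαβ => ext_of fun k => congrFun hαβ k
  rintro _ ⟨γ, hγ, rfl⟩ i -
  obtain ⟨s, hs⟩ := hγ i
  exact ⟨s, hs.symm⟩

theorem range_finite_of_transvections {ι G : Type*} [Fintype ι] [DecidableEq ι] [Group G]
    {ψ : MulAut (FreeGroup ι) →* G} (h1 : ∀ i j, i ≠ j → ψ (rho i j) = 1)
    (h2 : ∀ i j, i ≠ j → ψ (lam i j) = 1) : (Set.range ψ).Finite := by
  have h3 : transvections ι ≤ ψ.ker := by
    rw [transvections, Subgroup.closure_le]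
    rintro _ ⟨i, j, hij, rfl | rfl⟩
    · exact h1 i j hij
    · exact h2 i j hij
  refine ((letterAuts_finite ι).image ψ).subset ?_
  rintro _ ⟨α, rfl⟩
  obtain ⟨β, hβ, hs⟩ := exists_mul_letter α
  exact ⟨β * α, hs, by rw [_root_.map_mul, h3 hβ, one_mul]⟩

end FreeAut

/-- The representation of `Aut(F_n)` on the rational cohomology of `F_m` defined by a homomorphism
of outer automorphism groups. -/
def homRep {n m : ℕ} (φ : OutFG n →* OutFG m) : FreeRep (Fin n) (H1 m) :=
  (outRep m).comp (φ.comp OutFG.mk)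

theorem homRep_apply {n m : ℕ} (φ : OutFG n →* OutFG m) (g : MulAut (FreeGroup (Fin n))) :
    homRep φ g = outRep m (φ (OutFG.mk g)) := rfl

theorem homRep_conj {n m : ℕ} (φ : OutFG n →* OutFG m) (g : FreeGroup (Fin n)) :
    homRep φ (MulAut.conj g) = 1 := by
  rw [homRep_apply, OutFG.mk_conj, _root_.map_one, _root_.map_one]

theorem eq_one_of_homRep {n m : ℕ} (hm : 2 ≤ m) (φ : OutFG n →* OutFG m)
    {g : MulAut (FreeGroup (Fin n))} (hg : IsOfFinOrder (φ (OutFG.mk g))) (h : homRep φ g = 1) :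
    φ (OutFG.mk g) = 1 :=
  OutFG.eq_one_of_isOfFinOrder hm hg h

/-- A homomorphism has finite image if the even sign changes act trivially on cohomology. -/
theorem range_finite_of_eps {n m : ℕ} (hn : 6 ≤ n) (hm : 2 ≤ m) (hdim : m + 1 < 2 ^ (n - 1))
    (φ : OutFG n →* OutFG m) (h : ∀ i j, homRep φ (eps i) = homRep φ (eps j)) :
    (Set.range φ).Finite := by
  set ψ := φ.comp OutFG.mk with hψ
  have hsq : ∀ i, ψ (eps i) * ψ (eps i) = 1 := fun i => by
    rw [← _root_.map_mul, eps_mul_self, _root_.map_one]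
  have heps : ∀ i j, ψ (eps i) = ψ (eps j) := by
    intro i j
    have hc : eps i * eps j = eps j * eps i := eps_comm i j
    have h2 : (eps i * eps j) ^ 2 = 1 := by
      rw [pow_two, mul_assoc, ← mul_assoc (eps j), ← hc, mul_assoc, eps_mul_self, mul_one,
        eps_mul_self]
    have h1 : ψ (eps i * eps j) = 1 := by
      refine eq_one_of_homRep hm φ (isOfFinOrder_iff_pow_eq_one.2 ⟨2, two_pos, ?_⟩) ?_
      · rw [← _root_.map_pow, ← _root_.map_pow, h2, _root_.map_one, _root_.map_one]
      · rw [_root_.map_mul, h i j, ← _root_.map_mul, eps_mul_self, _root_.map_one]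
    rw [_root_.map_mul] at h1
    have := congrArg (· * ψ (eps j)) h1
    simpa only [mul_assoc, hsq, mul_one, one_mul] using this
  have hlam : ∀ i j, i ≠ j → ψ (lam i j) = ψ (rho i j) := by
    intro i j hij
    rw [lam_eq_conj hij]
    simp only [_root_.map_mul]
    rw [heps i j, hsq, one_mul, mul_assoc, hsq, mul_one]
  have hrho : ∀ i j, i ≠ j → ψ (rho i j) * ψ (rho i j) = 1 := by
    intro i j hij
    obtain ⟨k, hk⟩ : ∃ k, k ∉ ({i, j} : Finset (Fin n)) := by
      by_contra hc
      push Not at hc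
      have h1 := Finset.card_le_card (fun x _ => hc x : Finset.univ ⊆ ({i, j} : Finset (Fin n)))
      have h2 := Finset.card_le_two (a := i) (b := j)
      rw [Finset.card_univ, Fintype.card_fin] at h1
      omega
    simp only [Finset.mem_insert, Finset.mem_singleton, not_or] at hk
    have h1 := congrArg ψ (eps_rho_eps_snd hij)
    have h2 := congrArg ψ (eps_rho_comm hk.1 hk.2).eq
    simp only [_root_.map_mul, _root_.map_one] at h1 h2
    rw [heps j k, h2, mul_assoc (ψ (rho i j)), hsq, mul_one] at h1
    exact h1
  have hone : ∀ i j, i ≠ j → ψ (rho i j) = 1 := by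
    intro i j hij
    refine OutFG.eq_one_of_isOfFinOrder hm
      (isOfFinOrder_iff_pow_eq_one.2 ⟨2, two_pos, by rw [pow_two]; exact hrho i j hij⟩) ?_
    have hcomm : ∀ {g k : MulAut (FreeGroup (Fin n))}, Commute g k →
      Commute (outRep m (ψ g)) (outRep m (ψ k)) := fun hgk => (hgk.map ψ).map (outRep m)
    refine eq_one_of_finrank_lt (R := fun i j => outRep m (ψ (rho i j)))
      (fun i j hij => by rw [← _root_.map_mul, hrho i j hij, _root_.map_one])
      (fun i j k hij hik => by
        rw [← hlam i k hik]; exact hcomm (rho_lam_comm i hij hik))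
      (fun i j k hij hik => hcomm (rho_comm_snd hij hik))
      (fun i j k hij hik hjk => by
        simp only [← _root_.map_mul]; rw [rho_mul_rho hij hik hjk])
      (fun i j k l h1 h2 h3 h4 h5 => hcomm (rho_comm_of_ne h1 h2 h3 h4 h5)) ?_ hij
    rwa [finrank_H1, Fintype.card_fin]
  have := range_finite_of_transvections hone fun i j hij => by rw [hlam i j hij, hone i j hij]
  rwa [hψ, MonoidHom.coe_comp, Set.range_comp, OutFG.mk_surjective.range_eq, Set.image_univ] at this

section Weights

variable {ι V : Type*} [Fintype ι] [DecidableEq ι] [AddCommGroup V] [Module ℚ V]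

/-- The simultaneous eigenspaces of the inversions of the generators. -/
def wtR (R : FreeRep ι V) (I : Finset ι) : Submodule ℚ V :=
  wt (fun i => R (eps i)) I

variable {R : FreeRep ι V}

theorem mem_wtR {I : Finset ι} {v : V} :
    v ∈ wtR R I ↔ (∀ i ∈ I, R (eps i) v = -v) ∧ ∀ i ∉ I, R (eps i) v = v :=
  mem_wt_iff

theorem R_eps_sq (R : FreeRep ι V) (i : ι) :
    R (eps i) * R (eps i) = 1 := by
  rw [← _root_.map_mul, eps_mul_self, _root_.map_one]

theorem R_eps_comm (R : FreeRep ι V) (i j : ι) :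
    Commute (R (eps i)) (R (eps j)) :=
  (eps_comm i j).map R

theorem iSup_wtR (R : FreeRep ι V) : ⨆ I, wtR R I = ⊤ :=
  iSup_wt (R_eps_sq R) (R_eps_comm R)

theorem eq_of_wtR {X Y : End ℚ V} (h : ∀ I, ∀ v ∈ wtR R I, X v = Y v) : X = Y := by
  ext v
  have hv : v ∈ ⨆ I, wtR R I := by rw [iSup_wtR]; trivial
  suffices h1 : ⨆ I, wtR R I ≤ LinearMap.eqLocus X Y from h1 hv
  exact iSup_le h

theorem sum_finrank_wtR [FiniteDimensional ℚ V] (R : FreeRep ι V) :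
    finrank ℚ V = ∑ I, finrank ℚ (wtR R I) :=
  sum_finrank_wt (R_eps_sq R) (R_eps_comm R)

theorem perm_mem_wtR {I : Finset ι} {v : V} (π : Equiv.Perm ι) (hv : v ∈ wtR R I) :
    R (perm π) v ∈ wtR R (I.map π.toEmbedding) := by
  rw [mem_wtR] at hv ⊢
  have key : ∀ i, R (eps (π i)) (R (perm π) v) = R (perm π) (R (eps i) v) := fun i => by
    rw [← End.mul_apply, ← End.mul_apply, ← _root_.map_mul, ← _root_.map_mul, perm_eps]
  refine ⟨fun i hi => ?_, fun i hi => ?_⟩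
  · obtain ⟨j, hj, rfl⟩ := Finset.mem_map.1 hi
    exact (key j).trans (by rw [hv.1 j hj, map_neg])
  · obtain ⟨j, rfl⟩ := π.surjective i
    rw [key, hv.2 j fun hj => hi (Finset.mem_map_of_mem _ hj)]

theorem finrank_wtR_le [FiniteDimensional ℚ V] (I : Finset ι) (π : Equiv.Perm ι) :
    finrank ℚ (wtR R I) ≤ finrank ℚ (wtR R (I.map π.toEmbedding)) := by
  refine LinearMap.finrank_le_finrank_of_injective
    (f := (R (perm π)).restrict fun v hv => perm_mem_wtR π hv) ?_
  intro v w hvw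
  exact Subtype.ext (IsLow.R_injective R (perm π) (congrArg Subtype.val hvw))

theorem finrank_wtR_eq [FiniteDimensional ℚ V] (R : FreeRep ι V)
    {I J : Finset ι} (h : I.card = J.card) : finrank ℚ (wtR R I) = finrank ℚ (wtR R J) := by
  have key : ∀ {I J : Finset ι}, I.card = J.card → finrank ℚ (wtR R I) ≤ finrank ℚ (wtR R J) := by
    intro I J h
    let e : {x // x ∈ I} ≃ {x // x ∈ J} := Finset.equivOfCardEq h
    have hπ : I.map e.extendSubtype.toEmbedding = J := by
      refine Finset.eq_of_subset_of_card_le (fun x hx => ?_) (by rw [Finset.card_map, h])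
      obtain ⟨y, hy, rfl⟩ := Finset.mem_map.1 hx
      exact e.extendSubtype_mem y hy
    exact (finrank_wtR_le I e.extendSubtype).trans_eq (by rw [hπ])
  exact le_antisymm (key h) (key h.symm)

end Weights

section Det

/-- The determinant of the action on cohomology. -/
def detChar (n : ℕ) : MulAut (FreeGroup (Fin n)) →* ℚ := LinearMap.det.comp (autRep n)

variable {n : ℕ}

theorem detChar_conj (g : FreeGroup (Fin n)) : detChar n (MulAut.conj g) = 1 := by
  rw [detChar, MonoidHom.comp_apply, ← outRep_mk, OutFG.mk_conj, _root_.map_one, _root_.map_one]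

theorem detChar_eps (i : Fin n) : detChar n (eps i) = -1 := by
  rw [detChar, MonoidHom.comp_apply, ← LinearMap.det_conj _ (homQFree (Fin n))]
  have h1 : (homQFree (Fin n) : H1 n →ₗ[ℚ] (Fin n → ℚ)) ∘ₗ (autRep n (eps i)) ∘ₗ
      ((homQFree (Fin n)).symm : (Fin n → ℚ) →ₗ[ℚ] H1 n) =
      Matrix.toLin' (Matrix.diagonal fun k => if k = i then -1 else 1) := by
    have h2 : ∀ w : H1 n, homQFree (Fin n) (autRep n (eps i) w) =
        Matrix.toLin' (Matrix.diagonal fun k => if k = i then -1 else 1)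
          (homQFree (Fin n) w) := by
      intro w
      funext k
      rw [Matrix.toLin'_apply, Matrix.mulVec_diagonal]
      change (autRep n (eps i) w).1 (of k) = _ * w.1 (of k)
      rw [autRep_apply, eps_inv]
      split_ifs with h
      · rw [h, eps_self, homQ_inv w.2 trivial, neg_one_mul]
      · rw [eps_of_ne h, one_mul]
    refine LinearMap.ext fun v => ?_
    simpa using h2 ((homQFree (Fin n)).symm v)
  rw [h1, LinearMap.det_toLin', Matrix.det_diagonal, Finset.prod_ite_eq']
  simp

theorem detChar_epsSet (s : Finset (Fin n)) : detChar n (epsSet s) = (-1) ^ s.card := by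
  induction s using Finset.induction_on with
  | empty => rw [epsSet_empty, _root_.map_one, Finset.card_empty, pow_zero]
  | insert i s hi ih =>
    rw [epsSet_insert hi, _root_.map_mul, detChar_eps, ih, Finset.card_insert_of_notMem hi,
      pow_succ']

theorem detChar_of_pow_odd {g : MulAut (FreeGroup (Fin n))} {N : ℕ} (hN : Odd N)
    (hg : g ^ N = 1) : detChar n g = 1 := by
  have h1 := congrArg (detChar n) hg
  rw [_root_.map_pow, _root_.map_one] at h1
  exact hN.strictMono_pow.injective (by simpa using h1)

theorem detChar_gam {k : ℕ} (hk : Even (k + 1)) : detChar (k + 1) (gam k) = 1 := by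
  rw [gam, _root_.map_mul, detChar_epsSet, Finset.card_univ, Fintype.card_fin, hk.neg_one_pow,
    one_mul, detChar_of_pow_odd (N := k + 2) hk.add_one aut_cyc_pow]

end Det

namespace FreeAut

variable {ι : Type*} [DecidableEq ι]

theorem of_ne_inv_of {i k : ι} (h : k ≠ i) : of k ≠ (of i)⁻¹ := fun hc => by
  have h1 := congrArg (lift fun x => if x = k then Multiplicative.ofAdd (1 : ℤ) else 1) hc
  rw [_root_.map_inv, lift_apply_of, lift_apply_of, if_pos rfl, if_neg h.symm, inv_one] at h1
  exact absurd h1 (by decide)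

theorem eps_mk_self (s : ι × Bool) : eps s.1 (FreeGroup.mk [s]) = (FreeGroup.mk [s])⁻¹ := by
  obtain ⟨i, b⟩ := s
  cases b
  · change eps i (of i)⁻¹ = ((of i)⁻¹)⁻¹
    rw [_root_.map_inv, eps_self]
  · exact eps_self i

theorem eps_mk_of_ne {i : ι} {s : ι × Bool} (h : s.1 ≠ i) :
    eps i (FreeGroup.mk [s]) = FreeGroup.mk [s] := by
  obtain ⟨j, b⟩ := s
  cases b
  · change eps i (of j)⁻¹ = (of j)⁻¹
    rw [_root_.map_inv, eps_of_ne h]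
  · exact eps_of_ne h

theorem mk_eq_or_of_fst_eq {s t : ι × Bool} (h : s.1 = t.1) :
    FreeGroup.mk [s] = FreeGroup.mk [t] ∨ FreeGroup.mk [s] = (FreeGroup.mk [t])⁻¹ := by
  obtain ⟨i, b⟩ := s
  obtain ⟨j, c⟩ := t
  obtain rfl : i = j := h
  cases b <;> cases c <;> simp [FreeGroup.inv_mk, FreeGroup.invRev]

/-- A letter automorphism permutes the inversions of the generators. -/
theorem exists_letter_eps {β : MulAut (FreeGroup ι)} (hβ : ∀ i, ∃ s, β (of i) = FreeGroup.mk [s]) :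
    ∃ f : ι → ι, Function.Injective f ∧ ∀ i, β * eps i = eps (f i) * β := by
  choose s hs using hβ
  have hinj : ∀ k i, k ≠ i → (s k).1 ≠ (s i).1 := by
    intro k i hki hc
    rcases mk_eq_or_of_fst_eq hc with h | h
    · rw [← hs, ← hs] at h
      exact hki (of_injective (β.injective h))
    · rw [← hs, ← hs, ← _root_.map_inv] at h
      exact of_ne_inv_of hki (β.injective h)
  refine ⟨fun i => (s i).1, fun k i h => by_contra fun hc => hinj k i hc h, fun i => ?_⟩
  refine ext_of fun k => ?_
  rw [MulAut.mul_apply, MulAut.mul_apply]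
  by_cases hk : k = i
  · rw [hk, eps_self, _root_.map_inv, hs, eps_mk_self]
  · rw [eps_of_ne hk, hs, eps_mk_of_ne (hinj k i hk)]

theorem isOfFinOrder_mk_gam (k : ℕ) : IsOfFinOrder (OutFG.mk (gam k)) := by
  rw [gam, _root_.map_mul]
  have hc : Commute (OutFG.mk (epsSet (Finset.univ : Finset (Fin (k + 1)))))
      (OutFG.mk (aut (cyc k))) := by
    rw [aut_cyc, aut_swap, _root_.map_mul, _root_.map_mul]
    refine ((((eps_epsSet Finset.univ 0).symm).map OutFG.mk).mul_right ?_).mul_right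
      ((perm_epsSet_univ _).symm.map OutFG.mk)
    have h := congrArg (OutFG.mk (n := k + 1)) (epsSet_univ_multi (0 : Fin (k + 1)))
    rw [_root_.map_mul, _root_.map_mul, _root_.map_mul, OutFG.mk_conj, one_mul] at h
    exact h
  refine hc.isOfFinOrder_mul (isOfFinOrder_iff_pow_eq_one.2 ⟨2, two_pos, ?_⟩)
    (isOfFinOrder_iff_pow_eq_one.2 ⟨k + 2, by omega, ?_⟩)
  · rw [← _root_.map_pow, pow_two, epsSet_mul_self, _root_.map_one]
  · rw [← _root_.map_pow, aut_cyc_pow, _root_.map_one]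

end FreeAut

theorem homRep_trace {n m : ℕ} (hm : 2 ≤ m) (φ : OutFG n →* OutFG m)
    {g : MulAut (FreeGroup (Fin n))} (hg : IsOfFinOrder (OutFG.mk g)) :
    LinearMap.trace ℚ (H1 m) (homRep φ g) = 1 ∨
      LinearMap.trace ℚ (H1 m) (homRep φ g) ≤ finrank ℚ (LinearMap.ker (homRep φ g - 1)) := by
  have h1 := outRep_trace hm (φ.isOfFinOrder hg)
  by_cases h : ∃ α, OutFG.mk α = φ (OutFG.mk g) ∧ IsOfFinOrder α
  · exact Or.inr (h1.2 h)
  · push Not at h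
    exact Or.inl (h1.1 h)

section Median

variable {ι V : Type*} [Fintype ι] [DecidableEq ι] [AddCommGroup V] [Module ℚ V]

/-- The majority sign of three inversions of generators. -/
def median (R : FreeRep ι V) (a b c : ι) : End ℚ V :=
  (2⁻¹ : ℚ) • (R (eps a) + R (eps b) + R (eps c) - R (eps a) * R (eps b) * R (eps c))

variable {R : FreeRep ι V}

theorem median_apply (a b c : ι) (v : V) : median R a b c v =
    (2⁻¹ : ℚ) • (R (eps a) v + R (eps b) v + R (eps c) v - R (eps a) (R (eps b) (R (eps c) v))) :=
  rfl

theorem median_apply_of_card_le {a b c : ι} (hab : a ≠ b) (hac : a ≠ c) (hbc : b ≠ c)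
    {I : Finset ι} (hI : I.card ≤ 1) {v : V} (hv : v ∈ wtR R I) : median R a b c v = v := by
  rw [mem_wtR] at hv
  have h1 := Finset.card_le_one.1 hI
  rw [median_apply]
  by_cases ha : a ∈ I
  · have hb : b ∉ I := fun hb => hab (h1 a ha b hb)
    have hc : c ∉ I := fun hc => hac (h1 a ha c hc)
    rw [hv.2 c hc, hv.2 b hb, hv.1 a ha]
    module
  · by_cases hb : b ∈ I
    · have hc : c ∉ I := fun hc => hbc (h1 b hb c hc)
      rw [hv.2 c hc, hv.1 b hb, map_neg, hv.2 a ha]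
      module
    · by_cases hc : c ∈ I
      · rw [hv.1 c hc, map_neg, map_neg, hv.2 a ha, hv.2 b hb, hv.2 a ha]
        module
      · rw [hv.2 c hc, hv.2 b hb, hv.2 a ha]
        module

theorem median_apply_of_le_card {a b c : ι} (hab : a ≠ b) (hac : a ≠ c) (hbc : b ≠ c)
    {I : Finset ι} (hI : Iᶜ.card ≤ 1) {v : V} (hv : v ∈ wtR R I) : median R a b c v = -v := by
  rw [mem_wtR] at hv
  have h1 : ∀ x ∉ I, ∀ y ∉ I, x = y := fun x hx y hy =>
    Finset.card_le_one.1 hI x (Finset.mem_compl.2 hx) y (Finset.mem_compl.2 hy)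
  rw [median_apply]
  by_cases ha : a ∈ I
  · by_cases hb : b ∈ I
    · by_cases hc : c ∈ I
      · rw [hv.1 c hc, map_neg, map_neg, hv.1 b hb, map_neg, hv.1 a ha]
        module
      · rw [hv.2 c hc, hv.1 b hb, map_neg, hv.1 a ha]
        module
    · have hc : c ∈ I := by_contra fun hc => hbc (h1 b hb c hc)
      rw [hv.1 c hc, map_neg, map_neg, hv.2 b hb, hv.1 a ha]
      module
  · have hb : b ∈ I := by_contra fun hb => hab (h1 a ha b hb)
    have hc : c ∈ I := by_contra fun hc => hac (h1 a ha c hc)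
    rw [hv.1 c hc, map_neg, map_neg, hv.1 b hb, map_neg, hv.2 a ha]
    module

theorem eps_apply_eq_or {I : Finset ι} {v : V} (hv : v ∈ wtR R I) (i : ι) :
    R (eps i) v = v ∨ R (eps i) v = -v := by
  rw [mem_wtR] at hv
  by_cases hi : i ∈ I
  exacts [Or.inr (hv.1 i hi), Or.inl (hv.2 i hi)]

theorem median_sq (R : FreeRep ι V) (a b c : ι) :
    median R a b c * median R a b c = 1 := by
  refine eq_of_wtR (R := R) fun I v hv => ?_
  have h1 := eps_apply_eq_or hv
  rw [End.mul_apply, median_apply a b c v]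
  rcases h1 a with ha | ha <;> rcases h1 b with hb | hb <;> rcases h1 c with hc | hc <;>
    simp only [ha, hb, hc, map_neg, median_apply, map_smul, map_add, map_sub, End.one_apply] <;>
    module

theorem median_low (R : FreeRep ι V) (a b c : ι) :
    (R (eps a) * median R a b c - 1) * (R (eps b) * median R a b c - 1) = 0 := by
  refine eq_of_wtR (R := R) fun I v hv => ?_
  have h1 := eps_apply_eq_or hv
  rcases h1 a with ha | ha <;> rcases h1 b with hb | hb <;> rcases h1 c with hc | hc <;>
    simp only [ha, hb, hc, map_neg, median_apply, map_smul, map_add, map_sub, End.mul_apply,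
      End.one_apply, LinearMap.sub_apply, LinearMap.zero_apply] <;>
    module

theorem median_commute_eps (R : FreeRep ι V) (a b c i : ι) :
    Commute (median R a b c) (R (eps i)) :=
  (((((R_eps_comm R a i).add_left (R_eps_comm R b i)).add_left (R_eps_comm R c i))).sub_left
    (((R_eps_comm R a i).mul_left (R_eps_comm R b i)).mul_left (R_eps_comm R c i))).smul_left _

theorem exists_three_notMem (h : 6 ≤ Fintype.card ι) (i j : ι) : ∃ a b c : ι, a ≠ b ∧ a ≠ c ∧
    b ≠ c ∧ (a ≠ i ∧ a ≠ j) ∧ (b ≠ i ∧ b ≠ j) ∧ c ≠ i ∧ c ≠ j := by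
  have h1 : 2 < (({i, j} : Finset ι)ᶜ).card := by
    have := Finset.card_le_two (a := i) (b := j)
    rw [Finset.card_compl]
    omega
  obtain ⟨a, ha, b, hb, c, hc, hab, hac, hbc⟩ := Finset.two_lt_card.1 h1
  simp only [Finset.mem_compl, Finset.mem_insert, Finset.mem_singleton, not_or] at ha hb hc
  exact ⟨a, b, c, hab, hac, hbc, ha, hb, hc⟩

theorem commute_of_median (hcard : 6 ≤ Fintype.card ι) {M : End ℚ V}
    (hM : ∀ a b c, a ≠ b → a ≠ c → b ≠ c → median R a b c = M) (g : MulAut (FreeGroup ι)) :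
    Commute M (R g) := by
  have heps : ∀ i, Commute M (R (eps i)) := fun i => by
    obtain ⟨a, b, c, hab, hac, hbc, -⟩ := exists_three_notMem hcard i i
    rw [← hM a b c hab hac hbc]
    exact median_commute_eps R a b c i
  have hrho : ∀ i j, Commute M (R (rho i j)) := fun i j => by
    obtain ⟨a, b, c, hab, hac, hbc, ha, hb, hc⟩ := exists_three_notMem hcard i j
    rw [← hM a b c hab hac hbc]
    have h1 := fun {x : ι} (hx : x ≠ i ∧ x ≠ j) => (eps_rho_comm hx.1 hx.2).map R
    exact ((((h1 ha).add_left (h1 hb)).add_left (h1 hc)).sub_left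
      (((h1 ha).mul_left (h1 hb)).mul_left (h1 hc))).smul_left _
  have htr : ∀ β ∈ transvections ι, Commute M (R β) := by
    intro β hβ
    induction hβ using Subgroup.closure_induction with
    | mem x hx =>
      obtain ⟨i, j, hij, rfl | rfl⟩ := hx
      · exact hrho i j
      · rw [lam_eq_conj hij]
        simp only [_root_.map_mul]
        exact ((((heps i).mul_right (heps j)).mul_right (hrho i j)).mul_right (heps j)).mul_right
          (heps i)
    | one => rw [_root_.map_one]; exact Commute.one_right M
    | mul x y _ _ hx hy => rw [_root_.map_mul]; exact hx.mul_right hy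
    | inv x _ hx =>
      have h1 : R x * R x⁻¹ = 1 := by rw [← _root_.map_mul, mul_inv_cancel, _root_.map_one]
      have h2 : R x⁻¹ * R x = 1 := by rw [← _root_.map_mul, inv_mul_cancel, _root_.map_one]
      calc M * R x⁻¹ = R x⁻¹ * (R x * M) * R x⁻¹ := by rw [← mul_assoc, h2, one_mul]
        _ = R x⁻¹ * M := by rw [← hx.eq, mul_assoc, mul_assoc, h1, mul_one]
  obtain ⟨β, hβ, hs⟩ := exists_mul_letter g
  obtain ⟨f, hf, hfe⟩ := exists_letter_eps hs
  have h1 : Commute M (R (β * g)) := by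
    obtain ⟨x⟩ : Nonempty ι := Fintype.card_pos_iff.1 (by omega)
    obtain ⟨a, b, c, hab, hac, hbc, -⟩ :=
      exists_three_notMem hcard x x
    have h2 : ∀ i, SemiconjBy (R (β * g)) (R (eps i)) (R (eps (f i))) := fun i => by
      rw [SemiconjBy, ← _root_.map_mul, hfe, _root_.map_mul]
    have h3 : SemiconjBy (R (β * g)) (median R a b c) (median R (f a) (f b) (f c)) :=
      ((((h2 a).add_right (h2 b)).add_right (h2 c)).sub_right
      (((h2 a).mul_right (h2 b)).mul_right (h2 c))).smul_right _
    rw [hM a b c hab hac hbc, hM _ _ _ (hf.ne hab) (hf.ne hac) (hf.ne hbc)] at h3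
    exact Commute.symm h3
  have h2 : g = β⁻¹ * (β * g) := by group
  rw [h2, _root_.map_mul]
  exact (htr _ (inv_mem hβ)).mul_right h1

/-- The representation obtained by multiplying the part on which an involution is `-1` by a
character. -/
def twist (R : FreeRep ι V) (χ : MulAut (FreeGroup ι) →* ℚ) (M : End ℚ V)
    (hM : M * M = 1) (hc : ∀ g, Commute M (R g)) : FreeRep ι V where
  toFun g := R g * (((1 + χ g) / 2) • (1 : End ℚ V) + ((1 - χ g) / 2) • M)
  map_one' := by simp
  map_mul' g h := by
    have h1 : M * R h = R h * M := (hc h).eq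
    simp only [_root_.map_mul, mul_add, add_mul, mul_smul_comm, smul_mul_assoc, mul_one, mul_assoc,
      smul_smul, smul_add, h1]
    simp only [← mul_assoc (M : End ℚ V) (R h), h1]
    simp only [mul_assoc, hM, mul_one]
    module

theorem twist_apply (χ : MulAut (FreeGroup ι) →* ℚ) (M : End ℚ V)
    (hM : M * M = 1) (hc : ∀ g, Commute M (R g)) (g : MulAut (FreeGroup ι)) :
    twist R χ M hM hc g = R g * (((1 + χ g) / 2) • (1 : End ℚ V) + ((1 - χ g) / 2) • M) := rfl

theorem twist_of_eq_one {χ : MulAut (FreeGroup ι) →* ℚ} {M : End ℚ V}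
    (hM : M * M = 1) (hc : ∀ g, Commute M (R g)) {g : MulAut (FreeGroup ι)} (hg : χ g = 1) :
    twist R χ M hM hc g = R g := by
  rw [twist_apply, hg]
  norm_num

theorem twist_of_eq_neg_one {χ : MulAut (FreeGroup ι) →* ℚ} {M : End ℚ V}
    (hM : M * M = 1) (hc : ∀ g, Commute M (R g)) {g : MulAut (FreeGroup ι)} (hg : χ g = -1) :
    twist R χ M hM hc g = R g * M := by
  rw [twist_apply, hg]
  norm_num

end Median

/-- A homomorphism has finite image if all weights have at most one or all but at most one
elements. -/
theorem range_finite_of_wtR_extreme {n m : ℕ} (hn : 6 ≤ n) (heven : Even n) (hnm : n ≠ m)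
    (hm : 2 ≤ m) (hm₂ : 2 * m < n * (n + 1)) (hdim : m + 1 < 2 ^ (n - 1)) (φ : OutFG n →* OutFG m)
    (hw : ∀ I : Finset (Fin n), 2 ≤ I.card → I.card + 2 ≤ n → wtR (homRep φ) I = ⊥) :
    (Set.range φ).Finite := by
  obtain ⟨k, rfl⟩ : ∃ k, n = k + 1 := ⟨n - 1, by omega⟩
  have hcard : 6 ≤ Fintype.card (Fin (k + 1)) := by rwa [Fintype.card_fin]
  obtain ⟨M, hM⟩ : ∃ M, ∀ a b c, a ≠ b → a ≠ c → b ≠ c → median (homRep φ) a b c = M := by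
    obtain ⟨x, y, z, hxy, hxz, hyz, -⟩ := exists_three_notMem hcard 0 0
    refine ⟨median (homRep φ) x y z, fun a b c hab hac hbc =>
      eq_of_wtR (R := homRep φ) fun I v hv => ?_⟩
    by_cases h1 : I.card ≤ 1
    · rw [median_apply_of_card_le hab hac hbc h1 hv, median_apply_of_card_le hxy hxz hyz h1 hv]
    · by_cases h2 : Iᶜ.card ≤ 1
      · rw [median_apply_of_le_card hab hac hbc h2 hv, median_apply_of_le_card hxy hxz hyz h2 hv]
      · rw [Finset.card_compl, Fintype.card_fin] at h2
        rw [hw I (by omega) (by omega), Submodule.mem_bot] at hv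
        rw [hv, map_zero, map_zero]
  have hsq : M * M = 1 := by
    obtain ⟨a, b, c, hab, hac, hbc, -⟩ := exists_three_notMem hcard 0 0
    rw [← hM a b c hab hac hbc, median_sq]
  have hc := commute_of_median hcard hM
  set T := twist (homRep φ) (detChar (k + 1)) M hsq hc with hT
  have heps : ∀ i, T (eps i) = homRep φ (eps i) * M := fun i =>
    twist_of_eq_neg_one hsq hc (detChar_eps i)
  have hgam : T (gam k) = homRep φ (gam k) := twist_of_eq_one hsq hc (detChar_gam heven)
  have hlow : IsLow T := by
    refine ⟨fun g => ?_, fun i j hij => ?_, ?_, hcard⟩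
    · rw [hT, twist_of_eq_one hsq hc (detChar_conj g), homRep_conj]
    · obtain ⟨c, -, -, -, -, -, hc', -⟩ := exists_three_notMem hcard i j
      rw [heps, heps, ← hM i j c hij hc'.1.symm hc'.2.symm, median_low]
    · rw [finrank_H1, Fintype.card_fin]
      exact hm₂
  have htr := homRep_trace hm φ (isOfFinOrder_mk_gam k)
  rw [← hgam, hlow.trace_gam, hlow.finrank_ker_gam heven] at htr
  have hadd := hlow.finrank_eq_add
  rw [finrank_H1] at hadd
  by_cases hv : finrank ℚ (LinearMap.range (lowP T 0)) = 0
  · refine range_finite_of_eps hn hm hdim φ fun i j => ?_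
    have h1 : ∀ i, homRep φ (eps i) = M := fun i => by
      have h2 := IsLow.eps_eq_one hv i
      rw [heps] at h2
      calc _ = homRep φ (eps i) * M * M := by rw [mul_assoc, hsq, mul_one]
        _ = M := by rw [h2, one_mul]
    rw [h1, h1]
  · exfalso
    rcases htr with htr | htr
    · have h1 : finrank ℚ (LinearMap.range (lowP0 T)) + finrank ℚ (LinearMap.range (lowP T 0)) = 1 :=
        by exact_mod_cast htr
      have h2 : finrank ℚ (LinearMap.range (lowP T 0)) = 1 := by omega
      rw [h2] at hadd
      omega
    · have h1 : finrank ℚ (LinearMap.range (lowP0 T)) + finrank ℚ (LinearMap.range (lowP T 0)) ≤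
        finrank ℚ (LinearMap.range (lowP0 T)) := by exact_mod_cast htr
      omega

namespace FreeAut

variable {ι : Type*} [Fintype ι] [DecidableEq ι]

theorem eps_rot_comm {i j k : ι} (hij : i ≠ j) (hi : k ≠ i) (hj : k ≠ j) :
    Commute (eps k) (rot i j) := by
  have h : epsSet {k} = eps k := by
    rw [← insert_empty_eq, epsSet_insert (Finset.notMem_empty k), epsSet_empty, mul_one]
  rw [← h]
  exact (rot_epsSet hij (by simpa using hi.symm) (by simpa using hj.symm)).symm

theorem eps_lam_comm {i j k : ι} (hij : i ≠ j) (hi : k ≠ i) (hj : k ≠ j) :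
    Commute (eps k) (lam i j) := by
  rw [lam_eq_conj hij]
  exact ((((eps_comm k i).mul_right (eps_comm k j)).mul_right (eps_rho_comm hi hj)).mul_right
    (eps_comm k j)).mul_right (eps_comm k i)

end FreeAut

section OffWeight

variable {ι V : Type*} [Fintype ι] [DecidableEq ι] [AddCommGroup V] [Module ℚ V]

/-- Vectors that have weight `A` away from `i` and `j`. -/
def IsOffWt (R : FreeRep ι V) (i j : ι) (A : Finset ι) (x : V) : Prop :=
  (∀ k ∈ A, k ≠ i → k ≠ j → R (eps k) x = -x) ∧ ∀ k ∉ A, k ≠ i → k ≠ j → R (eps k) x = x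

variable {R : FreeRep ι V} {i j : ι} {A : Finset ι} {x : V}

theorem isOffWt_of_mem {I : Finset ι} (h : ∀ k, k ≠ i → k ≠ j → (k ∈ A ↔ k ∈ I))
    (hx : x ∈ wtR R I) : IsOffWt R i j A x := by
  rw [mem_wtR] at hx
  exact ⟨fun k hk hi hj => hx.1 k ((h k hi hj).1 hk),
    fun k hk hi hj => hx.2 k fun hc => hk ((h k hi hj).2 hc)⟩

theorem IsOffWt.add {y : V} (hx : IsOffWt R i j A x) (hy : IsOffWt R i j A y) :
    IsOffWt R i j A (x + y) :=
  ⟨fun k hk hi hj => by rw [map_add, hx.1 k hk hi hj, hy.1 k hk hi hj, neg_add],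
    fun k hk hi hj => by rw [map_add, hx.2 k hk hi hj, hy.2 k hk hi hj]⟩

theorem IsOffWt.apply {g : MulAut (FreeGroup ι)} (hg : ∀ k, k ≠ i → k ≠ j → Commute (eps k) g)
    (hx : IsOffWt R i j A x) : IsOffWt R i j A (R g x) := by
  have h1 : ∀ k, k ≠ i → k ≠ j → R (eps k) (R g x) = R g (R (eps k) x) := fun k hi hj => by
    rw [← End.mul_apply, ((hg k hi hj).map R).eq, End.mul_apply]
  exact ⟨fun k hk hi hj => by rw [h1 k hi hj, hx.1 k hk hi hj, map_neg],
    fun k hk hi hj => by rw [h1 k hi hj, hx.2 k hk hi hj]⟩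

theorem IsOffWt.exists_components (hij : i ≠ j) (hi : i ∉ A) (hj : j ∉ A)
    (hx : IsOffWt R i j A x) : ∃ x₀ ∈ wtR R A, ∃ x₁ ∈ wtR R (insert i A),
      ∃ x₂ ∈ wtR R (insert j A), ∃ x₃ ∈ wtR R (insert i (insert j A)),
      x = x₀ + x₁ + (x₂ + x₃) := by
  have hii : ∀ y, R (eps i) (R (eps i) y) = y := fun y => by
    rw [← End.mul_apply, R_eps_sq, End.one_apply]
  have hjj : ∀ y, R (eps j) (R (eps j) y) = y := fun y => by
    rw [← End.mul_apply, R_eps_sq, End.one_apply]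
  have hcc : ∀ k l y, R (eps k) (R (eps l) y) = R (eps l) (R (eps k) y) := fun k l y => by
    rw [← End.mul_apply, (R_eps_comm R k l).eq, End.mul_apply]
  have key : ∀ (s t : ℚ) (I : Finset ι),
      (∀ k, k ≠ i → k ≠ j → (k ∈ I ↔ k ∈ A)) → s * s = 1 → t * t = 1 →
      (s = if i ∈ I then -1 else 1) → (t = if j ∈ I then -1 else 1) →
      (4⁻¹ : ℚ) • (x + s • R (eps i) x + t • R (eps j) x + (s * t) • R (eps i) (R (eps j) x)) ∈
        wtR R I := by
    intro s t I hI hs ht hsi htj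
    set z := (4⁻¹ : ℚ) • (x + s • R (eps i) x + t • R (eps j) x +
      (s * t) • R (eps i) (R (eps j) x)) with hz
    have hzi : R (eps i) z = s • z := by
      rw [hz]
      simp only [map_smul, map_add, hii, smul_add, smul_smul]
      rw [show s * (4⁻¹ * s) = 4⁻¹ * (s * s) by ring, show s * (4⁻¹ * (s * t)) =
        4⁻¹ * (s * s) * t by ring, hs]
      module
    have hzj : R (eps j) z = t • z := by
      rw [hz]
      simp only [map_smul, map_add, hcc j i, hjj, smul_add, smul_smul]
      rw [show t * (4⁻¹ * t) = 4⁻¹ * (t * t) by ring, show t * (4⁻¹ * (s * t)) =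
        4⁻¹ * (t * t) * s by ring, ht]
      module
    have hzk : IsOffWt R i j A z := by
      have h1 : IsOffWt R i j A (R (eps i) x) := hx.apply fun k _ _ => eps_comm k i
      have h2 : IsOffWt R i j A (R (eps j) x) := hx.apply fun k _ _ => eps_comm k j
      have h3 : IsOffWt R i j A (R (eps i) (R (eps j) x)) := h2.apply fun k _ _ => eps_comm k i
      refine ⟨fun k hk hi hj => ?_, fun k hk hi hj => ?_⟩
      · rw [hz]
        simp only [map_smul, map_add, h1.1 k hk hi hj, h2.1 k hk hi hj, h3.1 k hk hi hj,
          hx.1 k hk hi hj]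
        module
      · rw [hz]
        simp only [map_smul, map_add, h1.2 k hk hi hj, h2.2 k hk hi hj, h3.2 k hk hi hj,
          hx.2 k hk hi hj]
    rw [mem_wtR]
    refine ⟨fun k hk => ?_, fun k hk => ?_⟩
    · by_cases hki : k = i
      · rw [hki] at hk ⊢
        rw [hzi, hsi, if_pos hk, neg_one_smul]
      · by_cases hkj : k = j
        · rw [hkj] at hk ⊢
          rw [hzj, htj, if_pos hk, neg_one_smul]
        · exact hzk.1 k ((hI k hki hkj).1 hk) hki hkj
    · by_cases hki : k = i
      · rw [hki] at hk ⊢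
        rw [hzi, hsi, if_neg hk, one_smul]
      · by_cases hkj : k = j
        · rw [hkj] at hk ⊢
          rw [hzj, htj, if_neg hk, one_smul]
        · exact hzk.2 k (fun hc => hk ((hI k hki hkj).2 hc)) hki hkj
  refine ⟨_, key 1 1 A (fun k _ _ => Iff.rfl) (by norm_num) (by norm_num) (by rw [if_neg hi])
      (by rw [if_neg hj]),
    _, key (-1) 1 _ (fun k h _ => by simp [h]) (by norm_num) (by norm_num) (by simp)
      (by simp [hij.symm, hj]),
    _, key 1 (-1) _ (fun k _ h => by simp [h]) (by norm_num) (by norm_num) (by simp [hij, hi])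
      (by simp),
    _, key (-1) (-1) _ (fun k h h' => by simp [h, h']) (by norm_num) (by norm_num) (by simp)
      (by simp), ?_⟩
  module

end OffWeight

/-- Representations whose weights of one cardinality are lines, isolated from the neighbouring
cardinalities. -/
structure IsLine {ι V : Type*} [Fintype ι] [DecidableEq ι] [AddCommGroup V] [Module ℚ V]
    (R : FreeRep ι V) (p : ℕ) : Prop where
  line : ∀ I : Finset ι, I.card = p + 1 → finrank ℚ (wtR R I) = 1
  below : ∀ I : Finset ι, I.card = p → wtR R I = ⊥
  above : ∀ I : Finset ι, I.card = p + 2 ∨ I.card = p + 3 → wtR R I = ⊥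
  card : p + 3 ≤ Fintype.card ι

namespace IsLine

variable {ι V : Type*} [Fintype ι] [DecidableEq ι] [AddCommGroup V] [Module ℚ V]
  [FiniteDimensional ℚ V] {R : FreeRep ι V} {p : ℕ} {i j : ι} {A : Finset ι} {x : V}

theorem mem_line (h : IsLine R p) (hij : i ≠ j) (hA : A.card = p + 1) (hi : i ∉ A) (hj : j ∉ A)
    (hx : IsOffWt R i j A x) : x ∈ wtR R A := by
  obtain ⟨x₀, h0, x₁, h1, x₂, h2, x₃, h3, rfl⟩ := hx.exists_components hij hi hj
  have hji : i ∉ insert j A := by simp [hij, hi]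
  rw [h.above _ (Or.inl (by rw [Finset.card_insert_of_notMem hi, hA])), Submodule.mem_bot] at h1
  rw [h.above _ (Or.inl (by rw [Finset.card_insert_of_notMem hj, hA])), Submodule.mem_bot] at h2
  rw [h.above _ (Or.inr (by rw [Finset.card_insert_of_notMem hji, Finset.card_insert_of_notMem hj,
    hA])), Submodule.mem_bot] at h3
  rwa [h1, h2, h3, add_zero, add_zero, add_zero]

theorem exists_pair (h : IsLine R p) (hij : i ≠ j) (hA : A.card = p) (hi : i ∉ A) (hj : j ∉ A)
    (hx : IsOffWt R i j A x) :
    ∃ x₁ ∈ wtR R (insert i A), ∃ x₂ ∈ wtR R (insert j A), x = x₁ + x₂ := by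
  obtain ⟨x₀, h0, x₁, h1, x₂, h2, x₃, h3, rfl⟩ := hx.exists_components hij hi hj
  have hji : i ∉ insert j A := by simp [hij, hi]
  rw [h.below _ hA, Submodule.mem_bot] at h0
  rw [h.above _ (Or.inl (by rw [Finset.card_insert_of_notMem hji, Finset.card_insert_of_notMem hj,
    hA])), Submodule.mem_bot] at h3
  exact ⟨x₁, h1, x₂, h2, by rw [h0, h3, zero_add, add_zero]⟩

theorem exists_smul (h : IsLine R p) (hA : A.card = p + 1) {u v : V} (hu : u ∈ wtR R A)
    (hu0 : u ≠ 0) (hv : v ∈ wtR R A) : ∃ c : ℚ, v = c • u := by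
  obtain ⟨c, hc⟩ := exists_smul_eq_of_finrank_eq_one (h.line A hA)
    (x := (⟨u, hu⟩ : wtR R A)) (fun hc => hu0 (congrArg Subtype.val hc)) ⟨v, hv⟩
  exact ⟨c, (congrArg Subtype.val hc).symm⟩

theorem eq_zero_of_mem_of_mem {I J : Finset ι} (hIJ : I ≠ J) (hI : x ∈ wtR R I)
    (hJ : x ∈ wtR R J) : x = 0 := by
  rw [mem_wtR] at hI hJ
  obtain ⟨k, hk⟩ : ∃ k, ¬ (k ∈ I ↔ k ∈ J) := by
    by_contra hc
    push Not at hc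
    exact hIJ (Finset.ext hc)
  have h2 : x = -x := by
    by_cases h1 : k ∈ I
    · have h3 : k ∉ J := fun h3 => hk (by simp [h1, h3])
      exact (hJ.2 k h3).symm.trans (hI.1 k h1)
    · have h3 : k ∈ J := by_contra fun h3 => hk (by simp [h1, h3])
      exact (hI.2 k h1).symm.trans (hJ.1 k h3)
  have h3 : (2 : ℚ) • x = 0 := by rw [two_smul]; nth_rewrite 2 [h2]; rw [add_neg_cancel]
  exact (smul_eq_zero.1 h3).resolve_left two_ne_zero

theorem swap_mem {I J : Finset ι} (hIJ : I.map (Equiv.swap i j).toEmbedding = J)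
    (hx : x ∈ wtR R I) : R (perm (Equiv.swap i j)) x ∈ wtR R J :=
  hIJ ▸ perm_mem_wtR _ hx

theorem map_swap_insert (hi : i ∉ A) (hj : j ∉ A) :
    (insert i A).map (Equiv.swap i j).toEmbedding = insert j A := by
  ext k
  simp only [Finset.mem_map_equiv, Equiv.symm_swap, Finset.mem_insert]
  by_cases hki : k = i
  · subst hki
    by_cases hkj : k = j
    · subst hkj; simp
    · simp [hkj, hj, Ne.symm hkj, hi]
  · by_cases hkj : k = j
    · subst hkj; simp
    · rw [Equiv.swap_apply_of_ne_of_ne hki hkj]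
      simp [hki, hkj]

theorem rot_apply (i j : ι) (x : V) :
    R (rot i j) x = R (rho i j) (R (eps i) (R (perm (Equiv.swap i j)) x)) := by
  rw [rot, _root_.map_mul, _root_.map_mul, End.mul_apply, End.mul_apply]

theorem rot_pow_apply (R : FreeRep ι V) (hij : i ≠ j) (x : V) :
    R (rot i j) (R (rot i j) (R (rot i j) x)) = x := by
  rw [← End.mul_apply, ← End.mul_apply, ← _root_.map_mul, ← _root_.map_mul, rot_mul_mul hij,
    _root_.map_one, End.one_apply]

/-- On isolated lines the rotation of order three acts trivially. -/
theorem rot_eq (h : IsLine R p) (hij : i ≠ j) {B : Finset ι} (hB : B.card = p + 1)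
    (hmem : R (rot i j) x ∈ wtR R B) (hx : x ∈ wtR R B) : R (rot i j) x = x := by
  by_cases h0 : x = 0
  · rw [h0, map_zero]
  obtain ⟨c, hc⟩ := h.exists_smul hB hx h0 hmem
  have h1 := rot_pow_apply R hij x
  rw [hc, map_smul, hc, map_smul, map_smul, hc, smul_smul, smul_smul] at h1
  have h2 : c * c * c = 1 := by
    have h3 : (c * c * c - 1) • x = 0 := by rw [sub_smul, h1, one_smul, sub_self]
    exact sub_eq_zero.1 ((smul_eq_zero.1 h3).resolve_right h0)
  have h3 : c = 1 := by
    have : c ^ 3 = 1 ^ 3 := by linear_combination h2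
    exact (Odd.strictMono_pow (by decide : Odd 3)).injective this
  rw [hc, h3, one_smul]

theorem rot_eq_of_notMem (h : IsLine R p) (hij : i ≠ j) (hA : A.card = p + 1) (hi : i ∉ A)
    (hj : j ∉ A) (hx : x ∈ wtR R A) : R (rot i j) x = x :=
  h.rot_eq hij hA (h.mem_line hij hA hi hj ((isOffWt_of_mem (fun _ _ _ => Iff.rfl) hx).apply
    fun _ => eps_rot_comm hij)) hx

/-- A nonzero fixed vector of the rotation makes the transvection interchange two lines. -/
theorem rho_mem_of_fixed (h : IsLine R p) (hij : i ≠ j) (hA : A.card = p) (hi : i ∉ A)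
    (hj : j ∉ A) {y : V} (hx : x ∈ wtR R (insert i A)) (hy : y ∈ wtR R (insert j A))
    (hxy : R (rot i j) (x + y) = x + y) (h0 : x + y ≠ 0) {u : V} (hu : u ∈ wtR R (insert i A)) :
    R (rho i j) u ∈ wtR R (insert j A) := by
  by_cases hu0 : u = 0
  · rw [hu0, map_zero]; exact zero_mem _
  have hAi : (insert i A).card = p + 1 := by rw [Finset.card_insert_of_notMem hi, hA]
  have hAj : (insert j A).card = p + 1 := by rw [Finset.card_insert_of_notMem hj, hA]
  set w := R (perm (Equiv.swap i j)) u with hw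
  have hwu : R (perm (Equiv.swap i j)) w = u := by
    rw [hw, ← End.mul_apply, ← _root_.map_mul, ← perm_mul, Equiv.swap_mul_self, perm_one,
      _root_.map_one, End.one_apply]
  have hwm : w ∈ wtR R (insert j A) := swap_mem (map_swap_insert hi hj) hu
  have hw0 : w ≠ 0 := fun hc => hu0 (by rw [← hwu, hc, map_zero])
  have hne : insert i A ≠ insert j A := fun hc => by
    have : i ∈ insert j A := hc ▸ Finset.mem_insert_self i A
    rcases Finset.mem_insert.1 this with h1 | h1
    exacts [hij h1, hi h1]
  have hindep : ∀ a b c d : ℚ, a • u + b • w = c • u + d • w → a = c ∧ b = d := by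
    intro a b c d he
    have h1 : (a - c) • u = (d - b) • w := by linear_combination (norm := module) he
    have h2 : (a - c) • u = 0 := eq_zero_of_mem_of_mem hne (Submodule.smul_mem _ _ hu)
      (h1 ▸ Submodule.smul_mem _ _ hwm)
    have h3 : (d - b) • w = 0 := h1 ▸ h2
    exact ⟨sub_eq_zero.1 ((smul_eq_zero.1 h2).resolve_right hu0),
      (sub_eq_zero.1 ((smul_eq_zero.1 h3).resolve_right hw0)).symm⟩
  have hpair : ∀ z, IsOffWt R i j A z → ∃ a b : ℚ, z = a • u + b • w := by
    intro z hz
    obtain ⟨z₁, h1, z₂, h2, rfl⟩ := h.exists_pair hij hA hi hj hz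
    obtain ⟨a, rfl⟩ := h.exists_smul hAi hu hu0 h1
    obtain ⟨b, rfl⟩ := h.exists_smul hAj hwm hw0 h2
    exact ⟨a, b, rfl⟩
  have hou : IsOffWt R i j A u := isOffWt_of_mem (fun k h1 _ => by simp [h1]) hu
  have how : IsOffWt R i j A w := isOffWt_of_mem (fun k _ h1 => by simp [h1]) hwm
  obtain ⟨a, c, hac⟩ := hpair _ (hou.apply fun _ => eps_rho_comm)
  obtain ⟨b, d, hbd⟩ := hpair _ (how.apply fun _ => eps_rho_comm)
  obtain ⟨r, s, hrs⟩ := hpair _ ((isOffWt_of_mem (fun k h1 _ => by simp [h1]) hx).add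
    (isOffWt_of_mem (fun k _ h1 => by simp [h1]) hy))
  rw [mem_wtR] at hu hwm
  have hiu : R (eps i) u = -u := hu.1 i (Finset.mem_insert_self i A)
  have hju : R (eps j) u = u := hu.2 j (by simp [hij.symm, hj])
  have hjw : R (eps j) w = -w := hwm.1 j (Finset.mem_insert_self j A)
  have hiw : R (eps i) w = w := hwm.2 i (by simp [hij, hi])
  have hgu : R (rot i j) u = b • u + d • w := by rw [rot_apply, ← hw, hiw, hbd]
  have hgw : R (rot i j) w = (-a) • u + (-c) • w := by
    rw [rot_apply, hwu, hiu, map_neg, hac]; module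
  have hrel : ∀ z, R (eps j) (R (rho i j) (R (eps j) (R (rho i j) z))) = z := fun z => by
    have h1 := congrArg (fun g => R g z) (eps_rho_eps_snd hij)
    simpa only [_root_.map_mul, End.mul_apply, _root_.map_one, End.one_apply] using h1
  have h1 := hrel u
  simp only [hac, hbd, map_add, map_smul, hju, hjw, smul_neg, map_neg] at h1
  obtain ⟨e1, e2⟩ := hindep (a * a - c * b) (-(a * c - c * d)) 1 0 (by
    linear_combination (norm := module) h1)
  have h2 := hrel w
  simp only [hac, hbd, map_add, map_smul, hju, hjw, smul_neg, map_neg] at h2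
  obtain ⟨e3, e4⟩ := hindep (b * a - d * b) (-(b * c - d * d)) 0 1 (by
    linear_combination (norm := module) h2)
  have h3 := rot_pow_apply R hij u
  simp only [hgu, hgw, map_add, map_smul] at h3
  obtain ⟨e5, e6⟩ := hindep (b * (b * b - d * a) + d * (-a * b + c * a))
    (b * (b * d - d * c) + d * (-a * d + c * c)) 1 0 (by linear_combination (norm := module) h3)
  rw [hrs, map_add, map_smul, map_smul, hgu, hgw] at hxy
  obtain ⟨e7, e8⟩ := hindep (r * b - s * a) (r * d - s * c) r s (by
    linear_combination (norm := module) hxy)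
  have hrs0 : r ≠ 0 ∨ s ≠ 0 := by
    by_contra hc
    push Not at hc
    exact h0 (by rw [hrs, hc.1, hc.2, zero_smul, zero_smul, add_zero])
  have ha : a = 0 := by
    by_cases had : a = d
    · subst had
      have e9 : (b - 1) * (c + 1) = a * a := by
        rcases hrs0 with hr | hr
        · exact mul_right_cancel₀ hr (by linear_combination (c + 1) * e7 - a * e8)
        · exact mul_right_cancel₀ hr (by linear_combination a * e7 - (b - 1) * e8)
      obtain rfl : c = b - 2 := by linear_combination (-1 : ℚ) * e9 - e1
      linear_combination (3⁻¹ : ℚ) * e6 + (3⁻¹ : ℚ) * a * e1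
    · have hd : a - d ≠ 0 := sub_ne_zero.2 had
      have hc : c = 0 := (mul_eq_zero.1 (by linear_combination -e2 : c * (a - d) = 0)).resolve_right hd
      have hb : b = 0 := (mul_eq_zero.1 (by linear_combination e3 : b * (a - d) = 0)).resolve_right hd
      rw [hb, hc] at e5
      norm_num at e5
  rw [hac, ha, zero_smul, zero_add]
  exact Submodule.smul_mem _ _ (mem_wtR.2 hwm)

/-- The rotation of order three has no fixed vectors on the sum of two interchanged lines. -/
theorem eq_zero_of_rot_fixed (h : IsLine R p) (hij : i ≠ j) (hA : A.card = p) (hi : i ∉ A)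
    (hj : j ∉ A) {y : V} (hx : x ∈ wtR R (insert i A)) (hy : y ∈ wtR R (insert j A))
    (hxy : R (rot i j) (x + y) = x + y) : x + y = 0 := by
  by_contra h0
  have key := fun {u : V} => h.rho_mem_of_fixed hij hA hi hj hx hy hxy h0 (u := u)
  obtain ⟨c, hc⟩ : ∃ c, c ∉ insert i (insert j A) := by
    by_contra hc
    push Not at hc
    have h1 := Finset.card_le_card (fun x _ => hc x : Finset.univ ⊆ insert i (insert j A))
    have h2 := Finset.card_insert_le i (insert j A)
    have h3 := Finset.card_insert_le j A
    have h4 := h.card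
    rw [Finset.card_univ] at h1
    omega
  simp only [Finset.mem_insert, not_or] at hc
  obtain ⟨hci, hcj, hcA⟩ := hc
  have hAi : (insert i A).card = p + 1 := by rw [Finset.card_insert_of_notMem hi, hA]
  have hAj : (insert j A).card = p + 1 := by rw [Finset.card_insert_of_notMem hj, hA]
  have hAc : (insert c A).card = p + 1 := by rw [Finset.card_insert_of_notMem hcA, hA]
  obtain ⟨u, hu, hu0⟩ : ∃ u ∈ wtR R (insert i A), u ≠ 0 := by
    refine (Submodule.ne_bot_iff _).1 fun hc => ?_
    have := h.line _ hAi
    rw [hc, finrank_bot] at this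
    exact zero_ne_one this
  have hlam : R (lam i j) u ∈ wtR R (insert j A) := by
    have hu' := mem_wtR.1 hu
    have h1 := mem_wtR.1 (key hu)
    rw [lam_eq_conj hij]
    simp only [_root_.map_mul, End.mul_apply]
    rw [hu'.1 i (Finset.mem_insert_self i A), map_neg, hu'.2 j (by simp [hij.symm, hj]), map_neg,
      map_neg, h1.1 j (Finset.mem_insert_self j A), neg_neg, h1.2 i (by simp [hij, hi])]
    exact key hu
  have hrho : R (rho i c) u ∈ wtR R (insert c A) := by
    have hmap : (insert i A).map (Equiv.swap j c).toEmbedding = insert i A := by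
      ext k
      simp only [Finset.mem_map_equiv, Equiv.symm_swap, Finset.mem_insert]
      by_cases hkj : k = j
      · subst hkj; simp [hci, hcA, hij.symm, hj]
      · by_cases hkc : k = c
        · subst hkc; simp [hci, hcA, hij.symm, hj]
        · rw [Equiv.swap_apply_of_ne_of_ne hkj hkc]
    have h1 := swap_mem (map_swap_insert hj hcA) (key (swap_mem hmap hu))
    have h2 : perm (Equiv.swap j c) * rho i j * perm (Equiv.swap j c) = rho i c := by
      rw [perm_rho, Equiv.swap_apply_left, Equiv.swap_apply_of_ne_of_ne hij (Ne.symm hci),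
        mul_assoc, ← perm_mul, Equiv.swap_mul_self, perm_one, mul_one]
    rwa [← End.mul_apply, ← End.mul_apply, ← _root_.map_mul, ← _root_.map_mul, h2] at h1
  have hcomm : R (rho i c) (R (lam i j) u) = R (lam i j) (R (rho i c) u) := by
    rw [← End.mul_apply, ((rho_lam_comm i (Ne.symm hci) hij).map R).eq, End.mul_apply]
  have h1 : R (rho i c) (R (lam i j) u) ∈ wtR R (insert j A) :=
    h.mem_line (Ne.symm hci) hAj (by simp [hij, hi]) (by simp [hcj, hcA])
      ((isOffWt_of_mem (fun _ _ _ => Iff.rfl) hlam).apply fun _ => eps_rho_comm)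
  have h2 : R (lam i j) (R (rho i c) u) ∈ wtR R (insert c A) :=
    h.mem_line hij hAc (by simp [Ne.symm hci, hi]) (by simp [Ne.symm hcj, hj])
      ((isOffWt_of_mem (fun _ _ _ => Iff.rfl) hrho).apply fun _ => eps_lam_comm hij)
  have hne : insert j A ≠ insert c A := fun hc => by
    have : c ∈ insert j A := hc ▸ Finset.mem_insert_self c A
    rcases Finset.mem_insert.1 this with h1 | h1
    exacts [hcj h1, hcA h1]
  have h3 := eq_zero_of_mem_of_mem hne h1 (hcomm ▸ h2)
  have h4 : R (lam i j) u = 0 := IsLow.R_injective R _ (h3.trans (map_zero _).symm)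
  exact hu0 (IsLow.R_injective R _ (h4.trans (map_zero _).symm))

end IsLine

section Rotation

variable {ι V : Type*} [Fintype ι] [DecidableEq ι] [AddCommGroup V] [Module ℚ V]

theorem FreeAut.swap_epsSet {s : Finset ι} {i j : ι} (hi : i ∉ s) (hj : j ∉ s) :
    Commute (perm (Equiv.swap i j)) (epsSet s) := by
  refine ext_of fun m => ?_
  by_cases hs : m ∈ s
  · have h1 : Equiv.swap i j m = m :=
      Equiv.swap_apply_of_ne_of_ne (fun h => hi (h ▸ hs)) fun h => hj (h ▸ hs)
    simp [perm_of, epsSet_of_mem, hs, h1]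
  · have h1 : Equiv.swap i j m ∉ s := by
      rw [Equiv.swap_apply_def]
      split_ifs <;> assumption
    simp [perm_of, epsSet_of_notMem, hs, h1]

/-- The projection onto the fixed vectors of the rotation of order three. -/
def rotAvg (R : FreeRep ι V) (i j : ι) : End ℚ V :=
  (3⁻¹ : ℚ) • (1 + R (rot i j) + R (rot i j) * R (rot i j))

variable {R : FreeRep ι V} {i j : ι}

theorem rot_mul_rotAvg (hij : i ≠ j) : R (rot i j) * rotAvg R i j = rotAvg R i j := by
  have h : R (rot i j) * (R (rot i j) * R (rot i j)) = 1 := by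
    rw [← mul_assoc, ← _root_.map_mul, ← _root_.map_mul, rot_mul_mul hij, _root_.map_one]
  rw [rotAvg, mul_smul_comm, mul_add, mul_add, h, mul_one]
  module

theorem rotAvg_eq_of_fixed {v : V} (hv : R (rot i j) v = v) : rotAvg R i j v = v := by
  simp only [rotAvg, LinearMap.smul_apply, LinearMap.add_apply, End.mul_apply, End.one_apply, hv]
  module

theorem rotAvg_idem (hij : i ≠ j) (v : V) :
    rotAvg R i j (rotAvg R i j v) = rotAvg R i j v :=
  rotAvg_eq_of_fixed (by rw [← End.mul_apply, rot_mul_rotAvg hij])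

theorem trace_rotAvg [FiniteDimensional ℚ V] (hij : i ≠ j) :
    LinearMap.trace ℚ V (rotAvg R i j) = finrank ℚ (LinearMap.range (rotAvg R i j)) :=
  LinearMap.IsProj.trace ⟨fun v => ⟨v, rfl⟩, by rintro _ ⟨v, rfl⟩; exact rotAvg_idem hij v⟩

theorem two_mul_trace_rot_mul (hij : i ≠ j) {X : End ℚ V}
    (hX : Commute (R (eps i * eps j * perm (Equiv.swap i j))) X) :
    2 * LinearMap.trace ℚ V (R (rot i j) * X) =
      3 * LinearMap.trace ℚ V (rotAvg R i j * X) - LinearMap.trace ℚ V X := by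
  set s := eps i * eps j * perm (Equiv.swap i j) with hs
  have h1 : R s * R s⁻¹ = 1 := by rw [← _root_.map_mul, mul_inv_cancel, _root_.map_one]
  have h2 : R s⁻¹ * R s = 1 := by rw [← _root_.map_mul, inv_mul_cancel, _root_.map_one]
  have h3 : R s * R (rot i j) = R (rot i j) * R (rot i j) * R s := by
    rw [← _root_.map_mul, hs, rot_conj hij, _root_.map_mul, _root_.map_mul]
  have h4 : R (rot i j) * R (rot i j) * X = R s * (R (rot i j) * X * R s⁻¹) := by
    calc _ = R (rot i j) * R (rot i j) * X * (R s * R s⁻¹) := by rw [h1, mul_one]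
      _ = R (rot i j) * R (rot i j) * (R s * X) * R s⁻¹ := by rw [hX.eq]; simp only [mul_assoc]
      _ = _ := by rw [← mul_assoc _ (R s) X, ← h3]; simp only [mul_assoc]
  have h5 : LinearMap.trace ℚ V (R (rot i j) * R (rot i j) * X) =
      LinearMap.trace ℚ V (R (rot i j) * X) := by
    rw [h4, LinearMap.trace_mul_comm, mul_assoc, h2, mul_one]
  rw [rotAvg, smul_mul_assoc, add_mul, add_mul, one_mul, map_smul, map_add, map_add, h5, smul_eq_mul]
  ring

theorem epsSet_apply_wtR {I : Finset ι} {v : V} (hv : v ∈ wtR R I) (s : Finset ι) :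
    R (epsSet s) v = (-1 : ℚ) ^ (s ∩ I).card • v := by
  induction s using Finset.induction_on with
  | empty => simp [epsSet_empty]
  | insert a s ha ih =>
    rw [epsSet_insert ha, _root_.map_mul, End.mul_apply, ih, map_smul]
    by_cases haI : a ∈ I
    · rw [(mem_wtR.1 hv).1 a haI, Finset.insert_inter_of_mem haI, Finset.card_insert_of_notMem
        (fun h => ha (Finset.mem_inter.1 h).1), pow_succ]
      module
    · rw [(mem_wtR.1 hv).2 a haI, Finset.insert_inter_of_notMem haI]

theorem card_le_finrank_of_wtR [FiniteDimensional ℚ V] {W : Submodule ℚ V}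
    {S : Finset (Finset ι)} (hS : ∀ I ∈ S, wtR R I ≠ ⊥ ∧ wtR R I ≤ W) : S.card ≤ finrank ℚ W := by
  choose! v hv hv0 using fun I hI => (Submodule.ne_bot_iff _).1 (hS I hI).1
  have hind := (iSupIndep_wt (R_eps_comm R)).comp (Subtype.val_injective (p := (· ∈ S)))
  have h1 : LinearIndependent ℚ (fun I : S => v I) :=
    hind.linearIndependent _ (fun I => hv I I.2) fun I => hv0 I I.2
  have h2 : LinearIndependent ℚ (fun I : S => (⟨v I, (hS I I.2).2 (hv I I.2)⟩ : W)) :=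
    LinearIndependent.of_comp W.subtype h1
  simpa using h2.fintype_card_le_finrank

namespace IsLine

variable [FiniteDimensional ℚ V] {p : ℕ} {A : Finset ι} {v : V}

theorem ne_bot (h : IsLine R p) (hA : A.card = p + 1) : wtR R A ≠ ⊥ := fun hc => by
  have := h.line A hA
  rw [hc, finrank_bot] at this
  exact zero_ne_one this

theorem rotAvg_eq_zero (h : IsLine R p) (hij : i ≠ j) (hA : A.card = p) (hi : i ∉ A) (hj : j ∉ A)
    (hv : IsOffWt R i j A v) : rotAvg R i j v = 0 := by
  have hg : ∀ x, IsOffWt R i j A x → IsOffWt R i j A (R (rot i j) x) :=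
    fun x hx => hx.apply fun _ => eps_rot_comm hij
  have h1 : IsOffWt R i j A (v + R (rot i j) v + R (rot i j) (R (rot i j) v)) :=
    (hv.add (hg _ hv)).add (hg _ (hg _ hv))
  obtain ⟨x, hx, y, hy, hxy⟩ := h.exists_pair hij hA hi hj h1
  have h2 : rotAvg R i j v = (3⁻¹ : ℚ) • (x + y) := by
    rw [← hxy]
    simp only [rotAvg, LinearMap.smul_apply, LinearMap.add_apply, End.mul_apply, End.one_apply]
  have h3 : x + y = (3 : ℚ) • rotAvg R i j v := by rw [h2]; module
  rw [h2, h.eq_zero_of_rot_fixed hij hA hi hj hx hy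
    (by rw [h3, map_smul, ← End.mul_apply, rot_mul_rotAvg hij]), smul_zero]

theorem rotAvg_eq_zero_of_mem (h : IsLine R p) (hij : i ≠ j) {I : Finset ι} (hI : I.card = p + 1)
    (hmem : ¬ (i ∈ I ↔ j ∈ I)) (hv : v ∈ wtR R I) : rotAvg R i j v = 0 := by
  have hcard : (I \ {i, j}).card = p := by
    by_cases hi : i ∈ I
    · have hj : j ∉ I := fun hj => hmem (by simp [hi, hj])
      have : I \ {i, j} = I.erase i := by
        ext k; simp only [Finset.mem_sdiff, Finset.mem_insert, Finset.mem_singleton,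
          Finset.mem_erase, not_or]
        exact ⟨fun h => ⟨h.2.1, h.1⟩, fun h => ⟨h.2, h.1, fun hk => hj (hk ▸ h.2)⟩⟩
      rw [this, Finset.card_erase_of_mem hi, hI, Nat.add_sub_cancel]
    · have hj : j ∈ I := by_contra fun hj => hmem (by simp [hi, hj])
      have : I \ {i, j} = I.erase j := by
        ext k; simp only [Finset.mem_sdiff, Finset.mem_insert, Finset.mem_singleton,
          Finset.mem_erase, not_or]
        exact ⟨fun h => ⟨h.2.2, h.1⟩, fun h => ⟨h.2, fun hk => hi (hk ▸ h.2), h.1⟩⟩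
      rw [this, Finset.card_erase_of_mem hj, hI, Nat.add_sub_cancel]
  exact h.rotAvg_eq_zero hij hcard (by simp) (by simp)
    (isOffWt_of_mem (fun k hki hkj => by simp [hki, hkj]) hv)

end IsLine

theorem card_pairs (hij : i ≠ j) : 2 * (Fintype.card ι - 2) ≤
    (((({i, j} : Finset ι) ×ˢ ({i, j} : Finset ι)ᶜ)).image fun q => ({q.1, q.2} : Finset ι)).card := by
  rw [Finset.card_image_of_injOn, Finset.card_product, Finset.card_compl, Finset.card_pair hij]
  rintro ⟨a, b⟩ hab ⟨c, d⟩ hcd heq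
  simp only [Finset.coe_product, Set.mem_prod, Finset.mem_coe, Finset.mem_compl] at hab hcd
  change ({a, b} : Finset ι) = {c, d} at heq
  have hne : ∀ {x y : ι}, x ∈ ({i, j} : Finset ι) → y ∉ ({i, j} : Finset ι) → x ≠ y :=
    fun hx hy h => hy (h ▸ hx)
  have h1 : a ∈ ({c, d} : Finset ι) := heq ▸ Finset.mem_insert_self a {b}
  have h2 : b ∈ ({c, d} : Finset ι) := heq ▸ by simp
  simp only [Finset.mem_insert, Finset.mem_singleton] at h1 h2
  rw [h1.resolve_right (hne hab.1 hcd.2), h2.resolve_left (hne hcd.1 hab.2).symm]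

/-- If the nonextreme weights are those of cardinality two, then the trace of a suitable torsion
element exceeds the dimension of its space of fixed vectors. -/
theorem IsLine.lt_trace_rot_mul_epsSet [FiniteDimensional ℚ V] (h : IsLine R 1) (hij : i ≠ j)
    (hw : ∀ I : Finset ι, I ≠ ∅ → I ≠ Finset.univ → I.card ≠ 2 → wtR R I = ⊥)
    (hn : 6 ≤ Fintype.card ι) (heven : Even (Fintype.card ι))
    (hdim : 2 * finrank ℚ V < Fintype.card ι * (Fintype.card ι + 1)) :
    1 < LinearMap.trace ℚ V (R (rot i j * epsSet {i, j}ᶜ)) ∧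
      (finrank ℚ (LinearMap.ker (R (rot i j * epsSet {i, j}ᶜ) - 1)) : ℚ) <
        LinearMap.trace ℚ V (R (rot i j * epsSet {i, j}ᶜ)) := by
  set s : Finset ι := {i, j}ᶜ with hs
  have hi : i ∉ s := by simp [hs]
  have hj : j ∉ s := by simp [hs]
  have hscard : s.card = Fintype.card ι - 2 := by rw [hs, Finset.card_compl, Finset.card_pair hij]
  have hsd : ∀ I : Finset ι, s ∩ I = I \ {i, j} := fun I => by
    rw [hs, Finset.inter_comm, Finset.sdiff_eq_inter_compl]
  have hδδ : R (epsSet s) * R (epsSet s) = 1 := by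
    rw [← _root_.map_mul, epsSet_mul_self, _root_.map_one]
  have hgδ : Commute (R (rot i j)) (R (epsSet s)) := (rot_epsSet hij hi hj).map R
  have hE : rotAvg R i j * R (epsSet s) = rotAvg R i j := by
    refine eq_of_wtR (R := R) fun I v hv => ?_
    rw [End.mul_apply, epsSet_apply_wtR hv, map_smul]
    by_cases h2 : I.card = 2
    · by_cases hmem : i ∈ I ↔ j ∈ I
      · suffices Even (s ∩ I).card by rw [this.neg_one_pow, one_smul]
        by_cases hiI : i ∈ I
        · have hsub : ({i, j} : Finset ι) ⊆ I := by
            simp [Finset.insert_subset_iff, hiI, hmem.1 hiI]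
          rw [hsd, Finset.card_sdiff_of_subset hsub, h2, Finset.card_pair hij]
          exact Even.zero
        · have : s ∩ I = I := by
            rw [hsd, Finset.sdiff_eq_self_iff_disjoint, Finset.disjoint_insert_right,
              Finset.disjoint_singleton_right]
            exact ⟨hiI, fun hc => hiI (hmem.2 hc)⟩
          rw [this, h2]
          exact even_two
      · rw [h.rotAvg_eq_zero_of_mem hij h2 hmem hv, smul_zero]
    · by_cases h0 : I = ∅
      · simp [h0]
      · by_cases h1 : I = Finset.univ
        · rw [h1, Finset.inter_univ, hscard, Even.neg_one_pow, one_smul]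
          exact (Nat.even_sub (by omega)).2 (by simp [heven])
        · rw [hw I h0 h1 h2, Submodule.mem_bot] at hv
          simp [hv]
  have htr := two_mul_trace_rot_mul (R := R) hij (X := R (epsSet s))
    (((((eps_epsSet s i).mul_left (eps_epsSet s j))).mul_left (swap_epsSet hi hj)).map R)
  rw [hE, trace_rotAvg hij, ← _root_.map_mul] at htr
  set f := finrank ℚ (LinearMap.range (rotAvg R i j)) with hf
  have hf1 : (Fintype.card ι - 2).choose 2 ≤ f := by
    rw [← hscard, ← Finset.card_powersetCard]
    refine card_le_finrank_of_wtR (R := R) fun I hI => ?_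
    rw [Finset.mem_powersetCard] at hI
    exact ⟨h.ne_bot hI.2, fun v hv => ⟨v, rotAvg_eq_of_fixed (h.rot_eq_of_notMem hij hI.2
      (fun hc => hi (hI.1 hc)) (fun hc => hj (hI.1 hc)) hv)⟩⟩
  have hfix : finrank ℚ (LinearMap.ker (R (rot i j * epsSet s) - 1)) ≤ f := by
    refine Submodule.finrank_mono fun v hv => ?_
    rw [LinearMap.mem_ker, LinearMap.sub_apply, sub_eq_zero, End.one_apply, _root_.map_mul,
      End.mul_apply] at hv
    have hc : ∀ x, R (epsSet s) (R (rot i j) x) = R (rot i j) (R (epsSet s) x) := fun x => by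
      rw [← End.mul_apply, ← hgδ.eq, End.mul_apply]
    have hd : ∀ x, R (epsSet s) (R (epsSet s) x) = x := fun x => by
      rw [← End.mul_apply, hδδ, End.one_apply]
    have h1 : R (epsSet s) v = v := by
      have h2 := IsLine.rot_pow_apply R hij (R (epsSet s) v)
      rw [hv] at h2
      have h3 : R (rot i j) v = R (epsSet s) v := by
        conv_rhs => rw [← hv, hc, hd]
      rw [h3, hv] at h2
      exact h2.symm
    rw [h1] at hv
    exact ⟨v, rotAvg_eq_of_fixed hv⟩
  have hneg : LinearMap.trace ℚ V (R (epsSet s)) ≤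
      finrank ℚ V - 2 * (2 * (Fintype.card ι - 2) : ℕ) := by
    set N : End ℚ V := (2⁻¹ : ℚ) • (1 - R (epsSet s)) with hN
    have hNN : N * N = N := by
      rw [hN, smul_mul_smul_comm, mul_sub, sub_mul, sub_mul, hδδ, mul_one, one_mul]
      module
    have h1 : LinearMap.trace ℚ V N = finrank ℚ (LinearMap.range N) :=
      trace_eq_finrank_range hNN
    have h2 : 2 * (Fintype.card ι - 2) ≤ finrank ℚ (LinearMap.range N) := by
      refine (card_pairs hij).trans (card_le_finrank_of_wtR (R := R) fun I hI => ?_)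
      obtain ⟨⟨a, b⟩, hab, rfl⟩ := Finset.mem_image.1 hI
      rw [Finset.mem_product, ← hs] at hab
      have hne : a ≠ b := fun hc => (Finset.mem_compl.1 (hs ▸ hab.2)) (hc ▸ hab.1)
      refine ⟨h.ne_bot (Finset.card_pair hne), fun v hv => ⟨v, ?_⟩⟩
      have hin : s ∩ {a, b} = {b} := by
        have : a ∉ s := by rw [hs, Finset.mem_compl, not_not]; exact hab.1
        rw [Finset.inter_insert_of_notMem this, Finset.inter_singleton_of_mem hab.2]
      rw [hN, LinearMap.smul_apply, LinearMap.sub_apply, epsSet_apply_wtR hv, hin,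
        Finset.card_singleton, End.one_apply]
      module
    rw [hN, map_smul, map_sub, LinearMap.trace_one, smul_eq_mul] at h1
    have h3 : ((2 * (Fintype.card ι - 2) : ℕ) : ℚ) ≤ (finrank ℚ (LinearMap.range N) : ℚ) := by
      exact_mod_cast h2
    linarith
  set n := Fintype.card ι
  obtain ⟨k, hk⟩ : ∃ k, n = k + 6 := ⟨n - 6, by omega⟩
  have hch : ((n - 2).choose 2 : ℚ) = (k + 4) * (k + 3) / 2 := by
    rw [Nat.cast_choose_two, show n - 2 = k + 4 by omega]
    push_cast
    ring
  have hf2 : (k + 4) * (k + 3) / 2 ≤ (f : ℚ) := hch ▸ (by exact_mod_cast hf1)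
  have hdim' : 2 * (finrank ℚ V : ℚ) < (k + 6) * (k + 7) := by
    rw [hk] at hdim
    exact_mod_cast hdim
  have hfix' : (finrank ℚ (LinearMap.ker (R (rot i j * epsSet s) - 1)) : ℚ) ≤ f := by
    exact_mod_cast hfix
  rw [show n - 2 = k + 4 by omega] at hneg
  push_cast at hneg
  have hk0 : (0 : ℚ) ≤ k := Nat.cast_nonneg k
  have hlt : (f : ℚ) < LinearMap.trace ℚ V (R (rot i j * epsSet s)) := by nlinarith
  exact ⟨by nlinarith, hfix'.trans_lt hlt⟩

theorem FreeAut.isOfFinOrder_rot_mul_epsSet {n : ℕ} {i j : Fin n} (hij : i ≠ j)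
    {s : Finset (Fin n)} (hi : i ∉ s) (hj : j ∉ s) :
    IsOfFinOrder (OutFG.mk (rot i j * epsSet s)) :=
  OutFG.mk.isOfFinOrder ((rot_epsSet hij hi hj).isOfFinOrder_mul
    (isOfFinOrder_iff_pow_eq_one.2 ⟨3, by norm_num, by rw [pow_three', rot_mul_mul hij]⟩)
    (isOfFinOrder_iff_pow_eq_one.2 ⟨2, two_pos, by rw [pow_two, epsSet_mul_self]⟩))

end Rotation

namespace FreeAut

variable {ι : Type*} [DecidableEq ι]

/-- The automorphism sending `b` to `c⁻¹` and `c` to `b`. -/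
def quarter (b c : ι) : MulAut (FreeGroup ι) := perm (Equiv.swap b c) * eps b

theorem quarter_fst (b c : ι) : quarter b c (of b) = (of c)⁻¹ := by
  simp [quarter, eps_self, perm_of]

theorem quarter_snd {b c : ι} (h : b ≠ c) : quarter b c (of c) = of b := by
  simp [quarter, eps_of_ne h.symm, perm_of]

theorem quarter_of_ne {b c k : ι} (hb : k ≠ b) (hc : k ≠ c) : quarter b c (of k) = of k := by
  simp [quarter, eps_of_ne hb, perm_of, Equiv.swap_apply_of_ne_of_ne hb hc]

theorem epsSet_univ_rho [Fintype ι] {i j : ι} (h : i ≠ j) :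
    epsSet Finset.univ * rho i j = lam i j * epsSet Finset.univ := by
  refine ext_of fun m => ?_
  by_cases hm : m = i
  · subst hm; simp [epsSet_of_mem, rho_self h, lam_self h]
  · simp [epsSet_of_mem, rho_of_ne hm, lam_of_ne hm]

/-- A product of two commuting elements of order four. -/
def quarters : MulAut (FreeGroup (Fin 6)) := quarter 2 3 * quarter 4 5

/-- An automorphism of rank six that has finite order as an outer automorphism. -/
def sixTorsion : MulAut (FreeGroup (Fin 6)) :=
  lam 3 1 * (rho 3 1)⁻¹ * (lam 5 1 * (rho 5 1)⁻¹) * (epsSet Finset.univ * rot 0 1 * quarters)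

theorem forall_fin_six {P : Fin 6 → Prop} (h0 : P 0) (h1 : P 1) (h2 : P 2) (h3 : P 3) (h4 : P 4)
    (h5 : P 5) (m : Fin 6) : P m := by
  fin_cases m <;> assumption

theorem quarters_mul_self : quarters * quarters = epsSet {2, 3, 4, 5} := by
  refine ext_of (forall_fin_six ?_ ?_ ?_ ?_ ?_ ?_) <;>
  simp [quarters, quarter_fst, quarter_snd, quarter_of_ne, epsSet_of_mem, epsSet_of_notMem]

theorem quarters_rot : Commute (rot 0 1) quarters := by
  refine ext_of (forall_fin_six ?_ ?_ ?_ ?_ ?_ ?_) <;>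
  simp [quarters, quarter_fst, quarter_snd, quarter_of_ne, rot_fst, rot_snd, rot_of_ne]

theorem quarters_swap : Commute (eps 0 * eps 1 * perm (Equiv.swap 0 1)) quarters := by
  refine ext_of (forall_fin_six ?_ ?_ ?_ ?_ ?_ ?_) <;>
  simp [quarters, quarter_fst, quarter_snd, quarter_of_ne, eps_self, eps_of_ne, perm_of,
    Equiv.swap_apply_def]

theorem eps_quarters : eps 3 * quarters = quarters * eps 2 ∧ eps 5 * quarters = quarters * eps 4 := by
  constructor <;> refine ext_of (forall_fin_six ?_ ?_ ?_ ?_ ?_ ?_) <;>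
  simp [quarters, quarter_fst, quarter_snd, quarter_of_ne, eps_self, eps_of_ne]

theorem sixTorsion_of : sixTorsion (of 0) = (of 1)⁻¹ ∧ sixTorsion (of 1) = of 1 * of 0 ∧
    sixTorsion (of 2) = of 1 * of 3 * (of 1)⁻¹ ∧ sixTorsion (of 3) = (of 2)⁻¹ ∧
    sixTorsion (of 4) = of 1 * of 5 * (of 1)⁻¹ ∧ sixTorsion (of 5) = (of 4)⁻¹ := by
  have hs : ∀ {i j : Fin 6}, i ≠ j → (rho i j).symm (of i) = of i * (of j)⁻¹ := rho_inv_self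
  have hn : ∀ {i j k : Fin 6}, k ≠ i → (rho i j).symm (of k) = of k := rho_inv_of_ne
  simp [sixTorsion, quarters, quarter_fst, quarter_snd, quarter_of_ne, rot_fst, rot_snd, rot_of_ne,
    epsSet_of_mem, hs, hn, lam_self, lam_of_ne, mul_assoc]

theorem isOfFinOrder_mk_sixTorsion : IsOfFinOrder (OutFG.mk sixTorsion) := by
  obtain ⟨h0, h1, h2, h3, h4, h5⟩ := sixTorsion_of
  set μ : MulAut (FreeGroup (Fin 6)) := MulAut.conj (of 1)⁻¹ * (sixTorsion * sixTorsion) with hμ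
  have hof : μ (of 0) = (of 1)⁻¹ * (of 0)⁻¹ ∧ μ (of 1) = of 0 ∧
      μ (of 2) = of 0 * (of 2)⁻¹ * (of 0)⁻¹ ∧ μ (of 3) = (of 3)⁻¹ ∧
      μ (of 4) = of 0 * (of 4)⁻¹ * (of 0)⁻¹ ∧ μ (of 5) = (of 5)⁻¹ := by
    simp [hμ, h0, h1, h2, h3, h4, h5, mul_assoc]
  obtain ⟨m0, m1, m2, m3, m4, m5⟩ := hof
  have h6 : μ * μ * μ = epsSet {2, 3, 4, 5} := by
    refine ext_of (forall_fin_six ?_ ?_ ?_ ?_ ?_ ?_) <;>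
    simp [m0, m1, m2, m3, m4, m5, epsSet_of_mem, epsSet_of_notMem, mul_assoc]
  have h7 : OutFG.mk μ = OutFG.mk sixTorsion ^ 2 := by
    rw [hμ, _root_.map_mul, OutFG.mk_conj, one_mul, _root_.map_mul, pow_two]
  refine isOfFinOrder_iff_pow_eq_one.2 ⟨2 * (3 * 2), by norm_num, ?_⟩
  rw [pow_mul, ← h7, pow_mul, pow_three', ← _root_.map_mul, ← _root_.map_mul, h6, pow_two,
    ← _root_.map_mul, epsSet_mul_self, _root_.map_one]

end FreeAut

section Fixing

variable {ι V : Type*} [Fintype ι] [DecidableEq ι] [AddCommGroup V] [Module ℚ V]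
  [FiniteDimensional ℚ V] {R : FreeRep ι V} {p : ℕ} {i j : ι} {I : Finset ι}
  {v : V}

theorem mem_wtR_of_comm (hw : ∀ J : Finset ι, J.card ≠ p + 1 → wtR R J = ⊥) (hI : I.card = p + 1)
    (hij : i ≠ j) (hmem : i ∈ I ↔ j ∈ I) {g : MulAut (FreeGroup ι)}
    (hg : ∀ k, k ≠ i → k ≠ j → Commute (eps k) g) (hv : v ∈ wtR R I) : R g v ∈ wtR R I := by
  have hi : i ∉ I \ {i, j} := by simp
  have hj : j ∉ I \ {i, j} := by simp
  obtain ⟨x₀, h0, x₁, h1, x₂, h2, x₃, h3, hx⟩ := ((isOffWt_of_mem (A := I \ {i, j})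
    (fun k hki hkj => by simp [hki, hkj]) hv).apply hg).exists_components hij hi hj
  have hc1 := Finset.card_insert_of_notMem hi
  have hc2 := Finset.card_insert_of_notMem hj
  have hc3 : (insert i (insert j (I \ {i, j}))).card = (I \ {i, j}).card + 2 := by
    rw [Finset.card_insert_of_notMem (by simp [hij]), hc2]
  rw [hx]
  by_cases hiI : i ∈ I
  · have hu : insert i (insert j (I \ {i, j})) = I := by
      ext k
      by_cases hki : k = i
      · simp [hki, hiI]
      · by_cases hkj : k = j
        · simp [hkj, hmem.1 hiI]
        · simp [hki, hkj]
    rw [hu] at h3 hc3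
    rw [hw _ (by omega), Submodule.mem_bot] at h0 h1 h2
    rwa [h0, h1, h2, zero_add, zero_add, zero_add]
  · have hu : I \ {i, j} = I := by
      rw [Finset.sdiff_eq_self_iff_disjoint, Finset.disjoint_insert_right,
        Finset.disjoint_singleton_right]
      exact ⟨hiI, fun hc => hiI (hmem.2 hc)⟩
    rw [hu] at h0 h1 h2 h3 hc1 hc2 hc3
    rw [hw _ (by omega), Submodule.mem_bot] at h1 h2 h3
    rwa [h1, h2, h3, add_zero, add_zero, add_zero]

theorem IsLine.rot_eq_of_iff (h : IsLine R p) (hw : ∀ J : Finset ι, J.card ≠ p + 1 → wtR R J = ⊥)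
    (hI : I.card = p + 1) (hij : i ≠ j) (hmem : i ∈ I ↔ j ∈ I) (hv : v ∈ wtR R I) :
    R (rot i j) v = v :=
  h.rot_eq hij hI (mem_wtR_of_comm hw hI hij hmem (fun _ => eps_rot_comm hij) hv) hv

theorem IsLine.quarter_eq (h : IsLine R p) (hw : ∀ J : Finset ι, J.card ≠ p + 1 → wtR R J = ⊥)
    (hI : I.card = p + 1) (hij : i ≠ j) (hmem : i ∈ I ↔ j ∈ I) {d : ι} (hdi : d ≠ i) (hdj : d ≠ j)
    (hd : d ∈ I ↔ i ∈ I) (hv : v ∈ wtR R I) : R (quarter i j) v = v := by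
  have hrho : ∀ x ∈ wtR R I, R (rho i j) x = x := by
    intro x hx
    by_cases h0 : x = 0
    · rw [h0, map_zero]
    have hex : ∀ {a b : ι}, a ≠ b → (a ∈ I ↔ b ∈ I) → ∃ c : ℚ, R (rho a b) x = c • x :=
      fun hab hm => h.exists_smul hI hx h0 (mem_wtR_of_comm hw hI hab hm (fun _ => eps_rho_comm) hx)
    obtain ⟨a, ha⟩ := hex hdj (hd.trans hmem)
    obtain ⟨b, hb⟩ := hex hdi.symm hd.symm
    obtain ⟨c, hc⟩ := hex hij hmem
    have h1 := DFunLike.congr_fun (congrArg R (rho_mul_rho hdi.symm hij hdj)) x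
    simp only [_root_.map_mul, End.mul_apply, ha, hb, hc, map_smul, smul_smul] at h1
    have h2 : (a * b) • R (rho i j) x = (a * b) • x := by
      rw [hc, smul_smul]
      rw [mul_comm b a] at h1
      rw [h1]
      congr 1
      ring
    have ha0 : ∀ {e : ℚ} {g : MulAut (FreeGroup ι)}, R g x = e • x → e ≠ 0 := fun he hc =>
      h0 (IsLow.R_injective R _ (by rw [he, hc, zero_smul, map_zero]))
    exact smul_right_injective V (mul_ne_zero (ha0 ha) (ha0 hb)) h2
  have h1 := h.rot_eq_of_iff hw hI hij hmem hv
  have hmap : I.map (Equiv.swap i j).toEmbedding = I := by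
    ext k
    rw [Finset.mem_map_equiv, Equiv.symm_swap, Equiv.swap_apply_def]
    split_ifs with h1 h2
    · rw [h1, hmem]
    · rw [h2, hmem]
    · rfl
  have hτ : R (perm (Equiv.swap i j)) v ∈ wtR R I := IsLine.swap_mem hmap hv
  rw [quarter, _root_.map_mul, End.mul_apply]
  rw [IsLine.rot_apply] at h1
  by_cases hi : i ∈ I
  · rw [(mem_wtR.1 hτ).1 i hi, map_neg, hrho _ hτ] at h1
    rwa [(mem_wtR.1 hv).1 i hi, map_neg]
  · rw [(mem_wtR.1 hτ).2 i hi, hrho _ hτ] at h1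
    rwa [(mem_wtR.1 hv).2 i hi]

end Fixing

section Six

variable {V : Type*} [AddCommGroup V] [Module ℚ V] [FiniteDimensional ℚ V]
  {R : FreeRep (Fin 6) V}

theorem homRep_sixTorsion (hw : ∀ J : Finset (Fin 6), J.card ≠ 3 → wtR R J = ⊥) :
    R sixTorsion = -(R (rot 0 1) * R quarters) := by
  have h1 : R (epsSet Finset.univ) = -1 := by
    refine eq_of_wtR (R := R) fun I v hv => ?_
    by_cases hI : I.card = 3
    · rw [epsSet_apply_wtR hv, Finset.univ_inter, hI]
      simp [pow_three]
    · rw [hw I hI, Submodule.mem_bot] at hv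
      rw [hv, map_zero, map_zero]
  have h2 : ∀ {i j : Fin 6}, i ≠ j → R (lam i j * (rho i j)⁻¹) = 1 := fun {i j} hij => by
    have h3 := congrArg R (epsSet_univ_rho hij)
    rw [_root_.map_mul, _root_.map_mul, h1, neg_one_mul, mul_neg_one, neg_inj] at h3
    rw [_root_.map_mul, ← h3, ← _root_.map_mul, mul_inv_cancel, _root_.map_one]
  rw [sixTorsion, _root_.map_mul, _root_.map_mul, h2 (by decide), h2 (by decide), one_mul, one_mul,
    _root_.map_mul, _root_.map_mul, h1, neg_one_mul, neg_mul]

/-- The projection onto the weights that do not separate `2, 3` and do not separate `4, 5`. -/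
def pairProj (R : FreeRep (Fin 6) V) : End ℚ V :=
  (4⁻¹ : ℚ) • (1 + R (eps 2) * R (eps 3) + R (eps 4) * R (eps 5) +
    R (eps 2) * R (eps 3) * (R (eps 4) * R (eps 5)))

theorem pairProj_apply {I : Finset (Fin 6)} {v : V} (hv : v ∈ wtR R I) :
    pairProj R v = if (2 ∈ I ↔ 3 ∈ I) ∧ (4 ∈ I ↔ 5 ∈ I) then v else 0 := by
  have he : ∀ k, R (eps k) v = (if k ∈ I then -1 else 1 : ℚ) • v := fun k => by
    split_ifs with hk
    · rw [(mem_wtR.1 hv).1 k hk, neg_one_smul]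
    · rw [(mem_wtR.1 hv).2 k hk, one_smul]
  simp only [pairProj, LinearMap.smul_apply, LinearMap.add_apply, End.mul_apply, End.one_apply, he,
    map_smul]
  by_cases h2 : 2 ∈ I <;> by_cases h3 : 3 ∈ I <;> by_cases h4 : 4 ∈ I <;> by_cases h5 : 5 ∈ I <;>
    simp only [h2, h3, h4, h5, if_true, if_false, iff_true, iff_false, and_true, not_true_eq_false,
      and_self, and_false] <;> module

theorem trace_quarters_mul (R : FreeRep (Fin 6) V) :
    LinearMap.trace ℚ V (R quarters * (R (eps 2) * R (eps 3))) = LinearMap.trace ℚ V (R quarters) ∧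
    LinearMap.trace ℚ V (R quarters * (R (eps 4) * R (eps 5))) = LinearMap.trace ℚ V (R quarters) ∧
    LinearMap.trace ℚ V (R quarters * (R (eps 2) * R (eps 3) * (R (eps 4) * R (eps 5)))) =
      LinearMap.trace ℚ V (R quarters) := by
  have key : ∀ {a b : Fin 6}, R (eps b) * R quarters = R quarters * R (eps a) → ∀ {Y : End ℚ V},
      Commute (R (eps a)) Y → LinearMap.trace ℚ V (R quarters * (Y * (R (eps a) * R (eps b)))) =
        LinearMap.trace ℚ V (R quarters * Y) := by
    intro a b hab Y hY
    have h1 : R quarters * (Y * (R (eps a) * R (eps b))) = R quarters * Y * R (eps a) * R (eps b) := by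
      simp only [mul_assoc]
    rw [h1, LinearMap.trace_mul_comm, ← mul_assoc, ← mul_assoc, hab, mul_assoc _ _ Y, hY.eq,
      ← mul_assoc, mul_assoc, R_eps_sq, mul_one]
  have h23 : R (eps 3) * R quarters = R quarters * R (eps 2) := by
    rw [← _root_.map_mul, eps_quarters.1, _root_.map_mul]
  have h45 : R (eps 5) * R quarters = R quarters * R (eps 4) := by
    rw [← _root_.map_mul, eps_quarters.2, _root_.map_mul]
  have h1 := key h23 (Commute.one_right _)
  have h2 := key h45 (Commute.one_right _)
  rw [one_mul, mul_one] at h1 h2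
  exact ⟨h1, h2, (key h45 ((R_eps_comm R 4 2).mul_right (R_eps_comm R 4 3))).trans h1⟩

theorem IsLine.quarters_mul_pairProj (h : IsLine R 2)
    (hw : ∀ J : Finset (Fin 6), J.card ≠ 3 → wtR R J = ⊥) :
    R quarters * pairProj R = pairProj R := by
  refine eq_of_wtR (R := R) fun I v hv => ?_
  rw [End.mul_apply, pairProj_apply hv]
  split_ifs with hI
  · by_cases hcard : I.card = 3
    · have hex : ∀ I : Finset (Fin 6), I.card = 3 → (2 ∈ I ↔ 3 ∈ I) ∧ (4 ∈ I ↔ 5 ∈ I) →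
          (∃ d, d ≠ 2 ∧ d ≠ 3 ∧ (d ∈ I ↔ 2 ∈ I)) ∧ ∃ d, d ≠ 4 ∧ d ≠ 5 ∧ (d ∈ I ↔ 4 ∈ I) := by decide
      obtain ⟨⟨d, hd2, hd3, hd⟩, d', hd4, hd5, hd'⟩ := hex I hcard hI
      rw [quarters, _root_.map_mul, End.mul_apply,
        h.quarter_eq hw hcard (by decide) hI.2 hd4 hd5 hd' hv,
        h.quarter_eq hw hcard (by decide) hI.1 hd2 hd3 hd hv]
    · rw [hw I hcard, Submodule.mem_bot] at hv
      rw [hv, map_zero]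
  · rw [map_zero]

theorem IsLine.four_le_trace_quarters (h : IsLine R 2)
    (hw : ∀ J : Finset (Fin 6), J.card ≠ 3 → wtR R J = ⊥) :
    4 ≤ LinearMap.trace ℚ V (R quarters) := by
  obtain ⟨h1, h2, h3⟩ := trace_quarters_mul R
  have h4 : LinearMap.trace ℚ V (R quarters * pairProj R) = LinearMap.trace ℚ V (R quarters) := by
    rw [pairProj, mul_smul_comm, mul_add, mul_add, mul_add, map_smul, map_add, map_add, map_add, h1,
      h2, h3, mul_one, smul_eq_mul]
    ring
  have hsq : pairProj R * pairProj R = pairProj R := by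
    refine eq_of_wtR (R := R) fun I v hv => ?_
    rw [End.mul_apply, pairProj_apply hv]
    split_ifs with hI
    · rw [pairProj_apply hv, if_pos hI]
    · rw [map_zero]
  have h5 : LinearMap.trace ℚ V (pairProj R) = finrank ℚ (LinearMap.range (pairProj R)) :=
    trace_eq_finrank_range hsq
  rw [← h4, h.quarters_mul_pairProj hw, h5]
  have h6 : ({{0, 2, 3}, {1, 2, 3}, {0, 4, 5}, {1, 4, 5}} : Finset (Finset (Fin 6))).card ≤
      finrank ℚ (LinearMap.range (pairProj R)) := by
    refine card_le_finrank_of_wtR (R := R) fun I hI => ?_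
    have hex : ∀ I ∈ ({{0, 2, 3}, {1, 2, 3}, {0, 4, 5}, {1, 4, 5}} : Finset (Finset (Fin 6))),
        I.card = 3 ∧ (2 ∈ I ↔ 3 ∈ I) ∧ (4 ∈ I ↔ 5 ∈ I) := by decide
    exact ⟨h.ne_bot (hex I hI).1, fun v hv => ⟨v, by rw [pairProj_apply hv, if_pos (hex I hI).2]⟩⟩
  exact_mod_cast (show 4 ≤ _ from h6)

theorem IsLine.rotAvg_eq (h : IsLine R 2) (hw : ∀ J : Finset (Fin 6), J.card ≠ 3 → wtR R J = ⊥) :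
    rotAvg R 0 1 = (2⁻¹ : ℚ) • (1 - R (epsSet {2, 3, 4, 5})) := by
  refine eq_of_wtR (R := R) fun I v hv => ?_
  by_cases hI : I.card = 3
  · have hpar : ∀ I : Finset (Fin 6), I.card = 3 → ((0 ∈ I ↔ 1 ∈ I) ↔
        Odd (({2, 3, 4, 5} : Finset (Fin 6)) ∩ I).card) := by decide
    rw [LinearMap.smul_apply, LinearMap.sub_apply, End.one_apply, epsSet_apply_wtR hv]
    by_cases hmem : (0 : Fin 6) ∈ I ↔ 1 ∈ I
    · rw [rotAvg_eq_of_fixed (h.rot_eq_of_iff hw hI (by decide) hmem hv),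
        ((hpar I hI).1 hmem).neg_one_pow]
      module
    · rw [h.rotAvg_eq_zero_of_mem (by decide) hI hmem hv,
        (Nat.not_odd_iff_even.1 fun ho => hmem ((hpar I hI).2 ho)).neg_one_pow]
      module
  · rw [hw I hI, Submodule.mem_bot] at hv
    rw [hv, map_zero, map_zero]

theorem IsLine.two_le_trace_sixTorsion (h : IsLine R 2)
    (hw : ∀ J : Finset (Fin 6), J.card ≠ 3 → wtR R J = ⊥) :
    2 ≤ LinearMap.trace ℚ V (R sixTorsion) ∧ LinearMap.ker (R sixTorsion - 1) = ⊥ := by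
  have hδ : R (epsSet {2, 3, 4, 5}) = R (eps 2) * R (eps 3) * (R (eps 4) * R (eps 5)) := by
    rw [epsSet_insert (by decide), epsSet_insert (by decide), epsSet_insert (by decide),
      ← insert_empty_eq, epsSet_insert (by decide), epsSet_empty, mul_one]
    simp only [_root_.map_mul, mul_assoc]
  rw [homRep_sixTorsion hw]
  refine ⟨?_, (Submodule.eq_bot_iff _).2 fun v hv => ?_⟩
  · have h1 := two_mul_trace_rot_mul (R := R) (by decide : (0 : Fin 6) ≠ 1) (quarters_swap.map R)
    have h2 : LinearMap.trace ℚ V (rotAvg R 0 1 * R quarters) = 0 := by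
      rw [h.rotAvg_eq hw, LinearMap.trace_mul_comm, mul_smul_comm, mul_sub, map_smul, map_sub,
        mul_one, hδ, (trace_quarters_mul R).2.2, sub_self, smul_zero]
    rw [map_neg]
    linarith [h.four_le_trace_quarters hw]
  · rw [LinearMap.mem_ker, LinearMap.sub_apply, LinearMap.neg_apply, End.mul_apply, End.one_apply,
      sub_eq_zero] at hv
    set g := R (rot 0 1)
    set d := R (epsSet {2, 3, 4, 5}) with hd
    have hg : ∀ x, g (g (g x)) = x := IsLine.rot_pow_apply R (by decide)
    have hK : ∀ x, R quarters (R quarters x) = d x := fun x => by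
      rw [← End.mul_apply, ← _root_.map_mul, quarters_mul_self]
    have hgK : ∀ x, R quarters (g x) = g (R quarters x) := fun x => by
      rw [← End.mul_apply, ← ((quarters_rot).map R).eq, End.mul_apply]
    have hgd : ∀ x, d (g x) = g (d x) := fun x => by rw [← hK, hgK, hgK, hK]
    have hdd : ∀ x, d (d x) = x := fun x => by
      rw [← End.mul_apply, hd, ← _root_.map_mul, epsSet_mul_self, _root_.map_one, End.one_apply]
    have hv' : g (R quarters v) = -v := neg_eq_iff_eq_neg.1 hv
    have h1 : g (g (d v)) = v := by rw [← hK, ← hgK, hv', map_neg, map_neg, hv', neg_neg]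
    have h2 : g v = d v := by rw [← hg (d v), h1]
    have h3 : d v = v := by
      have h4 := hg v
      rwa [h2, ← hgd, h2, hdd, h2] at h4
    have h4 : rotAvg R 0 1 v = v := rotAvg_eq_of_fixed (h2.trans h3)
    rw [h.rotAvg_eq hw, LinearMap.smul_apply, LinearMap.sub_apply, End.one_apply, ← hd, h3, sub_self,
      smul_zero] at h4
    exact h4.symm

end Six

theorem choose_le_choose_of_le_half {n k q : ℕ} (hkq : k ≤ q) (hq : q ≤ n / 2) :
    n.choose k ≤ n.choose q := by
  induction q, hkq using Nat.le_induction with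
  | base => exact le_rfl
  | succ q _ ih => exact (ih (by omega)).trans (Nat.choose_le_succ_of_lt_half_left (by omega))

theorem choose_le_choose_of_le_of_le {n k q : ℕ} (hk : k ≤ q) (hq : q + k ≤ n) :
    n.choose k ≤ n.choose q := by
  rcases Nat.le_total q (n / 2) with h | h
  · exact choose_le_choose_of_le_half hk h
  · rcases Nat.lt_or_ge (n / 2) (n - q) with h1 | h1
    · rw [show q = n / 2 by omega]
      exact choose_le_choose_of_le_half (by omega) le_rfl
    · rw [← Nat.choose_symm (show q ≤ n by omega)]
      exact choose_le_choose_of_le_half (by omega) h1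

theorem mul_succ_lt_two_pow {n : ℕ} (hn : 6 ≤ n) : n * (n + 1) < 2 ^ n := by
  induction n, hn using Nat.le_induction with
  | base => norm_num
  | succ k hk ih => rw [pow_succ]; nlinarith

section Weights

variable {ι V : Type*} [Fintype ι] [DecidableEq ι] [AddCommGroup V] [Module ℚ V]
  [FiniteDimensional ℚ V] {R : FreeRep ι V} {I : Finset ι}

theorem choose_mul_finrank_add_le (R : FreeRep ι V) {I J : Finset ι}
    (hIJ : I.card ≠ J.card) :
    (Fintype.card ι).choose I.card * finrank ℚ (wtR R I) +
      (Fintype.card ι).choose J.card * finrank ℚ (wtR R J) ≤ finrank ℚ V := by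
  have h1 : ∀ I : Finset ι, (Fintype.card ι).choose I.card * finrank ℚ (wtR R I) =
      ∑ K ∈ Finset.powersetCard I.card Finset.univ, finrank ℚ (wtR R K) := fun I => by
    rw [Finset.sum_congr rfl fun K hK => finrank_wtR_eq R (Finset.mem_powersetCard.1 hK).2,
      Finset.sum_const, Finset.card_powersetCard, Finset.card_univ, smul_eq_mul]
  rw [h1, h1, sum_finrank_wtR R, ← Finset.sum_union
    (Finset.disjoint_left.2 fun K hI hJ => hIJ ((Finset.mem_powersetCard.1 hI).2.symm.trans
      (Finset.mem_powersetCard.1 hJ).2))]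
  exact Finset.sum_le_sum_of_subset (Finset.subset_univ _)

theorem one_le_finrank_wtR (hI : wtR R I ≠ ⊥) : 1 ≤ finrank ℚ (wtR R I) :=
  Nat.one_le_iff_ne_zero.2 fun h => hI (Submodule.finrank_eq_zero.1 h)

theorem finrank_eq_one_of_choose (hI : wtR R I ≠ ⊥) (hI0 : I.card ≠ 0)
    (hV : finrank ℚ V < 2 * (Fintype.card ι).choose I.card) : finrank ℚ (wtR R I) = 1 := by
  have h1 := choose_mul_finrank_add_le R (I := I) (J := ∅) (by simpa using hI0)
  have h2 := one_le_finrank_wtR hI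
  by_contra h3
  have h4 : 2 ≤ finrank ℚ (wtR R I) := by omega
  nlinarith

theorem eq_bot_of_choose (hI : wtR R I ≠ ⊥) {J : Finset ι} (hIJ : I.card ≠ J.card)
    (hV : finrank ℚ V < (Fintype.card ι).choose I.card + (Fintype.card ι).choose J.card) :
    wtR R J = ⊥ := by
  by_contra hJ
  have h1 := choose_mul_finrank_add_le R hIJ
  have h2 := one_le_finrank_wtR hI
  have h3 := one_le_finrank_wtR hJ
  nlinarith

end Weights

/-- A weight with two elements is impossible. -/
theorem false_of_card_eq_two {n m : ℕ} (hn : 6 ≤ n) (heven : Even n) (hm : 2 ≤ m)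
    (hm₂ : 2 * m < n * (n + 1)) (φ : OutFG n →* OutFG m)
    {T : FreeRep (Fin n) (H1 m)}
    (hT : ∀ g, detChar n g = 1 → T g = homRep φ g) {I : Finset (Fin n)} (hI : I.card = 2)
    (hI0 : wtR T I ≠ ⊥) : False := by
  have hch : n.choose 2 * 2 = n * (n - 1) := by
    rw [Nat.choose_two_right, Nat.div_mul_cancel (Nat.even_mul_pred_self n).two_dvd]
  obtain ⟨k, rfl⟩ : ∃ k, n = k + 6 := ⟨n - 6, by omega⟩
  rw [show k + 6 - 1 = k + 5 by omega] at hch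
  have hbot : ∀ J : Finset (Fin (k + 6)), J ≠ ∅ → J ≠ Finset.univ → J.card ≠ 2 → wtR T J = ⊥ := by
    intro J h0 h1 h2
    refine eq_bot_of_choose hI0 (by rw [hI]; exact h2.symm) ?_
    have h3 : 1 ≤ J.card := Finset.card_pos.2 (Finset.nonempty_iff_ne_empty.2 h0)
    have h4 : J.card < k + 6 := by
      simpa using Finset.card_lt_card (Finset.ssubset_univ_iff.2 h1)
    have h5 := choose_le_choose_of_le_of_le h3 (show J.card + 1 ≤ k + 6 by omega)
    rw [Nat.choose_one_right] at h5
    rw [finrank_H1, Fintype.card_fin, hI]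
    nlinarith
  have hline : IsLine T 1 := by
    have hcard : ∀ J : Finset (Fin (k + 6)), J.card ≠ 0 → J.card < 6 → J.card ≠ 2 → wtR T J = ⊥ :=
      fun J h0 h1 => hbot J (fun hc => h0 (by rw [hc, Finset.card_empty])) fun hc => by
        rw [hc, Finset.card_univ, Fintype.card_fin] at h1
        omega
    refine ⟨fun J hJ => ?_, fun J hJ => hcard J (by omega) (by omega) (by omega),
      fun J hJ => hcard J (by omega) (by omega) (by omega), by rw [Fintype.card_fin]; omega⟩
    rw [finrank_wtR_eq T (hJ.trans hI.symm)]
    refine finrank_eq_one_of_choose hI0 (by omega) ?_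
    rw [finrank_H1, Fintype.card_fin, hI]
    nlinarith
  have h01 : (0 : Fin (k + 6)) ≠ 1 := by simp
  obtain ⟨h1, h2⟩ := hline.lt_trace_rot_mul_epsSet h01 hbot (by rwa [Fintype.card_fin])
    (by rwa [Fintype.card_fin]) (by rwa [Fintype.card_fin, finrank_H1])
  rw [hT _ (by
    rw [_root_.map_mul, detChar_epsSet, detChar_of_pow_odd (by decide : Odd 3)
      (by rw [pow_three', rot_mul_mul h01]), Finset.card_compl, Fintype.card_fin,
      Finset.card_pair h01, one_mul]
    exact ((Nat.even_sub (by omega)).2 (by simp [heven])).neg_one_pow)] at h1 h2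
  rcases homRep_trace hm φ (isOfFinOrder_rot_mul_epsSet h01 (s := {0, 1}ᶜ) (by simp) (by simp))
    with h3 | h3
  · exact h1.ne h3.symm
  · exact h2.not_ge h3

/-- In rank six a weight with three elements is impossible. -/
theorem false_of_card_eq_three {m : ℕ} (hm : 2 ≤ m) (hm₂ : m ≤ 20) (φ : OutFG 6 →* OutFG m)
    {I : Finset (Fin 6)} (hI : I.card = 3) (hI0 : wtR (homRep φ) I ≠ ⊥) : False := by
  have h20 : Nat.choose 6 3 = 20 := rfl
  have hbot : ∀ J : Finset (Fin 6), J.card ≠ 3 → wtR (homRep φ) J = ⊥ := fun J hJ => by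
    refine eq_bot_of_choose hI0 (by rw [hI]; exact hJ.symm) ?_
    have h1 : 0 < Nat.choose 6 J.card := Nat.choose_pos (by simpa using Finset.card_le_univ J)
    rw [finrank_H1, Fintype.card_fin, hI]
    omega
  have hline : IsLine (homRep φ) 2 := by
    refine ⟨fun J hJ => ?_, fun J hJ => hbot J (by omega), fun J hJ => hbot J (by omega), by simp⟩
    rw [finrank_wtR_eq (homRep φ) (hJ.trans hI.symm)]
    refine finrank_eq_one_of_choose hI0 (by omega) ?_
    rw [finrank_H1, Fintype.card_fin, hI]
    omega
  obtain ⟨h1, h2⟩ := hline.two_le_trace_sixTorsion hbot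
  have h3 := homRep_trace hm φ isOfFinOrder_mk_sixTorsion
  rw [h2, finrank_bot] at h3
  rcases h3 with h3 | h3 <;> norm_num at h3 <;> linarith

theorem wtR_twist_neg_one {n : ℕ} {V : Type*} [AddCommGroup V] [Module ℚ V]
    {R : FreeRep (Fin n) V} (hM : (-1 : End ℚ V) * -1 = 1)
    (hc : ∀ g, Commute (-1) (R g)) (I : Finset (Fin n)) :
    wtR (twist R (detChar n) (-1) hM hc) Iᶜ = wtR R I := by
  ext v
  simp only [mem_wtR, twist_of_eq_neg_one hM hc (detChar_eps _), mul_neg, mul_one,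
    LinearMap.neg_apply, Finset.mem_compl, not_not, neg_eq_iff_eq_neg, neg_neg]
  exact and_comm

/-- If `n ≠ m`, `n` is even, `n ≥ 6` and `n(n-1)/2 ≤ m < n(n+1)/2`, then
every homomorphism `Out(F_n) → Out(F_m)` has finite image. -/
theorem outFG_hom_image_finite (n m : ℕ) (hn : 6 ≤ n) (heven : Even n) (hnm : n ≠ m)
    (hm₁ : n * (n - 1) / 2 ≤ m) (hm₂ : m < n * (n + 1) / 2)
    (φ : OutFG n →* OutFG m) :
    (Set.range φ).Finite := by
  have hm : 2 ≤ m := by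
    have h1 : 6 * 5 ≤ n * (n - 1) := Nat.mul_le_mul hn (by omega)
    omega
  have hm3 : 2 * m < n * (n + 1) := by omega
  have hdim : m + 1 < 2 ^ (n - 1) := by
    have h1 := mul_succ_lt_two_pow hn
    rw [show n = n - 1 + 1 by omega, pow_succ] at h1
    rw [show n - 1 + 1 = n by omega] at h1
    omega
  refine range_finite_of_wtR_extreme hn heven hnm hm hm3 hdim φ fun I hI hI' => ?_
  by_contra h0
  by_cases h2 : I.card = 2
  · exact false_of_card_eq_two hn heven hm hm3 φ (fun _ _ => rfl) h2 h0
  by_cases hn2 : I.card + 2 = n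
  · have hM : (-1 : End ℚ (H1 m)) * -1 = 1 := LinearMap.ext fun v => neg_neg v
    have hc : ∀ g, Commute (-1) (homRep φ g) := fun g =>
      LinearMap.ext fun v => (map_neg (homRep φ g) v).symm
    refine false_of_card_eq_two hn heven hm hm3 φ (fun g hg => twist_of_eq_one hM hc hg)
      (I := Iᶜ) (by rw [Finset.card_compl, Fintype.card_fin]; omega) ?_
    rwa [wtR_twist_neg_one hM hc]
  have h3 := choose_mul_finrank_add_le (homRep φ) (I := I) (J := ∅) (by rw [Finset.card_empty]; omega)
  have h4 := one_le_finrank_wtR h0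
  have h5 := choose_le_choose_of_le_of_le (show 3 ≤ I.card by omega) (show I.card + 3 ≤ n by omega)
  rw [finrank_H1, Fintype.card_fin] at h3
  have h6 : n.choose 3 ≤ m := by nlinarith
  have h7 := Nat.choose_succ_right_eq n 2
  have h8 := Nat.choose_succ_right_eq n 1
  rw [Nat.choose_one_right] at h8
  obtain ⟨k, rfl⟩ : ∃ k, n = k + 6 := ⟨n - 6, by omega⟩
  rw [show k + 6 - 2 = k + 4 by omega] at h7
  rw [show k + 6 - 1 = k + 5 by omega] at h8
  obtain rfl : k = 0 := by
    by_contra hk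
    have hk1 : 1 ≤ k := Nat.one_le_iff_ne_zero.2 hk
    have h9 : (k + 6) * (k + 5) * (k + 4) < 3 * ((k + 6) * (k + 7)) := by
      rw [← h8]; nlinarith
    nlinarith
  exact false_of_card_eq_three hm (by omega) φ (by omega) h0
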